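/- The group PGL(2, ℤ[ω]) is profinitely rigid in the absolute sense: if Λ is any finitely generated, residually finite group having the same finite quotients as PGL(2, ℤ[ω]), then Λ is isomorphic to PGL(2, ℤ[ω]). -/

import Mathlib

/-- A group is residually finite if every nontrivial element survives in some
finite quotient, i.e. lies outside some finite-index normal subgroup. -/
def IsResiduallyFinite (G : Type*) [Group G] : Prop :=
  ∀ g : G, g ≠ 1 → ∃ N : Subgroup G, N.Normal ∧ N.FiniteIndex ∧ g ∉ N

/-- Two groups have the same finite quotients. -/
def SameFiniteQuotients (G : Type*) (H : Type*) [Group G] [Group H] : Prop :=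
  ∀ (Q : Type) [Group Q] [Finite Q],
    (∃ f : G →* Q, Function.Surjective f) ↔ ∃ f : H →* Q, Function.Surjective f

/-- The Eisenstein integers `ℤ[ω]`, the ring of integers of `ℚ(ω)` with
`ω² + ω + 1 = 0`. -/
abbrev Eisenstein : Type := NumberField.RingOfIntegers (CyclotomicField 3 ℚ)

/-- `PGL(2,R)`: the quotient of `GL(2,R)` by its center. -/
abbrev PGL2 (R : Type*) [CommRing R] : Type _ :=
  Matrix.GeneralLinearGroup (Fin 2) R ⧸
    Subgroup.center (Matrix.GeneralLinearGroup (Fin 2) R)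

open scoped MatrixGroups QuadraticAlgebra Matrix commutatorElement
open Function (Injective Surjective Bijective)
open Multiplicative (ofAdd toAdd)
open Matrix (mul_apply det_fin_two_of mul_fin_two GeneralLinearGroup one_fin_two trace_fin_two det_fin_two adjugate_fin_two_of adjugate_fin_two mulVec_mulVec dotProduct_mulVec trace_smul of_apply of det_mul SpecialLinearGroup)

local notation "Mat₂" => Matrix (Fin 2) (Fin 2)

open QuotientGroup (mk' eq_one_iff)
open MonoidHom (comp_apply)
open Subgroup (zpowers)
open Complex (normSq)
open QuadraticAlgebra (re_ofNat im_ofNat)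
open Matrix.GeneralLinearGroup (det val_det_apply)

section FiniteQuotients

open CategoryTheory

/-- The intersection of all normal subgroups of index at most `n`. -/
def normalCoreUpTo (G : Type*) [Group G] (n : ℕ) : Subgroup G :=
  sInf {M : Subgroup G | M.Normal ∧ M.FiniteIndex ∧ M.index ≤ n}

theorem normalCoreUpTo_le {G : Type*} [Group G] {n : ℕ} {M : Subgroup G} (h1 : M.Normal)
    (h2 : M.FiniteIndex) (h3 : M.index ≤ n) : normalCoreUpTo G n ≤ M :=
  sInf_le ⟨h1, h2, h3⟩

instance normalCoreUpTo_normal (G : Type*) [Group G] (n : ℕ) : (normalCoreUpTo G n).Normal := by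
  rw [normalCoreUpTo, sInf_eq_iInf]
  exact Subgroup.normal_iInf_normal fun M => Subgroup.normal_iInf_normal fun h => h.1

theorem normalCoreUpTo_anti (G : Type*) [Group G] : Antitone (normalCoreUpTo G) := fun _ _ h =>
  sInf_le_sInf fun _ hM => ⟨hM.1, hM.2.1, hM.2.2.trans h⟩

theorem finite_monoidHom_of_fg (G Q : Type*) [Group G] [Group.FG G] [Group Q] [Finite Q] : Finite (G →* Q) := by
  obtain ⟨S, hS, hfin⟩ := (Group.fg_iff (G := G)).1 inferInstance
  have := hfin.to_subtype
  refine Finite.of_injective (fun (f : G →* Q) (s : S) => f s) fun f g h => ?_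
  exact MonoidHom.eq_of_eqOn_dense hS fun s hs => congrFun h ⟨s, hs⟩

instance normalCoreUpTo_finiteIndex (G : Type*) [Group G] [Group.FG G] (n : ℕ) : (normalCoreUpTo G n).FiniteIndex := by
  have key : ∀ k : ℕ, Finite (G →* Equiv.Perm (Fin k)) := fun k => finite_monoidHom_of_fg _ _
  let K : Subgroup G := ⨅ (k : Fin (n + 1)) , ⨅ f : G →* Equiv.Perm (Fin k), f.ker
  have hK : K.FiniteIndex :=
    Subgroup.finiteIndex_iInf fun k => Subgroup.finiteIndex_iInf fun f => inferInstance
  refine Subgroup.finiteIndex_of_le (H := K) ?_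
  refine le_sInf fun M hM => ?_
  obtain ⟨h1, h2, h3⟩ := hM
  have e : (G ⧸ M) ≃ Fin M.index := by
    have : Finite (G ⧸ M) := inferInstance
    exact (Finite.equivFinOfCardEq (n := M.index) rfl)
  let f : G →* Equiv.Perm (Fin M.index) :=
    (e.permCongrHom.toMonoidHom).comp (MulAction.toPermHom G (G ⧸ M))
  intro g hg
  have h4 : g ∈ f.ker := by
    have := (Subgroup.mem_iInf.1 ((Subgroup.mem_iInf.1 hg) ⟨M.index, by omega⟩)) f
    exact this
  have h5 : MulAction.toPermHom G (G ⧸ M) g = 1 := by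
    have : e.permCongrHom (MulAction.toPermHom G (G ⧸ M) g) = 1 := h4
    exact (map_eq_one_iff _ e.permCongrHom.injective).1 this
  have h6 := congrArg (fun p => p ((1 : G) : G ⧸ M)) h5
  have h7 : ((g * 1 : G) : G ⧸ M) = ((1 : G) : G ⧸ M) := h6
  rw [mul_one] at h7
  exact (eq_one_iff g).1 h7

theorem exists_normal_index_le_core {G : Type*} [Group G] (M : Subgroup G) (h : M.FiniteIndex) :
    ∃ n, normalCoreUpTo G n ≤ M :=
  ⟨M.normalCore.index,
    (normalCoreUpTo_le inferInstance inferInstance le_rfl).trans M.normalCore_le⟩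

theorem Subgroup.eq_of_le_of_index_eq' {G : Type*} [Group G] {A B : Subgroup G}
    [A.FiniteIndex] (h : A ≤ B) (hi : A.index = B.index) : A = B := by
  refine le_antisymm h (Subgroup.relIndex_eq_one.1 ?_)
  have h1 := Subgroup.relIndex_mul_index h
  have h2 : B.index ≠ 0 := hi ▸ Subgroup.FiniteIndex.index_ne_zero
  exact Nat.eq_of_mul_eq_mul_right (Nat.pos_of_ne_zero h2) (by rw [h1, hi, one_mul])

/-- Surjections send `normalCoreUpTo` into `normalCoreUpTo`. -/
theorem normalCoreUpTo_le_comap {G H : Type*} [Group G] [Group H] (f : G →* H) (hf : Surjective f) (n : ℕ) :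
    normalCoreUpTo G n ≤ (normalCoreUpTo H n).comap f := by
  intro g hg
  rw [Subgroup.mem_comap, normalCoreUpTo, Subgroup.mem_sInf]
  rintro M ⟨h1, h2, h3⟩
  have h4 : (M.comap f).index = M.index := Subgroup.index_comap_of_surjective M hf
  exact normalCoreUpTo_le (M := M.comap f) inferInstance ⟨by rw [h4]; exact h2.index_ne_zero⟩
    (by rw [h4]; exact h3) hg

theorem normalCoreUpTo_quotient {G : Type*} [Group G] (n : ℕ) : normalCoreUpTo (G ⧸ normalCoreUpTo G n) n = ⊥ := by
  rw [eq_bot_iff]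
  intro x hx
  obtain ⟨g, rfl⟩ := QuotientGroup.mk_surjective x
  rw [Subgroup.mem_bot, eq_one_iff, normalCoreUpTo, Subgroup.mem_sInf]
  rintro M ⟨h1, h2, h3⟩
  have hle : normalCoreUpTo G n ≤ M := normalCoreUpTo_le h1 h2 h3
  have hs : Surjective (mk' (normalCoreUpTo G n)) :=
    QuotientGroup.mk_surjective
  have hc : (M.map (mk' (normalCoreUpTo G n))).comap
      (mk' (normalCoreUpTo G n)) = M := by
    rw [Subgroup.comap_map_eq, QuotientGroup.ker_mk']
    exact sup_eq_left.2 hle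
  have hi : (M.map (mk' (normalCoreUpTo G n))).index = M.index := by rw [← Subgroup.index_comap_of_surjective _ hs, hc]
  have := normalCoreUpTo_le (M := M.map (mk' (normalCoreUpTo G n)))
    (h1.map _ hs) ⟨by rw [hi]; exact h2.index_ne_zero⟩ (by rw [hi]; exact h3) hx
  rw [← hc]; exact this

theorem normalCoreUpTo_le_ker {G H : Type*} [Group G] [Group H] {n : ℕ}
    (f : H →* G ⧸ normalCoreUpTo G n) (hf : Surjective f) : normalCoreUpTo H n ≤ f.ker := by
  have := normalCoreUpTo_le_comap f hf n
  rwa [normalCoreUpTo_quotient] at this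

theorem index_normalCoreUpTo_eq {G H : Type} [Group G] [Group H] [Group.FG G] [Group.FG H]
    (h : SameFiniteQuotients G H) (n : ℕ) : (normalCoreUpTo G n).index = (normalCoreUpTo H n).index := by
  have main : ∀ {G H : Type} [Group G] [Group H] [Group.FG G] [Group.FG H],
      SameFiniteQuotients G H → (normalCoreUpTo G n).index ≤ (normalCoreUpTo H n).index := by
    intro G H _ _ _ _ h
    obtain ⟨f, hf⟩ := (h (G ⧸ normalCoreUpTo G n)).1 ⟨mk' _,
      QuotientGroup.mk_surjective⟩
    have h1 := Subgroup.index_antitone (normalCoreUpTo_le_ker f hf)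
    rw [Subgroup.index_ker, MonoidHom.range_eq_top.2 hf] at h1
    simpa [Subgroup.index] using h1
  exact le_antisymm (main h) (main fun Q _ _ => (h Q).symm)

/-- A correspondence between two groups that induces an isomorphism of profinite completions. -/
structure ProfiniteCorrespondence (G H : Type*) [Group G] [Group H] where
  R : ℕ → Subgroup (G × H)
  anti : Antitone R
  exists_right : ∀ n g, ∃ h, (g, h) ∈ R n
  exists_left : ∀ n h, ∃ g, (g, h) ∈ R n
  right_mem : ∀ M : Subgroup H, M.FiniteIndex → ∃ n, ∀ h, (1, h) ∈ R n → h ∈ M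
  left_mem : ∀ M : Subgroup G, M.FiniteIndex → ∃ n, ∀ g, (g, 1) ∈ R n → g ∈ M

theorem exists_profiniteCorrespondence {G H : Type} [Group G] [Group H] [Group.FG G]
    [Group.FG H] (h : SameFiniteQuotients G H) : Nonempty (ProfiniteCorrespondence G H) := by
  let F : ℕᵒᵖ ⥤ Type :=
    { obj := fun n => {f : H →* G ⧸ normalCoreUpTo G n.unop // Surjective f}
      map := fun {m n} e => TypeCat.ofHom fun f =>
        ⟨(QuotientGroup.map _ _ (MonoidHom.id G)
          (normalCoreUpTo_anti G (leOfHom e.unop))).comp f.1, by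
          rw [MonoidHom.coe_comp]
          refine Surjective.comp (fun x => ?_) f.2
          obtain ⟨g, rfl⟩ := QuotientGroup.mk_surjective x
          exact ⟨(g : G ⧸ _), rfl⟩⟩
      map_id := by
        intro n; ext f x
        obtain ⟨g, hg⟩ := QuotientGroup.mk_surjective (f.1 x)
        simp [← hg]; rfl
      map_comp := by
        intro n m k e e'; ext f x
        obtain ⟨g, hg⟩ := QuotientGroup.mk_surjective (f.1 x)
        simp [← hg]; rfl }
  have hfin : ∀ j, Finite (F.obj j) := fun j => by
    have := finite_monoidHom_of_fg H (G ⧸ normalCoreUpTo G j.unop)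
    exact Subtype.finite
  have hne : ∀ j, Nonempty (F.obj j) := fun j => by
    obtain ⟨f, hf⟩ := (h (G ⧸ normalCoreUpTo G j.unop)).1
      ⟨mk' _, QuotientGroup.mk_surjective⟩
    exact ⟨⟨f, hf⟩⟩
  obtain ⟨u, hu⟩ := nonempty_sections_of_finite_inverse_system F
  let f : ∀ n, H →* G ⧸ normalCoreUpTo G n := fun n => (u (Opposite.op n)).1
  have hfs : ∀ n, Surjective (f n) := fun n => (u (Opposite.op n)).2
  have hcomp : ∀ {n m : ℕ} (hnm : n ≤ m) (x : H) (g : G), f m x = (g : G ⧸ _) →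
      f n x = (g : G ⧸ _) := by
    intro n m hnm x g hx
    have h1 := hu (f := (homOfLE hnm).op)
    have h2 := congrArg (fun z => z.1 x) h1
    change QuotientGroup.map _ _ (MonoidHom.id G) (normalCoreUpTo_anti G hnm) (f m x) = f n x at h2
    rw [← h2, hx]; rfl
  have hker : ∀ n, (f n).ker = normalCoreUpTo H n := by
    intro n
    symm
    refine Subgroup.eq_of_le_of_index_eq' ?_ ?_
    · exact normalCoreUpTo_le_ker _ (hfs n)
    · rw [← index_normalCoreUpTo_eq h n, Subgroup.index_ker, MonoidHom.range_eq_top.2 (hfs n)]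
      simp [Subgroup.index]
  refine ⟨{ R := fun n => ((mk' (normalCoreUpTo G n)).comp
              (MonoidHom.fst G H)).eqLocus ((f n).comp (MonoidHom.snd G H))
            anti := ?_, exists_right := ?_, exists_left := ?_, right_mem := ?_, left_mem := ?_ }⟩
  · rintro n m hnm ⟨g, x⟩ hx
    exact (hcomp hnm x g (Eq.symm hx)).symm
  · intro n g
    obtain ⟨x, hx⟩ := hfs n g
    exact ⟨x, hx.symm⟩
  · intro n x
    obtain ⟨g, hg⟩ := QuotientGroup.mk_surjective (f n x)
    exact ⟨g, hg⟩
  · intro M hM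
    obtain ⟨n, hn⟩ := exists_normal_index_le_core M hM
    refine ⟨n, fun x hx => hn ?_⟩
    rw [← hker]
    exact Eq.symm hx
  · intro M hM
    obtain ⟨n, hn⟩ := exists_normal_index_le_core M hM
    refine ⟨n, fun g hg => hn ?_⟩
    exact (eq_one_iff g).1 (Eq.trans hg (map_one (f n)))

namespace ProfiniteCorrespondence

variable {G H : Type*} [Group G] [Group H]

/-- Homomorphisms to finite groups are transported along a correspondence. -/
theorem transport (c : ProfiniteCorrespondence G H) {Q : Type*} [Group Q] (f : G →* Q)
    [Finite f.range] : ∃ (f' : H →* Q) (n : ℕ), ∀ g h, (g, h) ∈ c.R n → f' h = f g := by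
  have : f.ker.FiniteIndex := inferInstance
  obtain ⟨n, hn⟩ := c.left_mem f.ker this
  choose u hu using c.exists_left n
  have key : ∀ g g' h, (g, h) ∈ c.R n → (g', h) ∈ c.R n → f g = f g' := by
    intro g g' h hg hg'
    have := hn (g⁻¹ * g') (by simpa using (c.R n).mul_mem ((c.R n).inv_mem hg) hg')
    rw [MonoidHom.mem_ker, map_mul, map_inv, inv_mul_eq_one] at this
    exact this
  refine ⟨{ toFun := fun h => f (u h), map_one' := ?_, map_mul' := ?_ }, n, ?_⟩
  · rw [← map_one f]; exact key _ _ 1 (hu 1) (c.R n).one_mem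
  · intro x y
    rw [← map_mul]
    exact key _ _ _ (hu _) ((c.R n).mul_mem (hu x) (hu y))
  · intro g h hg
    exact key _ _ _ (hu h) hg

/-- Restriction of a correspondence to corresponding subgroups of finite index. -/
theorem restrict (c : ProfiniteCorrespondence G H) (A : Subgroup G) (B : Subgroup H)
    [A.FiniteIndex] [B.FiniteIndex] (n₀ : ℕ) (h : ∀ x y, (x, y) ∈ c.R n₀ → (x ∈ A ↔ y ∈ B)) :
    ∃ c' : ProfiniteCorrespondence A B, ∀ n x y, (x, y) ∈ c'.R n → ((x : G), (y : H)) ∈ c.R (n + n₀) := by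
  refine ⟨{ R := fun n => (c.R (n + n₀)).comap (A.subtype.prodMap B.subtype)
            anti := fun n m hnm x hx => c.anti (by omega) hx
            exists_right := ?_, exists_left := ?_, right_mem := ?_, left_mem := ?_ },
          fun n x y hxy => hxy⟩
  · rintro n ⟨x, hx⟩
    obtain ⟨y, hy⟩ := c.exists_right (n + n₀) x
    exact ⟨⟨y, (h x y (c.anti (by omega) hy)).1 hx⟩, hy⟩
  · rintro n ⟨y, hy⟩
    obtain ⟨x, hx⟩ := c.exists_left (n + n₀) y
    exact ⟨⟨x, (h x y (c.anti (by omega) hx)).2 hy⟩, hx⟩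
  · intro M hM
    have hfi : (M.map B.subtype).FiniteIndex := ⟨by
      rw [Subgroup.index_map_subtype]
      exact mul_ne_zero hM.index_ne_zero Subgroup.FiniteIndex.index_ne_zero⟩
    obtain ⟨n, hn⟩ := c.right_mem _ hfi
    refine ⟨n, fun y hy => ?_⟩
    have := hn y (c.anti (by omega) hy)
    simpa using this
  · intro M hM
    have hfi : (M.map A.subtype).FiniteIndex := ⟨by
      rw [Subgroup.index_map_subtype]
      exact mul_ne_zero hM.index_ne_zero Subgroup.FiniteIndex.index_ne_zero⟩
    obtain ⟨n, hn⟩ := c.left_mem _ hfi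
    refine ⟨n, fun y hy => ?_⟩
    have := hn y (c.anti (by omega) hy)
    simpa using this

end ProfiniteCorrespondence

/-- A surjection from a residually finite group onto a group with the same finite quotients
is injective. -/
theorem injective_of_sameFiniteQuotients {G H : Type} [Group G] [Group H] [Group.FG G]
    [Group.FG H] (hrf : IsResiduallyFinite G) (h : SameFiniteQuotients G H) (f : G →* H)
    (hf : Surjective f) : Injective f := by
  rw [injective_iff_map_eq_one]
  intro g hg
  by_contra hne
  obtain ⟨M, h1, h2, h3⟩ := hrf g hne
  have e : normalCoreUpTo G M.index = (normalCoreUpTo H M.index).comap f := by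
    refine Subgroup.eq_of_le_of_index_eq' (normalCoreUpTo_le_comap f hf _) ?_
    rw [index_normalCoreUpTo_eq h, Subgroup.index_comap_of_surjective _ hf]
  refine h3 (normalCoreUpTo_le h1 h2 le_rfl ?_)
  rw [e, Subgroup.mem_comap, hg]
  exact Subgroup.one_mem _

end FiniteQuotients

section EisensteinModel

open QuadraticAlgebra

/-- The ring `R[ω]` with `ω² + ω + 1 = 0`. -/
abbrev EisensteinOver (R : Type*) [CommRing R] : Type _ := QuadraticAlgebra R (-1) (-1)

namespace EisensteinOver

variable {R S T : Type*} [CommRing R] [CommRing S] [CommRing T]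

/-- Functoriality of `R ↦ R[ω]`. -/
def map (f : R →+* S) : EisensteinOver R →+* EisensteinOver S where
  toFun z := ⟨f z.re, f z.im⟩
  map_one' := by ext <;> simp
  map_mul' x y := by ext <;> simp
  map_zero' := by ext <;> simp
  map_add' x y := by ext <;> simp

@[simp] theorem map_re (f : R →+* S) (z : EisensteinOver R) : (map f z).re = f z.re := rfl
@[simp] theorem map_im (f : R →+* S) (z : EisensteinOver R) : (map f z).im = f z.im := rfl

/-- Evaluation `R[ω] → S` at a root `z` of `z² + z + 1`. -/
def eval (f : R →+* S) (z : S) (hz : z ^ 2 + z + 1 = 0) : EisensteinOver R →+* S where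
  toFun x := f x.re + f x.im * z
  map_one' := by simp
  map_mul' x y := by
    simp only [re_mul, im_mul, map_add, map_mul, map_neg, map_one]
    linear_combination (- f x.im * f y.im) * hz
  map_zero' := by simp
  map_add' x y := by simp; ring

theorem eval_apply (f : R →+* S) (z : S) (hz : z ^ 2 + z + 1 = 0) (x : EisensteinOver R) :
    eval f z hz x = f x.re + f x.im * z := rfl

theorem norm_apply (x : EisensteinOver R) : x.norm = x.re ^ 2 - x.re * x.im + x.im ^ 2 := by rw [norm_def]; ring

end EisensteinOver

/-- The Eisenstein integers as pairs of integers. -/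
abbrev EisensteinInt : Type := EisensteinOver ℤ

namespace EisensteinInt

local notation "𝓔" => EisensteinInt

theorem norm_nonneg (x : 𝓔) : 0 ≤ x.norm := by
  rw [EisensteinOver.norm_apply]
  nlinarith [sq_nonneg (2 * x.re - x.im), sq_nonneg x.im]

theorem norm_eq_zero {x : 𝓔} : x.norm = 0 ↔ x = 0 := by
  refine ⟨fun h => ?_, fun h => by simp [h]⟩
  rw [EisensteinOver.norm_apply] at h
  have h1 : x.im = 0 := by
    by_contra hne
    have : 0 < x.im ^ 2 := by positivity
    nlinarith [sq_nonneg (2 * x.re - x.im)]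
  have h2 : x.re = 0 := by
    rw [h1] at h
    simpa using h
  ext <;> simp [h1, h2]

theorem norm_pos {x : 𝓔} (h : x ≠ 0) : 0 < x.norm :=
  lt_of_le_of_ne (norm_nonneg x) fun h' => h (norm_eq_zero.1 h'.symm)

instance : IsDomain 𝓔 := by
  have : NoZeroDivisors 𝓔 := ⟨fun {a b} h => by
    have h1 : a.norm * b.norm = 0 := by rw [← map_mul, h]; simp
    rcases mul_eq_zero.1 h1 with h2 | h2
    · exact Or.inl (norm_eq_zero.1 h2)
    · exact Or.inr (norm_eq_zero.1 h2)⟩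
  exact NoZeroDivisors.to_isDomain _

theorem isUnit_iff {x : 𝓔} : IsUnit x ↔ x.norm = 1 := by
  rw [isUnit_iff_norm_isUnit, Int.isUnit_iff]
  have := norm_nonneg x
  constructor
  · rintro (h | h) <;> omega
  · exact Or.inl

/-- The six units. -/
theorem eq_of_norm_eq_one {x : 𝓔} (h : x.norm = 1) :
    x = ⟨1, 0⟩ ∨ x = ⟨-1, 0⟩ ∨ x = ⟨0, 1⟩ ∨ x = ⟨0, -1⟩ ∨ x = ⟨1, 1⟩ ∨ x = ⟨-1, -1⟩ := by
  rw [EisensteinOver.norm_apply] at h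
  have h1 : x.im ^ 2 ≤ 1 := by nlinarith [sq_nonneg (2 * x.re - x.im)]
  have h2 : x.re ^ 2 ≤ 1 := by nlinarith [sq_nonneg (2 * x.im - x.re)]
  have h3 : -1 ≤ x.im ∧ x.im ≤ 1 := abs_le.1 (by simpa using sq_le_one_iff_abs_le_one _ |>.1 h1)
  have h4 : -1 ≤ x.re ∧ x.re ≤ 1 := abs_le.1 (by simpa using sq_le_one_iff_abs_le_one _ |>.1 h2)
  obtain ⟨a, b⟩ := x
  simp only at h h3 h4
  obtain ⟨h5, h6⟩ := h3
  obtain ⟨h7, h8⟩ := h4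
  interval_cases a <;> interval_cases b <;> simp_all

theorem sq_add_mul_add_sq_le {A B M : ℤ} (h1 : -A ≤ M) (h2 : A ≤ M) (h3 : -B ≤ M) (h4 : B ≤ M)
    (h5 : -(A + B) ≤ M) (h6 : A + B ≤ M) : A ^ 2 + A * B + B ^ 2 ≤ M ^ 2 := by
  have k1 : A ^ 2 ≤ M ^ 2 := sq_le_sq' (by linarith) h2
  have k2 : B ^ 2 ≤ M ^ 2 := sq_le_sq' (by linarith) h4
  have k3 : (A + B) ^ 2 ≤ M ^ 2 := sq_le_sq' (by linarith) h6
  rcases le_total 0 (A * B) with h | h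
  · linarith [show (A + B) ^ 2 = A ^ 2 + 2 * (A * B) + B ^ 2 by ring]
  · rcases le_total (A ^ 2) (B ^ 2) with h' | h'
    · have : A * (A + B) ≤ 0 := by
        rcases le_total 0 A with ha | ha
        · have : |A| ≤ |B| := sq_le_sq.1 h'
          rcases ha.eq_or_lt with rfl | ha
          · simp
          have hb : B ≤ 0 := by nlinarith
          rw [abs_of_pos ha, abs_of_nonpos hb] at this
          exact mul_nonpos_of_nonneg_of_nonpos ha.le (by linarith)
        · have : |A| ≤ |B| := sq_le_sq.1 h'
          rcases ha.eq_or_lt with rfl | ha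
          · simp
          have hb : 0 ≤ B := by nlinarith
          rw [abs_of_neg ha, abs_of_nonneg hb] at this
          exact mul_nonpos_of_nonpos_of_nonneg ha.le (by linarith)
      linarith [show A * (A + B) = A ^ 2 + A * B by ring]
    · have : B * (A + B) ≤ 0 := by
        have hab : |B| ≤ |A| := sq_le_sq.1 h'
        rcases le_total 0 B with ha | ha
        · rcases ha.eq_or_lt with rfl | ha
          · simp
          have hb : A ≤ 0 := by nlinarith
          rw [abs_of_pos ha, abs_of_nonpos hb] at hab
          exact mul_nonpos_of_nonneg_of_nonpos ha.le (by linarith)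
        · rcases ha.eq_or_lt with rfl | ha
          · simp
          have hb : 0 ≤ A := by nlinarith
          rw [abs_of_neg ha, abs_of_nonneg hb] at hab
          exact mul_nonpos_of_nonpos_of_nonneg ha.le (by linarith)
      linarith [show B * (A + B) = A * B + B ^ 2 by ring]

/-- Division with the optimal bound for the remainder. -/
theorem exists_norm_sub_mul_le (s q : 𝓔) (hq : q ≠ 0) : ∃ n : 𝓔, 3 * (s - n * q).norm ≤ q.norm := by
  obtain ⟨n, hn⟩ : ∃ n : 𝓔, ∀ m : 𝓔, (s - n * q).norm ≤ (s - m * q).norm := by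
    obtain ⟨n, hn⟩ := WellFounded.has_min (measure fun n : 𝓔 => (s - n * q).norm.natAbs).wf
      Set.univ ⟨0, trivial⟩
    refine ⟨n, fun m => ?_⟩
    have h1 := hn.2 m trivial
    have h2 := norm_nonneg (s - n * q)
    have h3 := norm_nonneg (s - m * q)
    have h4 : ¬ (s - m * q).norm.natAbs < (s - n * q).norm.natAbs := h1
    omega
  refine ⟨n, ?_⟩
  set r := s - n * q with hr
  have key : ∀ u : 𝓔, r.norm ≤ (r - u * q).norm := fun u => by
    have := hn (n + u)
    rwa [show s - (n + u) * q = r - u * q by rw [hr]; ring] at this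
  have hq0 := norm_pos hq
  have k1 := key ⟨1, 0⟩
  have k2 := key ⟨-1, 0⟩
  have k3 := key ⟨0, 1⟩
  have k4 := key ⟨0, -1⟩
  have k5 := key ⟨1, 1⟩
  have k6 := key ⟨-1, -1⟩
  have hX : ∃ X Y : ℤ, X = r.re * q.re - r.re * q.im + r.im * q.im ∧
    Y = r.im * q.re - r.re * q.im := ⟨_, _, rfl, rfl⟩
  obtain ⟨X, Y, hX, hY⟩ := hX
  have hN : r.norm * q.norm = X ^ 2 - X * Y + Y ^ 2 := by simp only [EisensteinOver.norm_apply, hX, hY]; ring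
  simp only [EisensteinOver.norm_apply, re_sub, im_sub, re_mul, im_mul] at k1 k2 k3 k4 k5 k6 hq0 hN ⊢
  set M := q.re ^ 2 - q.re * q.im + q.im ^ 2 with hM
  have j1 : 2 * X - Y ≤ M := by rw [hX, hY, hM]; linarith
  have j2 : -(2 * X - Y) ≤ M := by rw [hX, hY, hM]; linarith
  have j3 : 2 * Y - X ≤ M := by rw [hX, hY, hM]; linarith
  have j4 : -(2 * Y - X) ≤ M := by rw [hX, hY, hM]; linarith
  have j5 : X + Y ≤ M := by rw [hX, hY, hM]; linarith
  have j6 : -(X + Y) ≤ M := by rw [hX, hY, hM]; linarith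
  have h3 : 3 * (X ^ 2 - X * Y + Y ^ 2) ≤ M ^ 2 := by
    have e : 3 * (X ^ 2 - X * Y + Y ^ 2)
      = (2 * X - Y) ^ 2 + (2 * X - Y) * (2 * Y - X) + (2 * Y - X) ^ 2 := by ring
    rw [e]
    exact sq_add_mul_add_sq_le j2 j1 j4 j3 (by linarith) (by linarith)
  refine le_of_mul_le_mul_right ?_ hq0
  linarith [sq M]

theorem exists_norm_sub_mul_lt (s q : 𝓔) (hq : q ≠ 0) : ∃ n : 𝓔, (s - n * q).norm < q.norm := by
  obtain ⟨n, hn⟩ := exists_norm_sub_mul_le s q hq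
  have h1 := norm_pos hq
  have h2 := norm_nonneg (s - n * q)
  exact ⟨n, by omega⟩

instance : IsPrincipalIdealRing 𝓔 := by
  classical
  choose! quo hquo using exists_norm_sub_mul_lt
  let E : EuclideanDomain 𝓔 :=
    { (inferInstance : CommRing 𝓔) with
      exists_pair_ne := exists_pair_ne 𝓔
      quotient := fun a b => if b = 0 then 0 else quo a b
      quotient_zero := fun a => by simp
      remainder := fun a b => a - (if b = 0 then 0 else quo a b) * b
      quotient_mul_add_remainder_eq := fun a b => by ring
      r := fun x y => x.norm.natAbs < y.norm.natAbs
      r_wellFounded := (measure fun x : 𝓔 => x.norm.natAbs).wf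
      remainder_lt := fun a b hb => by
        have h1 := hquo a b hb
        have h2 := norm_nonneg (a - quo a b * b)
        simp only [if_neg hb]
        omega
      mul_left_not_lt := fun a b hb => by
        have h0 : (a * b).norm = a.norm * b.norm := map_mul QuadraticAlgebra.norm a b
        have h1 : 1 ≤ b.norm.natAbs := by have := norm_pos hb; omega
        rw [h0, Int.natAbs_mul]
        exact not_lt.2 (Nat.le_mul_of_pos_right _ h1) }
  exact EuclideanDomain.to_principal_ideal_domain (R := 𝓔)

end EisensteinInt

/-- The two models of the Eisenstein integers agree. -/
theorem nonempty_eisenstein_ringEquiv : Nonempty (EisensteinInt ≃+* Eisenstein) := by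
  have : NeZero ((3 : ℕ) : ℚ) := ⟨by norm_num⟩
  have : IsCyclotomicExtension {3} ℚ (CyclotomicField 3 ℚ) := by
    convert CyclotomicField.isCyclotomicExtension 3 ℚ using 1
    · rfl
    · exact Subsingleton.elim _ _
  have hζ := IsCyclotomicExtension.zeta_spec 3 ℚ (CyclotomicField 3 ℚ)
  let z : Eisenstein := hζ.toInteger
  have hz : z ^ 2 + z + 1 = 0 := by
    have h1 := hζ.toInteger_isPrimitiveRoot
    have h2 : (Polynomial.cyclotomic 3 Eisenstein).IsRoot z :=
      h1.isRoot_cyclotomic (by norm_num)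
    simpa [Polynomial.cyclotomic_three] using h2
  let e := EisensteinOver.eval (Int.castRingHom Eisenstein) z hz
  let pb := hζ.integralPowerBasis
  have hgen : pb.gen = z := hζ.integralPowerBasis_gen
  have hdim : pb.dim = 2 := by rw [hζ.integralPowerBasis_dim]; decide
  refine ⟨RingEquiv.ofBijective e ⟨?_, ?_⟩⟩
  · rw [injective_iff_map_eq_zero]
    intro x hx
    have hli := pb.basis.linearIndependent
    have h3 : ∑ i : Fin pb.dim, (if (i : ℕ) = 0 then x.re else x.im) • pb.basis i = 0 := by
      simp only [pb.coe_basis, hgen]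
      rw [← Fin.sum_congr' _ hdim.symm]
      simp only [Fin.sum_univ_two]
      simp only [EisensteinOver.eval_apply, e] at hx
      simpa using hx
    have h4 := Fintype.linearIndependent_iff.1 hli _ h3
    have h5 := h4 ⟨0, by omega⟩
    have h6 := h4 ⟨1, by omega⟩
    simp only [if_true] at h5
    simp only [one_ne_zero, if_false] at h6
    ext
    · exact h5
    · exact h6
  · intro y
    have h3 := pb.basis.sum_repr y
    rw [← Fin.sum_congr' _ hdim.symm] at h3
    simp only [pb.coe_basis, hgen, Fin.sum_univ_two] at h3
    refine ⟨⟨pb.basis.repr y (Fin.cast hdim.symm 0), pb.basis.repr y (Fin.cast hdim.symm 1)⟩, ?_⟩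
    conv_rhs => rw [← h3]
    simp [e, EisensteinOver.eval_apply]

end EisensteinModel

local notation "𝓔" => EisensteinInt

open EisensteinOver (norm_apply eval eval_apply)

section ProjectiveLinear

open QuadraticAlgebra

open Matrix

namespace PGL2

variable {R S T : Type*} [CommRing R] [CommRing S] [CommRing T]

/-- The class of an invertible matrix. -/
def mk : GL (Fin 2) R →* PGL2 R := mk' _

theorem mk_surjective : Surjective (mk : GL (Fin 2) R → PGL2 R) :=
  QuotientGroup.mk_surjective

theorem mk_eq_mk {A B : GL (Fin 2) R} : mk A = mk B ↔ ∃ u : Rˣ, (A : Mat₂ R) = (u : R) • (B : Matrix _ _ R) := by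
  have h1 : mk A = mk B ↔ B⁻¹ * A ∈ Subgroup.center (GL (Fin 2) R) := by rw [eq_comm]; exact QuotientGroup.eq
  rw [h1, GeneralLinearGroup.center_eq_range_scalar]
  constructor
  · rintro ⟨u, hu⟩
    refine ⟨u, ?_⟩
    have : A = B * GeneralLinearGroup.scalar (Fin 2) u := by rw [hu]; group
    rw [this]
    ext i j
    simp [GeneralLinearGroup.coe_scalar, Matrix.mul_diagonal, mul_comm]
  · rintro ⟨u, hu⟩
    refine ⟨u, ?_⟩
    have : A = B * GeneralLinearGroup.scalar (Fin 2) u := by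
      ext i j
      rw [hu]
      simp [GeneralLinearGroup.coe_scalar, Matrix.mul_diagonal, mul_comm]
    rw [this]; group

theorem mk_eq_one {A : GL (Fin 2) R} : mk A = 1 ↔ ∃ u : Rˣ, (A : Mat₂ R) = (u : R) • 1 := by
  rw [← map_one mk, mk_eq_mk]; rfl

/-- Functoriality of `PGL2`. -/
def map (f : R →+* S) : PGL2 R →* PGL2 S :=
  QuotientGroup.map _ _ (GeneralLinearGroup.map f) (by
    rw [GeneralLinearGroup.center_eq_range_scalar, GeneralLinearGroup.center_eq_range_scalar]
    rintro _ ⟨u, rfl⟩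
    exact ⟨Units.map f u, (GeneralLinearGroup.map_scalar f u).symm⟩)

@[simp] theorem map_mk (f : R →+* S) (A : GL (Fin 2) R) : map f (mk A) = mk (GeneralLinearGroup.map f A) := rfl

theorem map_map (f : R →+* S) (g : S →+* T) (x : PGL2 R) : map g (map f x) = map (g.comp f) x := by
  obtain ⟨A, rfl⟩ := mk_surjective x
  rfl

theorem map_id (x : PGL2 R) : map (RingHom.id R) x = x := by
  obtain ⟨A, rfl⟩ := mk_surjective x
  rw [map_mk, GeneralLinearGroup.map_id]; rfl

/-- Ring isomorphisms induce isomorphisms of `PGL2`. -/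
def mapEquiv (e : R ≃+* S) : PGL2 R ≃* PGL2 S :=
  { map (e : R →+* S) with
    invFun := map (e.symm : S →+* R)
    left_inv := fun x => by
      change map _ (map _ x) = x
      rw [map_map]
      convert map_id x
      ext; simp
    right_inv := fun x => by
      change map _ (map _ x) = x
      rw [map_map]
      convert map_id x
      ext; simp }

/-- The square of a projective class, normalised to have determinant one. -/
def sq : PGL2 R → Mat₂ R :=
  Quotient.lift (fun A : GL (Fin 2) R => (((det A)⁻¹ : Rˣ) : R) •
      ((A : Matrix _ _ R) * (A : Matrix _ _ R))) (by
    intro A B h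
    have h' : mk A = mk B := Quotient.sound h
    obtain ⟨u, hu⟩ := mk_eq_mk.1 h'
    have hd : det A = u ^ 2 * det B := by
      ext
      simp [hu]
    simp only [hd, hu]
    rw [smul_mul_smul_comm, smul_smul]
    congr 1
    rw [mul_inv, ← pow_two, ← Units.val_pow_eq_pow_val, ← Units.val_mul]
    simp)

theorem sq_mk (A : GL (Fin 2) R) : sq (mk A) = (((det A)⁻¹ : Rˣ) : R) • ((A : Mat₂ R) * (A : Matrix _ _ R)) := rfl

theorem sq_one : sq (1 : PGL2 R) = 1 := by rw [← map_one mk, sq_mk]; simp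

theorem sq_map (f : R →+* S) (x : PGL2 R) : sq (map f x) = (sq x).map f := by
  obtain ⟨A, rfl⟩ := mk_surjective x
  rw [map_mk, sq_mk, sq_mk]
  have : ((det (GeneralLinearGroup.map f A))⁻¹ : Sˣ)
    = Units.map (f : R →* S) (det A)⁻¹ := by
    rw [GeneralLinearGroup.map_det, map_inv]
  rw [this]
  ext i j
  simp [mul_apply]

theorem sq_conj (A : GL (Fin 2) R) (y : PGL2 R) :
    sq (mk A * y * (mk A)⁻¹) = (A : Mat₂ R) * sq y * ((A⁻¹ : GL (Fin 2) R) : Mat₂ R) := by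
  obtain ⟨B, rfl⟩ := mk_surjective y
  rw [← map_inv, ← map_mul, ← map_mul, sq_mk, sq_mk]
  have : det (A * B * A⁻¹) = det B := by rw [map_mul, map_mul, map_inv, mul_inv_cancel_comm]
  rw [this, Matrix.mul_smul, Matrix.smul_mul]
  congr 1
  have h : (A * B * A⁻¹) * (A * B * A⁻¹) = A * (B * B) * A⁻¹ := by group
  exact congrArg Units.val h

end PGL2

/-- Noncommutative polynomials evaluated at normalised squares. -/
noncomputable def evalSq {X R : Type*} [CommRing R] (u : X → PGL2 R) : FreeAlgebra ℤ X →ₐ[ℤ] Mat₂ R :=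
  FreeAlgebra.lift ℤ fun x => PGL2.sq (u x)

/-- The trace function attached to a map into `PGL2`. -/
noncomputable def sqTrace {X R : Type*} [CommRing R] (u : X → PGL2 R) (x : FreeAlgebra ℤ X) : R :=
  (evalSq u x).trace

section

variable {X R S : Type*} [CommRing R] [CommRing S]

@[simp] theorem evalSq_ι (u : X → PGL2 R) (x : X) : evalSq u (FreeAlgebra.ι ℤ x) = PGL2.sq (u x) := by simp [evalSq]

theorem evalSq_map (f : R →+* S) (u : X → PGL2 R) (x : FreeAlgebra ℤ X) :
    evalSq (fun g => PGL2.map f (u g)) x = (evalSq u x).map f := by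
  have : evalSq (fun g => PGL2.map f (u g)) =
      ((f.mapMatrix : Mat₂ R →+* _).toIntAlgHom).comp (evalSq u) := by
    ext g : 2
    change evalSq _ (FreeAlgebra.ι ℤ g) = (evalSq u (FreeAlgebra.ι ℤ g)).map f
    simp [PGL2.sq_map]
  rw [this]; rfl

theorem sqTrace_map (f : R →+* S) (u : X → PGL2 R) (x : FreeAlgebra ℤ X) :
    sqTrace (fun g => PGL2.map f (u g)) x = f (sqTrace u x) := by
  rw [sqTrace, evalSq_map, sqTrace, AddMonoidHom.map_trace f]

theorem evalSq_conj (A : GL (Fin 2) R) (u : X → PGL2 R) (x : FreeAlgebra ℤ X) :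
    evalSq (fun g => PGL2.mk A * u g * (PGL2.mk A)⁻¹) x
      = (A : Mat₂ R) * evalSq u x * ((A⁻¹ : GL (Fin 2) R) : Matrix _ _ R) := by
  have : evalSq (fun g => PGL2.mk A * u g * (PGL2.mk A)⁻¹) =
      ((MulSemiringAction.toRingHom (ConjAct (GL (Fin 2) R)) (Mat₂ R)
        (ConjAct.toConjAct A)).toIntAlgHom).comp (evalSq u) := by
    ext g : 2
    change evalSq _ (FreeAlgebra.ι ℤ g) = (A : Mat₂ R)
      * evalSq u (FreeAlgebra.ι ℤ g) * ((A⁻¹ : GL (Fin 2) R) : Matrix _ _ R)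
    rw [evalSq_ι, evalSq_ι, PGL2.sq_conj]
  rw [this]
  rfl

theorem sqTrace_conj (c : PGL2 R) (u : X → PGL2 R) (x : FreeAlgebra ℤ X) :
    sqTrace (fun g => c * u g * c⁻¹) x = sqTrace u x := by
  obtain ⟨A, rfl⟩ := PGL2.mk_surjective c
  rw [sqTrace, evalSq_conj, Matrix.trace_mul_comm, ← mul_assoc]
  have : ((A⁻¹ : GL (Fin 2) R) : Mat₂ R) * (A : Matrix _ _ R) = 1 := A.inv_mul
  rw [this, one_mul, sqTrace]

theorem sqTrace_add (u : X → PGL2 R) (x y : FreeAlgebra ℤ X) : sqTrace u (x + y) = sqTrace u x + sqTrace u y := by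
  simp [sqTrace, Matrix.trace_add]

end

namespace PGL2

variable {R S : Type*} [CommRing R] [CommRing S]

/-- The translation matrix. -/
def upper (n : R) : GL (Fin 2) R :=
  ⟨!![1, n; 0, 1], !![1, -n; 0, 1], by simp [one_fin_two], by simp [one_fin_two]⟩

/-- The diagonal matrix with entries `u, 1`. -/
def diag (u : Rˣ) : GL (Fin 2) R :=
  ⟨!![(u : R), 0; 0, 1], !![((u⁻¹ : Rˣ) : R), 0; 0, 1], by simp [one_fin_two],
    by simp [one_fin_two]⟩

/-- The permutation matrix. -/
def swap : GL (Fin 2) R :=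
  ⟨!![0, 1; 1, 0], !![0, 1; 1, 0], by simp [one_fin_two], by simp [one_fin_two]⟩

@[simp] theorem coe_upper (n : R) : (upper n : Mat₂ R) = !![1, n; 0, 1] := rfl
@[simp] theorem coe_swap : ((swap : GL (Fin 2) R) : Mat₂ R) = !![0, 1; 1, 0] := rfl
@[simp] theorem coe_diag (u : Rˣ) : (diag u : Mat₂ R) = !![(u : R), 0; 0, 1] := rfl

theorem upper_add (m n : R) : upper (m + n) = upper m * upper n := by
  ext i j; fin_cases i <;> fin_cases j <;> simp [add_comm]

theorem diag_mul (u v : Rˣ) : diag (u * v) = diag u * diag v := by ext i j; fin_cases i <;> fin_cases j <;> simp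

theorem map_upper (f : R →+* S) (n : R) : GeneralLinearGroup.map f (upper n) = upper (f n) := by
  ext i j; fin_cases i <;> fin_cases j <;> simp

theorem map_diag (f : R →+* S) (u : Rˣ) : GeneralLinearGroup.map f (diag u) = diag (Units.map f u) := by
  ext i j; fin_cases i <;> fin_cases j <;> simp

theorem map_swap (f : R →+* S) : GeneralLinearGroup.map f (swap : GL (Fin 2) R) = swap := by
  ext i j; fin_cases i <;> fin_cases j <;> simp

end PGL2

end ProjectiveLinear

open PGL2 (mk upper diag swap mk_surjective)

section Rigidity

open scoped Pointwise

namespace EisensteinInt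

/-- The sixth root of unity `1 + ω`. -/
def zeta : 𝓔ˣ := ⟨⟨1, 1⟩, ⟨0, -1⟩, by ext <;> simp, by ext <;> simp⟩

@[simp] theorem coe_zeta : (zeta : 𝓔) = ⟨1, 1⟩ := rfl

theorem zeta_sq : zeta ^ 2 = ⟨⟨0, 1⟩, ⟨-1, -1⟩, by ext <;> simp, by ext <;> simp⟩ := by ext <;> simp [pow_two]

theorem zeta_pow_three : zeta ^ 3 = -1 := by rw [pow_succ, zeta_sq]; ext <;> simp

theorem zeta_pow_six : zeta ^ 6 = 1 := by rw [show 6 = 3 * 2 from rfl, pow_mul, zeta_pow_three]; simp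

theorem exists_zeta_pow (u : 𝓔ˣ) : ∃ n : ℕ, u = zeta ^ n := by
  have h3 := zeta_pow_three
  have h2 := zeta_sq
  rcases eq_of_norm_eq_one (isUnit_iff.1 u.isUnit) with h | h | h | h | h | h
  · exact ⟨0, by ext <;> simp [h]⟩
  · exact ⟨3, by rw [h3]; ext <;> simp [h]⟩
  · exact ⟨2, by rw [h2]; ext <;> simp [h]⟩
  · exact ⟨5, by rw [show 5 = 3 + 2 from rfl, pow_add, h3, h2]; ext <;> simp [h]⟩
  · exact ⟨1, by ext <;> simp [h]⟩
  · exact ⟨4, by rw [show 4 = 3 + 1 from rfl, pow_add, h3]; ext <;> simp [h]⟩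

end EisensteinInt

open EisensteinInt

theorem diag_zeta_pow (n : ℕ) : diag (zeta ^ n) = diag zeta ^ n := by
  induction n with
  | zero => ext i j : 2; fin_cases i <;> fin_cases j <;> simp
  | succ n ih => rw [pow_succ, PGL2.diag_mul, ih, pow_succ]

theorem mk_upper_mem (K : Subgroup (PGL2 𝓔)) (h1 : mk (upper 1) ∈ K) (h2 : mk (diag zeta) ∈ K)
    (n : 𝓔) : mk (upper n) ∈ K := by
  have key : ∀ x : 𝓔, mk (upper x) ∈ K → ∀ k : ℤ, mk (upper (k • x)) ∈ K := by
    intro x hx k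
    have : upper (k • x) = upper x ^ k := by
      induction k using Int.induction_on with
      | zero => ext i j : 2; fin_cases i <;> fin_cases j <;> simp
      | succ k ih => rw [add_smul, one_smul, PGL2.upper_add, ih, zpow_add_one]
      | pred k ih =>
        rw [sub_smul, one_smul, zpow_sub_one, ← ih, eq_mul_inv_iff_mul_eq, ← PGL2.upper_add]
        congr 1; ring
    rw [this, map_zpow]
    exact K.zpow_mem hx k
  have h3 : mk (upper (⟨1, 1⟩ : 𝓔)) ∈ K := by
    have : diag zeta * upper 1 = upper (⟨1, 1⟩ : 𝓔) * diag zeta := by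
      ext i j : 2; fin_cases i <;> fin_cases j <;> simp [mul_apply, Fin.sum_univ_two]
    have h4 : mk (upper (⟨1, 1⟩ : 𝓔)) = mk (diag zeta) * mk (upper 1) * (mk (diag zeta))⁻¹ := by
      rw [← map_mul, this, map_mul, mul_inv_cancel_right]
    rw [h4]
    exact K.mul_mem (K.mul_mem h2 h1) (K.inv_mem h2)
  have : n = (n.re - n.im) • (1 : 𝓔) + n.im • (⟨1, 1⟩ : 𝓔) := by ext <;> simp
  rw [this, PGL2.upper_add, map_mul]
  exact K.mul_mem (key _ h1 _) (key _ h3 _)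

/-- The three standard generators. -/
theorem closure_generators : Subgroup.closure {mk (upper (1 : 𝓔)), mk (diag zeta), mk swap} = ⊤ := by
  rw [eq_top_iff]
  intro x _
  obtain ⟨A, rfl⟩ := mk_surjective x
  set K := Subgroup.closure {mk (upper (1 : 𝓔)), mk (diag zeta), mk swap} with hK
  have h1 : mk (upper 1) ∈ K := Subgroup.subset_closure (by simp)
  have h2 : mk (diag zeta) ∈ K := Subgroup.subset_closure (by simp)
  have h3 : mk swap ∈ K := Subgroup.subset_closure (by simp)
  have hu := mk_upper_mem K h1 h2
  induction hn : (A 1 0).norm.natAbs using Nat.strong_induction_on generalizing A with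
  | _ n ih =>
    by_cases h0 : A 1 0 = 0
    · have hdet : IsUnit (A 0 0 * A 1 1) := by
        have := (det A).isUnit
        rw [val_det_apply, det_fin_two, h0, mul_zero, sub_zero] at this
        exact this
      obtain ⟨x, hx⟩ := isUnit_of_mul_isUnit_left hdet
      obtain ⟨w, hw⟩ := isUnit_of_mul_isUnit_right hdet
      obtain ⟨k, hk⟩ := exists_zeta_pow (x * w⁻¹)
      have : mk A = mk (upper (A 0 1 * ((w⁻¹ : 𝓔ˣ) : 𝓔)) * diag (x * w⁻¹)) := by
        rw [PGL2.mk_eq_mk]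
        refine ⟨w, ?_⟩
        ext i j : 1
        fin_cases i <;> fin_cases j
        · simp [← hx, mul_left_comm]
        · simp only [Fin.zero_eta, Fin.mk_one]; simp; rw [mul_left_comm, Units.mul_inv, mul_one]
        · simp [h0]
        · simp [← hw]
      rw [this, map_mul, hk, diag_zeta_pow, map_pow]
      exact K.mul_mem (hu _) (K.pow_mem h2 _)
    · obtain ⟨q, hq⟩ := exists_norm_sub_mul_lt (A 0 0) (A 1 0) h0
      have h4 := ih ((A 0 0 - q * A 1 0).norm.natAbs) (by
        rw [← hn]
        have := EisensteinInt.norm_nonneg (A 0 0 - q * A 1 0)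
        omega) (swap * (upper (-q) * A)) trivial (by
          congr 2
          simp [Matrix.vecMul, dotProduct, Fin.sum_univ_two, sub_eq_add_neg])
      rw [map_mul, map_mul] at h4
      have h5 := (K.mul_mem_cancel_left h3).1 h4
      exact (K.mul_mem_cancel_left (hu _)).1 h5

instance : Group.FG (PGL2 𝓔) :=
  Group.fg_iff.2 ⟨_, closure_generators, by simp⟩

/-- The relations between the standard generators that are used below. -/
structure StdRelations {Q : Type*} [Group Q] (A D S : Q) : Prop where
  d6 : D ^ 6 = 1
  s2 : S * S = 1
  sd : S * D * S = D⁻¹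
  comm : A * (D * A * D⁻¹) = D * A * D⁻¹ * A
  ada : A * D ^ 2 * A = D * A * D
  cube : (A * D ^ 3 * S) ^ 3 = 1

theorem StdRelations.map {Q Q' : Type*} [Group Q] [Group Q'] {A D S : Q}
    (h : StdRelations A D S) (f : Q →* Q') : StdRelations (f A) (f D) (f S) where
  d6 := by rw [← map_pow, h.d6, map_one]
  s2 := by rw [← map_mul, h.s2, map_one]
  sd := by rw [← map_mul, ← map_mul, h.sd, map_inv]
  comm := by simpa using congrArg f h.comm
  ada := by simpa using congrArg f h.ada
  cube := by simpa using congrArg f h.cube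

theorem stdRelations : StdRelations (mk (upper (1 : 𝓔))) (mk (diag zeta)) (mk swap) := by
  have hconj : mk (diag zeta) * mk (upper (1 : 𝓔)) * (mk (diag zeta))⁻¹
      = mk (upper (⟨1, 1⟩ : 𝓔)) := by
    rw [mul_inv_eq_iff_eq_mul, ← map_mul, ← map_mul]
    congr 1
    ext i j : 2; fin_cases i <;> fin_cases j <;> simp [mul_apply, Fin.sum_univ_two]
  refine ⟨?_, ?_, ?_, ?_, ?_, ?_⟩
  · rw [← map_pow, ← diag_zeta_pow, zeta_pow_six]
    convert map_one mk
    ext i j : 2; fin_cases i <;> fin_cases j <;> simp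
  · rw [← map_mul]
    convert map_one mk
    ext i j : 2; fin_cases i <;> fin_cases j <;> simp
  · rw [eq_inv_iff_mul_eq_one, ← map_mul, ← map_mul, ← map_mul, PGL2.mk_eq_one]
    refine ⟨zeta, ?_⟩
    ext i j : 1; fin_cases i <;> fin_cases j <;> simp
  · rw [hconj, ← map_mul, ← map_mul, ← PGL2.upper_add, ← PGL2.upper_add, add_comm]
  · rw [← map_pow, ← map_mul, ← map_mul, ← map_mul, ← map_mul, ← diag_zeta_pow, zeta_sq]
    congr 1
    ext i j : 2
    fin_cases i <;> fin_cases j <;> ext <;> simp [mul_apply, Fin.sum_univ_two]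
  · rw [← map_pow, ← diag_zeta_pow, zeta_pow_three, ← map_mul, ← map_mul, ← map_pow, PGL2.mk_eq_one]
    refine ⟨-1, ?_⟩
    ext i j : 1
    fin_cases i <;> fin_cases j <;> simp [pow_succ]

section FiniteCase

variable {Q : Type*} [Group Q] {A D S : Q}

/-- A group generated by elements subject to the standard relations is small as soon as the
conjugates of `A` under `D` form, with `1`, a small group. -/
theorem StdRelations.card_closure_le (h : StdRelations A D S) (U : Subgroup Q) [Finite U]
    (hcard : Nat.card U ≤ 4) (hA : A ∈ U) (hnorm : ∀ u ∈ U, D * u * D⁻¹ ∈ U)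
    (hU : ∀ u ∈ U, u = 1 ∨ ∃ i : ℤ, u = D ^ i * A * D ^ (-i)) :
    Finite (Subgroup.closure {A, D, S}) ∧ Nat.card (Subgroup.closure {A, D, S}) ≤ 120 := by
  have hD6 := h.d6
  have hnorm' : ∀ (i : ℤ) (u : Q), u ∈ U → D ^ i * u * D ^ (-i) ∈ U := by
    have hpos : ∀ (i : ℕ) (u : Q), u ∈ U → D ^ i * u * (D ^ i)⁻¹ ∈ U := by
      intro i
      induction i with
      | zero => intro u hu; simpa using hu
      | succ i ih =>
        intro u hu
        have := hnorm _ (ih u hu)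
        rw [pow_succ', mul_inv_rev]
        simpa [mul_assoc] using this
    intro i u hu
    have : D ^ i = D ^ (i % 6).toNat := by
      have h0 : 0 ≤ i % 6 := Int.emod_nonneg _ (by norm_num)
      rw [← zpow_natCast, Int.toNat_of_nonneg h0]
      conv_lhs => rw [← Int.emod_add_mul_ediv i 6, zpow_add, zpow_mul]
      have : D ^ (6 : ℤ) = 1 := by exact_mod_cast hD6
      rw [this, one_zpow, mul_one]
    rw [zpow_neg, this]
    exact hpos _ _ hu
  have hSD : ∀ i : ℤ, S * D ^ i = D ^ (-i) * S := by
    intro i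
    have hs : S⁻¹ = S := inv_eq_of_mul_eq_one_left h.s2
    have h1 : S * D * S⁻¹ = D⁻¹ := by rw [hs]; exact h.sd
    have h2 : S * D ^ i * S⁻¹ = D ^ (-i) := by rw [← conj_zpow, h1, inv_zpow, zpow_neg]
    rw [← h2]; group
  have hSAS : S * A = D ^ (3 : ℤ) * A⁻¹ * D ^ (3 : ℤ) * S * A⁻¹ * D ^ (3 : ℤ) * S := by
    have h1 : A * (D ^ 3 * S) * (A * (D ^ 3 * S)) * (A * (D ^ 3 * S)) = 1 := by
      have := h.cube
      simpa [pow_succ, mul_assoc] using this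
    have h3 : D ^ (3 : ℤ) = D ^ 3 := by norm_cast
    have h4 : D ^ 3 * D ^ 3 = 1 := by rw [← pow_add]; exact hD6
    have h5 : D ^ 3 * S * (D ^ 3 * S) = 1 := by
      have := hSD 3
      rw [zpow_neg, h3, inv_eq_of_mul_eq_one_left h4] at this
      calc D ^ 3 * S * (D ^ 3 * S) = D ^ 3 * (S * D ^ 3) * S := by group
        _ = (D ^ 3 * D ^ 3) * (S * S) := by rw [this]; group
        _ = 1 := by rw [h4, h.s2, one_mul]
    rw [h3]
    have h6 : D ^ 3 * S * A = A⁻¹ * (D ^ 3 * S) * A⁻¹ * (D ^ 3 * S) := by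
      have h7 : A * (D ^ 3 * S) * A * ((D ^ 3 * S) * A * (D ^ 3 * S)) = 1 := by rw [← h1]; group
      have h8 : (D ^ 3 * S) * A * (D ^ 3 * S) = A⁻¹ * (D ^ 3 * S) * A⁻¹ := by
        have h9 := eq_inv_of_mul_eq_one_right h7
        rw [h9]
        have h10 : (D ^ 3 * S)⁻¹ = D ^ 3 * S := inv_eq_of_mul_eq_one_left h5
        calc (A * (D ^ 3 * S) * A)⁻¹ = A⁻¹ * (D ^ 3 * S)⁻¹ * A⁻¹ := by group
          _ = _ := by rw [h10]
      calc D ^ 3 * S * A = (D ^ 3 * S) * A * (D ^ 3 * S) * (D ^ 3 * S) := by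
            rw [mul_assoc _ (D ^ 3 * S) (D ^ 3 * S), h5, mul_one]
        _ = _ := by rw [h8]
    calc S * A = D ^ 3 * D ^ 3 * S * A := by rw [h4, one_mul]
      _ = D ^ 3 * (D ^ 3 * S * A) := by group
      _ = _ := by rw [h6]; group
  let X : Set Q := {x | ∃ u ∈ U, ∃ i : ℤ, x = u * D ^ i} ∪
    {x | ∃ u ∈ U, ∃ i : ℤ, ∃ v ∈ U, x = u * D ^ i * S * v}
  let f : (U × Fin 6) ⊕ (U × Fin 6 × U) → Q := fun p => match p with
    | Sum.inl (u, i) => u * D ^ (i : ℕ)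
    | Sum.inr (u, i, v) => u * D ^ (i : ℕ) * S * v
  have hmod : ∀ i : ℤ, ∃ j : Fin 6, D ^ i = D ^ (j : ℕ) := by
    intro i
    have h0 : 0 ≤ i % 6 := Int.emod_nonneg _ (by norm_num)
    have h6 : i % 6 < 6 := Int.emod_lt_of_pos _ (by norm_num)
    refine ⟨⟨(i % 6).toNat, by omega⟩, ?_⟩
    simp only
    rw [← zpow_natCast, Int.toNat_of_nonneg h0]
    conv_lhs => rw [← Int.emod_add_mul_ediv i 6, zpow_add, zpow_mul]
    have : D ^ (6 : ℤ) = 1 := by exact_mod_cast hD6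
    rw [this, one_zpow, mul_one]
  have hX : X ⊆ Set.range f := by
    rintro x (⟨u, hu, i, rfl⟩ | ⟨u, hu, i, v, hv, rfl⟩)
    · obtain ⟨j, hj⟩ := hmod i
      exact ⟨Sum.inl (⟨u, hu⟩, j), by simp [f, hj]⟩
    · obtain ⟨j, hj⟩ := hmod i
      exact ⟨Sum.inr (⟨u, hu⟩, j, ⟨v, hv⟩), by simp [f, hj]⟩
  have hXfin : X.Finite := (Set.finite_range f).subset hX
  have hXcard : X.ncard ≤ 120 := by
    have h1 : X.ncard ≤ (Set.range f).ncard := Set.ncard_le_ncard hX (Set.finite_range f)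
    have h2 : (Set.range f).ncard ≤ Nat.card ((U × Fin 6) ⊕ (U × Fin 6 × U)) := by
      rw [← Set.image_univ, ← Set.ncard_univ]
      exact Set.ncard_image_le (Set.toFinite _)
    rw [Nat.card_sum, Nat.card_prod, Nat.card_prod, Nat.card_prod, Nat.card_fin] at h2
    nlinarith
  have hleft : ∀ g ∈ ({A, D, S} : Set Q), ∀ x ∈ X, g * x ∈ X := by
    rintro g (rfl | rfl | rfl) x (⟨u, hu, i, rfl⟩ | ⟨u, hu, i, v, hv, rfl⟩)
    · exact Or.inl ⟨_, U.mul_mem hA hu, i, by group⟩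
    · exact Or.inr ⟨_, U.mul_mem hA hu, i, v, hv, by group⟩
    · exact Or.inl ⟨_, hnorm u hu, i + 1, by group⟩
    · exact Or.inr ⟨_, hnorm u hu, i + 1, v, hv, by group⟩
    · refine Or.inr ⟨1, U.one_mem, -i, _, hnorm' (-i) u hu, ?_⟩
      calc g * (u * D ^ i) = (g * D ^ i) * (D ^ (-i) * u * D ^ (- -i)) := by group
        _ = _ := by rw [hSD]; group
    · rcases hU u hu with rfl | ⟨j, rfl⟩
      · refine Or.inl ⟨_, hnorm' (-i) v hv, -i, ?_⟩
        calc g * (1 * D ^ i * g * v) = (g * D ^ i) * g * v := by group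
          _ = D ^ (-i) * (g * g) * v := by rw [hSD]; group
          _ = _ := by rw [h.s2]; group
      · refine Or.inr ⟨_, hnorm' (-j + 3) _ (U.inv_mem hA), 3 - (3 + j + -i) + (-j + 3),
          _, U.mul_mem (hnorm' (-(3 + j + -i)) _ (U.inv_mem hA)) hv, ?_⟩
        have e1 : g * (D ^ j * A * D ^ (-j) * D ^ i * g * v)
            = (g * D ^ j) * A * (D ^ (-j + i) * g) * v := by group
        have e2 : ∀ k : ℤ, D ^ k * g = g * D ^ (-k) := by intro k; rw [hSD, neg_neg]
        rw [e1, hSD j, e2 (-j + i), mul_assoc (D ^ (-j)) g A, hSAS]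
        have e3 : D ^ (-j) * (D ^ (3 : ℤ) * A⁻¹ * D ^ (3 : ℤ) * g * A⁻¹ * D ^ (3 : ℤ) * g)
            * (g * D ^ (-(-j + i))) * v = D ^ (-j) * (D ^ (3 : ℤ) * A⁻¹ * D ^ (3 : ℤ) * g * A⁻¹
              * D ^ (3 : ℤ)) * (g * g) * D ^ (-(-j + i)) * v := by group
        rw [e3, h.s2]
        have e4 : D ^ (-j) * (D ^ (3 : ℤ) * A⁻¹ * D ^ (3 : ℤ) * g * A⁻¹ * D ^ (3 : ℤ)) * 1
            * D ^ (-(-j + i)) * v = D ^ (-j) * D ^ (3 : ℤ) * A⁻¹ * D ^ (3 : ℤ)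
            * (g * D ^ (3 + j + -i)) * (D ^ (-(3 + j + -i)) * A⁻¹ * D ^ (3 + j + -i)) * v := by
          group
        rw [e4, hSD (3 + j + -i)]
        group
  have hstab : Subgroup.closure {A, D, S} ≤ MulAction.stabilizer Q X := by
    rw [Subgroup.closure_le]
    intro g hg
    rw [SetLike.mem_coe, MulAction.mem_stabilizer_iff]
    refine Set.eq_of_subset_of_ncard_le ?_ ?_ hXfin
    · rintro _ ⟨x, hx, rfl⟩
      exact hleft g hg x hx
    · exact (Set.ncard_image_of_injective X (mul_right_injective g)).ge
  have hsub : ((Subgroup.closure {A, D, S} : Subgroup Q) : Set Q) ⊆ X := by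
    intro g hg
    have h1 : g • X = X := hstab hg
    rw [← h1]
    exact ⟨1, Or.inl ⟨1, U.one_mem, 0, by simp⟩, by simp⟩
  refine ⟨(hXfin.subset hsub).to_subtype, ?_⟩
  have := Set.ncard_le_ncard hsub hXfin
  exact le_trans this hXcard

theorem StdRelations.card_closure_le_of_sq (h : StdRelations A D S) (hA : A * A = 1) :
    Finite (Subgroup.closure {A, D, S}) ∧ Nat.card (Subgroup.closure {A, D, S}) ≤ 120 := by
  set B := D * A * D⁻¹ with hB
  have hB2 : B * B = 1 := by
    rw [hB]; calc D * A * D⁻¹ * (D * A * D⁻¹) = D * (A * A) * D⁻¹ := by group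
      _ = 1 := by rw [hA]; group
  have hAB : A * B = B * A := h.comm
  have hDB : D * B * D⁻¹ = A * B := by
    have h1 := h.ada
    have h2 : D * A * D = B * D ^ 2 := by rw [hB]; simp [pow_two, mul_assoc]
    rw [h2] at h1
    calc D * B * D⁻¹ = D ^ 2 * A * (D ^ 2)⁻¹ := by simp only [hB, pow_two, mul_inv_rev, mul_assoc]
      _ = A * A * D ^ 2 * A * (D ^ 2)⁻¹ := by rw [hA, one_mul]
      _ = A * (A * D ^ 2 * A) * (D ^ 2)⁻¹ := by group
      _ = A * B := by rw [h1]; group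
  have hDAB : D * (A * B) * D⁻¹ = A := by
    calc D * (A * B) * D⁻¹ = (D * A * D⁻¹) * (D * B * D⁻¹) := by group
      _ = B * (A * B) := by rw [hDB]
      _ = A * (B * B) := by rw [← mul_assoc, ← hAB, mul_assoc]
      _ = A := by rw [hB2, mul_one]
  let U : Subgroup Q :=
    { carrier := {1, A, B, A * B}
      one_mem' := by simp
      mul_mem' := by
        have h1 : A * (A * B) = B := by rw [← mul_assoc, hA, one_mul]
        have h2 : B * (A * B) = A := by rw [← mul_assoc, ← hAB, mul_assoc, hB2, mul_one]
        have h3 : A * B * A = B := by rw [hAB, mul_assoc, hA, mul_one]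
        have h4 : A * B * B = A := by rw [mul_assoc, hB2, mul_one]
        have h5 : A * B * (A * B) = 1 := by rw [← mul_assoc, h3, hB2]
        rintro x y (rfl | rfl | rfl | rfl) (rfl | rfl | rfl | rfl) <;>
          simp [hA, hB2, h1, h2, h3, h4, h5, ← hAB]
      inv_mem' := by
        have h1 : A⁻¹ = A := inv_eq_of_mul_eq_one_left hA
        have h2 : B⁻¹ = B := inv_eq_of_mul_eq_one_left hB2
        rintro x (rfl | rfl | rfl | rfl) <;> simp [h1, h2, hAB] }
  have hUf : (U : Set Q).Finite := by
    change ({1, A, B, A * B} : Set Q).Finite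
    simp
  have : Finite U := hUf.to_subtype
  refine h.card_closure_le U ?_ (by change A ∈ ({1, A, B, A * B} : Set Q); simp) ?_ ?_
  · change ({1, A, B, A * B} : Set Q).ncard ≤ 4
    refine (Set.ncard_insert_le _ _).trans ?_
    refine Nat.succ_le_succ ((Set.ncard_insert_le _ _).trans ?_)
    refine Nat.succ_le_succ ((Set.ncard_insert_le _ _).trans ?_)
    simp
  · intro u hu
    change D * u * D⁻¹ ∈ ({1, A, B, A * B} : Set Q)
    rcases hu with rfl | rfl | rfl | rfl
    · simp
    · simp [← hB]
    · rw [hDB]; simp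
    · rw [hDAB]; simp
  · rintro u (rfl | rfl | rfl | rfl)
    · simp
    · exact Or.inr ⟨0, by simp⟩
    · exact Or.inr ⟨1, by simp [hB]⟩
    · refine Or.inr ⟨2, ?_⟩
      rw [← hDB, hB]; simp only [zpow_neg, zpow_ofNat, pow_two, mul_inv_rev, mul_assoc]

theorem StdRelations.card_closure_le_of_inv (h : StdRelations A D S) (hA : D * A * D⁻¹ = A⁻¹) :
    Finite (Subgroup.closure {A, D, S}) ∧ Nat.card (Subgroup.closure {A, D, S}) ≤ 120 := by
  have hDi : D * A⁻¹ * D⁻¹ = A := by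
    have := congrArg Inv.inv hA
    simpa [mul_assoc] using this
  have h3 : A * A = A⁻¹ := by
    have h1 := h.ada
    have h2 : D * A * D = A⁻¹ * D ^ 2 := by rw [← hA]; simp [pow_two, mul_assoc]
    rw [h2] at h1
    have h4 : D ^ 2 * A * (D ^ 2)⁻¹ = A := by
      calc D ^ 2 * A * (D ^ 2)⁻¹ = D * (D * A * D⁻¹) * D⁻¹ := by simp only [pow_two, mul_inv_rev, mul_assoc]
        _ = A := by rw [hA, hDi]
    calc A * A = A * (D ^ 2 * A * (D ^ 2)⁻¹) := by rw [h4]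
      _ = (A * D ^ 2 * A) * (D ^ 2)⁻¹ := by group
      _ = A⁻¹ := by rw [h1]; group
  let U : Subgroup Q :=
    { carrier := {1, A, A⁻¹}
      one_mem' := by simp
      mul_mem' := by
        have h4 : A⁻¹ * A⁻¹ = A := by rw [← mul_inv_rev, h3, inv_inv]
        rintro x y (rfl | rfl | rfl) (rfl | rfl | rfl) <;> simp [h3, h4]
      inv_mem' := by rintro x (rfl | rfl | rfl) <;> simp }
  have hUf : (U : Set Q).Finite := by
    change ({1, A, A⁻¹} : Set Q).Finite
    simp
  have : Finite U := hUf.to_subtype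
  refine h.card_closure_le U ?_ (by change A ∈ ({1, A, A⁻¹} : Set Q); simp) ?_ ?_
  · change ({1, A, A⁻¹} : Set Q).ncard ≤ 4
    refine (Set.ncard_insert_le _ _).trans ?_
    refine Nat.succ_le_succ ((Set.ncard_insert_le _ _).trans ?_)
    simp
  · intro u hu
    change D * u * D⁻¹ ∈ ({1, A, A⁻¹} : Set Q)
    rcases hu with rfl | rfl | rfl
    · simp
    · simp [hA]
    · simp [hDi]
  · rintro u (rfl | rfl | rfl)
    · simp
    · exact Or.inr ⟨0, by simp⟩
    · refine Or.inr ⟨1, ?_⟩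
      rw [← hA]; group

end FiniteCase

end Rigidity

section Rigidity

open scoped Pointwise

namespace PGL2

variable {F : Type*} [Field F]

/-- A matrix representing a given projective class. -/
def Represents (x : PGL2 F) (M : Mat₂ F) : Prop :=
  ∃ A : GL (Fin 2) F, mk A = x ∧ (A : Mat₂ F) = M

namespace Represents

variable {x y : PGL2 F} {M N : Mat₂ F}

theorem det_ne_zero (h : Represents x M) : M.det ≠ 0 := by
  obtain ⟨A, -, rfl⟩ := h
  exact (det A).ne_zero

theorem mul (h : Represents x M) (h' : Represents y N) : Represents (x * y) (M * N) := by
  obtain ⟨A, rfl, rfl⟩ := h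
  obtain ⟨B, rfl, rfl⟩ := h'
  exact ⟨A * B, map_mul _ _ _, rfl⟩

theorem one : Represents (1 : PGL2 F) 1 := ⟨1, map_one _, rfl⟩

theorem exists_smul (h : Represents x M) (h' : Represents x N) : ∃ u : F, u ≠ 0 ∧ M = u • N := by
  obtain ⟨A, rfl, rfl⟩ := h
  obtain ⟨B, h, rfl⟩ := h'
  obtain ⟨u, hu⟩ := mk_eq_mk.1 h.symm
  exact ⟨u, u.ne_zero, hu⟩

theorem eq_of_smul (h : Represents x M) (h' : Represents y N) {u : F} (hu : u ≠ 0) (e : M = u • N) : x = y := by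
  obtain ⟨A, rfl, rfl⟩ := h
  obtain ⟨B, rfl, rfl⟩ := h'
  exact mk_eq_mk.2 ⟨Units.mk0 u hu, e⟩

theorem smul (h : Represents x M) {u : F} (hu : u ≠ 0) : Represents x (u • M) := by
  have hd : (u • M).det ≠ 0 := by rw [Matrix.det_smul]; exact mul_ne_zero (pow_ne_zero _ hu) h.det_ne_zero
  refine ⟨GeneralLinearGroup.mkOfDetNeZero _ hd, ?_, rfl⟩
  exact eq_of_smul ⟨_, rfl, rfl⟩ h hu rfl

theorem inv (h : Represents x M) : Represents x⁻¹ M.adjugate := by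
  obtain ⟨A, rfl, rfl⟩ := h
  have hd : (A : Mat₂ F).det ≠ 0 := (det A).ne_zero
  have h1 : Represents (mk A)⁻¹ ((A⁻¹ : GL (Fin 2) F) : Mat₂ F) :=
    ⟨A⁻¹, map_inv _ _, rfl⟩
  have h2 := h1.smul hd
  rwa [Matrix.coe_units_inv, Matrix.inv_def, smul_smul, Ring.mul_inverse_cancel _ (isUnit_iff_ne_zero.2 hd),
    one_smul] at h2

end Represents

theorem exists_represents (x : PGL2 F) : ∃ p q r t : F, Represents x !![p, q; r, t] := by
  obtain ⟨A, rfl⟩ := mk_surjective x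
  exact ⟨_, _, _, _, A, rfl, Matrix.eta_fin_two _⟩

theorem represents_of_ne_zero {p q r t : F} (h : p * t - q * r ≠ 0) : ∃ x, Represents x !![p, q; r, t] :=
  ⟨_, GeneralLinearGroup.mkOfDetNeZero !![p, q; r, t] (by rwa [det_fin_two_of]),
    rfl, rfl⟩

theorem represents_upper (n : F) : Represents (mk (upper n)) !![1, n; 0, 1] := ⟨_, rfl, rfl⟩

theorem represents_diag (u : Fˣ) : Represents (mk (diag u)) !![(u : F), 0; 0, 1] := ⟨_, rfl, rfl⟩

theorem represents_swap : Represents (mk (swap : GL (Fin 2) F)) !![0, 1; 1, 0] := ⟨_, rfl, rfl⟩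

theorem smul_fin_two (u p q r t : F) : u • !![p, q; r, t] = !![u * p, u * q; u * r, u * t] := by simp

theorem of_injective {F : Type*} {p q r t p' q' r' t' : F} :
    (!![p, q; r, t] = !![p', q'; r', t']) ↔ p = p' ∧ q = q' ∧ r = r' ∧ t = t' := by
  constructor
  · intro h
    exact ⟨by simpa using congrFun (congrFun h 0) 0, by simpa using congrFun (congrFun h 0) 1,
      by simpa using congrFun (congrFun h 1) 0, by simpa using congrFun (congrFun h 1) 1⟩
  · rintro ⟨rfl, rfl, rfl, rfl⟩; rfl

/-- Every class is conjugate to that of a diagonal or of the standard unipotent matrix. -/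
theorem exists_conj_normalForm [IsAlgClosed F] (h2 : (2 : F) ≠ 0) (x : PGL2 F) :
    ∃ c : PGL2 F, (∃ l : F, Represents (c⁻¹ * x * c) !![l, 0; 0, 1]) ∨ c⁻¹ * x * c = mk (upper 1) := by
  have tri : ∃ c : PGL2 F, ∃ m n : F, Represents (c⁻¹ * x * c) !![m, n; 0, 1] := by
    obtain ⟨p, q, r, t, hx⟩ := exists_represents x
    by_cases hr : r = 0
    · subst hr
      have hd := hx.det_ne_zero
      rw [det_fin_two_of] at hd
      have ht : t ≠ 0 := by rintro rfl; simp at hd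
      refine ⟨1, p / t, q / t, ?_⟩
      have := hx.smul (inv_ne_zero ht)
      rw [smul_fin_two, inv_mul_cancel₀ ht, mul_zero] at this
      simpa [div_eq_inv_mul] using this
    · obtain ⟨s, hs⟩ := IsAlgClosed.exists_eq_mul_self ((p - t) ^ 2 + 4 * q * r)
      obtain ⟨μ, hμ⟩ : ∃ μ, μ ^ 2 - (p + t) * μ + (p * t - q * r) = 0 := by
        refine ⟨(p + t + s) / 2, ?_⟩
        field_simp
        linear_combination -hs
      obtain ⟨c, hc⟩ := represents_of_ne_zero (p := μ - t) (q := 1) (r := r) (t := 0)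
        (by simpa using hr)
      have h1 := (hc.inv.mul hx).mul hc
      rw [adjugate_fin_two_of, mul_fin_two, mul_fin_two] at h1
      have hd := h1.det_ne_zero
      have e1 : (-r * p + (μ - t) * r) * (μ - t) + (-r * q + (μ - t) * t) * r = 0 := by linear_combination r * hμ
      rw [e1] at h1 hd
      have hd2 : (-r * p + (μ - t) * r) * 1 + (-r * q + (μ - t) * t) * 0 ≠ 0 := by
        intro h0
        apply hd
        rw [det_fin_two_of, h0]
        ring
      have h3 := h1.smul (inv_ne_zero hd2)
      rw [smul_fin_two, inv_mul_cancel₀ hd2] at h3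
      simp only [mul_zero] at h3
      exact ⟨c, _, _, h3⟩
  obtain ⟨c, m, n, h⟩ := tri
  by_cases hm : m = 1
  · subst hm
    by_cases hn : n = 0
    · subst hn; exact ⟨c, Or.inl ⟨1, h⟩⟩
    · obtain ⟨e, he⟩ := represents_of_ne_zero (p := n) (q := 0) (r := 0) (t := (1 : F))
        (by simpa using hn)
      refine ⟨c * e, Or.inr ?_⟩
      have h1 := (he.inv.mul h).mul he
      have h2 : (c * e)⁻¹ * x * (c * e) = e⁻¹ * (c⁻¹ * x * c) * e := by group
      rw [h2]
      refine h1.eq_of_smul (represents_upper 1) hn ?_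
      rw [adjugate_fin_two_of, mul_fin_two, mul_fin_two, smul_fin_two,
        of_injective]
      refine ⟨?_, ?_, ?_, ?_⟩ <;> ring
  · have hm' : 1 - m ≠ 0 := sub_ne_zero.2 (Ne.symm hm)
    obtain ⟨e, he⟩ := represents_of_ne_zero (p := 1) (q := n / (1 - m)) (r := 0) (t := (1 : F))
      (by simp)
    refine ⟨c * e, Or.inl ⟨m, ?_⟩⟩
    have h1 := (he.inv.mul h).mul he
    have h2 : (c * e)⁻¹ * x * (c * e) = e⁻¹ * (c⁻¹ * x * c) * e := by group
    rw [h2]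
    convert h1 using 1
    rw [adjugate_fin_two_of, mul_fin_two, mul_fin_two, of_injective]
    refine ⟨?_, ?_, ?_, ?_⟩ <;> field_simp <;> ring

end PGL2

open PGL2 in
theorem StdRelations.of_diagonal {F : Type*} [Field F] {A D S : PGL2 F} (h : StdRelations A D S)
    {l : F} (hA : Represents A !![l, 0; 0, 1]) : A * A = 1 ∨ D * A * D⁻¹ = A⁻¹ := by
  obtain ⟨p, q, r, t, hD⟩ := exists_represents D
  have hl : l ≠ 0 := by simpa [det_fin_two_of] using hA.det_ne_zero
  have hd := hD.det_ne_zero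
  rw [det_fin_two_of] at hd
  by_cases hl1 : l = 1
  · subst hl1
    have : A = 1 := hA.eq_of_smul Represents.one one_ne_zero (by simp [one_fin_two])
    left; rw [this, one_mul]
  have hB := (hD.mul hA).mul hD.inv
  have hdB := hB.det_ne_zero
  obtain ⟨u, hu, e⟩ := (hA.mul hB).exists_smul (h.comm ▸ hB.mul hA)
  simp only [adjugate_fin_two_of, mul_fin_two, smul_fin_two, of_injective] at e
  simp only [adjugate_fin_two_of, mul_fin_two, det_fin_two_of] at hdB
  obtain ⟨e1, e2, e3, e4⟩ := e
  have hl1' : l - 1 ≠ 0 := sub_ne_zero.2 hl1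
  have f2 : p * q * (l - u) = 0 := by apply mul_left_cancel₀ hl1'; linear_combination -e2
  have f3 : r * t * (1 - u * l) = 0 := by apply mul_left_cancel₀ hl1'; linear_combination e3
  have f1 : (l * p * t - q * r) * (1 - u) = 0 := by apply mul_left_cancel₀ hl; linear_combination e1
  have f4 : (p * t - l * q * r) * (1 - u) = 0 := by linear_combination e4
  have hsq : l * l = 1 → A * A = 1 := fun hll =>
    (hA.mul hA).eq_of_smul Represents.one one_ne_zero (by simp [one_fin_two, hll])
  by_cases hpq : p * q = 0
  · by_cases hrt : r * t = 0
    · have hcase : (q = 0 ∧ r = 0) ∨ (p = 0 ∧ t = 0) := by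
        rcases mul_eq_zero.1 hpq with rfl | rfl <;> rcases mul_eq_zero.1 hrt with rfl | rfl <;>
          simp_all
      rcases hcase with ⟨rfl, rfl⟩ | ⟨rfl, rfl⟩
      · have hc : D * A = A * D := (hD.mul hA).eq_of_smul (hA.mul hD) one_ne_zero (by
          rw [mul_fin_two, mul_fin_two, smul_fin_two, of_injective]
          refine ⟨?_, ?_, ?_, ?_⟩ <;> ring)
        have h1 := h.ada
        have h2 : D ^ 2 * A = A * D ^ 2 := by rw [pow_two, mul_assoc, hc, ← mul_assoc, hc, mul_assoc]
        rw [mul_assoc, h2, hc, mul_assoc, ← pow_two] at h1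
        have h3 : A = 1 := by
          have := mul_left_cancel h1
          exact mul_eq_right.1 this
        left; rw [h3, one_mul]
      · right
        rw [mul_inv_eq_iff_eq_mul]
        refine (hD.mul hA).eq_of_smul (hA.inv.mul hD) one_ne_zero ?_
        rw [adjugate_fin_two_of, mul_fin_two, mul_fin_two, smul_fin_two,
          of_injective]
        refine ⟨?_, ?_, ?_, ?_⟩ <;> ring
    · have hul : u * l = 1 := by
        have := (mul_eq_zero.1 f3).resolve_left hrt
        linear_combination -this
      have hu1 : 1 - u ≠ 0 := by
        intro h0
        apply hl1
        linear_combination hul + l * h0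
      have g1 := (mul_eq_zero.1 f1).resolve_right hu1
      exfalso
      rcases mul_eq_zero.1 hpq with rfl | rfl
      · apply hd; linear_combination g1
      · apply hd
        have : l * (p * t - 0 * r) = 0 := by linear_combination g1
        exact (mul_eq_zero.1 this).resolve_left hl
  · have hul : u = l := by
      have := (mul_eq_zero.1 f2).resolve_left hpq
      linear_combination -this
    subst hul
    by_cases hrt : r * t = 0
    · have hu1 : 1 - u ≠ 0 := fun h0 => hl1 (by linear_combination -h0)
      have g1 := (mul_eq_zero.1 f1).resolve_right hu1
      have g4 := (mul_eq_zero.1 f4).resolve_right hu1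
      exfalso
      rcases mul_eq_zero.1 hrt with rfl | rfl
      · apply hd; linear_combination g4
      · apply hd; linear_combination g1
    · left
      have := (mul_eq_zero.1 f3).resolve_left hrt
      exact hsq (by linear_combination -this)

open PGL2 in
theorem PGL2.exists_conj_of_stdRelations_upper {F : Type*} [Field F] {D S : PGL2 F}
    (h : StdRelations (mk (upper (1 : F))) D S) (h6 : (6 : F) ≠ 0) :
    ∃ (z : F) (u : Fˣ) (c : PGL2 F), z ^ 2 + z + 1 = 0 ∧ (u : F) = 1 + z ∧
      c⁻¹ * mk (upper 1) * c = mk (upper 1) ∧ c⁻¹ * D * c = mk (diag u) ∧ c⁻¹ * S * c = mk swap := by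
  have h3 : (3 : F) ≠ 0 := fun h0 => h6 (by linear_combination 2 * h0)
  have hA := represents_upper (1 : F)
  obtain ⟨p, q, r, t, hD⟩ := exists_represents D
  have hd := hD.det_ne_zero
  rw [det_fin_two_of] at hd
  have hr : r = 0 := by
    have hB := (hD.mul hA).mul hD.inv
    obtain ⟨u, hu, e⟩ := (hA.mul hB).exists_smul (h.comm ▸ hB.mul hA)
    simp only [adjugate_fin_two_of, mul_fin_two, smul_fin_two, of_injective] at e
    obtain ⟨e1, e2, e3, e4⟩ := e
    by_contra hr
    have hu1 : u = 1 := by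
      apply mul_left_cancel₀ (pow_ne_zero 2 hr)
      linear_combination e3
    subst hu1
    apply pow_ne_zero 2 hr
    linear_combination -e1
  subst hr
  have ht : t ≠ 0 := by rintro rfl; simp at hd
  have hp : p ≠ 0 := by rintro rfl; simp at hd
  obtain ⟨δ, q', hδ, hD'⟩ : ∃ δ q' : F, δ ≠ 0 ∧ Represents D !![δ, q'; 0, 1] := by
    have := hD.smul (inv_ne_zero ht)
    rw [smul_fin_two, inv_mul_cancel₀ ht, mul_zero] at this
    exact ⟨_, _, mul_ne_zero (inv_ne_zero ht) hp, this⟩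
  have hδ2 : δ ^ 2 = δ - 1 := by
    have hADDA := (hA.mul (hD'.mul hD')).mul hA
    have hDAD := (hD'.mul hA).mul hD'
    have ada := h.ada
    rw [pow_two] at ada
    obtain ⟨u, hu, e⟩ := hADDA.exists_smul (ada ▸ hDAD)
    simp only [mul_fin_two, smul_fin_two, of_injective] at e
    obtain ⟨e1, e2, e3, e4⟩ := e
    have hu1 : u = 1 := by linear_combination -e4
    subst hu1
    linear_combination e2
  have hδ1 : 1 - δ ≠ 0 := by
    intro h0
    have : (1 : F) = 0 := by linear_combination hδ2 + (δ + 1 - 1) * h0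
    exact one_ne_zero this
  refine ⟨δ - 1, Units.mk0 δ hδ, mk (upper (q' / (1 - δ))), ?_, ?_, ?_, ?_, ?_⟩
  · linear_combination hδ2
  · simp
  · rw [mul_assoc, inv_mul_eq_iff_eq_mul, ← map_mul, ← map_mul, ← upper_add, ← upper_add, add_comm]
  · rw [mul_assoc, inv_mul_eq_iff_eq_mul]
    refine (hD'.mul (represents_upper _)).eq_of_smul
      ((represents_upper _).mul (represents_diag _)) one_ne_zero ?_
    rw [mul_fin_two, mul_fin_two, smul_fin_two, of_injective]
    refine ⟨?_, ?_, ?_, ?_⟩ <;> simp <;> field_simp <;> ring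
  · set c : PGL2 F := mk (upper (q' / (1 - δ)))
    have hAc : c⁻¹ * mk (upper 1) * c = mk (upper 1) := by
      rw [mul_assoc, inv_mul_eq_iff_eq_mul, ← map_mul, ← map_mul, ← upper_add, ← upper_add,
        add_comm]
    have hDc : c⁻¹ * D * c = mk (diag (Units.mk0 δ hδ)) := by
      rw [mul_assoc, inv_mul_eq_iff_eq_mul]
      refine (hD'.mul (represents_upper _)).eq_of_smul
        ((represents_upper _).mul (represents_diag _)) one_ne_zero ?_
      rw [mul_fin_two, mul_fin_two, smul_fin_two, of_injective]
      refine ⟨?_, ?_, ?_, ?_⟩ <;> simp <;> field_simp <;> ring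
    have hc := h.map (MulAut.conj c⁻¹).toMonoidHom
    simp only [MulEquiv.toMonoidHom_eq_coe, MonoidHom.coe_coe, MulAut.conj_apply, inv_inv, hAc,
      hDc] at hc
    set S' := c⁻¹ * S * c
    have hD2 := represents_diag (Units.mk0 δ hδ)
    rw [Units.val_mk0] at hD2
    obtain ⟨a, b, c', e, hS⟩ := exists_represents S'
    have hdS := hS.det_ne_zero
    rw [det_fin_two_of] at hdS
    have hsd : S' * mk (diag (Units.mk0 δ hδ)) = (mk (diag (Units.mk0 δ hδ)))⁻¹ * S' := by
      rw [← hc.sd, mul_assoc _ S' S', hc.s2, mul_one]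
    obtain ⟨u, hu, e'⟩ := (hS.mul hD2).exists_smul (hsd ▸ hD2.inv.mul hS)
    simp only [adjugate_fin_two_of, mul_fin_two, smul_fin_two, of_injective] at e'
    obtain ⟨e1, e2, e3, e4⟩ := e'
    have hb : b ≠ 0 := by
      rintro rfl
      have ha : a ≠ 0 := by rintro rfl; simp at hdS
      have he : e ≠ 0 := by rintro rfl; simp at hdS
      have hu : u = δ := by apply mul_left_cancel₀ ha; linear_combination -e1
      subst hu
      have h1 : u ^ 2 = 1 := by apply mul_left_cancel₀ he; linear_combination -e4
      apply h3
      linear_combination h1 + (2 + u) * (hδ2 - h1)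
    have hu1 : u = 1 := by apply mul_left_cancel₀ hb; linear_combination -e2
    subst hu1
    have ha : a = 0 := by apply mul_left_cancel₀ hδ1; linear_combination -e1
    have he : e = 0 := by apply mul_left_cancel₀ hδ1; linear_combination e4
    subst ha he
    have hc' : c' ≠ 0 := by rintro rfl; simp at hdS
    have hS1 := hS.smul (inv_ne_zero hc')
    rw [smul_fin_two, inv_mul_cancel₀ hc', mul_zero] at hS1
    set κ := c'⁻¹ * b
    have hcube := hc.cube
    simp only [pow_succ, pow_zero, one_mul] at hcube
    have hM := (hA.mul ((hD2.mul hD2).mul hD2)).mul hS1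
    obtain ⟨v, hv, e''⟩ := ((hM.mul hM).mul hM).exists_smul (hcube ▸ Represents.one)
    have hδ3 : δ * δ * δ = -1 := by linear_combination (δ + 1) * hδ2
    rw [one_fin_two] at e''
    simp only [mul_fin_two, smul_fin_two, of_injective, mul_zero, zero_mul, add_zero,
      zero_add, mul_one, one_mul, hδ3] at e''
    obtain ⟨g1, g2, g3, g4⟩ := e''
    have hκ : κ = 1 := by linear_combination -g3
    rw [hκ] at hS1
    exact hS1.eq_of_smul represents_swap one_ne_zero (by simp)

open PGL2 EisensteinInt in
/-- Representations of `PGL2` of the Eisenstein integers over an algebraically closed field of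
characteristic at least five: the image is small or the representation is standard. -/
theorem PGL2.rigidity {F : Type*} [Field F] [IsAlgClosed F] (h6 : (6 : F) ≠ 0) (ρ : PGL2 𝓔 →* PGL2 F) :
    (Finite ρ.range ∧ Nat.card ρ.range ≤ 120) ∨ ∃ (z : F) (hz : z ^ 2 + z + 1 = 0) (c : PGL2 F), ∀ γ,
        ρ γ = c * PGL2.map (eval (Int.castRingHom F) z hz) γ * c⁻¹ := by
  have h2 : (2 : F) ≠ 0 := fun h0 => h6 (by linear_combination 3 * h0)
  set A := ρ (mk (upper 1)) with hA
  set D := ρ (mk (diag zeta)) with hD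
  set S := ρ (mk swap) with hS
  have hrel : StdRelations A D S := stdRelations.map ρ
  have hrange : ρ.range = Subgroup.closure {A, D, S} := by
    rw [MonoidHom.range_eq_map, ← closure_generators, MonoidHom.map_closure]
    simp [Set.image_insert_eq, ← hA, ← hD, ← hS]
  have hsmall : A * A = 1 ∨ D * A * D⁻¹ = A⁻¹ → Finite ρ.range ∧ Nat.card ρ.range ≤ 120 := by
    rw [hrange]
    rintro (h | h)
    · exact hrel.card_closure_le_of_sq h
    · exact hrel.card_closure_le_of_inv h
  obtain ⟨c, hc⟩ := exists_conj_normalForm h2 A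
  have hc' := hrel.map (MulAut.conj c⁻¹).toMonoidHom
  rcases hc with ⟨l, hl⟩ | hc
  · left
    apply hsmall
    have := hc'.of_diagonal (l := l) (by simpa using hl)
    simp only [← map_mul, ← map_inv] at this
    rcases this with h | h
    · left
      exact (MulAut.conj c⁻¹).injective (by simpa using h)
    · right
      exact (MulAut.conj c⁻¹).injective h
  · right
    simp only [MulEquiv.toMonoidHom_eq_coe, MonoidHom.coe_coe, MulAut.conj_apply, inv_inv, hc]
      at hc'
    obtain ⟨z, u, e, hz, hu, f1, f2, f3⟩ := exists_conj_of_stdRelations_upper hc' h6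
    refine ⟨z, hz, c * e, ?_⟩
    set ev := eval (Int.castRingHom F) z hz with hev
    have key : ρ = (MulAut.conj (c * e)).toMonoidHom.comp (PGL2.map ev) := by
      refine MonoidHom.eq_of_eqOn_dense closure_generators ?_
      have g : ∀ x y : PGL2 F, e⁻¹ * (c⁻¹ * x * c) * e = y → x = c * e * y * (c * e)⁻¹ := by rintro x y rfl; group
      rintro x (rfl | rfl | rfl)
      · simp only [MulEquiv.toMonoidHom_eq_coe, comp_apply, MonoidHom.coe_coe,
          MulAut.conj_apply, map_mk]
        rw [map_upper, map_one]
        exact g _ _ (by rw [← hA, hc, f1])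
      · simp only [MulEquiv.toMonoidHom_eq_coe, comp_apply, MonoidHom.coe_coe,
          MulAut.conj_apply, map_mk]
        rw [map_diag]
        have : Units.map (ev : 𝓔 →* F) zeta = u := by
          ext
          simp [hu, hev, eval_apply]
        rw [this]
        exact g _ _ (by rw [← hD, f2])
      · simp only [MulEquiv.toMonoidHom_eq_coe, comp_apply, MonoidHom.coe_coe,
          MulAut.conj_apply, map_mk]
        rw [map_swap]
        exact g _ _ (by rw [← hS, f3])
    intro γ
    rw [key]; rfl

end Rigidity

instance Int.isJacobsonRing : IsJacobsonRing ℤ := by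
  rw [isJacobsonRing_iff_prime_eq]
  intro P hP
  by_cases h : P = ⊥
  · subst h
    rw [eq_bot_iff]
    intro x hx
    have h1 := Int.isUnit_iff.1 (Ideal.mem_jacobson_bot.1 hx x)
    rw [Ideal.mem_bot]
    rcases h1 with h1 | h1
    · exact mul_self_eq_zero.1 (by linarith)
    · nlinarith [sq_nonneg x]
  · have := Ring.DimensionLEOne.maximalOfPrime h hP
    exact Ideal.jacobson_eq_self_of_isMaximal

theorem Field.finite_of_finiteType_int (K : Type*) [Field K] [Algebra.FiniteType ℤ K] : Finite K := by
  have hfin : Module.Finite ℤ K := finite_of_finite_type_of_isJacobsonRing ℤ K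
  obtain ⟨p, hp⟩ := CharP.exists K
  rcases Nat.eq_zero_or_pos p with rfl | hpos
  · have := CharP.charP_to_charZero K
    have hinj : Injective (algebraMap ℤ K) := (algebraMap ℤ K).injective_int
    exact absurd (isField_of_isIntegral_of_isField hinj (Field.toIsField K)) Int.not_isField
  · refine Module.finite_of_fg_torsion K fun {x} => ?_
    refine ⟨⟨(p : ℤ), by simpa using hpos.ne'⟩, ?_⟩
    change (p : ℤ) • x = 0
    rw [zsmul_eq_mul, Int.cast_natCast, CharP.cast_eq_zero, zero_mul]

theorem PGL2.map_injective {R S : Type*} [CommRing R] [CommRing S] (f : R →+* S)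
    (hf : Injective f) : Injective (PGL2.map f) := by
  rw [injective_iff_map_eq_one]
  intro x hx
  obtain ⟨A, rfl⟩ := mk_surjective x
  rw [PGL2.map_mk, PGL2.mk_eq_one] at hx
  obtain ⟨u, hu⟩ := hx
  have e : ∀ i j, f (A i j) = (u : S) * (1 : Mat₂ S) i j := fun i j =>
    congrFun (congrFun hu i) j
  have e01 : A 0 1 = 0 := hf (by simpa using e 0 1)
  have e10 : A 1 0 = 0 := hf (by simpa using e 1 0)
  have e11 : A 0 0 = A 1 1 := hf (by rw [e 0 0, e 1 1]; simp)
  have hd : IsUnit (A 0 0) := by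
    have := (det A).isUnit
    rw [val_det_apply, det_fin_two, e01, zero_mul, sub_zero] at this
    exact isUnit_of_mul_isUnit_left this
  obtain ⟨v, hv⟩ := hd
  rw [PGL2.mk_eq_one]
  refine ⟨v, ?_⟩
  ext i j : 1
  fin_cases i <;> fin_cases j <;> simp [e01, e10, hv, e11]

theorem exists_ringHom_finite_field.{u} (S : Type u) [CommRing S] [Nontrivial S]
    [Algebra.FiniteType ℤ S] : ∃ (k : Type u) (_ : Field k) (_ : Finite k), Nonempty (S →+* k) := by
  obtain ⟨m, hm⟩ := Ideal.exists_maximal S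
  obtain ⟨k, _, f, hf⟩ : ∃ (k : Type u) (_ : Field k) (f : S →+* k), Surjective f :=
    ⟨m.ResidueField, inferInstance, algebraMap _ _, Ideal.algebraMap_residueField_surjective m⟩
  have : Algebra.FiniteType ℤ k := Algebra.FiniteType.of_surjective f.toIntAlgHom hf
  exact ⟨k, inferInstance, Field.finite_of_finiteType_int _, ⟨f⟩⟩

/-- Finitely many matrices over a field, and finitely many prescribed inverses, live over a
finitely generated subring. -/
theorem PGL2.exists_descent {Λ Ω ι : Type*} [Group Λ] [Group.FG Λ] [Field Ω] [Finite ι]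
    (ρ : ι → Λ →* PGL2 Ω) (T : Set Ω) (hT : T.Finite) : ∃ (S : Subalgebra ℤ Ω), Algebra.FiniteType ℤ S ∧ T ⊆ S ∧
      ∃ σ : ι → Λ →* PGL2 S, ∀ i g, ρ i g = PGL2.map (S.val : S →+* Ω) (σ i g) := by
  obtain ⟨X, hX, hfin⟩ := (Group.fg_iff (G := Λ)).1 inferInstance
  choose A hA using fun (i : ι) (g : Λ) => mk_surjective (ρ i g)
  let E : Set Ω := ⋃ i : ι, ⋃ g ∈ X, (Set.range fun p : Fin 2 × Fin 2 => A i g p.1 p.2) ∪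
    Set.range fun p : Fin 2 × Fin 2 => (A i g)⁻¹ p.1 p.2
  have hE : E.Finite := Set.finite_iUnion fun i => hfin.biUnion fun g _ =>
    (Set.finite_range _).union (Set.finite_range _)
  let S := Algebra.adjoin ℤ (T ∪ E)
  have hSE : E ⊆ S := Set.subset_union_right.trans Algebra.subset_adjoin
  refine ⟨S, ?_, Set.subset_union_left.trans Algebra.subset_adjoin, ?_⟩
  · exact (Subalgebra.fg_iff_finiteType _).1 ⟨(hT.union hE).toFinset, by simp [S]⟩
  have hinj := PGL2.map_injective (S.val : S →+* Ω) Subtype.val_injective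
  have hrange : ∀ i g, ρ i g ∈ (PGL2.map (S.val : S →+* Ω)).range := by
    intro i g
    have : Subgroup.closure X ≤ ((PGL2.map (S.val : S →+* Ω)).range).comap (ρ i) := by
      rw [Subgroup.closure_le]
      intro g hg
      have h1 : ∀ p q, A i g p q ∈ S := fun p q => hSE
        (Set.mem_iUnion.2 ⟨i, Set.mem_iUnion₂.2 ⟨g, hg, Or.inl ⟨(p, q), rfl⟩⟩⟩)
      have h2 : ∀ p q, (A i g)⁻¹ p q ∈ S := fun p q => hSE
        (Set.mem_iUnion.2 ⟨i, Set.mem_iUnion₂.2 ⟨g, hg, Or.inr ⟨(p, q), rfl⟩⟩⟩)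
      let M : Mat₂ S := fun p q => ⟨A i g p q, h1 p q⟩
      let N : Mat₂ S := fun p q => ⟨(A i g)⁻¹ p q, h2 p q⟩
      have hmap : Injective (fun M : Mat₂ S => M.map (S.val : S →+* Ω)) :=
        fun M N h => by
          ext p q
          exact congrFun (congrFun h p) q
      have hMN : M * N = 1 := hmap (by
        change (M * N).map _ = (1 : Mat₂ S).map _
        rw [Matrix.map_mul, Matrix.map_one _ (map_zero _) (map_one _)]
        exact (A i g).mul_inv)
      have hNM : N * M = 1 := hmap (by
        change (N * M).map _ = (1 : Mat₂ S).map _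
        rw [Matrix.map_mul, Matrix.map_one _ (map_zero _) (map_one _)]
        exact (A i g).inv_mul)
      refine ⟨mk ⟨M, N, hMN, hNM⟩, ?_⟩
      rw [← hA, PGL2.map_mk]
      congr 1
    rw [hX] at this
    exact this (Subgroup.mem_top g)
  let e := MonoidHom.ofInjective hinj
  refine ⟨fun i => e.symm.toMonoidHom.comp ((ρ i).codRestrict _ (hrange i)), fun i g => ?_⟩
  have := congrArg Subtype.val (e.apply_symm_apply ⟨ρ i g, hrange i g⟩)
  exact this.symm

/-- A representation whose character does not come from a small quotient. -/
def IsAdmissible {Λ Ω : Type*} [Group Λ] [CommRing Ω] (ρ : Λ →* PGL2 Ω) : Prop :=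
  ∃ g ∈ normalCoreUpTo Λ 120, (PGL2.sq (ρ g)).trace ≠ 2

/-- There are at most two admissible characters. -/
theorem ProfiniteCorrespondence.exists_sqTrace_eq {Λ Ω : Type*} [Group Λ] [Group.FG Λ] [Field Ω]
    [CharZero Ω] (c : ProfiniteCorrespondence Λ (PGL2 𝓔)) (ρ : Fin 3 → Λ →* PGL2 Ω)
    (hρ : ∀ i, IsAdmissible (ρ i)) : ∃ i j, i ≠ j ∧ sqTrace (ρ i) = sqTrace (ρ j) := by
  classical
  by_contra hne
  push Not at hne
  choose g hg hg2 using hρ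
  have hx : ∀ i j, ∃ x, i ≠ j → sqTrace (ρ i) x ≠ sqTrace (ρ j) x := by
    intro i j
    by_cases h : i = j
    · exact ⟨0, fun h' => absurd h h'⟩
    · obtain ⟨x, hx⟩ := Function.ne_iff.1 (hne i j h)
      exact ⟨x, fun _ => hx⟩
  choose x hx using hx
  let T : Set Ω := {(6 : Ω)⁻¹} ∪ (Set.range fun i => ((PGL2.sq (ρ i (g i))).trace - 2)⁻¹) ∪
    Set.range fun p : Fin 3 × Fin 3 =>
      (sqTrace (ρ p.1) (x p.1 p.2) - sqTrace (ρ p.2) (x p.1 p.2))⁻¹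
  have hT : T.Finite := ((Set.finite_singleton _).union (Set.finite_range _)).union
    (Set.finite_range _)
  obtain ⟨S, hS, hTS, σ, hσ⟩ := PGL2.exists_descent ρ T hT
  have hunit : ∀ s : S, (s : Ω) ≠ 0 → (s : Ω)⁻¹ ∈ T → IsUnit s := fun s hs hT =>
    .of_mul_eq_one ⟨_, hTS hT⟩ (Subtype.ext (mul_inv_cancel₀ hs))
  obtain ⟨k, _, _, ⟨π₀⟩⟩ := exists_ringHom_finite_field S
  let F := AlgebraicClosure k
  let π : S →+* F := (algebraMap k F).comp π₀
  have hsub : ∀ s : S, IsUnit s → π s ≠ 0 := fun s hs => (hs.map π).ne_zero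
  have hval : ∀ i y, ((sqTrace (σ i) y : S) : Ω) = sqTrace (ρ i) y := by
    intro i y
    have := sqTrace_map (S.val : S →+* Ω) (σ i) y
    rw [show (fun g => PGL2.map (S.val : S →+* Ω) (σ i g)) = ρ i from
      funext fun g => (hσ i g).symm] at this
    exact this.symm
  let τ : Fin 3 → Λ →* PGL2 F := fun i => (PGL2.map π).comp (σ i)
  have hτ : ∀ i y, sqTrace (τ i) y = π (sqTrace (σ i) y) := fun i y => sqTrace_map π (σ i) y
  have hτdiff : ∀ i j, i ≠ j → sqTrace (τ i) (x i j) ≠ sqTrace (τ j) (x i j) := by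
    intro i j hij h
    rw [hτ, hτ, ← sub_eq_zero, ← map_sub] at h
    refine hsub _ (hunit _ ?_ ?_) h
    · rw [AddSubgroupClass.coe_sub, hval, hval]
      exact sub_ne_zero.2 (hx i j hij)
    · rw [AddSubgroupClass.coe_sub, hval, hval]
      exact Or.inr ⟨(i, j), rfl⟩
  have h6 : (6 : F) ≠ 0 := by
    have : π 6 ≠ 0 := hsub _ (hunit _ (by change (6 : Ω) ≠ 0; norm_num) (Or.inl (Or.inl rfl)))
    rwa [map_ofNat] at this
  have hτg : ∀ i, τ i (g i) ≠ 1 := by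
    intro i h
    have h1 : (PGL2.sq (τ i (g i))).trace = π ((PGL2.sq (σ i (g i))).trace) := by
      change (PGL2.sq (PGL2.map π (σ i (g i)))).trace = _
      rw [PGL2.sq_map, AddMonoidHom.map_trace π]
    rw [h, PGL2.sq_one, Matrix.trace_one, Fintype.card_fin] at h1
    have h2 : (((PGL2.sq (σ i (g i))).trace : S) : Ω) = (PGL2.sq (ρ i (g i))).trace := by
      rw [hσ, PGL2.sq_map]
      exact AddMonoidHom.map_trace (S.val : S →+* Ω) (PGL2.sq (σ i (g i)))
    have h3 : π ((PGL2.sq (σ i (g i))).trace - 2) = 0 := by rw [map_sub, ← h1, map_ofNat]; norm_num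
    refine hsub _ (hunit _ ?_ ?_) h3
    · rw [AddSubgroupClass.coe_sub, h2]
      exact sub_ne_zero.2 (hg2 i)
    · rw [AddSubgroupClass.coe_sub, h2]
      exact Or.inl (Or.inr ⟨i, rfl⟩)
  have hfinr : ∀ i, Finite (τ i).range := by
    intro i
    have : (τ i).range ≤ (PGL2.map (algebraMap k F)).range := by
      rintro _ ⟨y, rfl⟩
      exact ⟨PGL2.map π₀ (σ i y), PGL2.map_map _ _ _⟩
    exact Set.Finite.subset (Set.finite_range _) this
  choose τ' n hn using fun i => have := hfinr i; c.transport (τ i)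
  let l := max (n 0) (max (n 1) (n 2))
  have hk : ∀ i y γ, (y, γ) ∈ c.R l → τ' i γ = τ i y := by
    intro i y γ h
    refine hn i y γ (c.anti ?_ h)
    fin_cases i <;> simp [l]
  choose w hw using c.exists_right l
  have hstd : ∀ i, ∃ (z : F) (hz : z ^ 2 + z + 1 = 0), ∀ y,
      sqTrace (τ i) y = eval (Int.castRingHom F) z hz (sqTrace w y) := by
    intro i
    rcases PGL2.rigidity h6 (τ' i) with ⟨h1, h2⟩ | ⟨z, hz, e, he⟩
    · exfalso
      have hr : (τ' i).range = (τ i).range := by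
        apply le_antisymm
        · rintro _ ⟨γ, rfl⟩
          obtain ⟨y, hy⟩ := c.exists_left l γ
          exact ⟨y, (hk i y γ hy).symm⟩
        · rintro _ ⟨y, rfl⟩
          exact ⟨w y, hk i y _ (hw y)⟩
      have h3 : (τ i).ker.index ≤ 120 := by rw [Subgroup.index_ker, ← hr]; exact h2
      have := hfinr i
      exact hτg i (normalCoreUpTo_le (M := (τ i).ker) inferInstance inferInstance h3 (hg i))
    · refine ⟨z, hz, fun y => ?_⟩
      have h1 : (τ i : Λ → PGL2 F) = fun y => e * PGL2.map (eval (Int.castRingHom F) z hz)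
          (w y) * e⁻¹ := funext fun y => by rw [← he, hk i y _ (hw y)]
      rw [h1, sqTrace_conj e (fun y => PGL2.map (eval (Int.castRingHom F) z hz) (w y)),
        sqTrace_map]
  choose z hz hzt using hstd
  have hzz : ∀ i j, i ≠ j → z i ≠ z j := by
    intro i j hij h
    apply hτdiff i j hij
    rw [hzt, hzt, eval_apply, eval_apply, h]
  have hs : ∀ i j, i ≠ j → z i + z j + 1 = 0 := by
    intro i j hij
    have : (z i - z j) * (z i + z j + 1) = 0 := by linear_combination hz i - hz j
    exact (mul_eq_zero.1 this).resolve_left (sub_ne_zero.2 (hzz i j hij))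
  apply hzz 1 2 (by decide)
  linear_combination hs 0 1 (by decide) - hs 0 2 (by decide)

section PadicLimits

open Filter

theorem Filter.exists_eventually_hyperfilter_eq {k : Type*} [Finite k] (f : ℕ → k) :
    ∃ r, ∀ᶠ n in (hyperfilter ℕ : Filter ℕ), f n = r := by
  obtain ⟨r, hr⟩ := Ultrafilter.eq_pure_of_finite ((hyperfilter ℕ).map f)
  refine ⟨r, ?_⟩
  have h : ({r} : Set k) ∈ (hyperfilter ℕ).map f := by rw [hr]; exact Set.mem_singleton r
  exact h

/-- The limit along the hyperfilter of a sequence in a finite ring. -/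
noncomputable def hyperLim (k : Type*) [CommRing k] [Finite k] : (ℕ → k) →+* k where
  toFun f := (exists_eventually_hyperfilter_eq f).choose
  map_one' := by
    obtain ⟨n, hn⟩ := (exists_eventually_hyperfilter_eq (1 : ℕ → k)).choose_spec.exists
    exact hn.symm
  map_zero' := by
    obtain ⟨n, hn⟩ := (exists_eventually_hyperfilter_eq (0 : ℕ → k)).choose_spec.exists
    exact hn.symm
  map_mul' f g := by
    obtain ⟨n, h1, h2, h3⟩ := ((exists_eventually_hyperfilter_eq (f * g)).choose_spec.and
      ((exists_eventually_hyperfilter_eq f).choose_spec.and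
      (exists_eventually_hyperfilter_eq g).choose_spec)).exists
    rw [← h1, ← h2, ← h3]; rfl
  map_add' f g := by
    obtain ⟨n, h1, h2, h3⟩ := ((exists_eventually_hyperfilter_eq (f + g)).choose_spec.and
      ((exists_eventually_hyperfilter_eq f).choose_spec.and
      (exists_eventually_hyperfilter_eq g).choose_spec)).exists
    rw [← h1, ← h2, ← h3]; rfl

theorem eventually_eq_hyperLim {k : Type*} [CommRing k] [Finite k] (f : ℕ → k) :
    ∀ᶠ n in (hyperfilter ℕ : Filter ℕ), f n = hyperLim k f :=
  (exists_eventually_hyperfilter_eq f).choose_spec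

variable (p : ℕ) [hp : Fact p.Prime]

/-- The limit along the hyperfilter of a sequence of integers. -/
noncomputable def padicLim : (ℕ → ℤ) →+* ℤ_[p] :=
  PadicInt.lift (f := fun j => have : NeZero (p ^ j) := ⟨(pow_pos hp.out.pos j).ne'⟩
    (hyperLim (ZMod (p ^ j))).comp (RingHom.pi fun n => (Int.castRingHom (ZMod (p ^ j))).comp
      (Pi.evalRingHom (fun _ => ℤ) n))) (by
    intro m n hmn
    have : NeZero (p ^ m) := ⟨(pow_pos hp.out.pos m).ne'⟩
    have : NeZero (p ^ n) := ⟨(pow_pos hp.out.pos n).ne'⟩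
    ext f
    simp only [RingHom.comp_apply]
    obtain ⟨k, h1, h2⟩ := ((eventually_eq_hyperLim (k := ZMod (p ^ m)) (fun k => (f k : ZMod (p ^ m)))).and
      (eventually_eq_hyperLim (k := ZMod (p ^ n)) (fun k => (f k : ZMod (p ^ n))))).exists
    change ZMod.castHom _ _ (hyperLim (ZMod (p ^ n)) (fun k => (f k : ZMod (p ^ n)))) =
      hyperLim (ZMod (p ^ m)) (fun k => (f k : ZMod (p ^ m)))
    rw [← h1, ← h2, map_intCast])

theorem eventually_toZModPow_padicLim (f : ℕ → ℤ) (j : ℕ) :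
    ∀ᶠ n in (hyperfilter ℕ : Filter ℕ), PadicInt.toZModPow j (padicLim p f) = f n := by
  have : NeZero (p ^ j) := ⟨(pow_pos hp.out.pos j).ne'⟩
  filter_upwards [eventually_eq_hyperLim (k := ZMod (p ^ j)) (fun k => (f k : ZMod (p ^ j)))]
    with n hn
  rw [hn, padicLim]
  exact RingHom.congr_fun (PadicInt.lift_spec _ j) f

/-- The limit along the hyperfilter of a sequence of Eisenstein integers. -/
noncomputable def eisensteinLim : (ℕ → 𝓔) →+* EisensteinOver ℤ_[p] :=
  (EisensteinOver.map (padicLim p)).comp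
    { toFun := fun f => ⟨fun n => (f n).re, fun n => (f n).im⟩
      map_one' := by ext <;> simp
      map_zero' := by ext <;> simp
      map_mul' := fun f g => by ext <;> simp
      map_add' := fun f g => by ext <;> simp }

/-- Reduction of Eisenstein integers modulo `N`. -/
def EisensteinInt.red (N : ℕ) : 𝓔 →+* EisensteinOver (ZMod N) :=
  EisensteinOver.map (Int.castRingHom (ZMod N))

/-- Reduction of `p`-adic Eisenstein integers modulo `p ^ j`. -/
noncomputable def EisensteinOver.padicRed (j : ℕ) : EisensteinOver ℤ_[p] →+* EisensteinOver (ZMod (p ^ j)) :=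
  EisensteinOver.map (PadicInt.toZModPow j)

/-- The inclusion of the Eisenstein integers in the `p`-adic ones. -/
noncomputable def EisensteinInt.toPadic : 𝓔 →+* EisensteinOver ℤ_[p] :=
  EisensteinOver.map (Int.castRingHom ℤ_[p])

theorem EisensteinOver.padicRed_comp_toPadic (j : ℕ) :
    (EisensteinOver.padicRed p j).comp (EisensteinInt.toPadic p) = EisensteinInt.red (p ^ j) := by
  ext x <;> simp [EisensteinOver.padicRed, EisensteinInt.toPadic, EisensteinInt.red]

instance EisensteinOver.instFinite (k : Type*) [CommRing k] [Finite k] : Finite (EisensteinOver k) :=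
  Finite.of_equiv _ (QuadraticAlgebra.equivProd (-1 : k) (-1)).symm

theorem eventually_padicRed_eisensteinLim (f : ℕ → 𝓔) (j : ℕ) : ∀ᶠ n in (hyperfilter ℕ : Filter ℕ),
      EisensteinOver.padicRed p j (eisensteinLim p f) = EisensteinInt.red (p ^ j) (f n) := by
  filter_upwards [eventually_toZModPow_padicLim p (fun n => (f n).re) j,
    eventually_toZModPow_padicLim p (fun n => (f n).im) j] with n h1 h2
  ext
  · exact h1
  · exact h2

theorem PGL2.eventually_map_padicRed (x : PGL2 (ℕ → 𝓔)) (j : ℕ) : ∀ᶠ n in (hyperfilter ℕ : Filter ℕ),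
      PGL2.map (EisensteinOver.padicRed p j) (PGL2.map (eisensteinLim p) x) =
        PGL2.map (EisensteinInt.red (p ^ j)) (PGL2.map (Pi.evalRingHom (fun _ => 𝓔) n) x) := by
  obtain ⟨A, rfl⟩ := mk_surjective x
  have h : ∀ᶠ n in (hyperfilter ℕ : Filter ℕ), ∀ i k : Fin 2,
      EisensteinOver.padicRed p j (eisensteinLim p (A i k)) =
        EisensteinInt.red (p ^ j) (A i k n) := by
    rw [eventually_all]; intro i
    rw [eventually_all]; intro k
    exact eventually_padicRed_eisensteinLim p (A i k) j
  filter_upwards [h] with n hn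
  simp only [PGL2.map_mk]
  congr 1
  apply GeneralLinearGroup.ext
  intro i k
  exact hn i k

theorem EisensteinOver.ext_of_padicRed {x y : EisensteinOver ℤ_[p]}
    (h : ∀ j, EisensteinOver.padicRed p j x = EisensteinOver.padicRed p j y) : x = y := by
  ext
  · exact PadicInt.ext_of_toZModPow.1 fun j => congrArg QuadraticAlgebra.re (h j)
  · exact PadicInt.ext_of_toZModPow.1 fun j => congrArg QuadraticAlgebra.im (h j)

theorem PGL2.ext_of_padicRed {x y : PGL2 (EisensteinOver ℤ_[p])}
    (h : ∀ j, PGL2.map (EisensteinOver.padicRed p j) x = PGL2.map (EisensteinOver.padicRed p j) y) : x = y := by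
  suffices key : ∀ x : PGL2 (EisensteinOver ℤ_[p]),
      (∀ j, PGL2.map (EisensteinOver.padicRed p j) x = 1) → x = 1 by
    rw [← inv_mul_eq_one]
    apply key
    intro j
    rw [map_mul, map_inv, h, inv_mul_cancel]
  intro x hx
  obtain ⟨A, rfl⟩ := mk_surjective x
  have e : ∀ j, ∃ u : EisensteinOver (ZMod (p ^ j)), ∀ i k,
      EisensteinOver.padicRed p j (A i k) = u * (1 : Mat₂ _) i k := by
    intro j
    have := hx j
    rw [PGL2.map_mk, PGL2.mk_eq_one] at this
    obtain ⟨u, hu⟩ := this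
    exact ⟨u, fun i k => congrFun (congrFun hu i) k⟩
  choose u hu using e
  have e01 : A 0 1 = 0 := EisensteinOver.ext_of_padicRed p fun j => by rw [hu]; simp
  have e10 : A 1 0 = 0 := EisensteinOver.ext_of_padicRed p fun j => by rw [hu]; simp
  have e11 : A 0 0 = A 1 1 := EisensteinOver.ext_of_padicRed p fun j => by rw [hu, hu]; simp
  have hd : IsUnit (A 0 0) := by
    have := (det A).isUnit
    rw [val_det_apply, det_fin_two, e01, zero_mul, sub_zero] at this
    exact isUnit_of_mul_isUnit_left this
  obtain ⟨v, hv⟩ := hd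
  rw [PGL2.mk_eq_one]
  refine ⟨v, ?_⟩
  ext i j : 1
  fin_cases i <;> fin_cases j <;> simp [e01, e10, hv, e11]

theorem PGL2.exists_map_eval_eq (v : ℕ → PGL2 𝓔) :
    ∃ x : PGL2 (ℕ → 𝓔), ∀ n, PGL2.map (Pi.evalRingHom (fun _ => 𝓔) n) x = v n := by
  choose A hA using fun n => mk_surjective (v n)
  refine ⟨mk ⟨of fun i k n => A n i k, of fun i k n => (A n)⁻¹ i k, ?_, ?_⟩, fun n => ?_⟩
  · ext i k n : 2
    have := congrFun (congrFun (A n).mul_inv i) k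
    rw [mul_apply] at this ⊢
    refine (Finset.sum_apply _ _ _).trans (this.trans ?_)
    rw [Matrix.one_apply, Matrix.one_apply]
    split_ifs <;> rfl
  · ext i k n : 2
    have := congrFun (congrFun (A n).inv_mul i) k
    rw [mul_apply] at this ⊢
    refine (Finset.sum_apply _ _ _).trans (this.trans ?_)
    rw [Matrix.one_apply, Matrix.one_apply]
    split_ifs <;> rfl
  · rw [← hA, PGL2.map_mk]
    congr 1

theorem ProfiniteCorrespondence.exists_red_eq_one {Λ : Type*} [Group Λ]
    (c : ProfiniteCorrespondence Λ (PGL2 𝓔)) (N : ℕ) [NeZero N] : ∃ n₀, ∀ g γ γ', (g, γ) ∈ c.R n₀ → (g, γ') ∈ c.R n₀ →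
      PGL2.map (EisensteinInt.red N) γ = PGL2.map (EisensteinInt.red N) γ' := by
  have : Finite (PGL2 (EisensteinOver (ZMod N))) := inferInstance
  obtain ⟨n, hn⟩ := c.right_mem (PGL2.map (EisensteinInt.red N)).ker inferInstance
  refine ⟨n, fun g γ γ' h h' => ?_⟩
  have h1 := hn (γ⁻¹ * γ') (by simpa using (c.R n).mul_mem ((c.R n).inv_mem h) h')
  rw [MonoidHom.mem_ker, map_mul, map_inv, inv_mul_eq_one] at h1
  exact h1

/-- The `p`-adic representation attached to a profinite correspondence. -/
theorem ProfiniteCorrespondence.exists_padicRep {Λ : Type*} [Group Λ] (c : ProfiniteCorrespondence Λ (PGL2 𝓔)) :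
    ∃ ρ : Λ →* PGL2 (EisensteinOver ℤ_[p]), ∀ j, ∃ n₀, ∀ g γ, (g, γ) ∈ c.R n₀ →
      PGL2.map (EisensteinOver.padicRed p j) (ρ g) = PGL2.map (EisensteinInt.red (p ^ j)) γ := by
  choose v hv using fun g n => c.exists_right n g
  choose u hu using fun g => PGL2.exists_map_eval_eq (v g)
  have key : ∀ j, ∃ n₀, ∀ g γ, (g, γ) ∈ c.R n₀ →
      PGL2.map (EisensteinOver.padicRed p j) (PGL2.map (eisensteinLim p) (u g)) =
        PGL2.map (EisensteinInt.red (p ^ j)) γ := by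
    intro j
    have : NeZero (p ^ j) := ⟨(pow_pos hp.out.pos j).ne'⟩
    obtain ⟨n₀, hn₀⟩ := c.exists_red_eq_one (p ^ j)
    refine ⟨n₀, fun g γ h => ?_⟩
    obtain ⟨n, h1, h2⟩ := ((PGL2.eventually_map_padicRed p (u g) j).and
      ((Nat.hyperfilter_le_atTop) (eventually_ge_atTop n₀))).exists
    rw [h1, hu]
    exact hn₀ g _ _ (c.anti h2 (hv g n)) h
  have hmul : ∀ g h, PGL2.map (eisensteinLim p) (u (g * h)) =
      PGL2.map (eisensteinLim p) (u g) * PGL2.map (eisensteinLim p) (u h) := by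
    intro g h
    apply PGL2.ext_of_padicRed
    intro j
    obtain ⟨n₀, hn₀⟩ := key j
    rw [map_mul, hn₀ g _ (hv g n₀), hn₀ h _ (hv h n₀), ← map_mul]
    exact hn₀ _ _ ((c.R n₀).mul_mem (hv g n₀) (hv h n₀))
  exact ⟨MonoidHom.mk' (fun g => PGL2.map (eisensteinLim p) (u g)) hmul, key⟩

end PadicLimits

open EisensteinInt (red toPadic)
open EisensteinOver (padicRed)

/-- Two fields with a common subfield embed in a common field. -/
theorem Field.exists_common_extension {L K K' : Type} [Field L] [Field K] [Field K'] (f : L →+* K) (g : L →+* K') :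
    ∃ (Ω : Type) (_ : Field Ω) (i : K →+* Ω) (j : K' →+* Ω), i.comp f = j.comp g := by
  algebraize [f, g]
  have : Nontrivial (TensorProduct L K K') := inferInstance
  obtain ⟨m, hm⟩ := Ideal.exists_maximal (TensorProduct L K K')
  refine ⟨_, Ideal.Quotient.field m,
    (Ideal.Quotient.mk m).comp (Algebra.TensorProduct.includeLeft : K →ₐ[L] TensorProduct L K K').toRingHom,
    (Ideal.Quotient.mk m).comp
      (Algebra.TensorProduct.includeRight : K' →ₐ[L] TensorProduct L K K').toRingHom, ?_⟩
  ext x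
  simp only [RingHom.comp_apply]
  congr 1
  exact ((Algebra.TensorProduct.includeLeft : K →ₐ[L] TensorProduct L K K').commutes x).trans
    ((Algebra.TensorProduct.includeRight : K' →ₐ[L] TensorProduct L K K').commutes x).symm

/-- Embeddings of a subfield which differ extend to embeddings which differ. -/
theorem Field.exists_embeddings_ne_of_subfield {L K Ω₀ : Type} [Field L] [Field K] [Field Ω₀]
    (f : L →+* K) (a b : L →+* Ω₀) {t : L} (h : a t ≠ b t) :
    ∃ (Ω : Type) (_ : Field Ω) (i j : K →+* Ω), i (f t) ≠ j (f t) := by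
  obtain ⟨Ω₁, _, i, k, h1⟩ := Field.exists_common_extension f a
  obtain ⟨Ω₂, _, j, l, h2⟩ := Field.exists_common_extension f (k.comp b)
  refine ⟨Ω₂, inferInstance, l.comp i, j, fun h3 => h ?_⟩
  have e1 : i (f t) = k (a t) := RingHom.congr_fun h1 t
  have e2 : j (f t) = l (k (b t)) := RingHom.congr_fun h2 t
  rw [RingHom.comp_apply, e1, e2] at h3
  exact k.injective (l.injective h3)

/-- Irrational elements of a field of characteristic zero are moved by embeddings. -/
theorem Field.exists_embeddings_ne {K : Type} [Field K] [CharZero K] (t : K) (ht : ∀ r : ℚ, (r : K) ≠ t) :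
    ∃ (Ω : Type) (_ : Field Ω) (i j : K →+* Ω), i t ≠ j t := by
  by_cases halg : IsAlgebraic ℚ t
  · have hti : IsIntegral ℚ t := halg.isIntegral
    let L := IntermediateField.adjoin ℚ {t}
    have : FiniteDimensional ℚ L := IntermediateField.adjoin.finiteDimensional hti
    let s : L := IntermediateField.AdjoinSimple.gen ℚ t
    obtain ⟨Q, _, _, hQ⟩ : ∃ (Q : Type) (_ : Field Q) (_ : Algebra ℚ Q), IsAlgClosure ℚ Q :=
      ⟨AlgebraicClosure ℚ, inferInstance, AlgebraicClosure.instAlgebra ℚ (R := ℚ), inferInstance⟩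
    have : IsAlgClosed Q := hQ.isAlgClosed
    let a : L →ₐ[ℚ] Q := IsAlgClosed.lift
    have hs : a s ∉ (⊥ : IntermediateField ℚ Q) := by
      intro h
      obtain ⟨r, hr⟩ := IntermediateField.mem_bot.1 h
      rw [← a.commutes] at hr
      have h1 : algebraMap ℚ L r = s := a.toRingHom.injective hr
      refine ht r ?_
      have h2 := congrArg (algebraMap L K) h1
      rw [← IsScalarTower.algebraMap_apply] at h2
      simpa [s] using h2
    have : IsGalois ℚ Q := IsAlgClosure.isGalois ℚ _
    rw [InfiniteGalois.mem_bot_iff_fixed] at hs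
    push Not at hs
    obtain ⟨σ, hσ⟩ := hs
    exact Field.exists_embeddings_ne_of_subfield (algebraMap L K) (σ.toRingHom.comp a.toRingHom)
      a.toRingHom (t := s) hσ
  · have h0 : Injective (Polynomial.aeval t : Polynomial ℚ →ₐ[ℚ] K) :=
      transcendental_iff_injective.1 halg
    have h1 : Injective (Polynomial.aeval (t + 1) : Polynomial ℚ →ₐ[ℚ] K) := by
      apply transcendental_iff_injective.1
      intro h
      apply halg
      have := h.sub isAlgebraic_one
      rwa [add_sub_cancel_right] at this
    let f : FractionRing (Polynomial ℚ) →+* K := IsFractionRing.lift (g := ((Polynomial.aeval t : Polynomial ℚ →ₐ[ℚ] K) : Polynomial ℚ →+* K)) h0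
    let g : FractionRing (Polynomial ℚ) →+* K :=
      IsFractionRing.lift (g := ((Polynomial.aeval (t + 1) : Polynomial ℚ →ₐ[ℚ] K) : Polynomial ℚ →+* K)) h1
    let s : FractionRing (Polynomial ℚ) :=
      algebraMap (Polynomial ℚ) _ Polynomial.X
    have hf : f s = t := by
      refine (IsFractionRing.lift_algebraMap (K := FractionRing (Polynomial ℚ)) h0 _).trans ?_
      exact Polynomial.aeval_X t
    have hg : g s = t + 1 := by
      refine (IsFractionRing.lift_algebraMap (K := FractionRing (Polynomial ℚ)) h1 _).trans ?_
      exact Polynomial.aeval_X (t + 1)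
    have := Field.exists_embeddings_ne_of_subfield f f g (t := s) (by rw [hf, hg]; simp)
    rwa [hf] at this

theorem Rat.exists_int_eq_of_forall_padicInt (r : ℚ)
    (h : ∀ (p : ℕ) [Fact p.Prime], ∃ t : ℤ_[p], (t : ℚ_[p]) = r) : ∃ m : ℤ, r = m := by
  have hden : r.den = 1 := by
    by_contra hne
    obtain ⟨p, hp, hpd⟩ := Nat.exists_prime_and_dvd hne
    have : Fact p.Prime := ⟨hp⟩
    obtain ⟨t, ht⟩ := h p
    have h1 : (r.num : ℚ_[p]) = t * (r.den : ℤ) := by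
      rw [ht]
      have : (r : ℚ) * r.den = r.num := Rat.mul_den_eq_num r
      exact_mod_cast this.symm
    have h2 : ‖((r.den : ℤ) : ℚ_[p])‖ < 1 :=
      Padic.norm_intCast_lt_one_iff.2 (by exact_mod_cast hpd)
    have h3 : ‖(r.num : ℚ_[p])‖ < 1 := by
      rw [h1, norm_mul]
      calc _ ≤ 1 * ‖((r.den : ℤ) : ℚ_[p])‖ := by gcongr; exact t.2
        _ < 1 := by rwa [one_mul]
    have h4 : (p : ℤ) ∣ r.num := Padic.norm_intCast_lt_one_iff.1 h3
    have h5 := r.reduced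
    have h6 : p ∣ r.num.natAbs := by rw [← Int.natCast_dvd_natCast]; simpa using h4
    exact hp.one_lt.ne' (Nat.dvd_one.1 (h5 ▸ Nat.dvd_gcd h6 hpd))
  refine ⟨r.num, ?_⟩
  conv_lhs => rw [← Rat.num_div_den r, hden]
  simp

/-- An integer which is a `p`-adic square for all `p` is a square. -/
theorem Int.exists_sq_eq_of_forall_padicInt (m : ℤ)
    (h : ∀ (p : ℕ) [Fact p.Prime], ∃ b : ℤ_[p], b ^ 2 = m) : ∃ k : ℤ, m = k ^ 2 := by
  rcases eq_or_ne m 0 with rfl | hm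
  · exact ⟨0, rfl⟩
  have hsq : ∀ y : ZMod 3, y ^ 2 ≠ -1 := by decide
  obtain ⟨a, k, hk, ha⟩ := Nat.sq_mul_squarefree m.natAbs
  have hm' : m.natAbs ≠ 0 := Int.natAbs_ne_zero.2 hm
  have hk0 : k ≠ 0 := by rintro rfl; simp at hk; omega
  have ha1 : a = 1 := by
    by_contra hne
    obtain ⟨p, hp, hpa⟩ := Nat.exists_prime_and_dvd hne
    have : Fact p.Prime := ⟨hp⟩
    obtain ⟨b, hb⟩ := h p
    have h1 : ((b : ℚ_[p]) ^ 2).valuation = padicValInt p m := by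
      rw [← Padic.valuation_intCast, ← PadicInt.coe_intCast, ← hb, PadicInt.coe_pow]
    rw [Padic.valuation_pow, padicValInt, ← hk, padicValNat.mul (pow_ne_zero _ hk0) ha.ne_zero,
      padicValNat.pow] at h1
    have h2 : padicValNat p a = 1 := by
      have h3 := ha.natFactorization_le_one p
      rw [Nat.factorization_def _ hp] at h3
      have h4 := one_le_padicValNat_of_dvd ha.ne_zero hpa
      omega
    rw [h2] at h1
    push_cast at h1
    omega
  rw [ha1, mul_one] at hk
  rcases Int.natAbs_eq m with h1 | h1
  · exact ⟨k, by rw [h1, ← hk]; push_cast; rfl⟩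
  · exfalso
    have : Fact (Nat.Prime 3) := ⟨Nat.prime_three⟩
    obtain ⟨b, hb⟩ := h 3
    rw [h1, ← hk] at hb
    have hkk : ((k : ℕ) : ℚ_[3]) ≠ 0 := by exact_mod_cast hk0
    have h2 : ((b : ℚ_[3]) / k) ^ 2 = -1 := by
      have := congrArg (fun x : ℤ_[3] => (x : ℚ_[3])) hb
      simp only [PadicInt.coe_pow, PadicInt.coe_intCast] at this
      rw [div_pow, this]
      push_cast
      field_simp
    have h3 : ‖(b : ℚ_[3]) / k‖ ≤ 1 := by
      have := congrArg norm h2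
      rw [norm_pow, norm_neg, norm_one] at this
      nlinarith [norm_nonneg ((b : ℚ_[3]) / k)]
    let e : ℤ_[3] := ⟨(b : ℚ_[3]) / k, h3⟩
    have h4 : e ^ 2 = -1 := by
      apply Subtype.ext
      push_cast
      exact h2
    have h5 := congrArg PadicInt.toZMod h4
    rw [map_pow, map_neg, map_one] at h5
    exact hsq _ h5

section IntegralCharacters

theorem PGL2.upper_natCast {R : Type*} [CommRing R] (n : ℕ) : upper (n : R) = upper 1 ^ n := by
  induction n with
  | zero => apply GeneralLinearGroup.ext; intro i j; fin_cases i <;> fin_cases j <;> simp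
  | succ n ih => rw [Nat.cast_succ, PGL2.upper_add, ih, pow_succ]

theorem PadicInt.ringHom_injective {p : ℕ} [Fact p.Prime] {Ω : Type*} [Field Ω] [CharZero Ω]
    (f : ℤ_[p] →+* Ω) : Injective f := by
  rw [injective_iff_map_eq_zero]
  intro x hx
  by_contra hne
  rw [PadicInt.unitCoeff_spec hne, map_mul, map_pow, map_natCast] at hx
  rcases mul_eq_zero.1 hx with h | h
  · exact ((PadicInt.unitCoeff hne).isUnit.map f).ne_zero h
  · have := eq_zero_of_pow_eq_zero h
    exact (Fact.out : p.Prime).ne_zero (by exact_mod_cast this)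

variable {Λ : Type} [Group Λ] {p : ℕ} [hp : Fact p.Prime]

/-- A `p`-adic representation compatible with a profinite correspondence. -/
def IsPadicRep (c : ProfiniteCorrespondence Λ (PGL2 𝓔)) (p : ℕ) [Fact p.Prime]
    (ρ : Λ →* PGL2 (EisensteinOver ℤ_[p])) : Prop :=
  ∀ j, ∃ n₀, ∀ g γ, (g, γ) ∈ c.R n₀ →
    PGL2.map (padicRed p j) (ρ g) = PGL2.map (red (p ^ j)) γ

namespace IsPadicRep

variable {c : ProfiniteCorrespondence Λ (PGL2 𝓔)} {ρ : Λ →* PGL2 (EisensteinOver ℤ_[p])}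

theorem exists_padicRed_trace (hρ : IsPadicRep c p ρ) (j : ℕ) :
    ∃ n₀, ∀ g γ, (g, γ) ∈ c.R n₀ → padicRed p j (PGL2.sq (ρ g)).trace = red (p ^ j) (PGL2.sq γ).trace := by
  obtain ⟨n₀, h⟩ := hρ j
  refine ⟨n₀, fun g γ hg => ?_⟩
  have := congrArg (fun x => (PGL2.sq x).trace) (h g γ hg)
  simp only [PGL2.sq_map] at this
  rwa [← AddMonoidHom.map_trace (padicRed p j),
    ← AddMonoidHom.map_trace (red (p ^ j))] at this

theorem isAdmissible [Group.FG Λ] (hρ : IsPadicRep c p ρ) {Ω : Type*} [Field Ω] [CharZero Ω]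
    (f : ℤ_[p] →+* Ω) (z : Ω) (hz : z ^ 2 + z + 1 = 0) : IsAdmissible ((PGL2.map (eval f z hz)).comp ρ) := by
  let N := normalCoreUpTo Λ 120
  obtain ⟨f', n₁, hf'⟩ := c.transport (mk' N)
  let M := Nat.card (Λ ⧸ N)
  have hM : 0 < M := Nat.card_pos
  have hpow : ∀ γ, f' (γ ^ M) = 1 := fun γ => by rw [map_pow, pow_card_eq_one']
  let G : GL (Fin 2) 𝓔 := upper (M : 𝓔) * (swap * upper (M : 𝓔) * swap)
  have hG : (G : Mat₂ 𝓔) = !![1 + (M : 𝓔) * M, (M : 𝓔); (M : 𝓔), 1] := by simp [G]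
  have hf'G : f' (mk G) = 1 := by
    have : f' (mk swap) * f' (mk swap) = 1 := by rw [← map_mul, stdRelations.s2, map_one]
    simp only [G, map_mul, PGL2.upper_natCast, map_pow]
    rw [← map_pow f', hpow, mul_one, one_mul, this]
  let m : ℤ := (2 + (M : ℤ) ^ 2) ^ 2 - 2
  have htr : (PGL2.sq (mk G)).trace = (m : 𝓔) := by
    have hdet : det G = 1 := by
      ext : 1
      rw [val_det_apply, hG, det_fin_two_of]
      simp
    rw [PGL2.sq_mk, hdet, hG, inv_one, Units.val_one, one_smul, mul_fin_two,
      Matrix.trace_fin_two_of]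
    simp only [m]
    push_cast
    ring
  have hm : 0 < (m - 2) ^ 2 := by
    have : (0 : ℤ) < M := by exact_mod_cast hM
    have : 0 < m - 2 := by simp only [m]; nlinarith [pow_pos this 2, pow_pos this 4]
    positivity
  obtain ⟨j, hj⟩ : ∃ j, (m - 2) ^ 2 < (p ^ j : ℕ) := by
    obtain ⟨j, hj⟩ := pow_unbounded_of_one_lt ((m - 2) ^ 2).toNat hp.out.one_lt
    exact ⟨j, by omega⟩
  obtain ⟨n₂, hn₂⟩ := hρ.exists_padicRed_trace j
  obtain ⟨g, hg⟩ := c.exists_left (max n₁ n₂) (mk G)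
  refine ⟨g, ?_, fun h => ?_⟩
  · have h1 := hf' g _ (c.anti (le_max_left _ _) hg)
    rw [hf'G] at h1
    exact (eq_one_iff g).1 h1.symm
  · have h1 := hn₂ g _ (c.anti (le_max_right _ _) hg)
    rw [htr] at h1
    set τ := (PGL2.sq (ρ g)).trace with hτ
    have h2 : (PGL2.sq (PGL2.map (eval f z hz) (ρ g))).trace =
        eval f z hz τ := by
      rw [PGL2.sq_map, hτ, AddMonoidHom.map_trace (eval f z hz)]
    rw [comp_apply, h2, eval_apply] at h
    have h3 : f ((τ.re - 2) ^ 2 - (τ.re - 2) * τ.im + τ.im ^ 2) = 0 := by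
      simp only [map_add, map_sub, map_pow, map_mul, map_ofNat]
      linear_combination (f τ.re - 2 + f τ.im * (-1 - z)) * h + (f τ.im) ^ 2 * hz
    have h4 := (injective_iff_map_eq_zero f).1 (PadicInt.ringHom_injective f) _ h3
    have h5 : PadicInt.toZModPow j τ.re = m := by
      have := congrArg QuadraticAlgebra.re h1
      simpa [padicRed, red] using this
    have h6 : PadicInt.toZModPow j τ.im = 0 := by
      have := congrArg QuadraticAlgebra.im h1
      simpa [padicRed, red] using this
    have h7 := congrArg (PadicInt.toZModPow j) h4
    simp only [map_add, map_sub, map_pow, map_mul, map_ofNat, h5, h6, map_zero] at h7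
    have h8 : (((m - 2) ^ 2 : ℤ) : ZMod (p ^ j)) = 0 := by
      push_cast
      linear_combination h7
    rw [ZMod.intCast_zmod_eq_zero_iff_dvd] at h8
    exact absurd (Int.le_of_dvd hm h8) (not_le.2 hj)

theorem exists_im_ne_zero (hρ : IsPadicRep c p ρ) : ∃ x : FreeAlgebra ℤ Λ, (sqTrace ρ x).im ≠ 0 := by
  let G : GL (Fin 2) 𝓔 := ⟨!![⟨0, 1⟩, -1; 1, 0], !![0, 1; -1, ⟨0, 1⟩],
    by simp [one_fin_two]; ext <;> simp, by simp [one_fin_two]; ext <;> simp⟩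
  have hG : (G : Mat₂ 𝓔) = !![⟨0, 1⟩, -1; 1, 0] := rfl
  have htr : (PGL2.sq (mk G)).trace = (⟨-3, -1⟩ : 𝓔) := by
    have hdet : det G = 1 := by
      ext : 1
      rw [val_det_apply, hG, det_fin_two_of]
      simp
    rw [PGL2.sq_mk, hdet, hG, inv_one, Units.val_one, one_smul, mul_fin_two,
      Matrix.trace_fin_two_of]
    ext <;> simp
  obtain ⟨n, hn⟩ := hρ.exists_padicRed_trace 1
  obtain ⟨g, hg⟩ := c.exists_left n (mk G)
  refine ⟨FreeAlgebra.ι ℤ g, fun h => ?_⟩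
  have h1 := congrArg QuadraticAlgebra.im (hn g _ hg)
  rw [sqTrace, evalSq_ι] at h
  rw [htr] at h1
  simp only [padicRed, red, EisensteinOver.map_im, h, map_zero] at h1
  have : (1 : ZMod (p ^ 1)) = 0 := by
    have h2 : (0 : ZMod (p ^ 1)) = -1 := by simpa using h1
    linear_combination h2
  rw [pow_one] at this
  have := hp.out
  have : Fact (1 < p) := ⟨this.one_lt⟩
  exact one_ne_zero ‹(1 : ZMod p) = 0›

/-- The trace and the norm of the character are independent of the prime and of the embedding. -/
theorem map_trace_eq [Group.FG Λ] (hρ : IsPadicRep c p ρ) {q : ℕ} [Fact q.Prime]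
    {σ : Λ →* PGL2 (EisensteinOver ℤ_[q])} (hσ : IsPadicRep c q σ) {Ω : Type*} [Field Ω]
    [CharZero Ω] [IsAlgClosed Ω] (f : ℤ_[p] →+* Ω) (g : ℤ_[q] →+* Ω) (x : FreeAlgebra ℤ Λ) :
    f (2 * (sqTrace ρ x).re - (sqTrace ρ x).im) = g (2 * (sqTrace σ x).re - (sqTrace σ x).im) ∧
      f (sqTrace ρ x).norm = g (sqTrace σ x).norm := by
  obtain ⟨z, hz⟩ : ∃ z : Ω, z ^ 2 + z + 1 = 0 := by
    obtain ⟨s, hs⟩ := IsAlgClosed.exists_eq_mul_self (-3 : Ω)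
    refine ⟨(s - 1) / 2, ?_⟩
    field_simp
    linear_combination -hs
  have hz' : (-1 - z) ^ 2 + (-1 - z) + 1 = 0 := by linear_combination hz
  have hzz : z - (-1 - z) ≠ 0 := by
    intro h
    have : (3 : Ω) = 0 := by linear_combination 4 * hz - (z - (-1 - z)) * h
    norm_num at this
  let R : ∀ (w : Ω), w ^ 2 + w + 1 = 0 → Λ →* PGL2 Ω := fun w hw =>
    (PGL2.map (eval f w hw)).comp ρ
  let S : ∀ (w : Ω), w ^ 2 + w + 1 = 0 → Λ →* PGL2 Ω := fun w hw =>
    (PGL2.map (eval g w hw)).comp σ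
  have eR : ∀ w hw y, sqTrace (R w hw) y = f (sqTrace ρ y).re + f (sqTrace ρ y).im * w :=
    fun w hw y => sqTrace_map (eval f w hw) ρ y
  have eS : ∀ w hw y, sqTrace (S w hw) y = g (sqTrace σ y).re + g (sqTrace σ y).im * w :=
    fun w hw y => sqTrace_map (eval g w hw) σ y
  have hR : sqTrace (R z hz) ≠ sqTrace (R _ hz') := by
    intro h
    obtain ⟨y, hy⟩ := hρ.exists_im_ne_zero
    have h1 := congrFun h y
    rw [eR, eR] at h1
    have h2 : f (sqTrace ρ y).im * (z - (-1 - z)) = 0 := by linear_combination h1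
    exact hy ((injective_iff_map_eq_zero f).1 (PadicInt.ringHom_injective f) _
      ((mul_eq_zero.1 h2).resolve_right hzz))
  have hS : sqTrace (S z hz) ≠ sqTrace (S _ hz') := by
    intro h
    obtain ⟨y, hy⟩ := hσ.exists_im_ne_zero
    have h1 := congrFun h y
    rw [eS, eS] at h1
    have h2 : g (sqTrace σ y).im * (z - (-1 - z)) = 0 := by linear_combination h1
    exact hy ((injective_iff_map_eq_zero g).1 (PadicInt.ringHom_injective g) _
      ((mul_eq_zero.1 h2).resolve_right hzz))
  have key : ∀ w hw, sqTrace (S w hw) = sqTrace (R z hz) ∨ sqTrace (S w hw) = sqTrace (R _ hz') := by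
    intro w hw
    obtain ⟨i, j, hij, h⟩ := c.exists_sqTrace_eq ![R z hz, R _ hz', S w hw] (by
      intro i
      fin_cases i
      · exact hρ.isAdmissible f z hz
      · exact hρ.isAdmissible f _ hz'
      · exact hσ.isAdmissible g w hw)
    fin_cases i <;> fin_cases j
    · exact absurd rfl hij
    · exact absurd h hR
    · exact Or.inl h.symm
    · exact absurd h.symm hR
    · exact absurd rfl hij
    · exact Or.inr h.symm
    · exact Or.inl h
    · exact Or.inr h
    · exact absurd rfl hij
  have hcase : (sqTrace (S z hz) x = sqTrace (R z hz) x ∧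
      sqTrace (S _ hz') x = sqTrace (R _ hz') x) ∨ (sqTrace (S z hz) x = sqTrace (R _ hz') x ∧
      sqTrace (S _ hz') x = sqTrace (R z hz) x) := by
    rcases key z hz with h1 | h1 <;> rcases key _ hz' with h2 | h2
    · exact absurd (h1.trans h2.symm) hS
    · exact Or.inl ⟨congrFun h1 x, congrFun h2 x⟩
    · exact Or.inr ⟨congrFun h1 x, congrFun h2 x⟩
    · exact absurd (h1.trans h2.symm) hS
  simp only [eR, eS] at hcase
  simp only [norm_apply, map_add, map_sub, map_mul, map_pow, map_ofNat]
  set α := f (sqTrace ρ x).re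
  set β := f (sqTrace ρ x).im
  set α' := g (sqTrace σ x).re
  set β' := g (sqTrace σ x).im
  have n1 : α ^ 2 - α * β + β ^ 2 = (α + β * z) * (α + β * (-1 - z)) := by linear_combination β ^ 2 * hz
  have n2 : α' ^ 2 - α' * β' + β' ^ 2 = (α' + β' * z) * (α' + β' * (-1 - z)) := by linear_combination β' ^ 2 * hz
  rcases hcase with ⟨h1, h2⟩ | ⟨h1, h2⟩
  · exact ⟨by linear_combination -h1 - h2, by rw [n1, n2, h1, h2]⟩
  · exact ⟨by linear_combination -h1 - h2, by rw [n1, n2, h1, h2, mul_comm]⟩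

end IsPadicRep

/-- A family of compatible `p`-adic integers is a rational integer. -/
theorem exists_int_of_forall_embedding (t : ∀ (p : ℕ) [Fact p.Prime], ℤ_[p])
    (h : ∀ (p q : ℕ) [Fact p.Prime] [Fact q.Prime] (Ω : Type) [Field Ω] [CharZero Ω] [IsAlgClosed Ω]
      (f : ℤ_[p] →+* Ω) (g : ℤ_[q] →+* Ω), f (t p) = g (t q)) : ∃ m : ℤ, ∀ (p : ℕ) [Fact p.Prime], t p = m := by
  have hrat : ∀ (p : ℕ) [Fact p.Prime], ∃ r : ℚ, (r : ℚ_[p]) = t p := by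
    intro p _
    by_contra hne
    push Not at hne
    obtain ⟨Ω, _, i, j, hij⟩ := Field.exists_embeddings_ne (t p : ℚ_[p]) hne
    have : CharZero Ω := charZero_of_injective_ringHom i.injective
    let e : Ω →+* AlgebraicClosure Ω := algebraMap _ _
    have h1 := h p p (AlgebraicClosure Ω) ((e.comp i).comp PadicInt.Coe.ringHom)
      ((e.comp j).comp PadicInt.Coe.ringHom)
    exact hij (e.injective h1)
  choose r hr using hrat
  have hr' : ∀ (p q : ℕ) [Fact p.Prime] [Fact q.Prime], r p = r q := by
    intro p q _ _
    obtain ⟨Ω, _, i, j, hij⟩ := Field.exists_common_extension (algebraMap ℚ ℚ_[p]) (algebraMap ℚ ℚ_[q])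
    have : CharZero Ω := charZero_of_injective_ringHom i.injective
    let e : Ω →+* AlgebraicClosure Ω := algebraMap _ _
    have h1 := h p q (AlgebraicClosure Ω) ((e.comp i).comp PadicInt.Coe.ringHom)
      ((e.comp j).comp PadicInt.Coe.ringHom)
    have h2 : i (t p : ℚ_[p]) = j (t q : ℚ_[q]) := e.injective h1
    rw [← hr, ← hr, map_ratCast, map_ratCast] at h2
    exact_mod_cast h2
  have : Fact (Nat.Prime 2) := ⟨Nat.prime_two⟩
  obtain ⟨m, hm⟩ := Rat.exists_int_eq_of_forall_padicInt (r 2) (fun p _ => ⟨t p, by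
    rw [← hr, hr' p 2]⟩)
  refine ⟨m, fun p _ => ?_⟩
  apply Subtype.ext
  rw [← hr, hr' p 2, hm]
  simp

end IntegralCharacters

theorem EisensteinInt.toPadic_injective (p : ℕ) [Fact p.Prime] : Injective (toPadic p) := by
  intro x y h
  ext
  · simpa [toPadic] using congrArg QuadraticAlgebra.re h
  · simpa [toPadic] using congrArg QuadraticAlgebra.im h

theorem EisensteinOver.star_eq {R : Type*} [CommRing R] (x : EisensteinOver R) : star x = ⟨x.re - x.im, -x.im⟩ := by
  ext <;> simp [sub_eq_add_neg]

/-- A trace and a norm which are integral and independent of `p` come from an Eisenstein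
integer. -/
theorem EisensteinInt.exists_eq_toPadic (τ : ∀ (p : ℕ) [Fact p.Prime], EisensteinOver ℤ_[p])
    (T N : ℤ) (hT : ∀ (p : ℕ) [Fact p.Prime], 2 * (τ p).re - (τ p).im = T)
    (hN : ∀ (p : ℕ) [Fact p.Prime], (τ p).norm = N) :
    ∃ a : 𝓔, ∀ (p : ℕ) [Fact p.Prime], τ p = toPadic p a ∨ τ p = toPadic p (star a) := by
  have h3 : ∀ (p : ℕ) [Fact p.Prime], 3 * (τ p).im ^ 2 = ((4 * N - T ^ 2 : ℤ) : ℤ_[p]) := by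
    intro p _
    push_cast
    rw [← hT, ← hN, norm_apply]
    ring
  obtain ⟨m, hm⟩ : (3 : ℤ) ∣ 4 * N - T ^ 2 := by
    have : Fact (Nat.Prime 3) := ⟨Nat.prime_three⟩
    have h1 : ‖((4 * N - T ^ 2 : ℤ) : ℤ_[3])‖ < 1 := by
      rw [← h3 3, norm_mul]
      have h2 : ‖((3 : ℤ) : ℤ_[3])‖ < 1 := (PadicInt.norm_int_lt_one_iff_dvd 3).2 (by simp)
      have h4 : ‖(τ 3).im ^ 2‖ ≤ 1 := PadicInt.norm_le_one _
      calc _ ≤ ‖(3 : ℤ_[3])‖ * 1 := by gcongr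
        _ < 1 := by rw [mul_one]; exact_mod_cast h2
    exact_mod_cast (PadicInt.norm_int_lt_one_iff_dvd _).1 h1
  have h4 : ∀ (p : ℕ) [Fact p.Prime], (τ p).im ^ 2 = (m : ℤ_[p]) := by
    intro p _
    have := h3 p
    rw [hm] at this
    push_cast at this
    exact mul_left_cancel₀ (by norm_num) this
  obtain ⟨k, hk⟩ := Int.exists_sq_eq_of_forall_padicInt m fun p _ => ⟨_, h4 p⟩
  obtain ⟨l, hl⟩ : ∃ l, T = k + 2 * l := by
    have h5 : T ^ 2 + 3 * k ^ 2 = 4 * N := by rw [← hk]; linarith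
    have h6 : T % 2 = k % 2 := by
      have h7 : (T ^ 2 + 3 * k ^ 2) % 2 = 0 := by omega
      rcases Int.emod_two_eq_zero_or_one T with h | h <;>
        rcases Int.emod_two_eq_zero_or_one k with h' | h' <;>
        simp [pow_two, Int.add_emod, Int.mul_emod, h, h'] at h7 ⊢
    exact ⟨(T - k) / 2, by omega⟩
  refine ⟨⟨k + l, k⟩, fun p _ => ?_⟩
  have h5 : (τ p).im ^ 2 = (k : ℤ_[p]) ^ 2 := by rw [h4, hk]; push_cast; rfl
  have hT' := hT p
  rw [hl] at hT'
  push_cast at hT'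
  have h2 : (2 : ℤ_[p]) ≠ 0 := by norm_num
  rcases sq_eq_sq_iff_eq_or_eq_neg.1 h5 with h | h
  · left
    ext
    · apply mul_left_cancel₀ h2
      simp only [toPadic, EisensteinOver.map_re, eq_intCast]
      push_cast
      linear_combination hT' + h
    · simp [toPadic, h]
  · right
    rw [EisensteinOver.star_eq]
    ext
    · apply mul_left_cancel₀ h2
      simp only [toPadic, EisensteinOver.map_re, eq_intCast]
      push_cast
      linear_combination hT' + h
    · simp [toPadic, h]

theorem AddSubgroup.eq_top_or_eq_top_of_cover {A : Type*} [AddGroup A] (H K : AddSubgroup A)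
    (h : ∀ x, x ∈ H ∨ x ∈ K) : (∀ x, x ∈ H) ∨ ∀ x, x ∈ K := by
  by_contra hne
  push Not at hne
  obtain ⟨⟨x, hx⟩, y, hy⟩ := hne
  have hxK := (h x).resolve_left hx
  have hyH := (h y).resolve_right hy
  rcases h (x + y) with h1 | h1
  · exact hx ((H.add_mem_cancel_right hyH).1 h1)
  · exact hy ((K.add_mem_cancel_left hxK).1 h1)

/-- The `2`-adic character is integral, and determines the other ones up to conjugation. -/
theorem ProfiniteCorrespondence.exists_integral_character {Λ : Type} [Group Λ] [Group.FG Λ]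
    (c : ProfiniteCorrespondence Λ (PGL2 𝓔)) (ρ : ∀ (p : ℕ) [Fact p.Prime], Λ →* PGL2 (EisensteinOver ℤ_[p]))
    (hρ : ∀ (p : ℕ) [Fact p.Prime], IsPadicRep c p (ρ p)) :
    ∃ χ : FreeAlgebra ℤ Λ →+ 𝓔, (∀ x, sqTrace (ρ 2) x = toPadic 2 (χ x)) ∧
      ∀ (p : ℕ) [Fact p.Prime], (∀ x, sqTrace (ρ p) x = toPadic p (χ x)) ∨
        ∀ x, sqTrace (ρ p) x = toPadic p (star (χ x)) := by
  have h1 : ∀ x, ∃ a : 𝓔, ∀ (p : ℕ) [Fact p.Prime], sqTrace (ρ p) x = toPadic p a ∨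
      sqTrace (ρ p) x = toPadic p (star a) := by
    intro x
    obtain ⟨T, hT⟩ := exists_int_of_forall_embedding
      (fun p _ => 2 * (sqTrace (ρ p) x).re - (sqTrace (ρ p) x).im)
      fun p q _ _ Ω _ _ _ f g => ((hρ p).map_trace_eq (hρ q) f g x).1
    obtain ⟨N, hN⟩ := exists_int_of_forall_embedding (fun p _ => (sqTrace (ρ p) x).norm)
      fun p q _ _ Ω _ _ _ f g => ((hρ p).map_trace_eq (hρ q) f g x).2
    exact EisensteinInt.exists_eq_toPadic (fun p _ => sqTrace (ρ p) x) T N hT hN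
  have h2 : ∀ x, ∃ a : 𝓔, sqTrace (ρ 2) x = toPadic 2 a ∧
      ∀ (p : ℕ) [Fact p.Prime], sqTrace (ρ p) x = toPadic p a ∨
        sqTrace (ρ p) x = toPadic p (star a) := by
    intro x
    obtain ⟨a, ha⟩ := h1 x
    rcases ha 2 with h | h
    · exact ⟨a, h, ha⟩
    · refine ⟨star a, h, fun p _ => ?_⟩
      rw [star_star]
      exact (ha p).symm
  choose χ hχ2 hχ using h2
  have hadd : ∀ x y, χ (x + y) = χ x + χ y := fun x y =>
    EisensteinInt.toPadic_injective 2 (by rw [← hχ2, sqTrace_add, hχ2, hχ2, map_add])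
  let χ' : FreeAlgebra ℤ Λ →+ 𝓔 := AddMonoidHom.mk' χ hadd
  refine ⟨χ', hχ2, fun p _ => ?_⟩
  let τ : FreeAlgebra ℤ Λ →+ EisensteinOver ℤ_[p] := AddMonoidHom.mk' _ (sqTrace_add (ρ p))
  exact AddSubgroup.eq_top_or_eq_top_of_cover
    (τ.eqLocus ((toPadic p).toAddMonoidHom.comp χ'))
    (τ.eqLocus ((toPadic p).toAddMonoidHom.comp
      ((starAddEquiv (R := 𝓔)).toAddMonoidHom.comp χ'))) fun x => hχ x p

/-- Normalised squares generate the full matrix ring. -/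
theorem evalSq_id_surjective : Surjective (evalSq (id : PGL2 𝓔 → PGL2 𝓔)) := by
  let w : 𝓔ˣ := EisensteinInt.zeta ^ 2
  have hw : (w : 𝓔) = ⟨0, 1⟩ := by simp only [w]; rw [EisensteinInt.zeta_sq]
  have hw' : ((w⁻¹ : 𝓔ˣ) : 𝓔) = ⟨-1, -1⟩ := by simp only [w]; rw [EisensteinInt.zeta_sq]; rfl
  let S := (evalSq (id : PGL2 𝓔 → PGL2 𝓔)).range
  have hS : ∀ γ : PGL2 𝓔, PGL2.sq γ ∈ S := fun γ => ⟨FreeAlgebra.ι ℤ γ, evalSq_ι _ _⟩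
  have e1 : ∀ n : 𝓔, PGL2.sq (mk (upper n * diag w)) =
      !![⟨0, 1⟩, ⟨0, -1⟩ * n; 0, ⟨-1, -1⟩] := by
    intro n
    have hd : det (upper n * diag w) = w := by
      ext : 1
      rw [val_det_apply]
      simp [det_fin_two_of]
    rw [PGL2.sq_mk, hd, hw']
    ext i j : 1
    fin_cases i <;> fin_cases j <;> ext <;> simp [hw]
  have e2 : ∀ n : 𝓔, PGL2.sq (mk (swap * (upper n * diag w) * swap)) =
      !![⟨-1, -1⟩, 0; ⟨0, -1⟩ * n, ⟨0, 1⟩] := by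
    intro n
    have hd : det
        (swap * (upper n * diag w) * swap) = w := by
      ext : 1
      rw [val_det_apply]
      simp [det_fin_two_of]
    rw [PGL2.sq_mk, hd, hw']
    ext i j : 1
    fin_cases i <;> fin_cases j <;> ext <;> simp [hw, add_comm]
  have u : ∀ m : 𝓔, (!![0, m; 0, 0] : Mat₂ 𝓔) ∈ S := by
    intro m
    have := S.sub_mem (hS (mk (upper (⟨1, 1⟩ * m) * diag w)))
      (hS (mk (upper 0 * diag w)))
    rw [e1, e1] at this
    convert this using 1
    ext i j : 1
    fin_cases i <;> fin_cases j <;> ext <;> simp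
  have l : ∀ m : 𝓔, (!![0, 0; m, 0] : Mat₂ 𝓔) ∈ S := by
    intro m
    have := S.sub_mem (hS (mk (swap * (upper (⟨1, 1⟩ * m) * diag w) * swap)))
      (hS (mk (swap * (upper 0 * diag w) * swap)))
    rw [e2, e2] at this
    convert this using 1
    ext i j : 1
    fin_cases i <;> fin_cases j <;> ext <;> simp
  intro M
  have : M = !![0, M 0 0; 0, 0] * !![0, 0; 1, 0] + !![0, M 0 1; 0, 0] + !![0, 0; M 1 0, 0] +
      !![0, 0; M 1 1, 0] * !![0, 1; 0, 0] := by
    ext i j : 1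
    fin_cases i <;> fin_cases j <;> simp
  change M ∈ S
  rw [this]
  exact S.add_mem (S.add_mem (S.add_mem (S.mul_mem (u _) (l _)) (u _)) (l _)) (S.mul_mem (l _) (u _))

/-- Arbitrary integral matrices are approximated by polynomials in normalised squares. -/
theorem IsPadicRep.exists_evalSq_padicRed_eq {Λ : Type} [Group Λ] {p : ℕ} [Fact p.Prime]
    {c : ProfiniteCorrespondence Λ (PGL2 𝓔)} {ρ : Λ →* PGL2 (EisensteinOver ℤ_[p])}
    (hρ : IsPadicRep c p ρ) (j : ℕ) (M : Mat₂ 𝓔) : ∃ x, (evalSq ρ x).map (padicRed p j) = M.map (red (p ^ j)) := by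
  obtain ⟨n, hn⟩ := hρ j
  choose s hs using c.exists_left n
  obtain ⟨y, rfl⟩ := evalSq_id_surjective M
  have h1 : evalSq ρ (FreeAlgebra.lift ℤ (fun γ => FreeAlgebra.ι ℤ (s γ)) y) =
      evalSq (fun γ => ρ (s γ)) y := by
    have : (evalSq ρ).comp (FreeAlgebra.lift ℤ (fun γ => FreeAlgebra.ι ℤ (s γ))) =
        evalSq (fun γ => ρ (s γ)) := by
      ext γ : 2
      change evalSq ρ (FreeAlgebra.lift ℤ _ (FreeAlgebra.ι ℤ γ)) =
        evalSq (fun γ => ρ (s γ)) (FreeAlgebra.ι ℤ γ)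
      rw [FreeAlgebra.lift_ι_apply, evalSq_ι, evalSq_ι]
    exact AlgHom.congr_fun this y
  refine ⟨FreeAlgebra.lift ℤ (fun γ => FreeAlgebra.ι ℤ (s γ)) y, ?_⟩
  rw [h1, ← evalSq_map, ← evalSq_map]
  congr 2
  funext γ
  exact hn _ _ (hs γ)

section HermiteReduction

open scoped ComplexOrder

namespace EisensteinInt

/-- The complex cube root of unity. -/
noncomputable def cubeRoot : ℂ := ⟨-1 / 2, Real.sqrt 3 / 2⟩

theorem cubeRoot_spec : cubeRoot ^ 2 + cubeRoot + 1 = 0 := by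
  have h : Real.sqrt 3 * Real.sqrt 3 = 3 := Real.mul_self_sqrt (by norm_num)
  apply Complex.ext
  · simp [cubeRoot, pow_two]; nlinarith
  · simp [cubeRoot, pow_two]; ring

/-- The embedding of the Eisenstein integers in the complex numbers. -/
noncomputable def toComplex : 𝓔 →+* ℂ := eval (Int.castRingHom ℂ) cubeRoot cubeRoot_spec

theorem normSq_add_mul_cubeRoot (x y : ℝ) : normSq (x + y * cubeRoot) = x ^ 2 - x * y + y ^ 2 := by
  have h : Real.sqrt 3 * Real.sqrt 3 = 3 := Real.mul_self_sqrt (by norm_num)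
  rw [Complex.normSq_apply]
  simp [cubeRoot]
  nlinarith

theorem normSq_toComplex (x : 𝓔) : normSq (toComplex x) = x.norm := by
  have := normSq_add_mul_cubeRoot x.re x.im
  rw [norm_apply]
  push_cast
  rw [← this]
  simp [toComplex, eval_apply]

/-- The covering radius of the hexagonal lattice. -/
theorem exists_normSq_add_le (w : ℂ) : ∃ t : 𝓔, normSq (toComplex t + w) ≤ 1 / 3 := by
  have h3 : Real.sqrt 3 ≠ 0 := by positivity
  obtain ⟨x, y, hw⟩ : ∃ x y : ℝ, w = x + y * cubeRoot := by
    refine ⟨w.re + w.im / Real.sqrt 3, 2 * w.im / Real.sqrt 3, ?_⟩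
    apply Complex.ext
    · simp [cubeRoot]; ring
    · simp [cubeRoot]; field_simp
  have key : ∀ m n : ℤ, normSq (toComplex ⟨m, n⟩ + w) =
      (x + m) ^ 2 - (x + m) * (y + n) + (y + n) ^ 2 := by
    intro m n
    rw [hw, ← normSq_add_mul_cubeRoot]
    congr 1
    simp [toComplex, eval_apply]
    ring
  have fx := Int.fract_nonneg x
  have fx' := Int.fract_lt_one x
  have fy := Int.fract_nonneg y
  have fy' := Int.fract_lt_one y
  have ex : x = ⌊x⌋ + Int.fract x := (Int.floor_add_fract x).symm
  have ey : y = ⌊y⌋ + Int.fract y := (Int.floor_add_fract y).symm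
  set u := Int.fract x
  set v := Int.fract y
  have key' : ∀ a b : ℤ, ∃ t : 𝓔, normSq (toComplex t + w) =
      (u + a) ^ 2 - (u + a) * (v + b) + (v + b) ^ 2 := by
    intro a b
    refine ⟨⟨a - ⌊x⌋, b - ⌊y⌋⟩, ?_⟩
    rw [key]
    push_cast
    rw [ex, ey]
    simp only [Int.floor_intCast_add, Int.floor_eq_zero_iff.2 (show u ∈ Set.Ico (0 : ℝ) 1 from ⟨fx, fx'⟩),
      Int.floor_eq_zero_iff.2 (show v ∈ Set.Ico (0 : ℝ) 1 from ⟨fy, fy'⟩)]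
    push_cast
    ring
  obtain ⟨t1, h1⟩ := key' 0 0
  obtain ⟨t2, h2⟩ := key' (-1) (-1)
  obtain ⟨t3, h3⟩ := key' 0 (-1)
  obtain ⟨t4, h4⟩ := key' (-1) 0
  push_cast at h1 h2 h3 h4
  by_contra hne
  push Not at hne
  have k1 := hne t1
  have k2 := hne t2
  have k3 := hne t3
  have k4 := hne t4
  rw [h1] at k1
  rw [h2] at k2
  rw [h3] at k3
  rw [h4] at k4
  clear h1 h2 h3 h4 key key'
  rcases le_total v u with h | h
  · nlinarith [mul_nonneg (sub_nonneg.2 h) fy, mul_nonneg (sub_nonneg.2 h) (sub_nonneg.2 fx'.le),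
      mul_nonneg fy (sub_nonneg.2 fx'.le)]
  · nlinarith [mul_nonneg (sub_nonneg.2 h) fx, mul_nonneg (sub_nonneg.2 h) (sub_nonneg.2 fy'.le),
      mul_nonneg fx (sub_nonneg.2 fy'.le)]

end EisensteinInt

open EisensteinInt

variable {ι : Type} [Fintype ι]

/-- The value of a Hermitian form at a vector. -/
noncomputable def hermVal (H : Matrix ι ι ℂ) (v : ι → ℂ) : ℝ := (star v ⬝ᵥ H *ᵥ v).re

theorem hermVal_mulVec (H U : Matrix ι ι ℂ) (v : ι → ℂ) : hermVal H (U *ᵥ v) = hermVal (Uᴴ * H * U) v := by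
  rw [hermVal, hermVal, Matrix.star_mulVec, ← mulVec_mulVec, ← mulVec_mulVec,
    dotProduct_mulVec (star v) Uᴴ]

variable [DecidableEq ι]

theorem normSq_det_toComplex (U : GL ι 𝓔) : normSq ((U : Matrix ι ι 𝓔).map toComplex).det = 1 := by
  have h := RingHom.map_det toComplex (U : Matrix ι ι 𝓔)
  rw [RingHom.mapMatrix_apply] at h
  rw [← h, normSq_toComplex]
  have hu : IsUnit (U : Matrix ι ι 𝓔).det := (det U).isUnit
  rw [EisensteinInt.isUnit_iff] at hu
  rw [hu]; norm_num

theorem det_conj_toComplex (H : Matrix ι ι ℂ) (U : GL ι 𝓔) :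
    (((U : Matrix ι ι 𝓔).map toComplex)ᴴ * H * (U : Matrix ι ι 𝓔).map toComplex).det = H.det := by
  rw [det_mul, det_mul, Matrix.det_conjTranspose, mul_right_comm]
  have := normSq_det_toComplex U
  have h2 : star ((U : Matrix ι ι 𝓔).map toComplex).det * ((U : Matrix ι ι 𝓔).map toComplex).det = 1 := by
    refine Complex.normSq_eq_conj_mul_self.symm.trans ?_
    rw [this]; simp
  rw [h2, one_mul]

/-- The reduction statement: some unimodular transformation makes a diagonal entry small. -/
def HermiteBound (ι : Type) [Fintype ι] [DecidableEq ι] (i : ι) (n : ℕ) (C : ℝ) : Prop :=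
  ∀ H : Matrix ι ι ℂ, H.PosDef → ∃ U : GL ι 𝓔,
    hermVal H (fun j => toComplex (U j i)) ^ n ≤ C * H.det.re

theorem hermiteBound_unit : HermiteBound Unit () 1 1 := by
  intro H hH
  refine ⟨1, ?_⟩
  simp [hermVal, dotProduct, Matrix.mulVec]

theorem HermiteBound.succ {i : ι} {n : ℕ} {C : ℝ} (hC : 0 < C) (h : HermiteBound ι i n C) :
    HermiteBound (Unit ⊕ ι) (Sum.inl ()) (n + 1) ((17 / 11) ^ n * C) := by
  intro H hH
  by_contra hne
  push Not at hne
  have hdet : 0 < H.det.re := (Complex.lt_def.1 hH.det_pos).1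
  have hpos : ∀ (K : Matrix (Unit ⊕ ι) (Unit ⊕ ι) ℂ), K.PosDef → ∀ v, 0 ≤ hermVal K v := fun K hK v =>
    (Complex.le_def.1 (hK.posSemidef.dotProduct_mulVec_nonneg v)).1
  set q : GL (Unit ⊕ ι) 𝓔 → ℝ := fun U => hermVal H fun j => toComplex (U j (Sum.inl ())) with hq
  set C' := (17 / 11) ^ n * C with hC'
  have hC'pos : 0 < C' * H.det.re := by positivity
  have hlow : ∀ U, min 1 (C' * H.det.re) ≤ q U := by
    intro U
    by_contra hlt
    push Not at hlt
    have h0 : 0 ≤ q U := hpos H hH _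
    have h1 : q U < 1 := hlt.trans_le (min_le_left _ _)
    have h2 : q U ^ (n + 1) ≤ q U := pow_le_of_le_one h0 h1.le (by omega)
    exact absurd (hne U) (not_lt.2 (h2.trans (hlt.le.trans (min_le_right _ _))))
  have hbdd : BddBelow (Set.range q) := ⟨_, by rintro _ ⟨U, rfl⟩; exact hlow U⟩
  have hm : 0 < ⨅ U, q U := lt_of_lt_of_le (lt_min one_pos hC'pos) (le_ciInf hlow)
  obtain ⟨U, hU⟩ : ∃ U, q U < 51 / 50 * ⨅ U, q U := exists_lt_of_ciInf_lt (by linarith)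
  set Û : Matrix (Unit ⊕ ι) (Unit ⊕ ι) ℂ := (U : Matrix (Unit ⊕ ι) (Unit ⊕ ι) 𝓔).map toComplex with hÛ
  set H₁ := Ûᴴ * H * Û with hH₁def
  have hUinj : Injective Û.mulVec := by
    apply Matrix.mulVec_injective_of_isUnit
    rw [Matrix.isUnit_iff_isUnit_det, isUnit_iff_ne_zero]
    intro h0
    have := normSq_det_toComplex U
    rw [← hÛ, h0] at this
    simp at this
  have hH₁ : H₁.PosDef := hH.conjTranspose_mul_mul_same hUinj
  have hdet₁ : H₁.det = H.det := det_conj_toComplex H U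
  have hcol : ∀ V : GL (Unit ⊕ ι) 𝓔, q (U * V) = hermVal H₁ fun j => toComplex (V j (Sum.inl ())) := by
    intro V
    rw [hH₁def, ← hermVal_mulVec]
    simp only [hq]
    congr 1
    funext j
    simp [mul_apply, Matrix.mulVec, dotProduct, hÛ]
  set A := H₁.toBlocks₁₁ with hA
  set B := H₁.toBlocks₁₂ with hB
  set D := H₁.toBlocks₂₂ with hD
  have hblock : H₁ = Matrix.fromBlocks A B Bᴴ D := by
    have h1 : Bᴴ = H₁.toBlocks₂₁ := by
      ext a b
      have := congrFun (congrFun hH₁.1 (Sum.inr a)) (Sum.inl b)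
      exact this
    rw [h1, hA, hB, hD, Matrix.fromBlocks_toBlocks]
  have hAherm : A.IsHermitian := by
    ext a b
    exact congrFun (congrFun hH₁.1 (Sum.inl a)) (Sum.inl b)
  set μ := q U with hμ
  have hμA : A = of fun _ _ => (μ : ℂ) := by
    have h1 := hcol 1
    rw [mul_one] at h1
    have h2 : (fun j => toComplex ((1 : GL (Unit ⊕ ι) 𝓔) j (Sum.inl ()))) = Pi.single (Sum.inl ()) 1 := by
      funext j
      rcases j with ⟨⟩ | j <;> simp
    rw [h2] at h1
    ext ⟨⟩ ⟨⟩
    have h3 : A () () = H₁ (Sum.inl ()) (Sum.inl ()) := rfl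
    have h4 : ((A () ()).re : ℂ) = A () () := by
      have := congrFun (congrFun hAherm ()) ()
      rw [Matrix.conjTranspose_apply] at this
      exact Complex.conj_eq_iff_re.1 this
    rw [of_apply, ← h4]
    congr 1
    refine Eq.trans ?_ h1.symm
    rw [h3, hermVal]
    simp
  have hμpos : 0 < μ := lt_of_lt_of_le (lt_min one_pos hC'pos) (hlow U)
  have hAdet : A.det = (μ : ℂ) := by rw [Matrix.det_unique, hμA]; rfl
  have hAunit : IsUnit A.det := by rw [hAdet]; simpa using hμpos.ne'
  let _ : Invertible A := A.invertibleOfIsUnitDet hAunit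
  set S := D - Bᴴ * A⁻¹ * B with hS
  have hschur : ∀ (x : Unit → ℂ) (y : ι → ℂ), hermVal H₁ (Sum.elim x y) =
      μ * normSq (x () + ((A⁻¹ * B) *ᵥ y) ()) + (star y ⬝ᵥ S *ᵥ y).re := by
    intro x y
    have := Matrix.schur_complement_eq₁₁ B D x y hAherm
    rw [← hblock, ← dotProduct_mulVec, ← dotProduct_mulVec,
      ← dotProduct_mulVec] at this
    rw [hermVal, this, Complex.add_re]
    congr 1
    have hAv : ∀ v : Unit → ℂ, (star v ⬝ᵥ A *ᵥ v).re = μ * normSq (v ()) := by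
      intro v
      rw [hμA]
      simp [dotProduct, Matrix.mulVec, Complex.normSq_apply]
      ring
    rw [hAv]
    rfl
  have hSherm : S.IsHermitian := by
    have := (Matrix.IsHermitian.fromBlocks₁₁ B D hAherm).1 (hblock ▸ hH₁.1)
    exact this
  have hSpos : S.PosDef := by
    refine Matrix.PosDef.of_dotProduct_mulVec_pos hSherm fun y hy => ?_
    have h1 := hschur (-((A⁻¹ * B) *ᵥ y)) y
    simp only [Pi.neg_apply, neg_add_cancel, map_zero, mul_zero, zero_add] at h1
    have h2 : Sum.elim (-((A⁻¹ * B) *ᵥ y)) y ≠ 0 := by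
      intro h0
      apply hy
      funext j
      exact congrFun h0 (Sum.inr j)
    have h3 := (Complex.lt_def.1 (hH₁.dotProduct_mulVec_pos h2)).1
    have h4 : (star y ⬝ᵥ S *ᵥ y).im = 0 := hSherm.im_star_dotProduct_mulVec_self y
    rw [Complex.lt_def]
    refine ⟨?_, h4.symm⟩
    rw [← h1]
    exact h3
  have hSdet : H.det.re = μ * S.det.re := by
    rw [← hdet₁, hblock, Matrix.det_fromBlocks₁₁, Matrix.invOf_eq_nonsing_inv, hAdet]
    simp [hS]
  obtain ⟨U', hU'⟩ := h S hSpos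
  set y : ι → ℂ := fun j => toComplex (U' j i) with hy
  obtain ⟨t, ht⟩ := exists_normSq_add_le (((A⁻¹ * B) *ᵥ y) ())
  let M₀ : Matrix (Unit ⊕ ι) (Unit ⊕ ι) 𝓔 :=
    Matrix.fromBlocks 1 (of fun _ j => if j = i then t else 0) 0 (U' : Matrix ι ι 𝓔)
  let M := M₀.submatrix id (Equiv.swap (Sum.inl ()) (Sum.inr i))
  have hM : IsUnit M.det := by
    simp only [M, Matrix.det_permute', M₀, Matrix.det_fromBlocks_zero₂₁, Matrix.det_one, one_mul]
    refine IsUnit.mul ?_ (det U').isUnit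
    exact (Units.isUnit (Equiv.Perm.sign (Equiv.swap (Sum.inl ()) (Sum.inr i)))).map (Int.castRingHom 𝓔)
  let V : GL (Unit ⊕ ι) 𝓔 := GeneralLinearGroup.mk'' M hM
  have hV : (fun j => toComplex (V j (Sum.inl ()))) = Sum.elim (fun _ => toComplex t) y := by
    funext j
    change toComplex (M₀ j (Equiv.swap (Sum.inl ()) (Sum.inr i) (Sum.inl ()))) = _
    rw [Equiv.swap_apply_left]
    rcases j with ⟨⟩ | j
    · simp [M₀]
    · simp [M₀, hy]
  have h1 : (⨅ U, q U) ≤ q (U * V) := ciInf_le hbdd _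
  rw [hcol, hV, hschur] at h1
  have h2 : (star y ⬝ᵥ S *ᵥ y).re = hermVal S y := rfl
  rw [h2] at h1
  set s := hermVal S y
  have h3 : μ * normSq (toComplex t + ((A⁻¹ * B) *ᵥ y) ()) ≤ μ * (1 / 3) := by gcongr
  have h4 : μ ≤ 17 / 11 * s := by linarith
  have h5 : μ ^ (n + 1) ≤ C' * H.det.re := by
    calc μ ^ (n + 1) = μ ^ n * μ := pow_succ _ _
      _ ≤ (17 / 11 * s) ^ n * μ := by gcongr
      _ = (17 / 11) ^ n * s ^ n * μ := by rw [mul_pow]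
      _ ≤ (17 / 11) ^ n * (C * S.det.re) * μ := by gcongr
      _ = C' * H.det.re := by rw [hSdet, hC']; ring
  exact absurd (hne U) (not_lt.2 h5)

end HermiteReduction

open EisensteinInt (toComplex)

open scoped ComplexOrder

/-- A nondegenerate symmetric complex matrix is of the form `PᵀP`. -/
theorem Matrix.IsSymm.exists_transpose_mul_self {ι : Type*} [Fintype ι] [DecidableEq ι]
    {B : Matrix ι ι ℂ} (hB : B.IsSymm) (hdet : B.det ≠ 0) : ∃ P : Matrix ι ι ℂ, Pᵀ * P = B := by
  have key : ∀ M : Matrix ι ι ℂ, M.IsSymm →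
      QuadraticMap.associated (M.toQuadraticForm') = Matrix.toLinearMap₂' ℂ M := by
    intro M hM
    rw [Matrix.toQuadraticForm']
    refine QuadraticMap.associated_left_inverse (S := ℂ) (fun x y => ?_)
    rw [Matrix.toLinearMap₂'_apply', Matrix.toLinearMap₂'_apply', dotProduct_comm, dotProduct_mulVec,
      ← Matrix.mulVec_transpose, hM.eq, dotProduct_comm, dotProduct_comm]
  have h1 : (1 : Matrix ι ι ℂ).IsSymm := Matrix.isSymm_one
  obtain ⟨e⟩ := QuadraticForm.equivalent_of_isAlgClosed B.toQuadraticForm'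
    (1 : Matrix ι ι ℂ).toQuadraticForm'
    (by rw [key B hB]; exact LinearMap.separatingLeft_toLinearMap₂'_of_det_ne_zero' hdet)
    (by rw [key 1 h1]; exact LinearMap.separatingLeft_toLinearMap₂'_of_det_ne_zero' (by simp))
  have hc : (1 : Matrix ι ι ℂ).toQuadraticForm'.comp e.toLinearEquiv.toLinearMap =
      B.toQuadraticForm' := by
    ext x
    exact e.map_app x
  have h2 := congrArg QuadraticForm.toMatrix' hc
  rw [QuadraticForm.toMatrix'_comp, QuadraticForm.toMatrix', QuadraticForm.toMatrix', key B hB,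
    key 1 h1, LinearMap.toMatrix'_toLinearMap₂', LinearMap.toMatrix'_toLinearMap₂', mul_one] at h2
  exact ⟨_, h2⟩

/-- Hermite's bound for symmetric bilinear forms over the Eisenstein integers. -/
theorem HermiteBound.exists_norm_pow_le {ι : Type} [Fintype ι] [DecidableEq ι] {i : ι} {n : ℕ} {C : ℝ}
    (h : HermiteBound ι i n C) {B : Matrix ι ι 𝓔} (hB : B.IsSymm) (hdet : IsUnit B.det) :
    ∃ U : GL ι 𝓔, (((fun j => U j i) ⬝ᵥ B *ᵥ (fun j => U j i)).norm : ℝ) ^ n ≤ C ^ 2 := by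
  set Bc := B.map toComplex with hBc
  have hns : normSq Bc.det = 1 := by
    rw [hBc, ← RingHom.mapMatrix_apply, ← RingHom.map_det, EisensteinInt.normSq_toComplex,
      EisensteinInt.isUnit_iff.1 hdet]
    simp
  have hdet0 : Bc.det ≠ 0 := by intro h0; rw [h0] at hns; simp at hns
  obtain ⟨P, hP⟩ := Matrix.IsSymm.exists_transpose_mul_self (B := Bc) (hB.map _) hdet0
  have hPdet : P.det * P.det = Bc.det := by rw [← hP, det_mul, Matrix.det_transpose]
  have hPns : normSq P.det = 1 := by
    have h1 : normSq P.det * normSq P.det = 1 := by rw [← map_mul, hPdet, hns]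
    nlinarith [Complex.normSq_nonneg P.det]
  have hP0 : P.det ≠ 0 := by intro h0; rw [h0] at hPns; simp at hPns
  have hH : (Pᴴ * P).PosDef := by
    refine Matrix.PosDef.conjTranspose_mul_self _ (Matrix.mulVec_injective_of_isUnit ?_)
    rw [Matrix.isUnit_iff_isUnit_det]
    exact isUnit_iff_ne_zero.2 hP0
  have hHdet : (Pᴴ * P).det.re = 1 := by
    rw [det_mul, Matrix.det_conjTranspose]
    have : star P.det * P.det = (normSq P.det : ℂ) := Complex.normSq_eq_conj_mul_self.symm
    rw [this, hPns]; simp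
  obtain ⟨U, hU⟩ := h _ hH
  refine ⟨U, ?_⟩
  rw [hHdet, mul_one] at hU
  set v : ι → ℂ := fun j => toComplex (U j i) with hv
  have h1 : toComplex ((fun j => U j i) ⬝ᵥ B *ᵥ (fun j => U j i)) = v ⬝ᵥ Bc *ᵥ v := by
    simp [dotProduct, Matrix.mulVec, hv, hBc]
  have h2 : v ⬝ᵥ Bc *ᵥ v = ∑ j, (P *ᵥ v) j * (P *ᵥ v) j := by
    rw [← hP, ← mulVec_mulVec, dotProduct_mulVec, Matrix.vecMul_transpose]
    rfl
  have h3 : hermVal (Pᴴ * P) v = ∑ j, ‖(P *ᵥ v) j‖ ^ 2 := by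
    rw [hermVal, ← mulVec_mulVec, dotProduct_mulVec, ← Matrix.star_mulVec]
    simp only [dotProduct, Pi.star_apply, Complex.re_sum]
    refine Finset.sum_congr rfl fun j _ => ?_
    have : star ((P *ᵥ v) j) * (P *ᵥ v) j = (normSq ((P *ᵥ v) j) : ℂ) :=
      Complex.normSq_eq_conj_mul_self.symm
    rw [this, Complex.ofReal_re, Complex.normSq_eq_norm_sq]
  have h4 : ‖v ⬝ᵥ Bc *ᵥ v‖ ≤ hermVal (Pᴴ * P) v := by
    rw [h2, h3]
    refine (norm_sum_le _ _).trans (le_of_eq ?_)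
    refine Finset.sum_congr rfl fun j _ => ?_
    rw [norm_mul, sq]
  rw [← EisensteinInt.normSq_toComplex, h1, Complex.normSq_eq_norm_sq, ← pow_mul, mul_comm 2 n, pow_mul]
  refine pow_le_pow_left₀ (by positivity) ?_ 2
  exact (pow_le_pow_left₀ (norm_nonneg _) h4 n).trans hU

/-- A type with four elements on which Hermite's bound is available. -/
abbrev HermiteIndex : Type := Unit ⊕ (Unit ⊕ (Unit ⊕ Unit))

theorem exists_norm_lt_four {B : Matrix HermiteIndex HermiteIndex 𝓔} (hB : B.IsSymm) (hdet : IsUnit B.det) :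
    ∃ (U : GL HermiteIndex 𝓔) (i : HermiteIndex), ((fun j => U j i) ⬝ᵥ B *ᵥ (fun j => U j i)).norm < 4 := by
  have h := ((hermiteBound_unit.succ (by norm_num)).succ (by norm_num)).succ (by norm_num)
  obtain ⟨U, hU⟩ := h.exists_norm_pow_le hB hdet
  refine ⟨U, Sum.inl (), ?_⟩
  by_contra hge
  push Not at hge
  have h4 : (4 : ℝ) ≤ (((fun j => U j (Sum.inl ())) ⬝ᵥ B *ᵥ (fun j => U j (Sum.inl ()))).norm : ℝ) := by
    exact_mod_cast hge
  have h5 := (pow_le_pow_left₀ (by norm_num) h4 (1 + 1 + 1 + 1)).trans hU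
  norm_num at h5

section QuaternionOrders

local notation "κ" => HermiteIndex

variable {W : Type*} [CommRing W]

local notation "M₂" => Mat₂ W

/-- The coordinates of a `2 × 2` matrix. -/
def coordsLin : M₂ →ₗ[W] κ → W where
  toFun M := Sum.elim (fun _ => M 0 0) (Sum.elim (fun _ => M 0 1) (Sum.elim (fun _ => M 1 0) fun _ => M 1 1))
  map_add' M N := by ext (_ | _ | _ | _) <;> rfl
  map_smul' a M := by ext (_ | _ | _ | _) <;> rfl

/-- The coordinates of a `2 × 2` matrix, dual with respect to the polar form of the determinant. -/
def dualCoordsLin : M₂ →ₗ[W] κ → W where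
  toFun M := Sum.elim (fun _ => M 1 1) (Sum.elim (fun _ => -M 1 0) (Sum.elim (fun _ => -M 0 1) fun _ => M 0 0))
  map_add' M N := by ext (_ | _ | _ | _) <;> simp [add_comm]
  map_smul' a M := by ext (_ | _ | _ | _) <;> simp

theorem trace_mul_adjugate_eq (x y : M₂) : (x * y.adjugate).trace = coordsLin x ⬝ᵥ dualCoordsLin y := by
  simp [coordsLin, dualCoordsLin, dotProduct, adjugate_fin_two, trace_fin_two, mul_apply,
    Fin.sum_univ_two]
  ring

theorem trace_mul_adjugate_comm (x y : M₂) : (x * y.adjugate).trace = (y * x.adjugate).trace := by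
  simp [adjugate_fin_two, trace_fin_two, mul_apply, Fin.sum_univ_two]
  ring

theorem trace_mul_adjugate_self (x : M₂) : (x * x.adjugate).trace = 2 * x.det := by
  rw [Matrix.mul_adjugate]; simp [mul_comm]

theorem adjugate_eq_trace_smul_sub (x : M₂) : x.adjugate = x.trace • 1 - x := by
  ext i j; fin_cases i <;> fin_cases j <;> simp [adjugate_fin_two, trace_fin_two]

theorem coordsLin_injective : Injective (coordsLin : M₂ → κ → W) := by
  intro x y h
  have h0 := congrFun h (Sum.inl ())
  have h1 := congrFun h (Sum.inr (Sum.inl ()))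
  have h2 := congrFun h (Sum.inr (Sum.inr (Sum.inl ())))
  have h3 := congrFun h (Sum.inr (Sum.inr (Sum.inr ())))
  simp only [coordsLin, LinearMap.coe_mk, AddHom.coe_mk, Sum.elim_inl, Sum.elim_inr] at h0 h1 h2 h3
  ext i j; fin_cases i <;> fin_cases j <;> assumption

theorem gram_eq (y : κ → M₂) : (of fun i j => (y i * (y j).adjugate).trace) =
    of (fun k => coordsLin (y k)) * (of fun k => dualCoordsLin (y k))ᵀ := by
  ext i j
  rw [of_apply, trace_mul_adjugate_eq]
  rfl

theorem mul_det_update_sub {V : Type*} [AddCommGroup V] [Module W V] (f : V →ₗ[W] κ → W) (y : κ → V) (i : κ)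
    {z : V} {δ : W} {c : κ → W} (hz : δ • z = ∑ j, c j • y j) (n : W) :
    δ * (of fun k => f (Function.update y i (z - n • y i) k)).det = (c i - n * δ) * (of fun k => f (y k)).det := by
  have h1 : (of fun k => f (Function.update y i (z - n • y i) k)) =
      (of fun k => f (y k)).updateRow i (f (z - n • y i)) := by
    ext k l
    by_cases hk : k = i
    · subst hk; simp
    · simp [hk]
  rw [h1, ← Matrix.det_updateRow_smul]
  have h2 : δ • f (z - n • y i) = ∑ k, (c k - if k = i then n * δ else 0) • (of fun k => f (y k)) k := by
    rw [← map_smul, smul_sub, hz, map_sub, map_sum]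
    simp only [sub_smul, Finset.sum_sub_distrib, map_smul, ite_smul, zero_smul, Finset.sum_ite_eq', Finset.mem_univ,
      if_true, smul_smul]
    rw [mul_comm δ n]
    rfl
  rw [h2, Matrix.det_updateRow_sum]
  simp

/-- An order in `M₂(W)` over the Eisenstein integers. -/
structure IsEisensteinOrder (ι : 𝓔 →+* W) (D : Subring M₂) : Prop where
  smul_mem : ∀ (a : 𝓔) {M : M₂}, M ∈ D → ι a • M ∈ D
  trace_mem : ∀ {M : M₂}, M ∈ D → M.trace ∈ ι.range
  det_mem : ∀ {M : M₂}, M ∈ D → M.det ∈ ι.range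

namespace IsEisensteinOrder

variable {ι : 𝓔 →+* W} {D : Subring (Mat₂ W)}

theorem adjugate_mem (hD : IsEisensteinOrder ι D) {M : M₂} (hM : M ∈ D) : M.adjugate ∈ D := by
  obtain ⟨t, ht⟩ := hD.trace_mem hM
  rw [adjugate_eq_trace_smul_sub, ← ht]
  exact D.sub_mem (hD.smul_mem t D.one_mem) hM

theorem polar_mem (hD : IsEisensteinOrder ι D) {x y : M₂} (hx : x ∈ D) (hy : y ∈ D) :
    (x * y.adjugate).trace ∈ ι.range :=
  hD.trace_mem (D.mul_mem hx (hD.adjugate_mem hy))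

theorem sum_mem (hD : IsEisensteinOrder ι D) {y : κ → M₂} (hy : ∀ k, y k ∈ D) (c : κ → 𝓔) : ∑ k, ι (c k) • y k ∈ D :=
  D.sum_mem fun k _ => hD.smul_mem _ (hy k)

theorem exists_gram (hD : IsEisensteinOrder ι D) {y : κ → M₂} (hy : ∀ k, y k ∈ D) :
    ∃ G : Matrix κ κ 𝓔, G.map ι = of fun i j => (y i * (y j).adjugate).trace := by
  choose β hβ using fun i j => hD.polar_mem (hy i) (hy j)
  exact ⟨of β, by ext i j; exact hβ i j⟩

theorem map_det_gram {y : κ → M₂} {G : Matrix κ κ 𝓔} (hG : G.map ι = of fun i j => (y i * (y j).adjugate).trace) :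
    ι G.det = (of fun k => coordsLin (y k)).det * (of fun k => dualCoordsLin (y k)).det := by
  rw [RingHom.map_det, RingHom.mapMatrix_apply, hG, gram_eq, det_mul, Matrix.det_transpose]

theorem isSymm_gram (hι : Injective ι) {y : κ → M₂} {G : Matrix κ κ 𝓔}
    (hG : G.map ι = of fun i j => (y i * (y j).adjugate).trace) : G.IsSymm := by
  refine Matrix.ext fun i j => ?_
  apply hι
  have h1 := congrFun (congrFun hG i) j
  have h2 := congrFun (congrFun hG j) i
  simp only [Matrix.map_apply, of_apply] at h1 h2
  rw [Matrix.transpose_apply, h1, h2, trace_mul_adjugate_comm]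

theorem trace_sum_mul_adjugate (y : κ → M₂) (c : κ → W) (z : M₂) :
    ((∑ k, c k • y k) * z.adjugate).trace = ∑ k, c k * (y k * z.adjugate).trace := by
  simp only [Finset.sum_mul, Matrix.trace_sum, trace_smul, Matrix.smul_mul, smul_eq_mul]

theorem trace_mul_adjugate_sum (y : κ → M₂) (c : κ → W) (z : M₂) :
    (z * (∑ k, c k • y k).adjugate).trace = ∑ k, c k * (z * (y k).adjugate).trace := by
  rw [trace_mul_adjugate_comm, trace_sum_mul_adjugate]
  simp_rw [trace_mul_adjugate_comm z]

theorem eq_zero_of_orthogonal [IsDomain W] {y : κ → M₂} (hy : (of fun k => dualCoordsLin (y k)).det ≠ 0) {w : M₂}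
    (hw : ∀ k, (w * (y k).adjugate).trace = 0) : w = 0 := by
  apply coordsLin_injective
  rw [map_zero]
  refine Matrix.eq_zero_of_mulVec_eq_zero hy ?_
  ext k
  rw [Pi.zero_apply, ← hw k, trace_mul_adjugate_eq]
  exact dotProduct_comm _ _

theorem exists_smul_eq_sum [IsDomain W] (hD : IsEisensteinOrder ι D) {y : κ → M₂} (hy : ∀ k, y k ∈ D)
    {G : Matrix κ κ 𝓔} (hG : G.map ι = of fun i j => (y i * (y j).adjugate).trace)
    (hdet : ι G.det ≠ 0) {z : M₂} (hz : z ∈ D) : ∃ c : κ → 𝓔, ι G.det • z = ∑ k, ι (c k) • y k := by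
  choose b hb using fun k => hD.polar_mem hz (hy k)
  refine ⟨b ᵥ* G.adjugate, ?_⟩
  rw [map_det_gram hG] at hdet
  rw [← sub_eq_zero]
  refine eq_zero_of_orthogonal (right_ne_zero_of_mul hdet) fun k => ?_
  rw [sub_mul, Matrix.trace_sub, trace_sum_mul_adjugate, Matrix.smul_mul, trace_smul, ← hb k, sub_eq_zero]
  have h1 : (b ᵥ* G.adjugate) ᵥ* G = G.det • b := by
    rw [Matrix.vecMul_vecMul, Matrix.adjugate_mul, Matrix.vecMul_smul, Matrix.vecMul_one]
  have h2 := congrArg ι (congrFun h1 k)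
  simp only [Pi.smul_apply, smul_eq_mul, map_mul] at h2
  rw [smul_eq_mul, ← h2, Matrix.vecMul, dotProduct, map_sum]
  refine Finset.sum_congr rfl fun j _ => ?_
  rw [map_mul]
  congr 1
  exact congrFun (congrFun hG j) k

theorem exists_eq_sum_of_minimal [IsDomain W] (hι : Injective ι) (hD : IsEisensteinOrder ι D)
    {y : κ → M₂} (hy : ∀ k, y k ∈ D) {G : Matrix κ κ 𝓔} (hG : G.map ι = of fun i j => (y i * (y j).adjugate).trace)
    (hdet : G.det ≠ 0) (hmin : ∀ y' : κ → M₂, (∀ k, y' k ∈ D) → ∀ G' : Matrix κ κ 𝓔,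
      G'.map ι = (of fun i j => (y' i * (y' j).adjugate).trace) → G'.det ≠ 0 → G.det.norm ≤ G'.det.norm)
    {z : M₂} (hz : z ∈ D) : ∃ c : κ → 𝓔, z = ∑ k, ι (c k) • y k := by
  have hdet' : ι G.det ≠ 0 := (map_ne_zero_iff ι hι).2 hdet
  obtain ⟨c, hc⟩ := hD.exists_smul_eq_sum hy hG hdet' hz
  have key : ∀ i, ∃ n, c i = n * G.det := by
    intro i
    obtain ⟨n, hn⟩ := EisensteinInt.exists_norm_sub_mul_lt (c i) G.det hdet
    refine ⟨n, ?_⟩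
    by_contra hne
    have hne' : c i - n * G.det ≠ 0 := sub_ne_zero.2 hne
    set y' := Function.update y i (z - ι n • y i) with hy'
    have hy'D : ∀ k, y' k ∈ D := by
      intro k
      by_cases hk : k = i
      · subst hk
        rw [hy', Function.update_self]
        exact D.sub_mem hz (hD.smul_mem _ (hy k))
      · rw [hy', Function.update_of_ne hk]; exact hy k
    obtain ⟨G', hG'⟩ := hD.exists_gram hy'D
    have h1 := mul_det_update_sub coordsLin y i hc (ι n)
    have h2 := mul_det_update_sub dualCoordsLin y i hc (ι n)
    have h3 : G.det * G'.det = (c i - n * G.det) ^ 2 := by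
      apply mul_left_cancel₀ hdet
      apply hι
      simp only [map_mul, map_pow, map_sub]
      have e1 := map_det_gram hG
      have e2 := map_det_gram hG'
      calc ι G.det * (ι G.det * ι G'.det) = (ι G.det * (of fun k => coordsLin (y' k)).det) *
            (ι G.det * (of fun k => dualCoordsLin (y' k)).det) := by rw [e2]; ring
        _ = _ := by rw [h1, h2]; linear_combination -(ι (c i) - ι n * ι G.det) ^ 2 * e1
    have h4 : G'.det ≠ 0 := by
      rintro h0
      rw [h0, mul_zero] at h3
      exact hne' (pow_eq_zero_iff (two_ne_zero)|>.1 h3.symm)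
    have h5 := hmin y' hy'D G' hG' h4
    have h6 : G.det.norm * G'.det.norm = (c i - n * G.det).norm ^ 2 := by rw [← map_mul, h3, map_pow]
    have h7 := EisensteinInt.norm_pos hne'
    nlinarith
  choose n hn using key
  refine ⟨n, ?_⟩
  apply smul_right_injective _ hdet'
  simp only
  rw [hc, Finset.smul_sum]
  refine Finset.sum_congr rfl fun k _ => ?_
  rw [hn k, map_mul, smul_smul, mul_comm]

/-- The trace form of the order has a basis with unit Gram determinant. -/
theorem exists_basis [IsDomain W] (hι : Injective ι) (hD : IsEisensteinOrder ι D)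
    (hprime : ∀ p : ℕ, p.Prime → ∃ y : κ → M₂, (∀ k, y k ∈ D) ∧ ∃ G : Matrix κ κ 𝓔,
      G.map ι = (of fun i j => (y i * (y j).adjugate).trace) ∧ ¬ (p : ℤ) ∣ G.det.norm) :
    ∃ y : κ → M₂, (∀ k, y k ∈ D) ∧ ∃ G : Matrix κ κ 𝓔,
      G.map ι = (of fun i j => (y i * (y j).adjugate).trace) ∧ IsUnit G.det ∧
      ∀ z ∈ D, ∃ c : κ → 𝓔, z = ∑ k, ι (c k) • y k := by
  classical
  have hex : ∃ m : ℕ, ∃ y : κ → M₂, (∀ k, y k ∈ D) ∧ ∃ G : Matrix κ κ 𝓔,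
      G.map ι = (of fun i j => (y i * (y j).adjugate).trace) ∧ G.det ≠ 0 ∧
        G.det.norm = m := by
    obtain ⟨y, hy, G, hG, hp⟩ := hprime 2 Nat.prime_two
    refine ⟨G.det.norm.toNat, y, hy, G, hG, ?_, (Int.toNat_of_nonneg (EisensteinInt.norm_nonneg _)).symm⟩
    rintro h0
    rw [h0] at hp
    simp at hp
  obtain ⟨y, hy, G, hG, hdet, hm⟩ := Nat.find_spec hex
  have hspan : ∀ z ∈ D, ∃ c : κ → 𝓔, z = ∑ k, ι (c k) • y k := by
    intro z hz
    refine hD.exists_eq_sum_of_minimal hι hy hG hdet ?_ hz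
    intro y' hy' G' hG' hdet'
    have := Nat.find_min' hex ⟨y', hy', G', hG', hdet',
      (Int.toNat_of_nonneg (EisensteinInt.norm_nonneg _)).symm⟩
    rw [hm, ← Int.toNat_of_nonneg (EisensteinInt.norm_nonneg G'.det)]
    exact_mod_cast this
  refine ⟨y, hy, G, hG, ?_, hspan⟩
  rw [EisensteinInt.isUnit_iff]
  by_contra hne
  have h1 : G.det.norm.toNat ≠ 1 := by
    intro h
    apply hne
    rw [← Int.toNat_of_nonneg (EisensteinInt.norm_nonneg G.det), h]; rfl
  obtain ⟨p, hp, hpd⟩ := Nat.exists_prime_and_dvd h1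
  have hpd' : (p : ℤ) ∣ G.det.norm := by
    rw [← Int.toNat_of_nonneg (EisensteinInt.norm_nonneg G.det)]
    exact_mod_cast hpd
  obtain ⟨y', hy', G', hG', hnd⟩ := hprime p hp
  apply hnd
  choose c hc using fun k => hspan (y' k) (hy' k)
  have hN : G' = of c * G * (of c)ᵀ := by
    refine Matrix.ext fun i j => ?_
    apply hι
    have e1 := congrFun (congrFun hG' i) j
    simp only [Matrix.map_apply, of_apply] at e1
    rw [e1, hc i, hc j, trace_mul_adjugate_sum, mul_apply, map_sum]
    refine Finset.sum_congr rfl fun l _ => ?_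
    rw [trace_sum_mul_adjugate, map_mul, mul_apply, map_sum, mul_comm]
    congr 1
    refine Finset.sum_congr rfl fun m _ => ?_
    rw [map_mul]
    congr 1
    exact (congrFun (congrFun hG m) l).symm
  rw [hN, det_mul, det_mul, map_mul, map_mul]
  exact (hpd'.mul_left _).mul_right _

end IsEisensteinOrder

end QuaternionOrders

section OrderConjugacy

local notation "κ" => HermiteIndex

variable {W : Type*} [CommRing W]

local notation "M₂" => Mat₂ W

namespace IsEisensteinOrder

variable {ι : 𝓔 →+* W} {D : Subring (Mat₂ W)}

/-- Every integral functional on the order is represented by an element of the order. -/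
def IsPerfect (ι : 𝓔 →+* W) (D : Subring M₂) : Prop :=
  ∀ f : M₂ → 𝓔, (∀ y ∈ D, ∀ z ∈ D, f (y + z) = f y + f z) → (∀ a : 𝓔, ∀ y ∈ D, f (ι a • y) = a * f y) →
    ∃ y₀ ∈ D, ∀ y ∈ D, (y₀ * y.adjugate).trace = ι (f y)

theorem exists_trace_mul_adjugate_eq (hD : IsEisensteinOrder ι D) (hι : Injective ι) {y : κ → M₂}
    (hy : ∀ k, y k ∈ D) {G : Matrix κ κ 𝓔} (hG : G.map ι = of fun i j => (y i * (y j).adjugate).trace)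
    (hu : IsUnit G.det) (t : κ → 𝓔) : ∃ x ∈ D, ∀ k, (x * (y k).adjugate).trace = ι (t k) := by
  refine ⟨_, hD.sum_mem hy (G⁻¹ *ᵥ t), fun k => ?_⟩
  rw [trace_sum_mul_adjugate]
  have h1 : G *ᵥ (G⁻¹ *ᵥ t) = t := by rw [mulVec_mulVec, Matrix.mul_nonsing_inv _ hu, Matrix.one_mulVec]
  conv_rhs => rw [← h1, Matrix.mulVec, dotProduct, map_sum]
  refine Finset.sum_congr rfl fun j _ => ?_
  rw [map_mul, mul_comm]
  congr 1
  rw [← (isSymm_gram hι hG).apply]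
  exact (congrFun (congrFun hG j) k).symm

theorem isPerfect (hD : IsEisensteinOrder ι D) (hι : Injective ι) {y : κ → M₂}
    (hy : ∀ k, y k ∈ D) {G : Matrix κ κ 𝓔} (hG : G.map ι = of fun i j => (y i * (y j).adjugate).trace)
    (hu : IsUnit G.det) (hspan : ∀ z ∈ D, ∃ c : κ → 𝓔, z = ∑ k, ι (c k) • y k) : IsPerfect ι D := by
  intro f hadd hsmul
  obtain ⟨x, hx, hxt⟩ := hD.exists_trace_mul_adjugate_eq hι hy hG hu (fun k => f (y k))
  refine ⟨x, hx, fun z hz => ?_⟩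
  obtain ⟨c, rfl⟩ := hspan z hz
  have hf0 : f 0 = 0 := by simpa using hsmul 0 0 D.zero_mem
  have hsum : ∀ s : Finset κ, f (∑ k ∈ s, ι (c k) • y k) = ∑ k ∈ s, c k * f (y k) := by
    intro s
    induction s using Finset.cons_induction with
    | empty => simpa using hf0
    | cons a s ha ih =>
      rw [Finset.sum_cons, Finset.sum_cons, hadd _ (hD.smul_mem _ (hy a)) _
        (D.sum_mem fun k _ => hD.smul_mem _ (hy k)), hsmul _ _ (hy a), ih]
  rw [trace_mul_adjugate_sum, hsum, map_sum]
  refine Finset.sum_congr rfl fun k _ => ?_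
  rw [hxt, map_mul]

theorem exists_idempotent [IsDomain W] (hD : IsEisensteinOrder ι D) (hι : Injective ι) {y : κ → M₂}
    (hy : ∀ k, y k ∈ D) {G : Matrix κ κ 𝓔} (hG : G.map ι = of fun i j => (y i * (y j).adjugate).trace)
    (hu : IsUnit G.det) : ∃ e ∈ D, e.trace = 1 ∧ e.det = 0 := by
  obtain ⟨U, i, hU⟩ := exists_norm_lt_four (isSymm_gram hι hG) hu
  set z := ∑ k, ι (U k i) • y k with hz
  have hzD : z ∈ D := hD.sum_mem hy (fun k => U k i)
  obtain ⟨d, hd⟩ := hD.det_mem hzD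
  have h1 : ι ((fun j => U j i) ⬝ᵥ G *ᵥ (fun j => U j i)) = ι (2 * d) := by
    rw [map_mul, hd, map_ofNat, ← trace_mul_adjugate_self, hz, trace_sum_mul_adjugate, dotProduct, map_sum]
    refine Finset.sum_congr rfl fun k _ => ?_
    rw [map_mul, trace_mul_adjugate_sum, Matrix.mulVec, dotProduct, map_sum]
    congr 1
    refine Finset.sum_congr rfl fun l _ => ?_
    rw [map_mul, mul_comm]
    congr 1
    exact congrFun (congrFun hG k) l
  rw [hι h1, map_mul] at hU
  have h2 : (2 : 𝓔).norm = 4 := by rw [norm_apply]; rfl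
  rw [h2] at hU
  have h3 : d = 0 := by
    by_contra hne
    have := EisensteinInt.norm_pos hne
    omega
  rw [h3, map_zero] at hd
  obtain ⟨x, hx, hxt⟩ := hD.exists_trace_mul_adjugate_eq hι hy hG hu
    (fun k => ((U⁻¹ : GL κ 𝓔) : Matrix κ κ 𝓔) i k)
  refine ⟨x * z.adjugate, D.mul_mem hx (hD.adjugate_mem hzD), ?_, ?_⟩
  · rw [hz, trace_mul_adjugate_sum]
    have h4 : (((U⁻¹ : GL κ 𝓔) : Matrix κ κ 𝓔) * (U : Matrix κ κ 𝓔)) i i = 1 := by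
      rw [← Units.val_mul, inv_mul_cancel]; simp
    rw [mul_apply] at h4
    rw [← map_one ι, ← h4, map_sum]
    refine Finset.sum_congr rfl fun k _ => ?_
    rw [hxt, map_mul, mul_comm]
  · rw [det_mul, Matrix.det_adjugate, ← hd]; simp

/-- A rank one idempotent over a local ring is conjugate to a coordinate projection. -/
theorem exists_conj_idempotent [IsLocalRing W] {e : M₂} (h1 : e.trace = 1) (h0 : e.det = 0) :
    ∃ P : GL (Fin 2) W, e * (P : M₂) = (P : M₂) * !![1, 0; 0, 0] := by
  obtain ⟨a, b, c, d, rfl⟩ : ∃ a b c d, e = !![a, b; c, d] := ⟨_, _, _, _, Matrix.eta_fin_two e⟩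
  simp only [Matrix.trace_fin_two_of, det_fin_two_of] at h1 h0
  have hu : IsUnit a ∨ IsUnit d := IsLocalRing.isUnit_or_isUnit_of_isUnit_add (by rw [h1]; exact isUnit_one)
  rcases hu with hu | hu
  · refine ⟨GeneralLinearGroup.mk'' !![a, -b; c, a] ?_, ?_⟩
    · rw [det_fin_two_of]
      have : a * a - -b * c = a := by linear_combination a * h1 - h0
      rwa [this]
    · change !![a, b; c, d] * !![a, -b; c, a] = !![a, -b; c, a] * !![1, 0; 0, 0]
      ext i j; fin_cases i <;> fin_cases j <;> simp
      · linear_combination a * h1 - h0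
      · ring
      · linear_combination c * h1
      · linear_combination h0
  · refine ⟨GeneralLinearGroup.mk'' !![b, d; d, -c] ?_, ?_⟩
    · rw [det_fin_two_of]
      have : b * -c - d * d = -d := by linear_combination h0 - d * h1
      rw [this]; exact hu.neg
    · change !![a, b; c, d] * !![b, d; d, -c] = !![b, d; d, -c] * !![1, 0; 0, 0]
      ext i j; fin_cases i <;> fin_cases j <;> simp
      · linear_combination b * h1
      · linear_combination h0
      · linear_combination d * h1 - h0
      · ring

theorem exists_coord_ne_zero {y : κ → M₂} (hy : (of fun k => coordsLin (y k)).det ≠ 0) (l : κ) :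
    ∃ k, coordsLin (y k) l ≠ 0 := by
  by_contra h
  push Not at h
  exact hy (Matrix.det_eq_zero_of_column_eq_zero l h)

/-- An order containing the coordinate projections is diagonally conjugate to the standard one. -/
theorem exists_unit_of_projection_mem [IsDomain W] (hD : IsEisensteinOrder ι D) (hι : Injective ι)
    (hperf : IsPerfect ι D) {y : κ → M₂} (hy : ∀ k, y k ∈ D)
    (hdet : (of fun k => coordsLin (y k)).det ≠ 0) (hE : !![1, 0; 0, 0] ∈ D) : ∃ x : Wˣ, ∀ M : M₂, M ∈ D ↔ ∃ N : Mat₂ 𝓔,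
      M = !![ι (N 0 0), x * ι (N 0 1); (x⁻¹ : Wˣ) * ι (N 1 0), ι (N 1 1)] := by
  have hE' : !![0, 0; 0, 1] ∈ D := by
    have : (!![0, 0; 0, 1] : M₂) = 1 - !![1, 0; 0, 0] := by ext i j; fin_cases i <;> fin_cases j <;> simp
    rw [this]; exact D.sub_mem D.one_mem hE
  have m00 : ∀ M ∈ D, !![M 0 0, 0; 0, 0] ∈ D := fun M hM => by
    have := D.mul_mem (D.mul_mem hE hM) hE
    convert this using 1
    ext i j; fin_cases i <;> fin_cases j <;> simp [mul_apply, Matrix.vecMul, dotProduct, Fin.sum_univ_two]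
  have m01 : ∀ M ∈ D, !![0, M 0 1; 0, 0] ∈ D := fun M hM => by
    have := D.mul_mem (D.mul_mem hE hM) hE'
    convert this using 1
    ext i j; fin_cases i <;> fin_cases j <;> simp [mul_apply, Matrix.vecMul, dotProduct, Fin.sum_univ_two]
  have m10 : ∀ M ∈ D, !![0, 0; M 1 0, 0] ∈ D := fun M hM => by
    have := D.mul_mem (D.mul_mem hE' hM) hE
    convert this using 1
    ext i j; fin_cases i <;> fin_cases j <;> simp [mul_apply, Matrix.vecMul, dotProduct, Fin.sum_univ_two]
  have m11 : ∀ M ∈ D, !![0, 0; 0, M 1 1] ∈ D := fun M hM => by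
    have := D.mul_mem (D.mul_mem hE' hM) hE'
    convert this using 1
    ext i j; fin_cases i <;> fin_cases j <;> simp [mul_apply, Matrix.vecMul, dotProduct, Fin.sum_univ_two]
  have r00 : ∀ M ∈ D, M 0 0 ∈ ι.range := fun M hM => by
    simpa [trace_fin_two] using hD.trace_mem (m00 M hM)
  have r11 : ∀ M ∈ D, M 1 1 ∈ ι.range := fun M hM => by
    simpa [trace_fin_two] using hD.trace_mem (m11 M hM)
  have rmul : ∀ M ∈ D, ∀ N ∈ D, M 0 1 * N 1 0 ∈ ι.range := fun M hM N hN => by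
    simpa [trace_fin_two, mul_apply, Fin.sum_univ_two] using
      hD.trace_mem (D.mul_mem (m01 M hM) (m10 N hN))
  obtain ⟨k, hk⟩ := exists_coord_ne_zero hdet (Sum.inr (Sum.inl ()))
  obtain ⟨l, hl⟩ := exists_coord_ne_zero hdet (Sum.inr (Sum.inr (Sum.inl ())))
  change y k 0 1 ≠ 0 at hk
  change y l 1 0 ≠ 0 at hl
  set u := y k 0 1 with hu
  let J : Ideal 𝓔 :=
    { carrier := {j | ∃ M ∈ D, ι j = u * M 1 0}
      add_mem' := by
        rintro _ _ ⟨M, hM, h⟩ ⟨N, hN, h'⟩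
        exact ⟨M + N, D.add_mem hM hN, by rw [map_add, h, h', Matrix.add_apply, mul_add]⟩
      zero_mem' := ⟨0, D.zero_mem, by simp⟩
      smul_mem' := by
        rintro a _ ⟨M, hM, h⟩
        exact ⟨ι a • M, hD.smul_mem a hM, by rw [smul_eq_mul, map_mul, h, Matrix.smul_apply, smul_eq_mul]; ring⟩ }
  obtain ⟨j, hj⟩ := IsPrincipalIdealRing.principal J
  obtain ⟨M₀, hM₀, hjM⟩ : j ∈ J := by rw [hj]; exact Submodule.mem_span_singleton_self j
  set w := M₀ 1 0 with hw
  have hmul : ∀ M ∈ D, ∃ a, M 1 0 = ι a * w := by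
    intro M hM
    obtain ⟨b, hb⟩ := rmul (y k) (hy k) M hM
    have hbJ : b ∈ J := ⟨M, hM, hb⟩
    rw [hj, Submodule.mem_span_singleton] at hbJ
    obtain ⟨a, rfl⟩ := hbJ
    refine ⟨a, mul_left_cancel₀ hk ?_⟩
    rw [smul_eq_mul, map_mul, hjM] at hb
    rw [← hb]; ring
  have hw0 : w ≠ 0 := by
    intro h0
    obtain ⟨a, ha⟩ := hmul _ (hy l)
    rw [h0, mul_zero] at ha
    exact hl ha
  obtain ⟨x, hx, hxw⟩ : ∃ M ∈ D, M 0 1 * w = 1 := by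
    have hmul' : ∀ M, ∃ a, M ∈ D → M 1 0 = ι a * w := fun M => by
      by_cases hM : M ∈ D
      · obtain ⟨a, ha⟩ := hmul M hM
        exact ⟨a, fun _ => ha⟩
      · exact ⟨0, fun h => absurd h hM⟩
    choose f hf using hmul'
    obtain ⟨y₀, hy₀, h⟩ := hperf f (fun M hM N hN => by
        apply hι
        apply mul_right_cancel₀ hw0
        rw [← hf _ (D.add_mem hM hN), map_add, add_mul, ← hf M hM, ← hf N hN, Matrix.add_apply])
      (fun a M hM => by
        apply hι
        apply mul_right_cancel₀ hw0
        rw [← hf _ (hD.smul_mem a hM), map_mul, mul_assoc, ← hf M hM, Matrix.smul_apply, smul_eq_mul])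
    refine ⟨-y₀, D.neg_mem hy₀, ?_⟩
    have h1 := h _ (m10 M₀ hM₀)
    have h2 := hf _ (m10 M₀ hM₀)
    have h3 : f !![0, 0; w, 0] = 1 := by
      apply hι
      apply mul_right_cancel₀ hw0
      rw [← h2]; simp [hw]
    rw [← hw, h3, map_one] at h1
    rw [← h1]
    simp [adjugate_fin_two, trace_fin_two, mul_apply, Fin.sum_univ_two]
  refine ⟨⟨x 0 1, w, hxw, by rw [mul_comm]; exact hxw⟩, fun M => ⟨fun hM => ?_, ?_⟩⟩
  · obtain ⟨a, ha⟩ := r00 M hM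
    obtain ⟨b, hb⟩ := rmul M hM M₀ hM₀
    obtain ⟨c, hc⟩ := rmul x hx M hM
    obtain ⟨d, hd⟩ := r11 M hM
    refine ⟨!![a, b; c, d], ?_⟩
    ext i j; fin_cases i <;> fin_cases j
    · exact ha.symm
    · change M 0 1 = x 0 1 * ι b
      rw [hb]; linear_combination -M 0 1 * hxw
    · change M 1 0 = w * ι c
      rw [hc]; linear_combination -M 1 0 * hxw
    · exact hd.symm
  · rintro ⟨N, rfl⟩
    have h1 := D.add_mem (D.add_mem (hD.smul_mem (N 0 0) hE) (hD.smul_mem (N 0 1) (m01 x hx)))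
      (D.add_mem (hD.smul_mem (N 1 0) (m10 M₀ hM₀)) (hD.smul_mem (N 1 1) hE'))
    convert h1 using 1
    ext i j; fin_cases i <;> fin_cases j <;> simp [mul_comm, hw]

/-- Conjugation by an invertible matrix. -/
def conjHom (P : GL (Fin 2) W) : M₂ →+* M₂ where
  toFun M := P * M * ((P⁻¹ : GL (Fin 2) W) : M₂)
  map_one' := by simp
  map_zero' := by simp
  map_add' M N := by rw [mul_add, add_mul]
  map_mul' M N := by
    have : ((P⁻¹ : GL (Fin 2) W) : M₂) * P = 1 := by rw [← Units.val_mul, inv_mul_cancel]; rfl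
    calc (P : M₂) * (M * N) * ((P⁻¹ : GL (Fin 2) W) : M₂)
        = P * M * (((P⁻¹ : GL (Fin 2) W) : M₂) * P) * N * ((P⁻¹ : GL (Fin 2) W) : M₂) := by
          rw [this]; simp only [mul_assoc, one_mul]
      _ = _ := by simp only [mul_assoc]

theorem conjHom_apply (P : GL (Fin 2) W) (M : M₂) : conjHom P M = P * M * ((P⁻¹ : GL (Fin 2) W) : M₂) := rfl

theorem conjHom_smul (P : GL (Fin 2) W) (a : W) (M : M₂) : conjHom P (a • M) = a • conjHom P M := by
  simp [conjHom_apply]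

theorem conjHom_mul (P Q : GL (Fin 2) W) (M : M₂) : conjHom (P * Q) M = conjHom P (conjHom Q M) := by
  simp only [conjHom_apply, mul_inv_rev, Units.val_mul, mul_assoc]

theorem conjHom_one (M : M₂) : conjHom 1 M = M := by simp [conjHom_apply]

theorem trace_conjHom (P : GL (Fin 2) W) (M : M₂) : (conjHom P M).trace = M.trace := by
  rw [conjHom_apply, Matrix.trace_mul_comm, ← mul_assoc, ← Units.val_mul, inv_mul_cancel]; simp

theorem det_conjHom (P : GL (Fin 2) W) (M : M₂) : (conjHom P M).det = M.det := by
  rw [conjHom_apply, Matrix.det_mul_comm, ← mul_assoc, ← Units.val_mul, inv_mul_cancel]; simp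

theorem adjugate_conjHom (P : GL (Fin 2) W) (M : M₂) : (conjHom P M).adjugate = conjHom P M.adjugate := by
  rw [adjugate_eq_trace_smul_sub, adjugate_eq_trace_smul_sub, map_sub, conjHom_smul, map_one, trace_conjHom]

theorem comap_conjHom (hD : IsEisensteinOrder ι D) (P : GL (Fin 2) W) : IsEisensteinOrder ι (D.comap (conjHom P)) where
  smul_mem a M hM := by rw [Subring.mem_comap, conjHom_smul]; exact hD.smul_mem a hM
  trace_mem {M} hM := by rw [← trace_conjHom P]; exact hD.trace_mem hM
  det_mem {M} hM := by rw [← det_conjHom P]; exact hD.det_mem hM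

theorem IsPerfect.comap_conjHom (hD : IsPerfect ι D) (P : GL (Fin 2) W) : IsPerfect ι (D.comap (conjHom P)) := by
  have hinv : ∀ M, conjHom P (conjHom P⁻¹ M) = M := fun M => by
    rw [← conjHom_mul, mul_inv_cancel, conjHom_one]
  intro f hadd hsmul
  obtain ⟨y₀, hy₀, h⟩ := hD (fun M => f (conjHom P⁻¹ M))
    (fun y hy z hz => by
      rw [map_add]; exact hadd _ (by rwa [Subring.mem_comap, hinv]) _ (by rwa [Subring.mem_comap, hinv]))
    (fun a y hy => by
      rw [conjHom_smul]; exact hsmul _ _ (by rwa [Subring.mem_comap, hinv]))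
  refine ⟨conjHom P⁻¹ y₀, by rwa [Subring.mem_comap, hinv], fun y hy => ?_⟩
  have h1 := h _ hy
  rw [← conjHom_mul, inv_mul_cancel, conjHom_one] at h1
  rw [← h1, ← trace_conjHom P, map_mul, hinv, adjugate_conjHom]

/-- A unimodular order over a local domain is conjugate to the standard one. -/
theorem exists_conj [IsDomain W] [IsLocalRing W] (hι : Injective ι) (hD : IsEisensteinOrder ι D)
    (hprime : ∀ p : ℕ, p.Prime → ∃ y : κ → M₂, (∀ k, y k ∈ D) ∧ ∃ G : Matrix κ κ 𝓔,
      G.map ι = (of fun i j => (y i * (y j).adjugate).trace) ∧ ¬ (p : ℤ) ∣ G.det.norm) :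
    ∃ P : GL (Fin 2) W, ∀ M, conjHom P M ∈ D ↔ ∃ N : Mat₂ 𝓔, M = N.map ι := by
  obtain ⟨y, hy, G, hG, hu, hspan⟩ := hD.exists_basis hι hprime
  have hperf := hD.isPerfect hι hy hG hu hspan
  obtain ⟨e, he, he1, he0⟩ := hD.exists_idempotent hι hy hG hu
  obtain ⟨P, hP⟩ := exists_conj_idempotent he1 he0
  have hE : conjHom P !![1, 0; 0, 0] = e := by
    rw [conjHom_apply, ← hP, mul_assoc, ← Units.val_mul, mul_inv_cancel]; simp
  have hinv : ∀ M, conjHom P (conjHom P⁻¹ M) = M := fun M => by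
    rw [← conjHom_mul, mul_inv_cancel, conjHom_one]
  have hG' : G.map ι = of fun i j => (conjHom P⁻¹ (y i) * (conjHom P⁻¹ (y j)).adjugate).trace := by
    rw [hG]
    ext i j
    rw [of_apply, of_apply, adjugate_conjHom, ← map_mul, trace_conjHom]
  obtain ⟨x, hx⟩ := (hD.comap_conjHom P).exists_unit_of_projection_mem hι (hperf.comap_conjHom P)
    (y := fun k => conjHom P⁻¹ (y k)) (fun k => by rw [Subring.mem_comap, hinv]; exact hy k)
    (by
      have h1 := map_det_gram hG'
      intro h0
      rw [h0, zero_mul] at h1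
      exact hu.ne_zero (hι (h1.trans (map_zero ι).symm))) (by rw [Subring.mem_comap, hE]; exact he)
  refine ⟨P * diag x, fun M => ?_⟩
  rw [conjHom_mul, ← Subring.mem_comap, hx]
  have hinv' : ∀ a b c d : W, conjHom (diag x) !![a, b; c, d] = !![a, x * b; (x⁻¹ : Wˣ) * c, d] := by
    intro a b c d
    have : ((diag x)⁻¹ : GL (Fin 2) W) = diag x⁻¹ := by
      rw [inv_eq_iff_mul_eq_one, ← PGL2.diag_mul, mul_inv_cancel]
      ext i j; fin_cases i <;> fin_cases j <;> simp
    rw [conjHom_apply, this, PGL2.coe_diag, PGL2.coe_diag]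
    ext i j; fin_cases i <;> fin_cases j <;> simp [mul_comm, mul_assoc]
  have hinj : Injective (conjHom (diag x)) := by
    intro A B h
    have := congrArg (conjHom (diag x)⁻¹) h
    rwa [← conjHom_mul, ← conjHom_mul, inv_mul_cancel, conjHom_one, conjHom_one] at this
  refine exists_congr fun N => ?_
  have h1 : N.map ι = !![ι (N 0 0), ι (N 0 1); ι (N 1 0), ι (N 1 1)] := by ext i j; fin_cases i <;> fin_cases j <;> rfl
  rw [h1, ← hinv', hinj.eq_iff]

end IsEisensteinOrder

end OrderConjugacy

local notation "𝓦" => EisensteinOver ℤ_[2]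

section TwoAdicEisenstein

local notation "κ" => HermiteIndex

namespace EisensteinOver

theorem toZMod_eq_zero_iff (x : ℤ_[2]) : PadicInt.toZMod x = 0 ↔ ¬ IsUnit x := by
  rw [← RingHom.mem_ker, PadicInt.ker_toZMod, IsLocalRing.mem_maximalIdeal, mem_nonunits_iff]

theorem isUnit_two_adic_iff (x : 𝓦) : ¬ IsUnit x ↔ PadicInt.toZMod x.re = 0 ∧ PadicInt.toZMod x.im = 0 := by
  rw [QuadraticAlgebra.isUnit_iff_norm_isUnit, ← toZMod_eq_zero_iff, norm_apply]
  simp only [map_add, map_sub, map_mul, map_pow]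
  generalize PadicInt.toZMod x.re = a
  generalize PadicInt.toZMod x.im = b
  revert a b
  decide

instance : IsLocalRing 𝓦 := by
  have : Nontrivial 𝓦 := ⟨0, 1, fun h => by simpa using congrArg QuadraticAlgebra.re h⟩
  refine IsLocalRing.of_nonunits_add fun a b ha hb => ?_
  rw [mem_nonunits_iff, isUnit_two_adic_iff] at ha hb ⊢
  simp [ha, hb]

theorem eq_zero_of_norm_eq_zero {x : 𝓦} (h : x.norm = 0) : x = 0 := by
  have key : ∀ t : ℤ_[2], t ^ 2 - t + 1 ≠ 0 := by
    intro t ht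
    have h1 := congrArg PadicInt.toZMod ht
    simp only [map_add, map_sub, map_pow, map_one, map_zero] at h1
    generalize PadicInt.toZMod t = a at h1
    revert a
    decide
  rw [norm_apply] at h
  rcases ValuationRing.dvd_total x.re x.im with ⟨t, ht⟩ | ⟨t, ht⟩
  · have h1 : x.re ^ 2 * (t ^ 2 - t + 1) = 0 := by rw [← h, ht]; ring
    have h2 : x.re = 0 := pow_eq_zero_iff (two_ne_zero) |>.1 ((mul_eq_zero.1 h1).resolve_right (key t))
    ext
    · exact h2
    · rw [ht, h2, zero_mul]; rfl
  · have h1 : x.im ^ 2 * (t ^ 2 - t + 1) = 0 := by rw [← h, ht]; ring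
    have h2 : x.im = 0 := pow_eq_zero_iff (two_ne_zero) |>.1 ((mul_eq_zero.1 h1).resolve_right (key t))
    ext
    · rw [ht, h2, zero_mul]; rfl
    · exact h2

instance : IsDomain 𝓦 := by
  have : NoZeroDivisors 𝓦 := ⟨fun {a b} h => by
    have h1 : a.norm * b.norm = 0 := by rw [← map_mul, h]; simp
    rcases mul_eq_zero.1 h1 with h2 | h2
    · exact Or.inl (eq_zero_of_norm_eq_zero h2)
    · exact Or.inr (eq_zero_of_norm_eq_zero h2)⟩
  exact NoZeroDivisors.to_isDomain _

end EisensteinOver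

theorem EisensteinInt.mem_range_toPadic_of_two_mul {x : 𝓦} (h : 2 * x ∈ (toPadic 2).range) : x ∈ (toPadic 2).range := by
  obtain ⟨a, ha⟩ := h
  have h1 : (a.re : ℤ_[2]) = 2 * x.re := by simpa [toPadic, re_ofNat, im_ofNat] using congrArg QuadraticAlgebra.re ha
  have h2 : (a.im : ℤ_[2]) = 2 * x.im := by simpa [toPadic, re_ofNat, im_ofNat] using congrArg QuadraticAlgebra.im ha
  have key : ∀ (m : ℤ) (t : ℤ_[2]), (m : ℤ_[2]) = 2 * t → ∃ n : ℤ, (n : ℤ_[2]) = t := by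
    intro m t hm
    have h3 : (2 : ℤ_[2]) ^ 1 ∣ m := by rw [pow_one]; exact ⟨t, hm⟩
    have h4 := (PadicInt.pow_p_dvd_int_iff (p := 2) 1 m).1 (by exact_mod_cast h3)
    obtain ⟨n, rfl⟩ := h4
    refine ⟨n, mul_left_cancel₀ (two_ne_zero : (2 : ℤ_[2]) ≠ 0) ?_⟩
    rw [← hm]; push_cast; ring
  obtain ⟨r, hr⟩ := key _ _ h1
  obtain ⟨s, hs⟩ := key _ _ h2
  refine ⟨⟨r, s⟩, ?_⟩
  ext
  · exact hr
  · exact hs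

/-- The ring of matrices generated by normalised squares and the cube roots of unity. -/
noncomputable def sqOrder {X : Type*} (u : X → PGL2 𝓦) : Subring (Mat₂ 𝓦) where
  carrier := {M | ∃ x y, M = evalSq u x + (toPadic 2 ⟨0, 1⟩) • evalSq u y}
  one_mem' := ⟨1, 0, by simp⟩
  zero_mem' := ⟨0, 0, by simp⟩
  add_mem' := by
    rintro _ _ ⟨x, y, rfl⟩ ⟨z, w, rfl⟩
    exact ⟨x + z, y + w, by rw [map_add, map_add, smul_add]; abel⟩
  neg_mem' := by
    rintro _ ⟨x, y, rfl⟩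
    exact ⟨-x, -y, by rw [map_neg, map_neg, smul_neg]; abel⟩
  mul_mem' := by
    rintro _ _ ⟨x, y, rfl⟩ ⟨z, w, rfl⟩
    have h : (toPadic 2 ⟨0, 1⟩) * (toPadic 2 ⟨0, 1⟩) =
        -1 - (toPadic 2 ⟨0, 1⟩) := by
      rw [← map_mul, ← map_one (toPadic 2), ← map_neg, ← map_sub]
      congr 1
    refine ⟨x * z - y * w, x * w + y * z - y * w, ?_⟩
    simp only [map_mul, map_sub, map_add, add_mul, mul_add, smul_mul_assoc, mul_smul_comm, smul_smul, h, smul_add,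
      smul_sub, sub_smul, neg_smul, one_smul]
    abel

theorem isEisensteinOrder_sqOrder {X : Type*} {u : X → PGL2 𝓦} {χ : FreeAlgebra ℤ X → 𝓔}
    (hχ : ∀ x, sqTrace u x = toPadic 2 (χ x)) : IsEisensteinOrder (toPadic 2) (sqOrder u) := by
  have tr : ∀ M ∈ sqOrder u, M.trace ∈ (toPadic 2).range := by
    rintro _ ⟨x, y, rfl⟩
    refine ⟨χ x + ⟨0, 1⟩ * χ y, ?_⟩
    rw [map_add, map_mul, ← hχ, ← hχ, Matrix.trace_add, trace_smul]
    rfl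
  refine ⟨?_, fun {M} hM => tr M hM, ?_⟩
  · intro a M hM
    have h1 : toPadic 2 a = (a.re : 𝓦) + a.im * toPadic 2 ⟨0, 1⟩ := by ext <;> simp [toPadic]
    have h2 : (toPadic 2 ⟨0, 1⟩) • (1 : Mat₂ 𝓦) ∈ sqOrder u := ⟨0, 1, by simp⟩
    have h3 : toPadic 2 a • M = ((a.re : Mat₂ 𝓦) +
        a.im * (toPadic 2 ⟨0, 1⟩) • (1 : Mat₂ 𝓦)) * M := by
      rw [h1, add_smul, add_mul, mul_smul, mul_assoc, smul_mul_assoc, one_mul]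
      congr 1
      · rw [← zsmul_eq_mul, ← Int.cast_smul_eq_zsmul 𝓦]
      · rw [← zsmul_eq_mul, ← Int.cast_smul_eq_zsmul 𝓦]
    rw [h3]
    exact (sqOrder u).mul_mem ((sqOrder u).add_mem (intCast_mem (sqOrder u) _)
      ((sqOrder u).mul_mem (intCast_mem (sqOrder u) _) h2)) hM
  · intro M hM
    apply EisensteinInt.mem_range_toPadic_of_two_mul
    have h1 : 2 * M.det = M.trace * M.trace - (M * M).trace := by
      simp [det_fin_two, trace_fin_two, mul_apply, Fin.sum_univ_two]
      ring
    rw [h1]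
    exact Subring.sub_mem _ (Subring.mul_mem _ (tr M hM) (tr M hM)) (tr _ ((sqOrder u).mul_mem hM hM))

theorem EisensteinOver.norm_map {R S : Type*} [CommRing R] [CommRing S] (f : R →+* S) (x : EisensteinOver R) :
    (EisensteinOver.map f x).norm = f x.norm := by
  simp [norm_apply]

/-- The matrix units, indexed by the standard four element type. -/
def matrixUnit (R : Type*) [CommRing R] : κ → Mat₂ R :=
  Sum.elim (fun _ => !![1, 0; 0, 0]) (Sum.elim (fun _ => !![0, 1; 0, 0])
    (Sum.elim (fun _ => !![0, 0; 1, 0]) fun _ => !![0, 0; 0, 1]))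

theorem matrixUnit_map {R S : Type*} [CommRing R] [CommRing S] (f : R →+* S) (k : κ) :
    (matrixUnit R k).map f = matrixUnit S k := by
  rcases k with _ | _ | _ | _ <;> ext i j <;> fin_cases i <;> fin_cases j <;> simp [matrixUnit]

theorem isUnit_det_gram_matrixUnit (R : Type*) [CommRing R] :
    IsUnit (of fun i j => (matrixUnit R i * (matrixUnit R j).adjugate).trace).det := by
  rw [gram_eq, det_mul, Matrix.det_transpose]
  have h1 : (of fun k => coordsLin (matrixUnit R k)) = 1 := by
    ext (_ | _ | _ | _) (_ | _ | _ | _) <;> simp [coordsLin, matrixUnit]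
  have h2 : (of fun k => dualCoordsLin (matrixUnit R k)) *
      (of fun k => dualCoordsLin (matrixUnit R k)) = 1 := by
    ext (_ | _ | _ | _) (_ | _ | _ | _) <;>
      simp [dualCoordsLin, matrixUnit, mul_apply]
  rw [h1, Matrix.det_one, one_mul]
  have h3 := congrArg Matrix.det h2
  rw [det_mul, Matrix.det_one] at h3
  exact IsUnit.of_mul_eq_one _ h3

theorem trace_mul_adjugate_evalSq {X R : Type*} [CommRing R] (u : X → PGL2 R) (x y : FreeAlgebra ℤ X) :
    (evalSq u x * (evalSq u y).adjugate).trace = sqTrace u x * sqTrace u y - sqTrace u (x * y) := by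
  rw [adjugate_eq_trace_smul_sub, mul_sub, Matrix.trace_sub, mul_smul_comm, mul_one, trace_smul, sqTrace,
    sqTrace, sqTrace, map_mul, smul_eq_mul, mul_comm]

/-- The order generated by the normalised squares of a `2`-adic representation is conjugate to the standard one. -/
theorem ProfiniteCorrespondence.exists_conj_sqOrder {Λ : Type} [Group Λ] [Group.FG Λ]
    (c : ProfiniteCorrespondence Λ (PGL2 𝓔)) (ρ : ∀ (p : ℕ) [Fact p.Prime], Λ →* PGL2 (EisensteinOver ℤ_[p]))
    (hρ : ∀ (p : ℕ) [Fact p.Prime], IsPadicRep c p (ρ p)) :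
    ∃ P : GL (Fin 2) 𝓦, ∀ M, IsEisensteinOrder.conjHom P M ∈ sqOrder (ρ 2) ↔ ∃ N : Mat₂ 𝓔, M = N.map (toPadic 2) := by
  obtain ⟨χ, hχ2, hχ⟩ := c.exists_integral_character ρ hρ
  refine (isEisensteinOrder_sqOrder hχ2).exists_conj (EisensteinInt.toPadic_injective 2) fun p hp => ?_
  have : Fact p.Prime := ⟨hp⟩
  choose x hx using fun k => (hρ p).exists_evalSq_padicRed_eq 1 (matrixUnit 𝓔 k)
  refine ⟨fun k => evalSq (ρ 2) (x k), fun k => ⟨x k, 0, by simp⟩,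
    of fun i j => χ (x i) * χ (x j) - χ (x i * x j), ?_, ?_⟩
  · refine Matrix.ext fun i j => ?_
    rw [of_apply, trace_mul_adjugate_evalSq, hχ2, hχ2, hχ2, ← map_mul, ← map_sub]
    rfl
  · set G : Matrix κ κ 𝓔 := of fun i j => χ (x i) * χ (x j) - χ (x i * x j) with hG
    intro hdvd
    have hgram : ∀ i j, padicRed p 1 (sqTrace (ρ p) (x i) * sqTrace (ρ p) (x j) -
        sqTrace (ρ p) (x i * x j)) = (matrixUnit (EisensteinOver (ZMod (p ^ 1))) i *
          (matrixUnit (EisensteinOver (ZMod (p ^ 1))) j).adjugate).trace := by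
      intro i j
      rw [← trace_mul_adjugate_evalSq, AddMonoidHom.map_trace (padicRed p 1)]
      have h1 : ∀ A B : Mat₂ (EisensteinOver ℤ_[p]),
          (A * B.adjugate).map (padicRed p 1) =
          A.map (padicRed p 1) * (B.map (padicRed p 1)).adjugate := by
        intro A B
        rw [Matrix.map_mul]
        congr 1
        exact RingHom.map_adjugate (padicRed p 1) B
      rw [h1, hx, hx, matrixUnit_map, matrixUnit_map]
    have hunit : ∃ z : 𝓔, z.norm = G.det.norm ∧ IsUnit (red (p ^ 1) z) := by
      rcases hχ p with h | h
      · refine ⟨G.det, rfl, ?_⟩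
        rw [RingHom.map_det, RingHom.mapMatrix_apply]
        convert isUnit_det_gram_matrixUnit (EisensteinOver (ZMod (p ^ 1))) using 2
        refine Matrix.ext fun i j => ?_
        rw [of_apply, ← hgram, h, h, h, ← map_mul, ← map_sub]
        exact (RingHom.congr_fun (EisensteinOver.padicRed_comp_toPadic p 1) _).symm
      · refine ⟨star G.det, QuadraticAlgebra.norm_star _, ?_⟩
        rw [← starRingEnd_apply, RingHom.map_det, RingHom.map_det, RingHom.mapMatrix_apply, RingHom.mapMatrix_apply]
        convert isUnit_det_gram_matrixUnit (EisensteinOver (ZMod (p ^ 1))) using 2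
        refine Matrix.ext fun i j => ?_
        rw [of_apply, ← hgram, h, h, h, ← map_mul, ← map_sub]
        refine Eq.trans ?_ (RingHom.congr_fun (EisensteinOver.padicRed_comp_toPadic p 1) _).symm
        simp only [Matrix.map_apply, hG, of_apply, map_sub, map_mul, starRingEnd_apply]
    obtain ⟨z, hz, hu⟩ := hunit
    rw [QuadraticAlgebra.isUnit_iff_norm_isUnit, red, EisensteinOver.norm_map, hz] at hu
    have h0 : (Int.castRingHom (ZMod (p ^ 1))) G.det.norm = 0 := by
      rw [eq_intCast, ZMod.intCast_zmod_eq_zero_iff_dvd]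
      simpa using hdvd
    rw [h0, isUnit_zero_iff] at hu
    have : Fact (1 < p ^ 1) := ⟨by rw [pow_one]; exact hp.one_lt⟩
    exact zero_ne_one hu

end TwoAdicEisenstein

section IntegralRepresentation

open IsEisensteinOrder

/-- The normaliser of the matrix ring over a principal ideal domain, in invertible matrices over
a local extension. -/
theorem PGL2.exists_map_eq_of_normalizes {R W : Type*} [CommRing R] [IsDomain R] [IsPrincipalIdealRing R]
    [CommRing W] [IsDomain W] [IsLocalRing W] {ι : R →+* W} (hι : Injective ι) (X : GL (Fin 2) W)
    (hX : ∀ N : Mat₂ R, ∃ N' : Mat₂ R, conjHom X (N.map ι) = N'.map ι) : ∃ y : PGL2 R, PGL2.map ι y = PGL2.mk X := by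
  set Δ : Wˣ := det X with hΔ
  have hΔX : (Δ : W) = X 0 0 * X 1 1 - X 0 1 * X 1 0 := by rw [hΔ, val_det_apply, det_fin_two]
  have hinv : ∀ i j, (Δ : W) * (X⁻¹ : GL (Fin 2) W) i j = (X : Mat₂ W).adjugate i j := by
    intro i j
    have h1 : (X : Mat₂ W).adjugate = (Δ : W) • ((X⁻¹ : GL (Fin 2) W) : Mat₂ W) := by
      calc (X : Mat₂ W).adjugate
          = (X : Mat₂ W).adjugate * (X * ((X⁻¹ : GL (Fin 2) W) : Mat₂ W)) := by
            rw [← Units.val_mul, mul_inv_cancel]; simp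
        _ = _ := by rw [← mul_assoc, Matrix.adjugate_mul, smul_mul_assoc, one_mul]; rfl
    rw [h1]; rfl
  have key : ∀ i j k l, ∃ r : R, (Δ : W) * ι r = X i j * (X : Mat₂ W).adjugate k l := by
    intro i j k l
    obtain ⟨N', hN'⟩ := hX (Matrix.single j k 1)
    refine ⟨N' i l, ?_⟩
    have h1 := congrFun (congrFun hN' i) l
    rw [Matrix.map_apply] at h1
    rw [← h1, conjHom_apply, ← hinv, mul_apply, Fin.sum_univ_two, mul_apply, mul_apply,
      Fin.sum_univ_two, Fin.sum_univ_two]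
    fin_cases j <;> fin_cases k <;> simp [Matrix.single] <;> ring
  have key' : ∀ i j k l, ∃ r : R, (Δ : W) * ι r = X i j * X k l := by
    intro i j k l
    fin_cases k <;> fin_cases l
    · obtain ⟨r, hr⟩ := key i j 1 1
      exact ⟨r, by rw [hr, adjugate_fin_two]; simp⟩
    · obtain ⟨r, hr⟩ := key i j 0 1
      exact ⟨-r, by rw [map_neg, mul_neg, hr, adjugate_fin_two]; simp⟩
    · obtain ⟨r, hr⟩ := key i j 1 0
      exact ⟨-r, by rw [map_neg, mul_neg, hr, adjugate_fin_two]; simp⟩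
    · obtain ⟨r, hr⟩ := key i j 0 0
      exact ⟨r, by rw [hr, adjugate_fin_two]; simp⟩
  obtain ⟨i₀, j₀, x₀, hx₀⟩ : ∃ i j, ∃ u : Wˣ, (u : W) = X i j := by
    by_contra hne
    push Not at hne
    have hn : ∀ i j, X i j ∈ IsLocalRing.maximalIdeal W := fun i j => by
      rw [IsLocalRing.mem_maximalIdeal]
      rintro ⟨u, hu⟩
      exact hne i j u hu
    have h1 : (Δ : W) ∈ IsLocalRing.maximalIdeal W := by
      rw [hΔX]
      exact Ideal.sub_mem _ (Ideal.mul_mem_left _ _ (hn _ _)) (Ideal.mul_mem_left _ _ (hn _ _))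
    exact (IsLocalRing.mem_maximalIdeal _).1 h1 Δ.isUnit
  choose Y hY using fun i j => key' i j i₀ j₀
  simp only [← hx₀] at hY
  set e := Y i₀ j₀ with he
  have hXY : ∀ i j, X i j = (Δ : W) * (x₀⁻¹ : Wˣ) * ι (Y i j) := by
    intro i j
    have : (Δ : W) * (x₀⁻¹ : Wˣ) * ι (Y i j) = (Δ * ι (Y i j)) * (x₀⁻¹ : Wˣ) := by ring
    rw [this, hY, Units.mul_inv_cancel_right]
  have he2 : (Δ : W) * ι e = (x₀ : W) * x₀ := by rw [he, hY, hx₀]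
  have hdiv : ∀ i j k l, e ∣ Y i j * Y k l := by
    intro i j k l
    obtain ⟨r, hr⟩ := key' i j k l
    refine ⟨r, hι ?_⟩
    rw [map_mul, map_mul]
    have h1 := hY i j
    have h2 := hY k l
    apply mul_left_cancel₀ (mul_ne_zero Δ.ne_zero Δ.ne_zero)
    calc (Δ : W) * Δ * (ι (Y i j) * ι (Y k l)) = (Δ * ι (Y i j)) * (Δ * ι (Y k l)) := by ring
      _ = (X i j * X k l) * (x₀ * x₀) := by rw [h1, h2]; ring
      _ = _ := by rw [← hr, ← he2]; ring
  have hdet : Y 0 0 * Y 1 1 - Y 0 1 * Y 1 0 = e := by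
    apply hι
    apply mul_left_cancel₀ (mul_ne_zero Δ.ne_zero Δ.ne_zero)
    simp only [map_sub, map_mul]
    calc (Δ : W) * Δ * (ι (Y 0 0) * ι (Y 1 1) - ι (Y 0 1) * ι (Y 1 0))
        = (Δ * ι (Y 0 0)) * (Δ * ι (Y 1 1)) - (Δ * ι (Y 0 1)) * (Δ * ι (Y 1 0)) := by ring
      _ = (X 0 0 * X 1 1 - X 0 1 * X 1 0) * (x₀ * x₀) := by rw [hY, hY, hY, hY]; ring
      _ = _ := by rw [← hΔX, ← he2]; ring
  have he0 : e ≠ 0 := by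
    intro h0
    rw [h0, map_zero, mul_zero] at he2
    exact mul_ne_zero x₀.ne_zero x₀.ne_zero he2.symm
  obtain ⟨g, hg⟩ := IsPrincipalIdealRing.principal (Ideal.span (Set.range fun ij : Fin 2 × Fin 2 => Y ij.1 ij.2))
  have hgY : ∀ i j, ∃ z, Y i j = g * z := by
    intro i j
    have h1 : Y i j ∈ Ideal.span (Set.range fun ij : Fin 2 × Fin 2 => Y ij.1 ij.2) :=
      Ideal.subset_span ⟨(i, j), rfl⟩
    rw [hg, Submodule.mem_span_singleton] at h1
    obtain ⟨a, ha⟩ := h1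
    exact ⟨a, by rw [← ha, smul_eq_mul, mul_comm]⟩
  have hge : e ∣ g * g := by
    have h1 : g ∈ Ideal.span (Set.range fun ij : Fin 2 × Fin 2 => Y ij.1 ij.2) := by
      rw [hg]; exact Submodule.mem_span_singleton_self g
    have h2 : ∀ i j, ∀ a ∈ Ideal.span (Set.range fun ij : Fin 2 × Fin 2 => Y ij.1 ij.2), e ∣ Y i j * a := by
      intro i j a ha
      induction ha using Submodule.span_induction with
      | mem a ha => obtain ⟨kl, rfl⟩ := ha; exact hdiv _ _ _ _
      | zero => simp
      | add a b _ _ ha hb => rw [mul_add]; exact dvd_add ha hb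
      | smul c a _ ha => rw [smul_eq_mul, mul_left_comm]; exact ha.mul_left c
    have h3 : ∀ a ∈ Ideal.span (Set.range fun ij : Fin 2 × Fin 2 => Y ij.1 ij.2), e ∣ a * g := by
      intro a ha
      induction ha using Submodule.span_induction with
      | mem a ha => obtain ⟨kl, rfl⟩ := ha; exact h2 _ _ _ h1
      | zero => simp
      | add a b _ _ ha hb => rw [add_mul]; exact dvd_add ha hb
      | smul c a _ ha => rw [smul_eq_mul, mul_assoc]; exact ha.mul_left c
    exact h3 g h1
  choose Z hZ using hgY
  obtain ⟨m, hm⟩ := hge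
  have hg0 : g ≠ 0 := by
    rintro rfl
    exact he0 (by rw [he, hZ, zero_mul])
  have hunit : (Z 0 0 * Z 1 1 - Z 0 1 * Z 1 0) * m = 1 := by
    apply mul_left_cancel₀ (mul_ne_zero hg0 hg0)
    calc g * g * ((Z 0 0 * Z 1 1 - Z 0 1 * Z 1 0) * m)
        = ((g * Z 0 0) * (g * Z 1 1) - (g * Z 0 1) * (g * Z 1 0)) * m := by ring
      _ = _ := by rw [← hZ, ← hZ, ← hZ, ← hZ, hdet, mul_one, hm]
  have hZdet : IsUnit (of Z).det := by rw [det_fin_two]; exact IsUnit.of_mul_eq_one _ hunit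
  refine ⟨PGL2.mk (GeneralLinearGroup.mk'' (of Z) hZdet), ?_⟩
  have hgu : IsUnit (ι g) := by
    have h1 : (x₀ : W) = (Δ : W) * (x₀⁻¹ : Wˣ) * (ι g * ι (Z i₀ j₀)) := by rw [hx₀, hXY, hZ, map_mul]
    have h2 : IsUnit ((Δ : W) * (x₀⁻¹ : Wˣ) * (ι g * ι (Z i₀ j₀))) := by rw [← h1]; exact x₀.isUnit
    exact isUnit_of_mul_isUnit_left (isUnit_of_mul_isUnit_right h2)
  obtain ⟨v, hv⟩ := hgu
  rw [eq_comm, PGL2.map_mk, PGL2.mk_eq_mk]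
  refine ⟨Δ * x₀⁻¹ * v, ?_⟩
  ext i j
  rw [hXY, hZ, map_mul, ← hv, ← mul_assoc]
  rfl

/-- A group with a profinite correspondence to `PGL2 𝓔` has an integral representation which is `2`-adically conjugate
to the one coming from the correspondence. -/
theorem ProfiniteCorrespondence.exists_integralRep {Λ : Type} [Group Λ] [Group.FG Λ]
    (c : ProfiniteCorrespondence Λ (PGL2 𝓔)) : ∃ ρ : Λ →* PGL2 𝓦, IsPadicRep c 2 ρ ∧ ∃ (q : PGL2 𝓦) (φ : Λ →* PGL2 𝓔),
      ∀ g, PGL2.map (toPadic 2) (φ g) = q⁻¹ * ρ g * q := by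
  choose ρ hρ using fun (p : ℕ) (hp : Fact p.Prime) => c.exists_padicRep p
  refine ⟨ρ 2 inferInstance, hρ 2 inferInstance, ?_⟩
  obtain ⟨P, hP⟩ := c.exists_conj_sqOrder (fun p hp => ρ p hp) (fun p hp => hρ p hp)
  set r := ρ 2 inferInstance with hr
  have hinv : ∀ M, conjHom P (conjHom P⁻¹ M) = M := fun M => by
    rw [← conjHom_mul, mul_inv_cancel, conjHom_one]
  have hex : ∀ g, ∃ y : PGL2 𝓔, PGL2.map (toPadic 2) y = (PGL2.mk P)⁻¹ * r g * PGL2.mk P := by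
    intro g
    obtain ⟨A, hA⟩ := mk_surjective (r g)
    have hnorm : ∀ M ∈ sqOrder r, conjHom A M ∈ sqOrder r := by
      have h1 : ∀ x, conjHom A (evalSq r x) =
          evalSq r (FreeAlgebra.lift ℤ (fun h => FreeAlgebra.ι ℤ (g * h * g⁻¹)) x) := by
        intro x
        rw [conjHom_apply, ← evalSq_conj]
        have : (evalSq r).comp (FreeAlgebra.lift ℤ (fun h => FreeAlgebra.ι ℤ (g * h * g⁻¹))) =
            evalSq (fun h => PGL2.mk A * r h * (PGL2.mk A)⁻¹) := by
          ext h : 2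
          change evalSq r (FreeAlgebra.lift ℤ _ (FreeAlgebra.ι ℤ h)) = evalSq _ (FreeAlgebra.ι ℤ h)
          rw [FreeAlgebra.lift_ι_apply, evalSq_ι, evalSq_ι, hA, map_mul, map_mul, map_inv]
        rw [← this]; rfl
      rintro _ ⟨x, y, rfl⟩
      rw [map_add, conjHom_smul, h1, h1]
      exact ⟨_, _, rfl⟩
    have h2 := PGL2.exists_map_eq_of_normalizes (EisensteinInt.toPadic_injective 2) (P⁻¹ * A * P) (fun N => by
      rw [← hP, ← conjHom_mul]
      have h3 : P * (P⁻¹ * A * P) = A * P := by group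
      rw [h3, conjHom_mul]
      exact hnorm _ ((hP _).2 ⟨N, rfl⟩))
    rw [map_mul, map_mul, map_inv, hA] at h2
    exact h2
  choose φ hφ using hex
  have hinj := PGL2.map_injective _ (EisensteinInt.toPadic_injective 2)
  refine ⟨PGL2.mk P, ⟨⟨φ, hinj ?_⟩, fun g h => hinj ?_⟩, hφ⟩
  · rw [hφ, map_one, map_one]; group
  · rw [map_mul, hφ, hφ, hφ, map_mul]; group

end IntegralRepresentation

namespace EisensteinInt

theorem norm_mul_of_isUnit {u : 𝓔} (hu : IsUnit u) (x : 𝓔) : (x * u).norm = x.norm := by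
  rw [map_mul, isUnit_iff.1 hu, mul_one]

theorem norm_add_mul (s q : 𝓔) (x y : ℤ) : (s + ⟨x, y⟩ * q).norm = s.norm + (x ^ 2 - x * y + y ^ 2) * q.norm +
    x * (2 * s.re * q.re - s.re * q.im - s.im * q.re + 2 * s.im * q.im) +
    y * (2 * s.im * q.re - s.im * q.im - s.re * q.re - s.re * q.im) := by
  simp only [norm_apply, QuadraticAlgebra.re_add, QuadraticAlgebra.im_add, QuadraticAlgebra.re_mul,
    QuadraticAlgebra.im_mul]
  ring

theorem isUnit_mk {x y : ℤ} (h : x ^ 2 - x * y + y ^ 2 = 1) : IsUnit (⟨x, y⟩ : 𝓔) := by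
  rw [isUnit_iff, norm_apply]; exact h

theorem exists_unit_norm_add_lt {s q : 𝓔} (hq : q ≠ 0) (h : s.norm = q.norm) :
    ∃ u : 𝓔, IsUnit u ∧ (s + u * q).norm < q.norm := by
  have hpos := norm_pos hq
  by_contra hne
  push Not at hne
  have k1 := hne _ (isUnit_mk (x := 1) (y := 0) (by norm_num))
  have k2 := hne _ (isUnit_mk (x := -1) (y := 0) (by norm_num))
  have k3 := hne _ (isUnit_mk (x := 0) (y := 1) (by norm_num))
  have k4 := hne _ (isUnit_mk (x := 0) (y := -1) (by norm_num))
  have k5 := hne _ (isUnit_mk (x := 1) (y := 1) (by norm_num))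
  have k6 := hne _ (isUnit_mk (x := -1) (y := -1) (by norm_num))
  rw [norm_add_mul, h] at k1 k2 k3 k4 k5 k6
  have hsum : (2 * s.re * q.re - s.re * q.im - s.im * q.re + 2 * s.im * q.im) ^ 2 +
      (2 * s.re * q.re - s.re * q.im - s.im * q.re + 2 * s.im * q.im) *
        (2 * s.im * q.re - s.im * q.im - s.re * q.re - s.re * q.im) +
      (2 * s.im * q.re - s.im * q.im - s.re * q.re - s.re * q.im) ^ 2 = 3 * s.norm * q.norm := by
    simp only [norm_apply]
    ring
  rw [h] at hsum
  generalize (2 * s.re * q.re - s.re * q.im - s.im * q.re + 2 * s.im * q.im) = α at *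
  generalize (2 * s.im * q.re - s.im * q.im - s.re * q.re - s.re * q.im) = β at *
  generalize QuadraticAlgebra.norm q = μ at *
  have f1 : α ^ 2 ≤ μ ^ 2 := by nlinarith
  have f2 : β ^ 2 ≤ μ ^ 2 := by nlinarith
  have f3 : (α + β) ^ 2 ≤ μ ^ 2 := by nlinarith
  nlinarith

/-- A lattice vector of norm less than four is zero, a unit, or a sum of two units with norm three. -/
theorem eq_or_of_norm_lt_four {x y : ℤ} (h : x ^ 2 - x * y + y ^ 2 < 4) :
    (x = 0 ∧ y = 0) ∨ x ^ 2 - x * y + y ^ 2 = 1 ∨ ∃ a b c d : ℤ, x = a + c ∧ y = b + d ∧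
      a ^ 2 - a * b + b ^ 2 = 1 ∧ c ^ 2 - c * d + d ^ 2 = 1 ∧ (a + c) ^ 2 - (a + c) * (b + d) + (b + d) ^ 2 = 3 := by
  have hx1 : -2 ≤ x := by nlinarith [sq_nonneg (2 * y - x)]
  have hx2 : x ≤ 2 := by nlinarith [sq_nonneg (2 * y - x)]
  have hy1 : -2 ≤ y := by nlinarith [sq_nonneg (2 * x - y)]
  have hy2 : y ≤ 2 := by nlinarith [sq_nonneg (2 * x - y)]
  have split : ∀ a b c d : ℤ, x = a + c ∧ y = b + d ∧ a ^ 2 - a * b + b ^ 2 = 1 ∧ c ^ 2 - c * d + d ^ 2 = 1 ∧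
      (a + c) ^ 2 - (a + c) * (b + d) + (b + d) ^ 2 = 3 → (x = 0 ∧ y = 0) ∨ x ^ 2 - x * y + y ^ 2 = 1 ∨
      ∃ a b c d : ℤ, x = a + c ∧ y = b + d ∧ a ^ 2 - a * b + b ^ 2 = 1 ∧ c ^ 2 - c * d + d ^ 2 = 1 ∧
        (a + c) ^ 2 - (a + c) * (b + d) + (b + d) ^ 2 = 3 :=
    fun a b c d h => Or.inr (Or.inr ⟨a, b, c, d, h⟩)
  interval_cases x <;> interval_cases y <;> first
    | omega
    | (apply split 1 1 1 0; norm_num; done)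
    | (apply split 1 1 0 1; norm_num; done)
    | (apply split 1 0 0 (-1); norm_num; done)
    | (apply split (-1) 0 0 1; norm_num; done)
    | (apply split (-1) (-1) (-1) 0; norm_num; done)
    | (apply split (-1) (-1) 0 (-1); norm_num; done)

/-- Two lattice points in an open unit disc are equal, adjacent, or have a common neighbour in that disc. -/
theorem exists_intermediate {s q : 𝓔} {k : 𝓔} (h₁ : s.norm < q.norm) (h₂ : (s + k * q).norm < q.norm) :
    k = 0 ∨ IsUnit k ∨ ∃ u, IsUnit u ∧ IsUnit (k - u) ∧ (s + u * q).norm < q.norm := by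
  have hq : 0 < q.norm := lt_of_le_of_lt (norm_nonneg s) h₁
  have hpar : (s + k * q).norm + (s - (s + k * q)).norm + (2 * s + k * q).norm - (s + k * q).norm =
      2 * s.norm + 2 * (s + k * q).norm := by
    simp only [norm_apply, QuadraticAlgebra.re_add, QuadraticAlgebra.im_add, QuadraticAlgebra.re_sub,
      QuadraticAlgebra.im_sub, two_mul]
    ring
  have hk : k.norm < 4 := by
    have h3 : (s - (s + k * q)).norm = k.norm * q.norm := by rw [← map_mul, ← QuadraticAlgebra.norm_neg]; congr 1; ring
    have h4 := norm_nonneg (2 * s + k * q)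
    by_contra hge
    push Not at hge
    nlinarith
  have hsplit : ∀ u v : 𝓔, IsUnit u → IsUnit v → (u + v).norm = 3 → k = u + v →
      ∃ u, IsUnit u ∧ IsUnit (k - u) ∧ (s + u * q).norm < q.norm := by
    intro u v hu hv h3 hkuv
    refine ⟨u, hu, by rw [hkuv, add_sub_cancel_left]; exact hv, ?_⟩
    have h5 : (s + u * q).norm + (s + v * q).norm + ((u + v).norm - u.norm - v.norm) * q.norm =
        s.norm + (s + (u + v) * q).norm := by
      simp only [norm_apply, QuadraticAlgebra.re_add, QuadraticAlgebra.im_add, QuadraticAlgebra.re_mul,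
        QuadraticAlgebra.im_mul]
      ring
    rw [isUnit_iff.1 hu, isUnit_iff.1 hv, h3, ← hkuv] at h5
    have := norm_nonneg (s + v * q)
    linarith
  obtain ⟨x, y⟩ := k
  rw [norm_apply] at hk
  rcases eq_or_of_norm_lt_four hk with ⟨rfl, rfl⟩ | h | ⟨a, b, c, d, hx, hy, hab, hcd, h3⟩
  · exact Or.inl rfl
  · exact Or.inr (Or.inl (isUnit_mk h))
  · refine Or.inr (Or.inr (hsplit ⟨a, b⟩ ⟨c, d⟩ (isUnit_mk hab) (isUnit_mk hcd) ?_ ?_))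
    · rw [norm_apply]; exact h3
    · exact QuadraticAlgebra.ext hx hy

end EisensteinInt

theorem Matrix.SpecialLinearGroup.inv_mul_one_zero {R : Type*} [CommRing R] (A B : SL(2, R)) :
    (A⁻¹ * B) 1 0 = A 0 0 * B 1 0 - A 1 0 * B 0 0 := by
  rw [SpecialLinearGroup.coe_mul, SpecialLinearGroup.SL2_inv_expl, mul_apply, Fin.sum_univ_two]
  simp
  ring

theorem Matrix.SpecialLinearGroup.mul_one_zero {R : Type*} [CommRing R] (A B : SL(2, R)) :
    (A * B) 1 0 = A 1 0 * B 0 0 + A 1 1 * B 1 0 := by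
  rw [SpecialLinearGroup.coe_mul, mul_apply, Fin.sum_univ_two]

theorem norm_mul_one_zero (A : SL(2, 𝓔)) {K : SL(2, 𝓔)} (hK : K 1 0 = 0) : ((A * K) 1 0).norm = (A 1 0).norm := by
  have h : K 0 0 * K 1 1 = 1 := by
    have := K.det_coe
    rw [det_fin_two, hK, mul_zero, sub_zero] at this
    exact this
  rw [SpecialLinearGroup.mul_one_zero, hK, mul_zero, add_zero]
  exact EisensteinInt.norm_mul_of_isUnit (IsUnit.of_mul_eq_one _ h) _

/-- A group acting on the Farey complex of the Eisenstein integers, together with candidates `P` for the stabilizer of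
infinity and `Z` for the set of elements moving infinity to an adjacent vertex. -/
structure FareyData {E : Type*} [Group E] (θ : E →* SL(2, 𝓔)) (P : Subgroup E) (Z : Set E) : Prop where
  stab : ∀ p ∈ P, θ p 1 0 = 0
  mul_left : ∀ p ∈ P, ∀ z ∈ Z, p * z ∈ Z
  mul_right : ∀ z ∈ Z, ∀ p ∈ P, z * p ∈ Z
  inv_mem : ∀ z ∈ Z, z⁻¹ ∈ Z
  isUnit : ∀ z ∈ Z, IsUnit (θ z 1 0)
  exists_over : ∀ n : 𝓔, ∃ z ∈ Z, θ z 0 0 = n * θ z 1 0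
  unique : ∀ z ∈ Z, ∀ z' ∈ Z, θ (z⁻¹ * z') 1 0 = 0 → z⁻¹ * z' ∈ P
  triangle : ∀ z ∈ Z, ∀ z' ∈ Z, IsUnit (θ (z⁻¹ * z') 1 0) → z⁻¹ * z' ∈ Z
  closure : Subgroup.closure ((P : Set E) ∪ Z) = ⊤

namespace FareyData

variable {E : Type*} [Group E] {θ : E →* SL(2, 𝓔)} {P : Subgroup E} {Z : Set E}

/-- Elements reached from infinity by a path with increasing denominators. -/
inductive Ascending (θ : E →* SL(2, 𝓔)) (P : Subgroup E) (Z : Set E) : E → Prop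
  | base (p : E) (hp : p ∈ P) : Ascending θ P Z p
  | step (x z : E) (hx : Ascending θ P Z x) (hz : z ∈ Z) (h : (θ x 1 0).norm < (θ (x * z) 1 0).norm) :
    Ascending θ P Z (x * z)

theorem norm_eq {x y : E} (h : θ (x⁻¹ * y) 1 0 = 0) : (θ y 1 0).norm = (θ x 1 0).norm := by
  have := norm_mul_one_zero (θ x) h
  rwa [← map_mul, mul_inv_cancel_left] at this

theorem inv_eq_zero {x y : E} (h : θ (x⁻¹ * y) 1 0 = 0) : θ (y⁻¹ * x) 1 0 = 0 := by
  have h1 : y⁻¹ * x = (x⁻¹ * y)⁻¹ := by group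
  rw [h1, map_inv, SpecialLinearGroup.SL2_inv_expl]
  simpa using h

theorem isUnit_mul {w x y : E} (h : θ (x⁻¹ * y) 1 0 = 0) (hu : IsUnit (θ (w⁻¹ * x) 1 0)) :
    IsUnit (θ (w⁻¹ * y) 1 0) := by
  have h1 := norm_mul_one_zero (θ (w⁻¹ * x)) h
  rw [← map_mul, mul_assoc, mul_inv_cancel_left] at h1
  rw [EisensteinInt.isUnit_iff, h1]
  exact EisensteinInt.isUnit_iff.1 hu

theorem isUnit_inv {x y : E} (hu : IsUnit (θ (x⁻¹ * y) 1 0)) : IsUnit (θ (y⁻¹ * x) 1 0) := by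
  have h1 : y⁻¹ * x = (x⁻¹ * y)⁻¹ := by group
  rw [h1, map_inv, SpecialLinearGroup.SL2_inv_expl]
  simpa using hu

theorem trans_eq_zero {x y w : E} (h : θ (x⁻¹ * y) 1 0 = 0) (h' : θ (y⁻¹ * w) 1 0 = 0) : θ (x⁻¹ * w) 1 0 = 0 := by
  have h1 := norm_mul_one_zero (θ (x⁻¹ * y)) h'
  rw [← map_mul, mul_assoc, mul_inv_cancel_left, h] at h1
  exact EisensteinInt.norm_eq_zero.1 (by simpa using h1)

/-- The neighbours of a vertex are indexed by the Eisenstein integers. -/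
theorem exists_index {x y : E} (h : IsUnit (θ (x⁻¹ * y) 1 0)) : ∃ n : 𝓔, θ (x⁻¹ * y) 0 0 = n * θ (x⁻¹ * y) 1 0 := by
  obtain ⟨u, hu⟩ := h
  exact ⟨θ (x⁻¹ * y) 0 0 * (u⁻¹ : 𝓔ˣ), by rw [← hu]; simp⟩

theorem norm_of_index {x y : E} {n : 𝓔} (hu : IsUnit (θ (x⁻¹ * y) 1 0))
    (h : θ (x⁻¹ * y) 0 0 = n * θ (x⁻¹ * y) 1 0) : (θ y 1 0).norm = (θ x 1 1 + n * θ x 1 0).norm := by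
  have h1 := SpecialLinearGroup.mul_one_zero (θ x) (θ (x⁻¹ * y))
  rw [← map_mul, mul_inv_cancel_left, h] at h1
  rw [h1, ← EisensteinInt.norm_mul_of_isUnit hu (θ x 1 1 + n * θ x 1 0)]
  congr 1
  ring

theorem lowerLeft_of_index {x y y' : E} {n n' : 𝓔} (h : θ (x⁻¹ * y) 0 0 = n * θ (x⁻¹ * y) 1 0)
    (h' : θ (x⁻¹ * y') 0 0 = n' * θ (x⁻¹ * y') 1 0) :
    θ (y⁻¹ * y') 1 0 = (n - n') * (θ (x⁻¹ * y) 1 0 * θ (x⁻¹ * y') 1 0) := by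
  have h1 : y⁻¹ * y' = (x⁻¹ * y)⁻¹ * (x⁻¹ * y') := by group
  rw [h1, map_mul, map_inv, SpecialLinearGroup.inv_mul_one_zero, h, h']
  ring

/-- Uniqueness of ascending lifts below a given height. -/
def UniqueBelow (θ : E →* SL(2, 𝓔)) (P : Subgroup E) (Z : Set E) (m : ℤ) : Prop :=
  ∀ x y, Ascending θ P Z x → Ascending θ P Z y → (θ x 1 0).norm < m → θ (x⁻¹ * y) 1 0 = 0 → x⁻¹ * y ∈ P

theorem exists_lift (D : FareyData θ P Z) {x y : E} (h : IsUnit (θ (x⁻¹ * y) 1 0)) : ∃ z ∈ Z, θ ((x * z)⁻¹ * y) 1 0 = 0 := by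
  obtain ⟨u, hu⟩ := h
  obtain ⟨z, hz, hn⟩ := D.exists_over (θ (x⁻¹ * y) 0 0 * (u⁻¹ : 𝓔ˣ))
  refine ⟨z, hz, ?_⟩
  have h1 : (x * z)⁻¹ * y = z⁻¹ * (x⁻¹ * y) := by group
  rw [h1, map_mul, map_inv, SpecialLinearGroup.inv_mul_one_zero, hn, ← hu]
  linear_combination θ (x⁻¹ * y) 0 0 * θ z 1 0 * u.inv_mul

theorem Ascending.mul_right (D : FareyData θ P Z) {x p : E} (hx : Ascending θ P Z x) (hp : p ∈ P) : Ascending θ P Z (x * p) := by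
  cases hx with
  | base q hq => exact .base _ (P.mul_mem hq hp)
  | step y z hy hz h =>
    rw [mul_assoc] at *
    refine .step y (z * p) hy (D.mul_right z hz p hp) ?_
    rw [← mul_assoc, map_mul, norm_mul_one_zero _ (D.stab p hp)]
    exact h

/-- Every vertex is reached by an ascending path. -/
theorem exists_ascending (D : FareyData θ P Z) (x : E) : ∃ y, Ascending θ P Z y ∧ θ (x⁻¹ * y) 1 0 = 0 := by
  induction hm : (θ x 1 0).norm.toNat using Nat.strong_induction_on generalizing x with
  | _ m ih =>
    by_cases h0 : θ x 1 0 = 0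
    · refine ⟨1, .base 1 P.one_mem, ?_⟩
      rw [mul_one, map_inv, SpecialLinearGroup.SL2_inv_expl]
      simpa using h0
    obtain ⟨n, hn⟩ := EisensteinInt.exists_norm_sub_mul_lt (θ x 1 1) (θ x 1 0) h0
    obtain ⟨z, hz, hzn⟩ := D.exists_over (-n)
    have hu : IsUnit (θ (x⁻¹ * (x * z)) 1 0) := by rw [inv_mul_cancel_left]; exact D.isUnit z hz
    have hlt : (θ (x * z) 1 0).norm < (θ x 1 0).norm := by
      rw [norm_of_index hu (n := -n) (by rwa [inv_mul_cancel_left])]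
      rwa [neg_mul, ← sub_eq_add_neg]
    obtain ⟨y, hy, hxy⟩ := ih _ (by
      have := EisensteinInt.norm_nonneg (θ (x * z) 1 0)
      omega) (x * z) rfl
    obtain ⟨z', hz', hyz⟩ := D.exists_lift (isUnit_inv (isUnit_mul hxy hu))
    refine ⟨y * z', .step y z' hy hz' ?_, inv_eq_zero hyz⟩
    rw [norm_eq (inv_eq_zero hyz), norm_eq hxy]
    exact hlt

theorem adjacent_of_lt (D : FareyData θ P Z) {m : ℤ} (hm : UniqueBelow θ P Z m) {x y : E} (hx : Ascending θ P Z x)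
    (hy : Ascending θ P Z y) (hym : (θ y 1 0).norm < m) (hxy : (θ x 1 0).norm < (θ y 1 0).norm)
    (hu : IsUnit (θ (x⁻¹ * y) 1 0)) : x⁻¹ * y ∈ Z := by
  obtain ⟨z, hz, hzy⟩ := D.exists_lift hu
  have hn := norm_eq hzy
  have hasc : Ascending θ P Z (x * z) := .step x z hx hz (by rwa [← hn])
  have h1 := hm _ _ hasc hy (by rwa [← hn]) hzy
  have h2 : x⁻¹ * y = z * ((x * z)⁻¹ * y) := by group
  rw [h2]
  exact D.mul_right z hz _ h1

theorem adjacent (D : FareyData θ P Z) {m : ℤ} (hm : UniqueBelow θ P Z m) {x y : E} (hx : Ascending θ P Z x)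
    (hy : Ascending θ P Z y) (hxm : (θ x 1 0).norm < m) (hym : (θ y 1 0).norm < m)
    (hu : IsUnit (θ (x⁻¹ * y) 1 0)) : x⁻¹ * y ∈ Z := by
  rcases lt_trichotomy (θ x 1 0).norm (θ y 1 0).norm with h | h | h
  · exact D.adjacent_of_lt hm hx hy hym h hu
  · obtain ⟨n, hn⟩ := exists_index hu
    have hyn := norm_of_index hu hn
    have hx0 : θ x 1 0 ≠ 0 := by
      intro h0
      have hy0 : θ y 1 0 = 0 := EisensteinInt.norm_eq_zero.1 (by rw [← h, h0]; simp)
      rw [map_mul, map_inv, SpecialLinearGroup.inv_mul_one_zero, hy0, h0] at hu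
      simp at hu
    obtain ⟨u, hu', hlt⟩ := EisensteinInt.exists_unit_norm_add_lt hx0 (hyn.symm.trans h.symm)
    obtain ⟨z, hz, hzn⟩ := D.exists_over (n + u)
    obtain ⟨w, hw, hxw⟩ := D.exists_ascending (x * z)
    have hxz : x⁻¹ * (x * z) = z := by group
    have hzu : IsUnit (θ (x⁻¹ * (x * z)) 1 0) := by rw [hxz]; exact D.isUnit z hz
    have hzn' : θ (x⁻¹ * (x * z)) 0 0 = (n + u) * θ (x⁻¹ * (x * z)) 1 0 := by rwa [hxz]
    have hwlt : (θ w 1 0).norm < (θ x 1 0).norm := by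
      rw [norm_eq hxw, norm_of_index hzu hzn']
      convert hlt using 2
      ring
    have hu1 : IsUnit (θ (w⁻¹ * x) 1 0) := isUnit_inv (isUnit_mul hxw hzu)
    have hu2 : IsUnit (θ (w⁻¹ * y) 1 0) := by
      refine isUnit_inv (isUnit_mul hxw ?_)
      rw [lowerLeft_of_index hn hzn', sub_add_cancel_left]
      exact hu'.neg.mul (hu.mul hzu)
    have a1 := D.adjacent_of_lt hm hw hx hxm hwlt hu1
    have a2 := D.adjacent_of_lt hm hw hy hym (h ▸ hwlt) hu2
    have h3 : x⁻¹ * y = (w⁻¹ * x)⁻¹ * (w⁻¹ * y) := by group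
    rw [h3] at hu ⊢
    exact D.triangle _ a1 _ a2 hu
  · have := D.inv_mem _ (D.adjacent_of_lt hm hy hx hxm h (isUnit_inv hu))
    rwa [mul_inv_rev, inv_inv] at this

theorem mem_of_adjacent (D : FareyData θ P Z) {x y w w' : E} (hwx : w⁻¹ * x ∈ Z) (hwy : w'⁻¹ * y ∈ Z)
    (hww : w⁻¹ * w' ∈ Z) (h : θ (x⁻¹ * y) 1 0 = 0) : x⁻¹ * y ∈ P := by
  have h1 : w'⁻¹ * x = (w⁻¹ * w')⁻¹ * (w⁻¹ * x) := by group
  have h2 : w'⁻¹ * x ∈ Z := by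
    rw [h1]
    apply D.triangle _ hww _ hwx
    rw [← h1]
    exact isUnit_mul (inv_eq_zero h) (D.isUnit _ hwy)
  have h3 : x⁻¹ * y = (w'⁻¹ * x)⁻¹ * (w'⁻¹ * y) := by group
  rw [h3] at h ⊢
  exact D.unique _ h2 _ hwy h

theorem uniqueBelow (D : FareyData θ P Z) (m : ℕ) : UniqueBelow θ P Z m := by
  induction m with
  | zero => intro x y _ _ h; have := EisensteinInt.norm_nonneg (θ x 1 0); omega
  | succ m ih =>
    intro x y hx hy hxm hxy
    have hnorm := norm_eq hxy
    have hz : ∀ p ∈ P, (θ p 1 0).norm = 0 := fun p hp => by rw [D.stab p hp]; simp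
    cases hx with
    | base p hp =>
      cases hy with
      | base q hq => exact P.mul_mem (P.inv_mem hp) hq
      | step y z hy hz' h =>
        have := EisensteinInt.norm_nonneg (θ y 1 0)
        have := hz _ hp
        omega
    | step w z hw hz₁ hwx =>
      set x := w * z with hxdef
      cases hy with
      | base q hq =>
        have := EisensteinInt.norm_nonneg (θ w 1 0)
        have := hz _ hq
        omega
      | step w' z' hw' hz₂ hwy =>
        set y := w' * z' with hydef
        have hwx' : w⁻¹ * x ∈ Z := by rw [hxdef, inv_mul_cancel_left]; exact hz₁
        have hwy' : w'⁻¹ * y ∈ Z := by rw [hydef, inv_mul_cancel_left]; exact hz₂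
        have hum : (θ w 1 0).norm < m := by omega
        have hum' : (θ w' 1 0).norm < m := by omega
        have hu1 : IsUnit (θ (x⁻¹ * w) 1 0) := isUnit_inv (D.isUnit _ hwx')
        have hu2 : IsUnit (θ (x⁻¹ * w') 1 0) := isUnit_inv (isUnit_mul (inv_eq_zero hxy) (D.isUnit _ hwy'))
        obtain ⟨n, hn⟩ := exists_index hu1
        obtain ⟨n', hn'⟩ := exists_index hu2
        have hl1 := norm_of_index hu1 hn
        have hl2 := norm_of_index hu2 hn'
        have e2 : θ x 1 1 + n' * θ x 1 0 = (θ x 1 1 + n * θ x 1 0) + (n' - n) * θ x 1 0 := by ring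
        rw [hl1] at hwx
        rw [hl2, hnorm, e2] at hwy
        rcases EisensteinInt.exists_intermediate hwx hwy with h0 | hk | ⟨u, hu, hku, hlt⟩
        · have hww : θ (w⁻¹ * w') 1 0 = 0 := by
            rw [lowerLeft_of_index hn hn', sub_eq_zero.2 (sub_eq_zero.1 h0).symm, zero_mul]
          have hp := ih w w' hw hw' hum hww
          have h2 : w'⁻¹ * x ∈ Z := by
            have : w'⁻¹ * x = (w⁻¹ * w')⁻¹ * (w⁻¹ * x) := by group
            rw [this]
            exact D.mul_left _ (P.inv_mem hp) _ hwx'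
          have h3 : x⁻¹ * y = (w'⁻¹ * x)⁻¹ * (w'⁻¹ * y) := by group
          rw [h3] at hxy ⊢
          exact D.unique _ h2 _ hwy' hxy
        · refine D.mem_of_adjacent hwx' hwy' (D.adjacent ih hw hw' hum hum' ?_) hxy
          rw [lowerLeft_of_index hn hn', ← neg_sub n' n]
          exact hk.neg.mul (hu1.mul hu2)
        · obtain ⟨z₃, hz₃, hzn⟩ := D.exists_over (n + u)
          obtain ⟨v, hv, hxv⟩ := D.exists_ascending (x * z₃)
          have hxz : x⁻¹ * (x * z₃) = z₃ := by group
          have hzu : IsUnit (θ (x⁻¹ * (x * z₃)) 1 0) := by rw [hxz]; exact D.isUnit _ hz₃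
          have hzn' : θ (x⁻¹ * (x * z₃)) 0 0 = (n + u) * θ (x⁻¹ * (x * z₃)) 1 0 := by rwa [hxz]
          have hvlt : (θ v 1 0).norm < (θ x 1 0).norm := by
            rw [norm_eq hxv, norm_of_index hzu hzn']
            convert hlt using 2
            ring
          have hvm : (θ v 1 0).norm < m := by omega
          have a1 : w⁻¹ * v ∈ Z := by
            refine D.adjacent ih hw hv hum hvm (isUnit_mul hxv ?_)
            rw [lowerLeft_of_index hn hzn', sub_add_cancel_left]
            exact hu.neg.mul (hu1.mul hzu)
          have a2 : v⁻¹ * w' ∈ Z := by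
            refine D.adjacent ih hv hw' hvm hum' (isUnit_inv (isUnit_mul hxv ?_))
            rw [lowerLeft_of_index hn' hzn', ← sub_sub]
            exact hku.mul (hu2.mul hzu)
          obtain ⟨z₄, hz₄, hvz⟩ := D.exists_lift (isUnit_inv (isUnit_mul hxv hzu))
          have hvz' : v⁻¹ * (v * z₄) ∈ Z := by rw [inv_mul_cancel_left]; exact hz₄
          have p1 := D.mem_of_adjacent hwx' hvz' a1 (inv_eq_zero hvz)
          have p2 := D.mem_of_adjacent hvz' hwy' a2 (trans_eq_zero hvz hxy)
          have : x⁻¹ * y = (x⁻¹ * (v * z₄)) * ((v * z₄)⁻¹ * y) := by group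
          rw [this]
          exact P.mul_mem p1 p2

theorem unique_ascending (D : FareyData θ P Z) {x y : E} (hx : Ascending θ P Z x) (hy : Ascending θ P Z y)
    (h : θ (x⁻¹ * y) 1 0 = 0) : x⁻¹ * y ∈ P :=
  D.uniqueBelow ((θ x 1 0).norm.toNat + 1) x y hx hy (by omega) h

theorem ascending_mul (D : FareyData θ P Z) {x z : E} (hx : Ascending θ P Z x) (hz : z ∈ Z) : Ascending θ P Z (x * z) := by
  obtain ⟨y, hy, hxy⟩ := D.exists_ascending (x * z)
  have hu : IsUnit (θ (x⁻¹ * y) 1 0) := isUnit_mul hxy (by rw [inv_mul_cancel_left]; exact D.isUnit z hz)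
  have hadj : x⁻¹ * y ∈ Z := by
    refine D.adjacent (m := ((θ x 1 0).norm.toNat + (θ y 1 0).norm.toNat + 1 : ℕ)) (D.uniqueBelow _) hx hy ?_ ?_ hu
    · push_cast; omega
    · push_cast; omega
  have h1 : z⁻¹ * (x⁻¹ * y) ∈ P := by
    apply D.unique z hz _ hadj
    have : z⁻¹ * (x⁻¹ * y) = (x * z)⁻¹ * y := by group
    rwa [this]
  have h2 : x * z = y * (z⁻¹ * (x⁻¹ * y))⁻¹ := by group
  rw [h2]
  exact Ascending.mul_right D hy (P.inv_mem h1)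

theorem ascending (D : FareyData θ P Z) (x : E) : Ascending θ P Z x := by
  have hx : x ∈ Subgroup.closure ((P : Set E) ∪ Z) := by rw [D.closure]; trivial
  induction hx using Subgroup.closure_induction_right with
  | one => exact .base 1 P.one_mem
  | mul_right x _ y hy ih =>
    rcases hy with hy | hy
    · exact Ascending.mul_right D ih hy
    · exact D.ascending_mul ih hy
  | mul_inv_cancel x _ y hy ih =>
    rcases hy with hy | hy
    · exact Ascending.mul_right D ih (P.inv_mem hy)
    · exact D.ascending_mul ih (D.inv_mem y hy)

/-- The stabilizer of infinity is as expected. -/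
theorem mem_of_lowerLeft_eq_zero (D : FareyData θ P Z) {x : E} (h : θ x 1 0 = 0) : x ∈ P := by
  have := D.unique_ascending (.base 1 P.one_mem) (D.ascending x) (by rwa [inv_one, one_mul])
  rwa [inv_one, one_mul] at this

end FareyData

open Matrix.SpecialLinearGroup (SL2_inv_expl coe_mul inv_mul_one_zero mul_one_zero)

section SisterGroup

/-- The free group of rank two. -/
abbrev FreeGroupTwo : Type := FreeGroup (Fin 2)

namespace FreeGroupTwo

/-- The first generator. -/
abbrev gen₀ : FreeGroupTwo := FreeGroup.of 0
/-- The second generator. -/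
abbrev gen₁ : FreeGroupTwo := FreeGroup.of 1

/-- The monodromy automorphism. -/
def monodromy : MulAut FreeGroupTwo :=
  MonoidHom.toMulEquiv
    (FreeGroup.lift ![gen₀ * gen₁ * gen₀⁻¹, gen₁⁻¹ * gen₁⁻¹ * gen₁⁻¹ * gen₀⁻¹])
    (FreeGroup.lift ![gen₀⁻¹ * gen₀⁻¹ * gen₀⁻¹ * gen₁⁻¹, gen₁ * gen₀ * gen₁⁻¹])
    (by ext i; fin_cases i <;> simp [mul_assoc])
    (by ext i; fin_cases i <;> simp [mul_assoc])

theorem monodromy_gen₀ : monodromy gen₀ = gen₀ * gen₁ * gen₀⁻¹ := by simp [monodromy, MonoidHom.toMulEquiv]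

theorem monodromy_gen₁ : monodromy gen₁ = gen₁⁻¹ * gen₁⁻¹ * gen₁⁻¹ * gen₀⁻¹ := by simp [monodromy, MonoidHom.toMulEquiv]

theorem eq_top_of_gen_mem {S : Subgroup FreeGroupTwo} (h0 : gen₀ ∈ S) (h1 : gen₁ ∈ S) : S = ⊤ :=
  (Subgroup.eq_top_iff' S).2 fun w => by
    induction w using FreeGroup.induction_on with
    | C1 => exact S.one_mem
    | of i => fin_cases i; exacts [h0, h1]
    | inv_of i h => exact S.inv_mem h
    | mul x y hx hy => exact S.mul_mem hx hy

end FreeGroupTwo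

open FreeGroupTwo

/-- The mapping torus of the monodromy. -/
abbrev SisterGroup : Type := FreeGroupTwo ⋊[zpowersHom (MulAut FreeGroupTwo) monodromy] Multiplicative ℤ

namespace SisterGroup

/-- The first generator of the fibre. -/
def a : SisterGroup := SemidirectProduct.inl gen₀
/-- The second generator of the fibre. -/
def b : SisterGroup := SemidirectProduct.inl gen₁
/-- The stable letter. -/
def t : SisterGroup := SemidirectProduct.inr (ofAdd 1)
/-- The boundary of the fibre. -/
def c : SisterGroup := a * b * a⁻¹ * b⁻¹

theorem t_mul_inl (f : FreeGroupTwo) : t * SemidirectProduct.inl f = SemidirectProduct.inl (monodromy f) * t := by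
  have := SemidirectProduct.inl_aut (φ := zpowersHom (MulAut FreeGroupTwo) monodromy) (ofAdd 1) f
  rw [show (zpowersHom (MulAut FreeGroupTwo) monodromy) (ofAdd 1) f = monodromy f by simp] at this
  rw [this, t, map_inv, inv_mul_cancel_right]

theorem t_mul_a : t * a = a * b * a⁻¹ * t := by rw [a, t_mul_inl, monodromy_gen₀]; simp [b]

theorem t_mul_b : t * b = b⁻¹ * b⁻¹ * b⁻¹ * a⁻¹ * t := by rw [b, t_mul_inl, monodromy_gen₁]; simp [a]

section Identities

variable {G : Type*} [Group G] {a b t : G}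

/-- Rules for moving the stable letter to the right. -/
theorem moves (ha : t * a = a * b * a⁻¹ * t) (hb : t * b = b⁻¹ * b⁻¹ * b⁻¹ * a⁻¹ * t) :
    t * a⁻¹ = a * b⁻¹ * a⁻¹ * t ∧ t * b⁻¹ = a * b * b * b * t ∧
    t⁻¹ * a = a⁻¹ * a⁻¹ * a⁻¹ * b⁻¹ * t⁻¹ ∧ t⁻¹ * b = b * a * b⁻¹ * t⁻¹ ∧
    t⁻¹ * a⁻¹ = b * a * a * a * t⁻¹ ∧ t⁻¹ * b⁻¹ = b * a⁻¹ * b⁻¹ * t⁻¹ := by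
  have h1 : t * a * t⁻¹ = a * b * a⁻¹ := by rw [ha]; group
  have h2 : t * b * t⁻¹ = b⁻¹ * b⁻¹ * b⁻¹ * a⁻¹ := by rw [hb]; group
  have h3 : t * (b * a * b⁻¹) * t⁻¹ = b := by
    calc t * (b * a * b⁻¹) * t⁻¹ = (t * b * t⁻¹) * (t * a * t⁻¹) * (t * b * t⁻¹)⁻¹ := by group
      _ = b := by rw [h1, h2]; group
  have h4 : t * (a⁻¹ * a⁻¹ * a⁻¹ * b⁻¹) * t⁻¹ = a := by
    calc t * (a⁻¹ * a⁻¹ * a⁻¹ * b⁻¹) * t⁻¹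
        = (t * a * t⁻¹)⁻¹ * (t * a * t⁻¹)⁻¹ * (t * a * t⁻¹)⁻¹ * (t * b * t⁻¹)⁻¹ := by group
      _ = a := by rw [h1, h2]; group
  refine ⟨?_, ?_, ?_, ?_, ?_, ?_⟩
  · calc t * a⁻¹ = (t * a * t⁻¹)⁻¹ * t := by group
      _ = _ := by rw [h1]; group
  · calc t * b⁻¹ = (t * b * t⁻¹)⁻¹ * t := by group
      _ = _ := by rw [h2]; simp only [mul_inv_rev, inv_inv, mul_assoc]
  · nth_rw 1 [← h4]; group
  · nth_rw 1 [← h3]; group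
  · calc t⁻¹ * a⁻¹ = t⁻¹ * (t * (a⁻¹ * a⁻¹ * a⁻¹ * b⁻¹) * t⁻¹)⁻¹ := by rw [h4]
      _ = _ := by simp only [mul_inv_rev, inv_inv, mul_assoc, inv_mul_cancel_left]
  · calc t⁻¹ * b⁻¹ = t⁻¹ * (t * (b * a * b⁻¹) * t⁻¹)⁻¹ := by rw [h3]
      _ = _ := by group

/-- The identities behind the triangles of the Farey complex. -/
theorem triangles (ha : t * a = a * b * a⁻¹ * t) (hb : t * b = b⁻¹ * b⁻¹ * b⁻¹ * a⁻¹ * t) {c : G}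
    (hc : c = a * b * a⁻¹ * b⁻¹) :
    t * c = c * t ∧ (a⁻¹ * b⁻¹)⁻¹ * b⁻¹ = c⁻¹ * a ∧ (a⁻¹ * b⁻¹)⁻¹ * (t⁻¹ * b⁻¹) = c⁻¹ * t * a * (c * (t⁻¹ * t⁻¹)) ∧
    (a⁻¹ * b⁻¹)⁻¹ * (t⁻¹ * (a * b)) = t⁻¹ * b⁻¹ ∧ (a⁻¹ * b⁻¹)⁻¹ * (c⁻¹ * t * (a * b)) = c⁻¹ * b⁻¹ * (c⁻¹ * t) ∧
    (a⁻¹ * b⁻¹)⁻¹ * a = t⁻¹ * (a⁻¹ * b⁻¹) * (c⁻¹ * t) ∧ (a⁻¹ * b⁻¹)⁻¹ * (c⁻¹ * t * a) = c⁻¹ * t * (a⁻¹ * b⁻¹) ∧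
    (b⁻¹)⁻¹ * a = c⁻¹ * (a * b) ∧ (b⁻¹)⁻¹ * (c⁻¹ * (t * t) * a) = c⁻¹ * t * (a * b) * t ∧
    (b⁻¹)⁻¹ * (a * b) = c⁻¹ * t * (a⁻¹ * b⁻¹) * t⁻¹ ∧ (b⁻¹)⁻¹ * (c⁻¹ * t * (a * b)) = a⁻¹ * b⁻¹ * (c⁻¹ * t) ∧
    a⁻¹ * (a * b) = c⁻¹ * t * a * t⁻¹ ∧ a⁻¹ * (t⁻¹ * (a * b)) = t⁻¹ * a ∧
    (a⁻¹ * b⁻¹)⁻¹ = c⁻¹ * (a * b) ∧ (b⁻¹)⁻¹ = c⁻¹ * t * a * t⁻¹ := by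
  obtain ⟨m1, m2, m3, m4, m5, m6⟩ := moves ha hb
  have k : ∀ {x y z : G}, x * y = z → ∀ w, x * (y * w) = z * w := fun h w => by rw [← mul_assoc, h]
  have k1 := k ha
  have k2 := k hb
  have k3 := k m1
  have k4 := k m2
  have k5 := k m3
  have k6 := k m4
  have k7 := k m5
  have k8 := k m6
  subst hc
  refine ⟨?_, ?_, ?_, ?_, ?_, ?_, ?_, ?_, ?_, ?_, ?_, ?_, ?_, ?_, ?_⟩ <;>
  simp only [mul_assoc, mul_inv_rev, inv_inv, ha, hb, m2, m3, m4, m6, k1, k2, k3, k4, k5, k6, k7, k8,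
    inv_mul_cancel_left, mul_inv_cancel_left, inv_mul_cancel, mul_inv_cancel, mul_one]

end Identities

theorem commute_c_t : Commute c t := (triangles t_mul_a t_mul_b (c := c) rfl).1.symm

/-- The peripheral subgroup. -/
def peripheral : Subgroup SisterGroup :=
  (MonoidHom.noncommCoprod (zpowersHom SisterGroup c) (zpowersHom SisterGroup t)
    fun m n => by simpa using (commute_c_t.zpow_zpow _ _)).range

theorem mem_peripheral {x : SisterGroup} : x ∈ peripheral ↔ ∃ i j : ℤ, x = c ^ i * t ^ j := by
  constructor
  · rintro ⟨⟨i, j⟩, rfl⟩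
    exact ⟨i.toAdd, j.toAdd, by simp⟩
  · rintro ⟨i, j, rfl⟩
    exact ⟨(ofAdd i, ofAdd j), by simp⟩

/-- The matrix of the first generator. -/
def matA : SL(2, 𝓔) := ⟨!![1, ⟨0, -1⟩; ⟨0, -1⟩, ⟨0, -1⟩], by rw [det_fin_two_of]; rfl⟩
/-- The matrix of the second generator. -/
def matB : SL(2, 𝓔) := ⟨!![1, ⟨0, 1⟩; ⟨0, 1⟩, ⟨0, -1⟩], by rw [det_fin_two_of]; rfl⟩
/-- Translations. -/
def translation (x : 𝓔) : SL(2, 𝓔) := ⟨!![1, x; 0, 1], by rw [det_fin_two_of]; simp⟩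

theorem translation_add (x y : 𝓔) : translation (x + y) = translation x * translation y := by
  refine Subtype.ext (Matrix.ext fun i j => ?_)
  rw [coe_mul]
  fin_cases i <;> fin_cases j <;> simp [translation, add_comm]

theorem matrix_relation₀ : translation 2 * matA = matA * matB * matA⁻¹ * translation 2 := by
  rw [eq_comm, ← eq_mul_inv_iff_mul_eq]
  apply Subtype.ext
  simp only [SL2_inv_expl]
  decide

theorem matrix_relation₁ : translation 2 * matB = matB⁻¹ * matB⁻¹ * matB⁻¹ * matA⁻¹ * translation 2 := by
  apply Subtype.ext
  simp only [coe_mul, SL2_inv_expl]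
  decide

theorem map_zpow_apply_eq_conj {G K : Type*} [Group G] [Group K] {F : G →* K} {σ : MulAut G} {x : K}
    (h : ∀ g, F (σ g) = x * F g * x⁻¹) (n : ℤ) (g : G) : F ((σ ^ n) g) = x ^ n * F g * (x ^ n)⁻¹ := by
  let S : Subgroup (MulAut G × K) :=
    { carrier := {s | ∀ g, F (s.1 g) = s.2 * F g * s.2⁻¹}
      one_mem' := fun g => by simp
      mul_mem' := fun {s s'} hs hs' g => by
        change F (s.1 (s'.1 g)) = _
        rw [hs, hs']
        simp [mul_assoc]
      inv_mem' := fun {s} hs g => by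
        have := hs (s.1⁻¹ g)
        rw [MulAut.apply_inv_self] at this
        rw [this]
        simp [mul_assoc] }
  exact S.zpow_mem (x := (σ, x)) h n g

/-- The holonomy representation. -/
def holonomy : SisterGroup →* SL(2, 𝓔) :=
  SemidirectProduct.lift (FreeGroup.lift ![matA, matB]) (zpowersHom _ (translation 2)) (by
    have key : ∀ f, FreeGroup.lift ![matA, matB] (monodromy f) =
        translation 2 * FreeGroup.lift ![matA, matB] f * (translation 2)⁻¹ := by
      intro f
      have : (FreeGroup.lift ![matA, matB]).comp monodromy.toMonoidHom =
          (MulAut.conj (translation 2)).toMonoidHom.comp (FreeGroup.lift ![matA, matB]) := by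
        ext i : 1
        fin_cases i
        · change FreeGroup.lift ![matA, matB] (monodromy gen₀) = translation 2 * FreeGroup.lift ![matA, matB] gen₀ * _
          rw [monodromy_gen₀]
          simpa [eq_mul_inv_iff_mul_eq] using matrix_relation₀.symm
        · change FreeGroup.lift ![matA, matB] (monodromy gen₁) = translation 2 * FreeGroup.lift ![matA, matB] gen₁ * _
          rw [monodromy_gen₁]
          simpa [eq_mul_inv_iff_mul_eq] using matrix_relation₁.symm
      exact DFunLike.congr_fun this f
    intro g
    ext i : 1
    exact map_zpow_apply_eq_conj key g.toAdd _)

theorem holonomy_a : holonomy a = matA := by simp [holonomy, a]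
theorem holonomy_b : holonomy b = matB := by simp [holonomy, b]
theorem holonomy_t : holonomy t = translation 2 := by simp [holonomy, t]
theorem holonomy_c : holonomy c = -translation ⟨4, 2⟩ := by
  rw [c, map_mul, map_mul, map_mul, map_inv, map_inv, holonomy_a, holonomy_b]
  apply Subtype.ext
  simp only [SL2_inv_expl]
  decide

theorem translation_zpow (x : 𝓔) (n : ℤ) : translation x ^ n = translation (n • x) := by
  let f : Multiplicative 𝓔 →* SL(2, 𝓔) :=
    { toFun := fun x => translation x.toAdd
      map_one' := by
        refine Subtype.ext (Matrix.ext fun i j => ?_)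
        fin_cases i <;> fin_cases j <;> simp [translation]
      map_mul' := fun x y => translation_add _ _ }
  exact (map_zpow f (ofAdd x) n).symm

theorem holonomy_peripheral (i j : ℤ) : holonomy (c ^ i * t ^ j) = (-1) ^ i * translation ⟨2 * j + 4 * i, 2 * i⟩ := by
  have h1 : holonomy c = -1 * translation ⟨4, 2⟩ := by rw [holonomy_c, neg_mul, one_mul]
  have h2 : Commute (-1 : SL(2, 𝓔)) (translation ⟨4, 2⟩) := by rw [Commute, SemiconjBy]; simp
  rw [map_mul, map_zpow, map_zpow, h1, h2.mul_zpow, holonomy_t, translation_zpow, translation_zpow, mul_assoc,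
    ← translation_add]
  congr 2
  ext
  · simp; ring
  · simp [im_ofNat]; ring

theorem exists_sign (i : ℤ) : ∃ s : 𝓔, (s = 1 ∨ s = -1) ∧ ∀ A : SL(2, 𝓔), ∀ k l, ((-1) ^ i * A) k l = s * A k l := by
  rcases Int.even_or_odd i with h | h
  · exact ⟨1, Or.inl rfl, fun A k l => by rw [h.neg_one_zpow, one_mul, one_mul]⟩
  · exact ⟨-1, Or.inr rfl, fun A k l => by
      rw [h.neg_one_zpow, neg_mul, one_mul, neg_one_mul]; simp⟩

theorem peripheral_apply (i j : ℤ) : ∃ s : 𝓔, IsUnit s ∧ holonomy (c ^ i * t ^ j) 0 0 = s ∧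
    holonomy (c ^ i * t ^ j) 0 1 = s * ⟨2 * j + 4 * i, 2 * i⟩ ∧ holonomy (c ^ i * t ^ j) 1 0 = 0 ∧
    holonomy (c ^ i * t ^ j) 1 1 = s := by
  obtain ⟨s, hs, h⟩ := exists_sign i
  refine ⟨s, ?_, ?_⟩
  · rcases hs with rfl | rfl
    · exact isUnit_one
    · exact isUnit_one.neg
  · rw [holonomy_peripheral]
    simp only [h]
    simp [translation]

/-- Representatives for the edges at infinity. -/
def edge : Fin 4 → SisterGroup := ![a⁻¹ * b⁻¹, b⁻¹, a, a * b]

/-- The endpoints of the edges at infinity. -/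
def endpoint : Fin 4 → 𝓔 := ![0, 1, ⟨1, 1⟩, ⟨2, 1⟩]

theorem edge_apply (r : Fin 4) : IsUnit (holonomy (edge r) 1 0) ∧
    holonomy (edge r) 0 0 = endpoint r * holonomy (edge r) 1 0 := by
  fin_cases r <;> simp only [edge, endpoint, map_mul, map_inv, holonomy_a, holonomy_b, Fin.reduceFinMk,
      Matrix.cons_val, Fin.zero_eta, Fin.mk_one, Matrix.cons_val_zero, Matrix.cons_val_one,
      SL2_inv_expl, coe_mul, EisensteinInt.isUnit_iff] <;>
    decide

/-- Elements moving infinity to an adjacent vertex. -/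
def edges : Set SisterGroup := {z | ∃ r, ∃ p ∈ peripheral, ∃ q ∈ peripheral, z = p * edge r * q}

theorem edges_apply (i j : ℤ) (r : Fin 4) {q : SisterGroup} (hq : q ∈ peripheral) :
    IsUnit (holonomy (c ^ i * t ^ j * edge r * q) 1 0) ∧ holonomy (c ^ i * t ^ j * edge r * q) 0 0 =
      (endpoint r + ⟨2 * j + 4 * i, 2 * i⟩) * holonomy (c ^ i * t ^ j * edge r * q) 1 0 := by
  obtain ⟨k, l, rfl⟩ := mem_peripheral.1 hq
  obtain ⟨s, hs, h1, h2, h3, h4⟩ := peripheral_apply i j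
  obtain ⟨s', hs', h1', h2', h3', h4'⟩ := peripheral_apply k l
  obtain ⟨e1, e2⟩ := edge_apply r
  have g1 : holonomy (c ^ i * t ^ j * edge r * (c ^ k * t ^ l)) 1 0 = s * holonomy (edge r) 1 0 * s' := by
    rw [map_mul, mul_one_zero, h3', h1', map_mul,
      mul_one_zero, h3, h4]
    ring
  have g0 : holonomy (c ^ i * t ^ j * edge r * (c ^ k * t ^ l)) 0 0 =
      s * (holonomy (edge r) 0 0 + ⟨2 * j + 4 * i, 2 * i⟩ * holonomy (edge r) 1 0) * s' := by
    rw [map_mul, map_mul, coe_mul, coe_mul, mul_apply,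
      Fin.sum_univ_two, mul_apply, mul_apply, Fin.sum_univ_two, Fin.sum_univ_two, h1, h2, h1', h3']
    ring
  rw [g0, g1, e2]
  exact ⟨(hs.mul e1).mul hs', by ring⟩

end SisterGroup

end SisterGroup

local notation "𝔠" => (⁅FreeGroupTwo.gen₀, FreeGroupTwo.gen₁⁆ : FreeGroupTwo)

namespace SisterGroup

theorem t_mem_peripheral : t ∈ peripheral := mem_peripheral.2 ⟨0, 1, by simp⟩

theorem mem_edges {z : SisterGroup} (i j : ℤ) (r : Fin 4) (k l : ℤ)
    (h : z = c ^ i * t ^ j * edge r * (c ^ k * t ^ l)) : z ∈ edges :=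
  ⟨r, _, mem_peripheral.2 ⟨i, j, rfl⟩, _, mem_peripheral.2 ⟨k, l, rfl⟩, h⟩

theorem mul_left_mem_edges {p z : SisterGroup} (hp : p ∈ peripheral) (hz : z ∈ edges) : p * z ∈ edges := by
  obtain ⟨r, p', hp', q, hq, rfl⟩ := hz
  exact ⟨r, p * p', peripheral.mul_mem hp hp', q, hq, by group⟩

theorem mul_right_mem_edges {p z : SisterGroup} (hz : z ∈ edges) (hp : p ∈ peripheral) : z * p ∈ edges := by
  obtain ⟨r, p', hp', q, hq, rfl⟩ := hz
  exact ⟨r, p', hp', q * p, peripheral.mul_mem hq hp, by group⟩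

theorem edge_inv_mem (r : Fin 4) : (edge r)⁻¹ ∈ edges := by
  obtain ⟨-, -, -, -, -, -, -, -, -, -, -, -, -, h0, h1⟩ := triangles t_mul_a t_mul_b (c := c) rfl
  fin_cases r
  · exact mem_edges (-1) 0 3 0 0 (h0.trans (by simp [edge]))
  · exact mem_edges (-1) 1 2 0 (-1) (h1.trans (by simp [edge]))
  · refine mem_edges 0 (-1) 1 (-1) 1 ?_
    have : a⁻¹ = t⁻¹ * b⁻¹ * (c⁻¹ * t) := by
      rw [inv_inv] at h1
      rw [h1]; group
    simpa [edge] using this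
  · refine mem_edges 0 0 0 (-1) 0 ?_
    have : (a * b)⁻¹ = (a⁻¹ * b⁻¹) * c⁻¹ := by rw [← inv_inj, inv_inv, mul_inv_rev, h0]; group
    simpa [edge] using this

theorem inv_mem_edges {z : SisterGroup} (hz : z ∈ edges) : z⁻¹ ∈ edges := by
  obtain ⟨r, p, hp, q, hq, rfl⟩ := hz
  have h : (p * edge r * q)⁻¹ = q⁻¹ * ((edge r)⁻¹ * p⁻¹) := by group
  rw [h]
  exact mul_left_mem_edges (peripheral.inv_mem hq) (mul_right_mem_edges (edge_inv_mem r) (peripheral.inv_mem hp))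

theorem edge_triangle_of_le {r r' : Fin 4} (hr : r ≤ r') {i j : ℤ}
    (h : IsUnit (endpoint r' + ⟨2 * j + 4 * i, 2 * i⟩ - endpoint r)) :
    (edge r)⁻¹ * (c ^ i * t ^ j * edge r') ∈ edges := by
  obtain ⟨-, h1, h2, h3, h4, h5, h6, h7, h8, h9, h10, h11, h12, -, -⟩ := triangles t_mul_a t_mul_b (c := c) rfl
  obtain ⟨x, y, hx, hy, hxy⟩ : ∃ x y : ℤ, (endpoint r' + ⟨2 * j + 4 * i, 2 * i⟩ - endpoint r).re = x ∧
      (endpoint r' + ⟨2 * j + 4 * i, 2 * i⟩ - endpoint r).im = y ∧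
      ((x = 1 ∧ y = 0) ∨ (x = -1 ∧ y = 0) ∨ (x = 0 ∧ y = 1) ∨ (x = 0 ∧ y = -1) ∨ (x = 1 ∧ y = 1) ∨
        (x = -1 ∧ y = -1)) := by
    refine ⟨_, _, rfl, rfl, ?_⟩
    rcases EisensteinInt.eq_of_norm_eq_one (EisensteinInt.isUnit_iff.1 h) with h | h | h | h | h | h <;> rw [h] <;>
      simp
  simp only [QuadraticAlgebra.re_sub, QuadraticAlgebra.im_sub, QuadraticAlgebra.re_add, QuadraticAlgebra.im_add] at hx hy
  fin_cases r <;> fin_cases r' <;> first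
    | (exfalso; revert hr; decide)
    | skip
  all_goals simp [endpoint] at hx hy
  · omega
  · have hij : (i = 0 ∧ j = 0) ∨ (i = 0 ∧ j = -1) := by omega
    rcases hij with ⟨rfl, rfl⟩ | ⟨rfl, rfl⟩
    · exact mem_edges (-1) 0 2 0 0 (by simpa [edge] using h1)
    · exact mem_edges (-1) 1 2 1 (-2) (by simpa [edge, zpow_neg, zpow_ofNat, pow_two, mul_assoc] using h2)
  · have hij : (i = 0 ∧ j = 0) ∨ (i = -1 ∧ j = 1) := by omega
    rcases hij with ⟨rfl, rfl⟩ | ⟨rfl, rfl⟩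
    · exact mem_edges 0 (-1) 0 (-1) 1 (by simpa [edge, mul_assoc, pow_two] using h5)
    · exact mem_edges (-1) 1 0 0 0 (by simpa [edge, mul_assoc, pow_two] using h6)
  · have hij : (i = 0 ∧ j = -1) ∨ (i = -1 ∧ j = 1) := by omega
    rcases hij with ⟨rfl, rfl⟩ | ⟨rfl, rfl⟩
    · exact mem_edges 0 (-1) 1 0 0 (by simpa [edge, mul_assoc, pow_two] using h3)
    · exact mem_edges (-1) 0 1 (-1) 1 (by simpa [edge, mul_assoc, pow_two] using h4)
  · omega
  · have hij : (i = 0 ∧ j = 0) ∨ (i = -1 ∧ j = 2) := by omega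
    rcases hij with ⟨rfl, rfl⟩ | ⟨rfl, rfl⟩
    · exact mem_edges (-1) 0 3 0 0 (by simpa [edge, mul_assoc, pow_two] using h7)
    · exact mem_edges (-1) 1 3 0 1 (by simpa [edge, mul_assoc, pow_two] using h8)
  · have hij : (i = 0 ∧ j = 0) ∨ (i = -1 ∧ j = 1) := by omega
    rcases hij with ⟨rfl, rfl⟩ | ⟨rfl, rfl⟩
    · exact mem_edges (-1) 1 0 0 (-1) (by simpa [edge, mul_assoc, pow_two] using h9)
    · exact mem_edges 0 0 0 (-1) 1 (by simpa [edge, mul_assoc, pow_two] using h10)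
  · omega
  · have hij : (i = 0 ∧ j = 0) ∨ (i = 0 ∧ j = -1) := by omega
    rcases hij with ⟨rfl, rfl⟩ | ⟨rfl, rfl⟩
    · exact mem_edges (-1) 1 2 0 (-1) (by simpa [edge, mul_assoc, pow_two] using h11)
    · exact mem_edges 0 (-1) 2 0 0 (by simpa [edge, mul_assoc, pow_two] using h12)
  · omega

theorem edge_triangle {r r' : Fin 4} {i j : ℤ} (h : IsUnit (endpoint r' + ⟨2 * j + 4 * i, 2 * i⟩ - endpoint r)) :
    (edge r)⁻¹ * (c ^ i * t ^ j * edge r') ∈ edges := by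
  rcases le_total r r' with hr | hr
  · exact edge_triangle_of_le hr h
  · have h' : IsUnit (endpoint r + ⟨2 * (-j) + 4 * (-i), 2 * (-i)⟩ - endpoint r') := by
      convert h.neg using 1
      ext <;> simp <;> ring
    have h1 := inv_mem_edges (edge_triangle_of_le hr h')
    convert h1 using 1
    have h2 : c ^ i * t ^ j = t ^ j * c ^ i := commute_c_t.zpow_zpow i j
    rw [h2]
    group

theorem holonomy_inv_mul {z z' : SisterGroup} {n n' : 𝓔} (h : holonomy z 0 0 = n * holonomy z 1 0)
    (h' : holonomy z' 0 0 = n' * holonomy z' 1 0) :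
    holonomy (z⁻¹ * z') 1 0 = (n - n') * (holonomy z 1 0 * holonomy z' 1 0) := by
  rw [map_mul, map_inv, inv_mul_one_zero, h, h']
  ring

theorem exists_inl_mul_t_zpow (x : SisterGroup) : ∃ (f : FreeGroupTwo) (n : ℤ), x = SemidirectProduct.inl f * t ^ n := by
  refine ⟨x.left, x.right.toAdd, ?_⟩
  rw [t, ← map_zpow, ← ofAdd_zsmul]
  simp

theorem inl_mem_of_mem {S : Subgroup SisterGroup} (ha : a ∈ S) (hb : b ∈ S) (f : FreeGroupTwo) :
    SemidirectProduct.inl f ∈ S :=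
  (FreeGroupTwo.eq_top_of_gen_mem (S := S.comap SemidirectProduct.inl) ha hb).ge (Subgroup.mem_top f)

theorem eq_top_of_mem {S : Subgroup SisterGroup} (ha : a ∈ S) (hb : b ∈ S) (ht : t ∈ S) : S = ⊤ := by
  rw [eq_top_iff]
  intro x _
  obtain ⟨f, n, rfl⟩ := exists_inl_mul_t_zpow x
  exact S.mul_mem (inl_mem_of_mem ha hb f) (S.zpow_mem ht _)

theorem closure_eq_top : Subgroup.closure ((peripheral : Set SisterGroup) ∪ edges) = ⊤ := by
  refine eq_top_of_mem (Subgroup.subset_closure (Or.inr (mem_edges 0 0 2 0 0 (by simp [edge])))) ?_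
    (Subgroup.subset_closure (Or.inl t_mem_peripheral))
  rw [← inv_inv b]
  exact Subgroup.inv_mem _ (Subgroup.subset_closure (Or.inr (mem_edges 0 0 1 0 0 (by simp [edge]))))

/-- The action of the sister group on the Farey complex. -/
theorem fareyData : FareyData holonomy peripheral edges where
  stab p hp := by
    obtain ⟨i, j, rfl⟩ := mem_peripheral.1 hp
    obtain ⟨s, -, -, -, h, -⟩ := peripheral_apply i j
    exact h
  mul_left p hp z hz := mul_left_mem_edges hp hz
  mul_right z hz p hp := mul_right_mem_edges hz hp
  inv_mem z hz := inv_mem_edges hz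
  isUnit z hz := by
    obtain ⟨r, p, hp, q, hq, rfl⟩ := hz
    obtain ⟨i, j, rfl⟩ := mem_peripheral.1 hp
    exact (edges_apply i j r hq).1
  exists_over n := by
    obtain ⟨r, i, j, h⟩ : ∃ r i j, endpoint r + ⟨2 * j + 4 * i, 2 * i⟩ = n := by
      obtain ⟨x, y⟩ := n
      rcases Int.even_or_odd' y with ⟨i, rfl | rfl⟩ <;> rcases Int.even_or_odd' x with ⟨k, rfl | rfl⟩
      · exact ⟨0, i, k - 2 * i, by ext <;> simp [endpoint]; ring⟩
      · exact ⟨1, i, k - 2 * i, by ext <;> simp [endpoint]; ring⟩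
      · exact ⟨3, i, k - 1 - 2 * i, by ext <;> simp [endpoint] <;> ring⟩
      · exact ⟨2, i, k - 2 * i, by ext <;> simp [endpoint] <;> ring⟩
    refine ⟨_, mem_edges i j r 0 0 rfl, ?_⟩
    rw [← h]
    exact (edges_apply i j r (mem_peripheral.2 ⟨0, 0, rfl⟩)).2
  unique z hz z' hz' h := by
    obtain ⟨r, p, hp, q, hq, rfl⟩ := hz
    obtain ⟨i, j, rfl⟩ := mem_peripheral.1 hp
    obtain ⟨r', p', hp', q', hq', rfl⟩ := hz'
    obtain ⟨i', j', rfl⟩ := mem_peripheral.1 hp'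
    obtain ⟨hu, hn⟩ := edges_apply i j r hq
    obtain ⟨hu', hn'⟩ := edges_apply i' j' r' hq'
    rw [holonomy_inv_mul hn hn'] at h
    have h0 := sub_eq_zero.1 ((mul_eq_zero.1 h).resolve_right (hu.mul hu').ne_zero)
    have hre := congrArg QuadraticAlgebra.re h0
    have him := congrArg QuadraticAlgebra.im h0
    simp only [QuadraticAlgebra.re_add, QuadraticAlgebra.im_add] at hre him
    have hij : r = r' ∧ i = i' ∧ j = j' := by fin_cases r <;> fin_cases r' <;> simp [endpoint] at hre him ⊢ <;> omega
    obtain ⟨rfl, rfl, rfl⟩ := hij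
    have : (c ^ i * t ^ j * edge r * q)⁻¹ * (c ^ i * t ^ j * edge r * q') = q⁻¹ * q' := by group
    rw [this]
    exact peripheral.mul_mem (peripheral.inv_mem hq) hq'
  triangle z hz z' hz' h := by
    obtain ⟨r, p, hp, q, hq, rfl⟩ := hz
    obtain ⟨i, j, rfl⟩ := mem_peripheral.1 hp
    obtain ⟨r', p', hp', q', hq', rfl⟩ := hz'
    obtain ⟨i', j', rfl⟩ := mem_peripheral.1 hp'
    obtain ⟨hu, hn⟩ := edges_apply i j r hq
    obtain ⟨hu', hn'⟩ := edges_apply i' j' r' hq'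
    rw [holonomy_inv_mul hn hn'] at h
    have h0 := (isUnit_of_mul_isUnit_left h).neg
    have h1 : (edge r)⁻¹ * (c ^ (i' - i) * t ^ (j' - j) * edge r') ∈ edges := by
      apply edge_triangle
      convert h0 using 1
      ext <;> simp <;> ring
    have h2 : (c ^ i * t ^ j)⁻¹ * (c ^ i' * t ^ j') = c ^ (i' - i) * t ^ (j' - j) := by
      have e1 : c ^ (-i) * t ^ (-j) = t ^ (-j) * c ^ (-i) := commute_c_t.zpow_zpow _ _
      have e2 : c ^ i' * t ^ (-j) = t ^ (-j) * c ^ i' := commute_c_t.zpow_zpow _ _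
      calc (c ^ i * t ^ j)⁻¹ * (c ^ i' * t ^ j') = (t ^ (-j) * c ^ (-i)) * c ^ i' * t ^ j' := by group
        _ = c ^ (-i) * (t ^ (-j) * c ^ i') * t ^ j' := by rw [← e1]; group
        _ = c ^ (-i) * (c ^ i' * t ^ (-j)) * t ^ j' := by rw [e2]
        _ = _ := by group
    have h3 : (c ^ i * t ^ j * edge r * q)⁻¹ * (c ^ i' * t ^ j' * edge r' * q') =
        q⁻¹ * (((edge r)⁻¹ * (((c ^ i * t ^ j)⁻¹ * (c ^ i' * t ^ j')) * edge r')) * q') := by group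
    rw [h3, h2]
    exact mul_left_mem_edges (peripheral.inv_mem hq) (mul_right_mem_edges h1 hq')
  closure := closure_eq_top

theorem mem_peripheral_of_holonomy {x : SisterGroup} (h : holonomy x 1 0 = 0) : x ∈ peripheral :=
  fareyData.mem_of_lowerLeft_eq_zero h

theorem eq_one_of_holonomy {x : SisterGroup} (h10 : holonomy x 1 0 = 0) (h01 : holonomy x 0 1 = 0) : x = 1 := by
  obtain ⟨i, j, rfl⟩ := mem_peripheral.1 (mem_peripheral_of_holonomy h10)
  obtain ⟨s, hs, -, h, -⟩ := peripheral_apply i j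
  rw [h] at h01
  have h0 := (mul_eq_zero.1 h01).resolve_left hs.ne_zero
  have hre : 2 * j + 4 * i = 0 := congrArg QuadraticAlgebra.re h0
  have him : 2 * i = 0 := congrArg QuadraticAlgebra.im h0
  obtain ⟨rfl, rfl⟩ : i = 0 ∧ j = 0 := by omega
  simp

end SisterGroup

namespace PGL2

variable {R S : Type*} [CommRing R] [CommRing S]

/-- The determinant modulo squares. -/
def detClass : PGL2 R →* Rˣ ⧸ (powMonoidHom 2 : Rˣ →* Rˣ).range :=
  QuotientGroup.lift _ ((mk' _).comp det) (by
    rw [GeneralLinearGroup.center_eq_range_scalar]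
    rintro _ ⟨u, rfl⟩
    rw [MonoidHom.mem_ker, comp_apply]
    refine (eq_one_iff _).2 ⟨u, ?_⟩
    ext
    simp)

theorem detClass_mk (A : GL (Fin 2) R) : detClass (mk A) = QuotientGroup.mk (det A) := rfl

theorem detClass_mk_eq_one {A : GL (Fin 2) R} : detClass (mk A) = 1 ↔ ∃ u : Rˣ, u ^ 2 = det A := by
  rw [detClass_mk, eq_one_iff]; rfl

/-- The class of a matrix of determinant one. -/
def ofSL : SL(2, R) →* PGL2 R := mk.comp SpecialLinearGroup.toGL

theorem detClass_ofSL (A : SL(2, R)) : detClass (ofSL A) = 1 := by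
  change detClass (mk (SpecialLinearGroup.toGL A)) = 1
  rw [detClass_mk_eq_one]
  exact ⟨1, by ext; simp⟩

theorem exists_ofSL_of_detClass {γ : PGL2 R} (h : detClass γ = 1) : ∃ A : SL(2, R), ofSL A = γ := by
  obtain ⟨A, rfl⟩ := mk_surjective γ
  obtain ⟨u, hu⟩ := detClass_mk_eq_one.1 h
  have hu' : (u : R) ^ 2 = (A : Mat₂ R).det := congrArg Units.val hu
  refine ⟨⟨((u⁻¹ : Rˣ) : R) • (A : Mat₂ R), ?_⟩, ?_⟩
  · rw [Matrix.det_smul, Fintype.card_fin, ← hu', ← Units.val_pow_eq_pow_val, ← Units.val_pow_eq_pow_val,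
      ← Units.val_mul]
    simp
  · exact mk_eq_mk.2 ⟨u⁻¹, rfl⟩

theorem ofSL_eq_one {A : SL(2, R)} : ofSL A = 1 ↔ ∃ u : Rˣ, (A : Mat₂ R) = (u : R) • 1 := mk_eq_one

theorem map_ofSL (f : R →+* S) (A : SL(2, R)) : map f (ofSL A) = ofSL (SpecialLinearGroup.map f A) := by
  change map f (mk _) = mk _
  rw [map_mk]
  congr 1
  exact GeneralLinearGroup.ext fun _ _ => rfl

theorem ofSL_commute {A B : SL(2, R)} (h : Commute (ofSL A) (ofSL B)) :
    ∃ u : R, (A : Mat₂ R) * B = u • (B * A : Mat₂ R) := by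
  have h1 : ofSL (A * B) = ofSL (B * A) := by rw [map_mul, map_mul]; exact h
  obtain ⟨u, hu⟩ := mk_eq_mk.1 h1
  exact ⟨u, hu⟩

end PGL2

theorem EisensteinInt.red_two_eq_zero {x : 𝓔} (h : red 2 x = 0) : ∃ y, x = 2 * y := by
  have h1 : ((x.re : ℤ) : ZMod 2) = 0 := congrArg QuadraticAlgebra.re h
  have h2 : ((x.im : ℤ) : ZMod 2) = 0 := congrArg QuadraticAlgebra.im h
  obtain ⟨m, hm⟩ := (ZMod.intCast_zmod_eq_zero_iff_dvd _ 2).1 h1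
  obtain ⟨n, hn⟩ := (ZMod.intCast_zmod_eq_zero_iff_dvd _ 2).1 h2
  refine ⟨⟨m, n⟩, QuadraticAlgebra.ext ?_ ?_⟩
  · simpa [re_ofNat, im_ofNat] using hm
  · simpa [re_ofNat, im_ofNat] using hn

theorem EisensteinInt.eq_one_or_of_red_two {x : 𝓔} (hx : IsUnit x) (h : red 2 x = 1) : x = 1 ∨ x = -1 := by
  rcases eq_of_norm_eq_one (isUnit_iff.1 hx) with rfl | rfl | rfl | rfl | rfl | rfl
  · exact Or.inl rfl
  · exact Or.inr rfl
  all_goals exact absurd (congrArg QuadraticAlgebra.im h) (by decide)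

/-- Units which are squares modulo four are squares. -/
theorem EisensteinInt.isSquare_of_red_four {x : 𝓔ˣ} (h : ∃ y, y ^ 2 = red 4 x) : ∃ u : 𝓔ˣ, u ^ 2 = x := by
  obtain ⟨y, hy⟩ := h
  have hne : ∀ p q : ZMod 4, p ^ 2 - q ^ 2 = 3 → 2 * p * q - q ^ 2 = 0 → False := by decide
  have hne' : ∀ p q : ZMod 4, p ^ 2 - q ^ 2 = 0 → 2 * p * q - q ^ 2 = 3 → False := by decide
  have hne'' : ∀ p q : ZMod 4, p ^ 2 - q ^ 2 = 1 → 2 * p * q - q ^ 2 = 1 → False := by decide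
  have h1 := congrArg QuadraticAlgebra.re hy
  have h2 := congrArg QuadraticAlgebra.im hy
  have e1 : (y ^ 2).re = y.re ^ 2 - y.im ^ 2 := by rw [pow_two]; simp; ring
  have e2 : (y ^ 2).im = 2 * y.re * y.im - y.im ^ 2 := by rw [pow_two]; simp; ring
  rw [e1] at h1
  rw [e2] at h2
  have sq : ∀ z w : 𝓔, z * z = x.val → z * w = 1 → ∃ u : 𝓔ˣ, u ^ 2 = x := fun z w hz hw =>
    ⟨⟨z, w, hw, by rw [mul_comm]; exact hw⟩, Units.ext (by rw [pow_two]; exact hz)⟩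
  rcases eq_of_norm_eq_one (isUnit_iff.1 x.isUnit) with h | h | h | h | h | h <;> rw [h] at h1 h2
  · exact sq 1 1 (by rw [h]; rfl) (by rfl)
  · exact (hne _ _ (h1.trans (by decide)) (h2.trans (by decide))).elim
  · exact sq ⟨1, 1⟩ ⟨0, -1⟩ (by rw [h]; rfl) (by rfl)
  · exact (hne' _ _ (h1.trans (by decide)) (h2.trans (by decide))).elim
  · exact (hne'' _ _ (h1.trans (by decide)) (h2.trans (by decide))).elim
  · exact sq ⟨0, 1⟩ ⟨-1, -1⟩ (by rw [h]; rfl) (by rfl)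

theorem PGL2.detClass_eq_one_of_red_four {γ : PGL2 𝓔} (h : detClass (map (red 4) γ) = 1) : detClass γ = 1 := by
  obtain ⟨A, rfl⟩ := mk_surjective γ
  rw [map_mk, detClass_mk_eq_one] at h
  obtain ⟨u, hu⟩ := h
  rw [detClass_mk_eq_one]
  refine EisensteinInt.isSquare_of_red_four ⟨u, ?_⟩
  rw [← Units.val_pow_eq_pow_val, hu]
  exact (RingHom.map_det _ _).symm

theorem PGL2.map_red_two_surjective : Surjective (PGL2.map (red 2)) := by
  have lift : ∀ x : EisensteinOver (ZMod 2), ∃ y : 𝓔, red 2 y = x := fun x =>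
    ⟨⟨x.re.val, x.im.val⟩, by ext <;> simp [red]⟩
  have hunit : ∀ x : EisensteinOver (ZMod 2), x ≠ 0 → ∃ u : 𝓔ˣ, red 2 u = x := by
    rintro ⟨x, y⟩ h
    have hxy : (x = 1 ∧ y = 0) ∨ (x = 0 ∧ y = 1) ∨ (x = 1 ∧ y = 1) := by
      have : ¬ (x = 0 ∧ y = 0) := fun ⟨h1, h2⟩ => h (by rw [h1, h2]; rfl)
      clear h; revert x y; decide
    rcases hxy with ⟨rfl, rfl⟩ | ⟨rfl, rfl⟩ | ⟨rfl, rfl⟩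
    · exact ⟨1, by decide⟩
    · exact ⟨⟨⟨0, 1⟩, ⟨-1, -1⟩, by decide, by decide⟩, by decide⟩
    · exact ⟨⟨⟨1, 1⟩, ⟨0, -1⟩, by decide, by decide⟩, by decide⟩
  intro γ
  obtain ⟨A, rfl⟩ := mk_surjective γ
  have hdet : A 0 0 * A 1 1 - A 0 1 * A 1 0 ≠ 0 := by
    have := (det A).ne_zero
    rwa [val_det_apply, det_fin_two] at this
  have build : ∀ B : Mat₂ 𝓔, IsUnit B.det → (∀ i j, red 2 (B i j) = A i j) →
      ∃ γ, map (red 2) γ = mk A := by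
    intro B hB h
    refine ⟨mk (GeneralLinearGroup.mk'' B hB), ?_⟩
    rw [map_mk]
    congr 1
    exact GeneralLinearGroup.ext h
  obtain ⟨q, hq⟩ := lift (A 0 1)
  by_cases h10 : A 1 0 = 0
  · rw [h10, mul_zero, sub_zero] at hdet
    obtain ⟨x, hx⟩ := hunit _ (left_ne_zero_of_mul hdet)
    obtain ⟨y, hy⟩ := hunit _ (right_ne_zero_of_mul hdet)
    refine build !![x, q; 0, y] (by rw [det_fin_two_of]; simp) fun i j => ?_
    fin_cases i <;> fin_cases j
    exacts [hx, hq, (map_zero _).trans h10.symm, hy]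
  · obtain ⟨p, hp⟩ := lift (A 0 0)
    obtain ⟨s, hs⟩ := lift (A 1 1)
    obtain ⟨r, hr⟩ := hunit _ h10
    obtain ⟨d, hd⟩ := hunit _ hdet
    refine build !![p, ((r⁻¹ : 𝓔ˣ) : 𝓔) * (p * s - d); r, s] ?_ fun i j => ?_
    · rw [det_fin_two_of]
      convert d.isUnit using 1
      linear_combination (-(p * s) + d) * r.inv_mul
    · fin_cases i <;> fin_cases j
      · exact hp
      · change red 2 (((r⁻¹ : 𝓔ˣ) : 𝓔) * (p * s - d)) = A 0 1
        have h1 : red 2 ((r⁻¹ : 𝓔ˣ) : 𝓔) * A 1 0 = 1 := by rw [← hr, ← map_mul, r.inv_mul, map_one]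
        rw [map_mul, map_sub, map_mul, hp, hs, hd]
        linear_combination A 0 1 * h1
      · exact hr
      · exact hs

namespace SisterGroup

open PGL2

/-- The sister group inside the Bianchi group. -/
def toPGL : SisterGroup →* PGL2 𝓔 := ofSL.comp holonomy

theorem toPGL_injective : Injective toPGL := by
  rw [injective_iff_map_eq_one]
  intro x hx
  obtain ⟨u, hu⟩ := ofSL_eq_one.1 hx
  refine eq_one_of_holonomy ?_ ?_
  · rw [hu]; simp
  · rw [hu]; simp

/-- The sister group has a single cusp. -/
theorem exists_holonomy_mul_eq (p q : 𝓔) : ∃ x : SisterGroup, holonomy x 0 0 * q = holonomy x 1 0 * p := by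
  induction hm : q.norm.toNat using Nat.strong_induction_on generalizing p q with
  | _ m ih =>
    by_cases h0 : q = 0
    · exact ⟨1, by simp [h0]⟩
    obtain ⟨n, hn⟩ := EisensteinInt.exists_norm_sub_mul_lt p q h0
    obtain ⟨z, hz, hzn⟩ := fareyData.exists_over n
    have hlt : (holonomy z 0 0 * q - holonomy z 1 0 * p).norm < q.norm := by
      rw [hzn]
      convert hn using 1
      rw [← EisensteinInt.norm_mul_of_isUnit (fareyData.isUnit z hz) (p - n * q), ← QuadraticAlgebra.norm_neg]
      congr 1
      ring
    obtain ⟨x, hx⟩ := ih _ (by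
      have := EisensteinInt.norm_nonneg (holonomy z 0 0 * q - holonomy z 1 0 * p)
      omega) (holonomy z 1 1 * p - holonomy z 0 1 * q) (holonomy z 0 0 * q - holonomy z 1 0 * p) rfl
    refine ⟨z * x, ?_⟩
    rw [map_mul, coe_mul]
    simp only [mul_apply, Fin.sum_univ_two]
    linear_combination hx

theorem commute_red_two (x : SisterGroup) : Commute (map (red 2) (toPGL x)) (map (red 2) (toPGL a)) := by
  let S : Subgroup SisterGroup := (Subgroup.centralizer {map (red 2) (toPGL a)}).comap
    ((map (red 2)).comp toPGL)
  have key : ∀ y : SisterGroup, Commute (map (red 2) (toPGL y)) (map (red 2) (toPGL a)) →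
      y ∈ S := fun y hy => Subgroup.mem_centralizer_singleton_iff.2 hy
  have hb : map (red 2) (toPGL b) = map (red 2) (toPGL a) := by
    change map _ (ofSL (holonomy b)) = map _ (ofSL (holonomy a))
    rw [map_ofSL, map_ofSL, holonomy_a, holonomy_b]
    congr 1
    refine Subtype.ext (Matrix.ext fun i j => ?_)
    fin_cases i <;> fin_cases j <;> decide
  have ht : map (red 2) (toPGL t) = 1 := by
    change map _ (ofSL (holonomy t)) = 1
    rw [map_ofSL, holonomy_t, ← map_one ofSL]
    congr 1
    refine Subtype.ext (Matrix.ext fun i j => ?_)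
    fin_cases i <;> fin_cases j <;> decide
  have hS : S = ⊤ := eq_top_of_mem (key a (Commute.refl _)) (key b (by rw [hb])) (key t (by rw [ht]; exact Commute.one_left _))
  have hx : x ∈ S := hS ▸ Subgroup.mem_top x
  exact Subgroup.mem_centralizer_singleton_iff.1 hx

/-- The congruence subgroup isomorphic to the sister group. -/
theorem mem_range_toPGL {γ : PGL2 𝓔} : γ ∈ toPGL.range ↔ detClass γ = 1 ∧
    Commute (map (red 2) γ) (map (red 2) (toPGL a)) := by
  constructor
  · rintro ⟨x, rfl⟩
    exact ⟨detClass_ofSL _, commute_red_two x⟩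
  · rintro ⟨h1, h2⟩
    obtain ⟨A, rfl⟩ := exists_ofSL_of_detClass h1
    obtain ⟨x, hx⟩ := exists_holonomy_mul_eq (A 0 0) (A 1 0)
    rw [← sub_eq_zero, ← inv_mul_one_zero] at hx
    set K := (holonomy x)⁻¹ * A with hK
    have hA : ofSL A = toPGL x * ofSL K := by rw [toPGL, comp_apply, ← map_mul, hK, mul_inv_cancel_left]
    have hc : Commute (map (red 2) (ofSL K)) (map (red 2) (toPGL a)) := by
      have : ofSL K = (toPGL x)⁻¹ * ofSL A := by rw [hA, inv_mul_cancel_left]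
      rw [this, map_mul, map_inv]
      exact (commute_red_two x).inv_left.mul_left h2
    have hdet : K 0 0 * K 1 1 = 1 := by
      have := K.det_coe
      rwa [det_fin_two, hx, mul_zero, sub_zero] at this
    rw [toPGL, comp_apply, map_ofSL, map_ofSL, holonomy_a] at hc
    obtain ⟨u, hu⟩ := ofSL_commute hc
    have e00 := congrFun (congrFun hu 0) 0
    have e10 := congrFun (congrFun hu 1) 0
    have e11 := congrFun (congrFun hu 1) 1
    obtain ⟨p, hp⟩ : ∃ p : EisensteinOver (ZMod 2), p = ⟨0, 1⟩ := ⟨_, rfl⟩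
    have hpp : p * p + p + 1 = 0 := by rw [hp]; decide
    have m00 : SpecialLinearGroup.map (red 2) matA 0 0 = 1 := by decide
    have m01 : SpecialLinearGroup.map (red 2) matA 0 1 = p := by rw [hp]; decide
    have m10 : SpecialLinearGroup.map (red 2) matA 1 0 = p := by rw [hp]; decide
    have m11 : SpecialLinearGroup.map (red 2) matA 1 1 = p := by rw [hp]; decide
    have hKr : ∀ i j, SpecialLinearGroup.map (red 2) K i j = red 2 (K i j) :=
      fun _ _ => rfl
    simp only [mul_apply, Fin.sum_univ_two, Matrix.smul_apply, smul_eq_mul, m00, m01, m10, m11, hKr, hx,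
      map_zero] at e00 e10 e11
    have hd' : red 2 (K 0 0) * red 2 (K 1 1) = 1 := by rw [← map_mul, hdet, map_one]
    have key : red 2 (K 0 0) = 1 ∧ red 2 (K 0 1) = 0 := by
      generalize red 2 (K 0 0) = e at *
      generalize red 2 (K 0 1) = β at *
      generalize red 2 (K 1 1) = e' at *
      have k1 : e' = u * e := by linear_combination (-(p + 1)) * e10 + (e' - u * e) * hpp
      have k2 : e' = u * β + u * e' := by linear_combination (-(p + 1)) * e11 + (e' - u * β - u * e') * hpp
      have k3 : e' * β + u = 1 := by linear_combination β * k1 - u * hd' - e * k2 + hd'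
      have k4 : β = e - e' := by linear_combination e * k3 - β * hd' + k1
      have k5 : β = 0 := by linear_combination (-p) * (e00 + k4 - k1) + β * hpp
      have k6 : e * e = 1 := by rw [k5] at k4; rw [← hd', ← sub_eq_zero.1 k4.symm]
      refine ⟨?_, k5⟩
      have dec : ∀ x y : ZMod 2, x * x - y * y = 1 → x * y + y * x - y * y = 0 → x = 1 ∧ y = 0 := by decide
      have r1 : e.re * e.re + -1 * e.im * e.im = 1 := congrArg QuadraticAlgebra.re k6
      have r2 : e.re * e.im + e.im * e.re + -1 * e.im * e.im = 0 := congrArg QuadraticAlgebra.im k6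
      obtain ⟨d1, d2⟩ := dec e.re e.im (by linear_combination r1) (by linear_combination r2)
      exact QuadraticAlgebra.ext d1 d2
    obtain ⟨β, hβ⟩ := EisensteinInt.red_two_eq_zero key.2
    have hs : ∃ s : 𝓔, (s = 1 ∨ s = -1) ∧ K 0 0 = s ∧ K 1 1 = s := by
      rcases EisensteinInt.eq_one_or_of_red_two (IsUnit.of_mul_eq_one _ hdet) key.1 with h | h
      · exact ⟨1, Or.inl rfl, h, by rw [h, one_mul] at hdet; exact hdet⟩
      · exact ⟨-1, Or.inr rfl, h, by rw [h, neg_one_mul, neg_eq_iff_eq_neg] at hdet; exact hdet⟩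
    obtain ⟨s, hs, h00, h11⟩ := hs
    have hss : s * s = 1 := by rcases hs with rfl | rfl <;> ring
    obtain ⟨s', ⟨w, hw⟩, g00, g01, g10, g11⟩ := peripheral_apply (s * β).im ((s * β).re - 2 * (s * β).im)
    refine ⟨x * (c ^ (s * β).im * t ^ ((s * β).re - 2 * (s * β).im)), ?_⟩
    rw [hA, map_mul, eq_comm]
    congr 1
    refine mk_eq_mk.2 ⟨⟨s, s, hss, hss⟩ * w⁻¹, ?_⟩
    refine Matrix.ext fun i j => ?_
    change K i j = s * ((w⁻¹ : 𝓔ˣ) : 𝓔) * holonomy _ i j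
    have hβ' : (⟨2 * ((s * β).re - 2 * (s * β).im) + 4 * (s * β).im, 2 * (s * β).im⟩ : 𝓔) = 2 * (s * β) := by
      ext <;> simp [re_ofNat, im_ofNat]; ring
    have hw' : ((w⁻¹ : 𝓔ˣ) : 𝓔) * s' = 1 := by rw [← hw]; exact w.inv_mul
    fin_cases i <;> fin_cases j
    · change K 0 0 = _ * _ * holonomy _ 0 0
      rw [g00, h00]; linear_combination (-s) * hw'
    · change K 0 1 = _ * _ * holonomy _ 0 1
      rw [g01, hβ', hβ]; linear_combination (-(2 * s * s * β)) * hw' - 2 * β * hss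
    · change K 1 0 = _ * _ * holonomy _ 1 0
      rw [g10, hx, mul_zero]
    · change K 1 1 = _ * _ * holonomy _ 1 1
      rw [g11, h11]; linear_combination (-s) * hw'

end SisterGroup

section ReductionToSister

open PGL2

instance PGL2.instFinite {R : Type*} [CommRing R] [Finite R] : Finite (PGL2 R) :=
  Finite.of_surjective _ mk_surjective

theorem ProfiniteCorrespondence.exists_integralRep_normalized {Λ : Type} [Group Λ] [Group.FG Λ]
    (c : ProfiniteCorrespondence Λ (PGL2 𝓔)) : ∃ (φ : Λ →* PGL2 𝓔) (q : PGL2 𝓦),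
      map (padicRed 2 1) q = 1 ∧ ∀ j, ∃ n₀, ∀ g γ, (g, γ) ∈ c.R n₀ →
        map (red (2 ^ j)) (φ g) = (map (padicRed 2 j) q)⁻¹ * map (red (2 ^ j)) γ * map (padicRed 2 j) q := by
  obtain ⟨ρ, hρ, q, φ, hφ⟩ := c.exists_integralRep
  obtain ⟨δ, hδ⟩ : ∃ δ, map (red (2 ^ 1)) δ = map (padicRed 2 1) q :=
    map_red_two_surjective _
  have hcomp : ∀ j γ, map (padicRed 2 j) (map (toPadic 2) γ) =
      map (red (2 ^ j)) γ := fun j γ => by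
    rw [map_map, EisensteinOver.padicRed_comp_toPadic]
  refine ⟨(MulAut.conj δ).toMonoidHom.comp φ, q * (map (toPadic 2) δ)⁻¹, ?_, fun j => ?_⟩
  · rw [map_mul, map_inv, hcomp, hδ, mul_inv_cancel]
  · obtain ⟨n₀, hn₀⟩ := hρ j
    refine ⟨n₀, fun g γ hg => ?_⟩
    change map _ (δ * φ g * δ⁻¹) = _
    rw [← hn₀ g γ hg, ← hcomp]
    simp only [map_mul, map_inv, mul_inv_rev, inv_inv, mul_assoc, hφ]

namespace SisterGroup

theorem red_toPGL_ne_one : map (red (2 ^ 4)) (toPGL ⁅⁅a, b⁆, ⁅a, b⁻¹⁆⁆) ≠ 1 := by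
  intro h
  change map _ (ofSL _) = 1 at h
  rw [map_ofSL] at h
  obtain ⟨u, hu⟩ := ofSL_eq_one.1 h
  have h01 := congrFun (congrFun hu 0) 1
  rw [Matrix.smul_apply, Matrix.one_apply_ne (by decide), smul_zero] at h01
  have h02 : red (2 ^ 4) (holonomy ⁅⁅a, b⁆, ⁅a, b⁻¹⁆⁆ 0 1) = 0 := h01
  simp only [commutatorElement_def, map_mul, map_inv, holonomy_a, holonomy_b,
    SL2_inv_expl, coe_mul] at h02
  exact absurd h02 (by decide)

instance finiteIndex_range_toPGL : toPGL.range.FiniteIndex := by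
  refine @Subgroup.finiteIndex_of_le _ _ ((map (red 2)).ker ⊓ (map (red 4)).ker) _ ?_ ?_
  · infer_instance
  · intro γ hγ
    rw [Subgroup.mem_inf, MonoidHom.mem_ker, MonoidHom.mem_ker] at hγ
    rw [mem_range_toPGL, hγ.1]
    exact ⟨detClass_eq_one_of_red_four (by rw [hγ.2, map_one]), Commute.one_left _⟩

/-- Quotients of the sister group dominate the finite quotients of a subgroup. -/
def DominatesQuotients (L : Subgroup SisterGroup) : Prop :=
  ∀ (Q : Type) [Group Q] [Finite Q] (π : L →* Q), Surjective π →
    ∃ f : SisterGroup →* Q, Surjective f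

end SisterGroup

open SisterGroup

/-- Rigidity of the Bianchi group reduces to a statement on subgroups of the sister group. -/
theorem ProfiniteCorrespondence.exists_surjective {Λ : Type} [Group Λ] [Group.FG Λ]
    (c : ProfiniteCorrespondence Λ (PGL2 𝓔)) (H : ∀ L : Subgroup SisterGroup, L.FG → DominatesQuotients L →
      (∃ x₁ ∈ L, ∃ x₂ ∈ L, ∃ x₃ ∈ L, ∃ x₄ ∈ L, ⁅⁅x₁, x₂⁆, ⁅x₃, x₄⁆⁆ ≠ 1) → L = ⊤) :
    ∃ φ : Λ →* PGL2 𝓔, Surjective φ := by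
  obtain ⟨φ, q, hq, hφ⟩ := c.exists_integralRep_normalized
  refine ⟨φ, ?_⟩
  obtain ⟨n₁, hn₁⟩ := hφ 1
  obtain ⟨n₂, hn₂⟩ := hφ 2
  obtain ⟨n₃, hn₃⟩ := hφ 4
  have hmem : ∀ g γ, (g, γ) ∈ c.R (n₁ + n₂) → (φ g)⁻¹ * γ ∈ toPGL.range := by
    intro g γ h
    have e1 := hn₁ g γ (c.anti (by omega) h)
    have e2 := hn₂ g γ (c.anti (by omega) h)
    rw [hq, inv_one, one_mul, mul_one] at e1
    have e1' : map (red 2) ((φ g)⁻¹ * γ) = 1 := by rw [map_mul, map_inv, inv_mul_eq_one]; exact e1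
    rw [mem_range_toPGL, e1']
    refine ⟨detClass_eq_one_of_red_four (?_ : detClass (map (red (2 ^ 2)) _) = 1), Commute.one_left _⟩
    rw [map_mul, map_inv, map_mul, map_inv, e2, map_mul, map_mul, map_inv, inv_mul_eq_one, mul_right_comm,
      inv_mul_cancel, one_mul]
  have hfin : (toPGL.range.comap φ).FiniteIndex := ⟨by
    rw [Subgroup.index_comap]
    exact (Subgroup.instFiniteIndex_subgroupOf _ _ : (toPGL.range.subgroupOf φ.range).FiniteIndex).index_ne_zero⟩
  obtain ⟨c', hc'⟩ := c.restrict (toPGL.range.comap φ) toPGL.range (n₁ + n₂) fun x y hxy => by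
    have h := hmem x y hxy
    rw [Subgroup.mem_comap]
    constructor
    · intro hx; simpa using Subgroup.mul_mem _ hx h
    · intro hy; simpa using Subgroup.mul_mem _ hy (Subgroup.inv_mem _ h)
  let e : toPGL.range ≃* SisterGroup := (MonoidHom.ofInjective toPGL_injective).symm
  have he : ∀ y, toPGL (e y) = y := fun y => congrArg Subtype.val ((MonoidHom.ofInjective toPGL_injective).apply_symm_apply y)
  let ψ : toPGL.range.comap φ →* SisterGroup := e.toMonoidHom.comp (φ.subgroupComap toPGL.range)
  have hψ : ∀ x, toPGL (ψ x) = φ x := fun x => he _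
  have hfg : Group.FG (toPGL.range.comap φ) := inferInstance
  have htop : ψ.range = ⊤ := by
    refine H ψ.range ?_ ?_ ?_
    · exact (Group.fg_iff_subgroup_fg _).1 inferInstance
    · intro Q _ _ π hπ
      obtain ⟨f, n, hf⟩ := c'.transport (π.comp ψ.rangeRestrict)
      refine ⟨f.comp e.symm.toMonoidHom, fun y => ?_⟩
      obtain ⟨x, rfl⟩ := hπ y
      obtain ⟨g, rfl⟩ := ψ.rangeRestrict_surjective x
      obtain ⟨γ, hγ⟩ := c'.exists_right n g
      exact ⟨e γ, by simpa using hf g γ hγ⟩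
    · choose g hg using fun x : SisterGroup => c'.exists_left n₃ ⟨toPGL x, x, rfl⟩
      refine ⟨_, ⟨g a, rfl⟩, _, ⟨g b, rfl⟩, _, ⟨g a, rfl⟩, _, ⟨g b⁻¹, rfl⟩, fun h1 => ?_⟩
      have hR : ∀ x, ((g x : Λ), toPGL x) ∈ c.R n₃ := fun x => c.anti (by omega) (hc' _ _ _ (hg x))
      have hcomm : ∀ x y x' y', (x, y) ∈ c.R n₃ → (x', y') ∈ c.R n₃ → (⁅x, x'⁆, ⁅y, y'⁆) ∈ c.R n₃ := by
        intro x y x' y' h h'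
        exact (c.R n₃).mul_mem ((c.R n₃).mul_mem ((c.R n₃).mul_mem h h') ((c.R n₃).inv_mem h)) ((c.R n₃).inv_mem h')
      have h2 := hn₃ _ _ (hcomm _ _ _ _ (hcomm _ _ _ _ (hR a) (hR b)) (hcomm _ _ _ _ (hR a) (hR b⁻¹)))
      rw [← map_commutatorElement, ← map_commutatorElement, ← map_commutatorElement] at h1
      have h3 := congrArg toPGL h1
      rw [hψ, map_one] at h3
      have h4 : φ ⁅⁅(g a : Λ), (g b : Λ)⁆, ⁅(g a : Λ), (g b⁻¹ : Λ)⁆⁆ = 1 := h3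
      rw [h4, map_one, ← map_commutatorElement, ← map_commutatorElement, ← map_commutatorElement] at h2
      apply red_toPGL_ne_one
      rw [mul_assoc, eq_inv_mul_iff_mul_eq, mul_one] at h2
      exact mul_eq_right.1 h2.symm
  intro γ
  obtain ⟨g, hg⟩ := c.exists_left (n₁ + n₂) γ
  obtain ⟨x, hx⟩ := hmem g γ hg
  obtain ⟨y, rfl⟩ : x ∈ ψ.range := htop ▸ Subgroup.mem_top x
  rw [hψ] at hx
  exact ⟨g * y, by rw [map_mul, hx, mul_inv_cancel_left]⟩

end ReductionToSister

namespace SisterGroup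

open SemidirectProduct

/-- The fibre subgroup. -/
def fibre : Subgroup SisterGroup := (inl : FreeGroupTwo →* SisterGroup).range

instance : fibre.Normal := by rw [fibre, range_inl_eq_ker_rightHom]; infer_instance

theorem mem_fibre {x : SisterGroup} : x ∈ fibre ↔ rightHom x = 1 := by
  rw [fibre, range_inl_eq_ker_rightHom, MonoidHom.mem_ker]

theorem map_a_eq_map_b {A : Type*} [CommGroup A] (g : SisterGroup →* A) : g a = g b := by
  have := congrArg g t_mul_a
  simp only [map_mul, map_inv] at this
  rw [mul_comm, mul_left_inj] at this
  rw [this, mul_comm, inv_mul_cancel_left]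

theorem map_b_pow_five {A : Type*} [CommGroup A] (g : SisterGroup →* A) : g b ^ 5 = 1 := by
  have := congrArg g t_mul_b
  simp only [map_mul, map_inv, map_a_eq_map_b] at this
  rw [mul_comm, mul_left_inj] at this
  calc g b ^ 5 = g b * (g b * g b * g b * g b) := by simp only [pow_succ, pow_zero, one_mul, mul_assoc]
    _ = 1 := by nth_rw 1 [this]; group

theorem map_fibre_pow_five {A : Type*} [CommGroup A] (g : SisterGroup →* A) {x : SisterGroup} (hx : x ∈ fibre) :
    g x ^ 5 = 1 := by
  obtain ⟨f, rfl⟩ := hx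
  have h : inl f ∈ ((powMonoidHom 5).comp g).ker :=
    inl_mem_of_mem (by
      change g a ^ 5 = 1; rw [map_a_eq_map_b, map_b_pow_five]) (map_b_pow_five g) f
  exact h

theorem exists_mem_fibre_mul (x : SisterGroup) : ∃ f ∈ fibre, ∃ n : ℤ, x = f * t ^ n := by
  obtain ⟨f, n, h⟩ := exists_inl_mul_t_zpow x
  exact ⟨_, ⟨f, rfl⟩, n, h⟩

section

variable {G : Type} [Group G] {deg : G →* Multiplicative ℤ} {τ : G}

theorem mul_zpow_neg_mem_ker {x : G} {i : ℤ} (h : deg x = deg τ ^ i) : x * τ ^ (-i) ∈ deg.ker := by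
  rw [MonoidHom.mem_ker, map_mul, map_zpow, h, ← zpow_add, add_neg_cancel, zpow_zero]

theorem finite_quotient_zpowers [Finite deg.ker] (hgen : ∀ x, ∃ i : ℤ, deg x = deg τ ^ i) {m : ℕ} (hm : 0 < m) :
    Finite (G ⧸ zpowers (τ ^ m)) := by
  refine Finite.of_surjective
    (fun p : deg.ker × Fin m => (((p.1 : G) * τ ^ (p.2 : ℕ) : G) : G ⧸ zpowers (τ ^ m))) fun y => ?_
  obtain ⟨x, rfl⟩ := QuotientGroup.mk_surjective y
  obtain ⟨i, hi⟩ := hgen x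
  have h0 : (0 : ℤ) < m := by exact_mod_cast hm
  have h1 := Int.emod_nonneg i h0.ne'
  refine ⟨(⟨_, mul_zpow_neg_mem_ker hi⟩, ⟨(i % m).toNat, by have := Int.emod_lt_of_pos i h0; omega⟩), ?_⟩
  rw [QuotientGroup.eq]
  refine ⟨i / m, ?_⟩
  have h2 : (((i % m).toNat : ℕ) : ℤ) = i % m := Int.toNat_of_nonneg h1
  change (τ ^ m) ^ (i / m) = (x * τ ^ (-i) * τ ^ (i % (m : ℤ)).toNat)⁻¹ * x
  rw [← zpow_natCast τ m, ← zpow_natCast τ (i % m).toNat, h2, ← zpow_mul, mul_inv_rev, mul_inv_rev]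
  have h3 : (m : ℤ) * (i / m) = -(i % m) + i := by have := Int.emod_add_mul_ediv i m; omega
  rw [h3, zpow_add]
  group

/-- If the finite quotients of a finite-by-cyclic group are quotients of the sister group, then some finite quotient is
one in which the fibre corresponds to the finite part. -/
theorem exists_common_quotient [Finite deg.ker] (hτ : deg τ ≠ 1) (hgen : ∀ x, ∃ i : ℤ, deg x = deg τ ^ i)
    (hdom : ∀ (Q : Type) [Group Q] [Finite Q] (π : G →* Q), Surjective π → ∃ f : SisterGroup →* Q, Surjective f) :
    ∃ (Q : Type) (_ : Group Q) (_ : Finite Q) (π : G →* Q) (f : SisterGroup →* Q), Surjective π ∧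
      (∀ n ∈ deg.ker, π n = 1 → n = 1) ∧ deg.ker.map π = fibre.map f := by
  have hfin : Finite (MulAut deg.ker) := Finite.of_injective (fun σ : MulAut deg.ker => (σ : deg.ker → deg.ker))
    DFunLike.coe_injective
  obtain ⟨j, hj0, hjc, hjN⟩ : ∃ j : ℕ, 0 < j ∧ (∀ x, Commute (τ ^ j) x) ∧ ∀ n ∈ deg.ker, n ^ j = 1 := by
    have h1 : ∀ n ∈ deg.ker, Commute (τ ^ (orderOf (MulAut.conjNormal (H := deg.ker) τ) * Nat.card deg.ker)) n := by
      intro n hn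
      have h2 := congrArg Subtype.val (DFunLike.congr_fun (f := MulAut.conjNormal (H := deg.ker)
        (τ ^ (orderOf (MulAut.conjNormal (H := deg.ker) τ) * Nat.card deg.ker))) (g := 1)
        (by rw [map_pow, pow_mul, pow_orderOf_eq_one, one_pow]) ⟨n, hn⟩)
      rw [MulAut.conjNormal_apply] at h2
      exact mul_inv_eq_iff_eq_mul.1 h2
    refine ⟨orderOf (MulAut.conjNormal (H := deg.ker) τ) * Nat.card deg.ker,
      Nat.mul_pos (orderOf_pos _) Nat.card_pos, fun x => ?_, fun n hn => ?_⟩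
    · obtain ⟨i, hi⟩ := hgen x
      have h2 := (h1 _ (mul_zpow_neg_mem_ker hi)).mul_right
        (((Commute.refl τ).pow_left _).zpow_right i)
      rwa [mul_assoc, ← zpow_add, neg_add_cancel, zpow_zero, mul_one] at h2
    · rw [mul_comm, pow_mul]
      have := congrArg Subtype.val (pow_card_eq_one' (x := (⟨n, hn⟩ : deg.ker)))
      rw [show n ^ Nat.card deg.ker = 1 from this, one_pow]
  have hinj : ∀ i i' : ℤ, deg τ ^ i = deg τ ^ i' → i = i' := fun i i' h => by
    have h1 : i * (deg τ).toAdd = i' * (deg τ).toAdd := congrArg toAdd h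
    exact mul_right_cancel₀ (fun h0 => hτ (Multiplicative.toAdd.injective h0)) h1
  have hdvd : ∀ (e : ℤ) (m : ℕ), deg τ ^ e ∈ zpowers (deg (τ ^ m)) → ∃ q, e = m * q := by
    rintro e m ⟨q, hq⟩
    refine ⟨q, hinj _ _ ?_⟩
    rw [← hq, map_pow, zpow_mul, zpow_natCast]
  have hnorm : ∀ m, (zpowers (τ ^ (j * m))).Normal := fun m => ⟨by
    rintro _ ⟨q, rfl⟩ g
    have : Commute ((τ ^ (j * m)) ^ q) g := by rw [pow_mul]; exact ((hjc g).pow_left m).zpow_left q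
    refine ⟨q, ?_⟩
    change _ = g * (τ ^ (j * m)) ^ q * g⁻¹
    rw [← this.eq, mul_inv_cancel_right]⟩
  have := hnorm 1
  have := hnorm 5
  have hle : ∀ m, zpowers (τ ^ (j * m)) ≤ (zpowers (deg (τ ^ (j * m)))).comap deg := fun m => by
    rw [Subgroup.zpowers_le]; exact Subgroup.mem_zpowers _
  have := finite_quotient_zpowers hgen (m := j * 5) (by omega)
  have := finite_quotient_zpowers hgen (m := j * 1) (by omega)
  obtain ⟨f₅, hf₅⟩ := hdom _ (mk' (zpowers (τ ^ (j * 5)))) (QuotientGroup.mk'_surjective _)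
  let p : G ⧸ zpowers (τ ^ (j * 5)) →* G ⧸ zpowers (τ ^ (j * 1)) :=
    QuotientGroup.map _ _ (MonoidHom.id G) (by
      rw [Subgroup.zpowers_le]
      exact ⟨5, by simp [pow_mul]⟩)
  let π : G →* G ⧸ zpowers (τ ^ (j * 1)) := mk' _
  have hπ : Surjective π := QuotientGroup.mk'_surjective _
  have hp : ∀ g : G, p (QuotientGroup.mk g) = π g := fun g => rfl
  have hfs : Surjective (p.comp f₅) := by
    intro y
    obtain ⟨g, rfl⟩ := hπ y
    obtain ⟨x, hx⟩ := hf₅ (QuotientGroup.mk g)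
    exact ⟨x, by rw [comp_apply, hx, hp]⟩
  have hπz : π (τ ^ j) = 1 := (eq_one_iff _).2 ⟨1, by simp⟩
  let d₅ := QuotientGroup.map _ _ deg (hle 5)
  let d₁ := QuotientGroup.map _ _ deg (hle 1)
  have hd₁ : ∀ {g : G}, d₁ (π g) = 1 ↔ deg g ∈ zpowers (deg (τ ^ (j * 1))) := eq_one_iff _
  have hfib : ∀ x ∈ fibre, ∃ n ∈ deg.ker, p (f₅ x) = π n := by
    intro x hx
    obtain ⟨g, hg⟩ := QuotientGroup.mk_surjective (f₅ x)
    obtain ⟨e, he⟩ := hgen g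
    have h1 : d₅ (f₅ x) ^ 5 = 1 := map_fibre_pow_five (d₅.comp f₅) hx
    rw [← hg, ← map_pow] at h1
    have h2 : deg (g ^ 5) ∈ zpowers (deg (τ ^ (j * 5))) := (eq_one_iff _).1 h1
    rw [map_pow deg g, he, ← zpow_natCast (deg τ ^ e), ← zpow_mul] at h2
    obtain ⟨q, hq⟩ := hdvd _ _ h2
    refine ⟨_, mul_zpow_neg_mem_ker he, ?_⟩
    have hq' : -e = j * -q := by push_cast at hq; linarith
    rw [← hg, hp, map_mul, hq', zpow_mul, zpow_natCast, map_zpow, hπz, one_zpow]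
    exact (mul_one _).symm
  refine ⟨_, inferInstance, inferInstance, π, p.comp f₅, hπ, ?_, le_antisymm ?_ ?_⟩
  · intro n hn h
    obtain ⟨q, rfl⟩ := (eq_one_iff n).1 h
    change deg ((τ ^ (j * 1)) ^ q) = 1 at hn
    change (τ ^ (j * 1)) ^ q = 1
    have h0 : ((j * 1 : ℕ) : ℤ) * q = 0 := hinj _ _ (by
      rw [zpow_zero, zpow_mul, zpow_natCast, ← map_pow, ← map_zpow]; exact hn)
    rw [← zpow_natCast, ← zpow_mul, h0, zpow_zero]
  · rintro _ ⟨n, hn, rfl⟩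
    have hnK : (fibre.map (p.comp f₅)).Normal := Subgroup.Normal.map inferInstance _ hfs
    obtain ⟨s, hs⟩ := hπ (p (f₅ t))
    obtain ⟨e, he⟩ := hgen s
    have key : ∀ g : G, ∃ x ∈ fibre, ∃ i : ℤ, π g = p (f₅ x) * π s ^ i ∧ d₁ (π g) = d₁ (π (τ ^ (e * i))) := by
      intro g
      obtain ⟨y, hy⟩ := hfs (π g)
      obtain ⟨x, hx, i, rfl⟩ := exists_mem_fibre_mul y
      have h1 : π g = p (f₅ x) * π s ^ i := by rw [← hy, hs, comp_apply, map_mul, map_zpow, map_mul, map_zpow]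
      refine ⟨x, hx, i, h1, ?_⟩
      obtain ⟨n', hn', hxn⟩ := hfib x hx
      have h2 : deg n' = 1 := hn'
      rw [h1, map_mul, hxn, hd₁.2 (by rw [h2]; exact Subgroup.one_mem _), one_mul, ← map_zpow]
      change QuotientGroup.mk (deg (s ^ i)) = QuotientGroup.mk (deg (τ ^ (e * i)))
      rw [map_zpow, map_zpow, he, ← zpow_mul]
    obtain ⟨x, hx, i, h1, h2⟩ := key n
    obtain ⟨x', hx', i', h1', h2'⟩ := key τ
    rw [hd₁.2 (by rw [show deg n = 1 from hn]; exact Subgroup.one_mem _), eq_comm, hd₁, map_zpow] at h2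
    rw [eq_comm, ← div_eq_one, ← map_div, ← map_div, hd₁, div_eq_mul_inv, ← zpow_sub_one, map_zpow] at h2'
    obtain ⟨q, hq⟩ := hdvd _ _ h2
    obtain ⟨q', hq'⟩ := hdvd _ _ h2'
    have hi : i = j * (i' * q - i * q') := by push_cast at hq hq'; linear_combination i' * hq - i * hq'
    have hsj : π s ^ j ∈ fibre.map (p.comp f₅) := by
      rw [← eq_one_iff, QuotientGroup.mk_pow]
      have hpow : ∀ g, ∃ i : ℤ, ((π g : G ⧸ _) : (G ⧸ _) ⧸ fibre.map (p.comp f₅)) = QuotientGroup.mk (π s) ^ i := by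
        intro g
        obtain ⟨x, hx, i, h, -⟩ := key g
        refine ⟨i, ?_⟩
        have hk : (QuotientGroup.mk (p (f₅ x)) : (G ⧸ _) ⧸ fibre.map (p.comp f₅)) = 1 :=
          (eq_one_iff _).2 (Subgroup.mem_map_of_mem (p.comp f₅) hx)
        rw [h, QuotientGroup.mk_mul, hk, one_mul, QuotientGroup.mk_zpow]
      obtain ⟨i₁, h₁⟩ := hpow (s * τ ^ (-e))
      obtain ⟨i₂, h₂⟩ := hpow (τ ^ e)
      have h3 : (π s : (G ⧸ _) ⧸ fibre.map (p.comp f₅)) = QuotientGroup.mk (π (s * τ ^ (-e))) *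
          QuotientGroup.mk (π (τ ^ e)) := by
        rw [← QuotientGroup.mk_mul, ← map_mul]; congr 2; group
      have h4 : Commute (QuotientGroup.mk (π (s * τ ^ (-e))) : (G ⧸ _) ⧸ fibre.map (p.comp f₅))
          (QuotientGroup.mk (π (τ ^ e))) := by
        rw [h₁, h₂]; exact (Commute.refl _).zpow_zpow _ _
      rw [h3, h4.mul_pow, ← QuotientGroup.mk_pow, ← QuotientGroup.mk_pow, ← map_pow, ← map_pow,
        hjN _ (mul_zpow_neg_mem_ker he), show (τ ^ e) ^ j = (τ ^ j) ^ e by rw [← zpow_natCast, ← zpow_natCast, zpow_comm],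
        map_zpow, hπz]
      simp
    rw [h1, hi, zpow_mul, zpow_natCast]
    exact Subgroup.mul_mem _ ⟨x, hx, rfl⟩ (Subgroup.zpow_mem _ hsj _)
  · rintro _ ⟨x, hx, rfl⟩
    obtain ⟨n, hn, h⟩ := hfib x hx
    exact ⟨n, hn, h.symm⟩

theorem exists_generator (deg : G →* Multiplicative ℤ) : ∃ τ, ∀ x, ∃ i : ℤ, deg x = deg τ ^ i := by
  obtain ⟨⟨_, τ, rfl⟩, h⟩ := IsCyclic.exists_generator (α := deg.range)
  refine ⟨τ, fun x => ?_⟩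
  obtain ⟨i, hi⟩ := h ⟨deg x, x, rfl⟩
  exact ⟨i, (congrArg Subtype.val hi).symm⟩

/-- A version of `exists_common_quotient` relative to an invariant finite quotient of the kernel. -/
theorem exists_common_quotient_of_invariant (hτ : deg τ ≠ 1) (hgen : ∀ x, ∃ i : ℤ, deg x = deg τ ^ i)
    (hdom : ∀ (Q : Type) [Group Q] [Finite Q] (π : G →* Q), Surjective π →
      ∃ f : SisterGroup →* Q, Surjective f) {A : Type*} [Group A] [Finite A] (h : deg.ker →* A)
    (hinv : ∀ (g : G) (n : deg.ker), h n = 1 → h (MulAut.conjNormal g n) = 1) :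
    ∃ (Q : Type) (_ : Group Q) (_ : Finite Q) (π : G →* Q) (f : SisterGroup →* Q), Surjective π ∧
      (∀ n : deg.ker, π n = 1 ↔ h n = 1) ∧ deg.ker.map π = fibre.map f := by
  have hn : (h.ker.map deg.ker.subtype).Normal := ⟨by
    rintro _ ⟨n, hn, rfl⟩ g
    exact ⟨MulAut.conjNormal g n, hinv g n hn, MulAut.conjNormal_apply g n⟩⟩
  have hmem : ∀ n : deg.ker, (n : G) ∈ h.ker.map deg.ker.subtype ↔ h n = 1 := fun n =>
    ⟨fun ⟨n', h1, h2⟩ => by rwa [← Subtype.ext h2], fun h1 => ⟨n, h1, rfl⟩⟩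
  let deg' : G ⧸ h.ker.map deg.ker.subtype →* Multiplicative ℤ := QuotientGroup.lift _ deg (by
    rintro _ ⟨n, -, rfl⟩
    exact n.2)
  have hker : ∀ x : G, (x : G ⧸ h.ker.map deg.ker.subtype) ∈ deg'.ker ↔ x ∈ deg.ker := fun x => Iff.rfl
  have hfin : Finite deg'.ker := by
    refine Finite.of_surjective (α := deg.ker ⧸ h.ker) (fun y => Quotient.liftOn' y
      (fun n => (⟨QuotientGroup.mk (n : G), n.2⟩ : deg'.ker)) fun n n' hnn => Subtype.ext ?_) ?_
    · rw [QuotientGroup.leftRel_apply] at hnn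
      exact QuotientGroup.eq.2 ((hmem (n⁻¹ * n')).2 hnn)
    · rintro ⟨y, hy⟩
      obtain ⟨x, rfl⟩ := QuotientGroup.mk_surjective y
      exact ⟨QuotientGroup.mk ⟨x, hy⟩, rfl⟩
  obtain ⟨Q, i₁, i₂, π, f, hπ, h1, h2⟩ := exists_common_quotient (deg := deg') (τ := (τ : G ⧸ _)) hτ
    (fun x => by obtain ⟨x, rfl⟩ := QuotientGroup.mk_surjective x; exact hgen x)
    (fun Q _ _ π hπ => hdom Q (π.comp (mk' _)) (hπ.comp (QuotientGroup.mk'_surjective _)))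
  refine ⟨Q, i₁, i₂, π.comp (mk' _), f, hπ.comp (QuotientGroup.mk'_surjective _), fun n => ?_, ?_⟩
  · rw [← hmem, ← eq_one_iff]
    refine ⟨fun h3 => h1 _ n.2 h3, fun h3 => ?_⟩
    change π (QuotientGroup.mk (n : G)) = 1
    rw [h3, map_one]
  · rw [← h2, ← Subgroup.map_map]
    congr 1
    ext y
    constructor
    · rintro ⟨x, hx, rfl⟩; exact hx
    · intro hy
      obtain ⟨x, rfl⟩ := QuotientGroup.mk_surjective y
      exact ⟨x, hy, rfl⟩

theorem exists_hom_of_invariant (hτ : deg τ ≠ 1) (hgen : ∀ x, ∃ i : ℤ, deg x = deg τ ^ i)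
    (hdom : ∀ (Q : Type) [Group Q] [Finite Q] (π : G →* Q), Surjective π →
      ∃ f : SisterGroup →* Q, Surjective f) {A : Type*} [Group A] [Finite A] (h : deg.ker →* A)
    (hs : Surjective h) (hinv : ∀ (g : G) (n : deg.ker), h n = 1 → h (MulAut.conjNormal g n) = 1) :
    ∃ (φ : FreeGroupTwo →* A) (l : G), Surjective φ ∧
      ∀ w n, φ w = h n → φ (FreeGroupTwo.monodromy w) = h (MulAut.conjNormal l n) := by
  obtain ⟨Q, _, _, π, f, hπ, h1, h2⟩ := exists_common_quotient_of_invariant hτ hgen hdom h hinv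
  have heq : ∀ n n' : deg.ker, π n = π n' ↔ h n = h n' := fun n n' => by
    rw [← inv_mul_eq_one, ← inv_mul_eq_one (a := h n), ← map_inv, ← map_inv, ← map_mul, ← map_mul, ← h1]; rfl
  have hex : ∀ w : FreeGroupTwo, ∃ n : deg.ker, π n = f (inl w) := fun w => by
    obtain ⟨n, hn, h⟩ := h2.symm ▸ Subgroup.mem_map_of_mem f (⟨w, rfl⟩ : inl w ∈ fibre)
    exact ⟨⟨n, hn⟩, h⟩
  choose ν hν using hex
  have key : ∀ w (n : deg.ker), π n = f (inl w) → h (ν w) = h n := fun w n hn => (heq _ _).1 ((hν w).trans hn.symm)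
  let φ : FreeGroupTwo →* A := MonoidHom.mk' (fun w => h (ν w)) fun w w' => by
    rw [← map_mul]
    exact key _ (ν w * ν w') (by rw [Subgroup.coe_mul, map_mul, hν, hν, map_mul, map_mul])
  obtain ⟨l, hl⟩ := hπ (f t)
  refine ⟨φ, l, fun y => ?_, fun w n hn => key _ _ ?_⟩
  · obtain ⟨n, rfl⟩ := hs y
    obtain ⟨_, ⟨w, rfl⟩, hw⟩ := h2 ▸ Subgroup.mem_map_of_mem π n.2
    exact ⟨w, key w n hw.symm⟩
  · have h3 : f (inl (FreeGroupTwo.monodromy w)) = f t * f (inl w) * (f t)⁻¹ := by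
      rw [← map_inv, ← map_mul, ← map_mul, t_mul_inl, mul_inv_cancel_right]
    rw [MulAut.conjNormal_apply, map_mul, map_mul, map_inv, hl, h3, (heq n (ν w)).2 hn.symm, hν]

/-- Elementary abelian quotients of a group generated by two elements. -/
theorem card_le_four {A : Type*} [CommGroup A] (hA : ∀ x : A, x ^ 2 = 1) (φ : FreeGroupTwo →* A)
    (hφ : Surjective φ) : Nat.card A ≤ 4 := by
  have hz : ∀ (x : A) (i : ℤ), ∃ e : Fin 2, x ^ i = x ^ (e : ℕ) := by
    intro x i
    rcases Int.even_or_odd' i with ⟨k, rfl | rfl⟩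
    · exact ⟨0, by rw [zpow_mul, zpow_ofNat, hA, one_zpow]; simp⟩
    · exact ⟨1, by rw [zpow_add, zpow_mul, zpow_ofNat, hA, one_zpow]; simp⟩
  have hsurj : Surjective fun p : Fin 2 × Fin 2 =>
      φ FreeGroupTwo.gen₀ ^ (p.1 : ℕ) * φ FreeGroupTwo.gen₁ ^ (p.2 : ℕ) := by
    intro y
    obtain ⟨w, rfl⟩ := hφ y
    have hw : φ w ∈ zpowers (φ FreeGroupTwo.gen₀) ⊔ zpowers (φ FreeGroupTwo.gen₁) := by
      induction w using FreeGroup.induction_on with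
      | C1 => rw [map_one]; exact Subgroup.one_mem _
      | of i =>
        fin_cases i
        · exact Subgroup.mem_sup_left (Subgroup.mem_zpowers _)
        · exact Subgroup.mem_sup_right (Subgroup.mem_zpowers _)
      | inv_of i h => rw [map_inv]; exact Subgroup.inv_mem _ h
      | mul x y hx hy => rw [map_mul]; exact Subgroup.mul_mem _ hx hy
    obtain ⟨_, ⟨i, rfl⟩, _, ⟨j, rfl⟩, h⟩ := Subgroup.mem_sup.1 hw
    obtain ⟨e, he⟩ := hz (φ FreeGroupTwo.gen₀) i
    obtain ⟨e', he'⟩ := hz (φ FreeGroupTwo.gen₁) j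
    exact ⟨(e, e'), by rw [← h]; simp only [he, he']⟩
  calc Nat.card A ≤ Nat.card (Fin 2 × Fin 2) := Nat.card_le_card_of_surjective _ hsurj
    _ = 4 := by simp

end

end SisterGroup

theorem commute_map_freeGroup {α G : Type*} [Group G] (f : FreeGroup α →* G)
    (h : ∀ i j, Commute (f (FreeGroup.of i)) (f (FreeGroup.of j))) (u v : FreeGroup α) : Commute (f u) (f v) := by
  have hgen : ∀ u i, Commute (f u) (f (FreeGroup.of i)) := by
    intro u i
    induction u using FreeGroup.induction_on with
    | C1 => rw [map_one]; exact Commute.one_left _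
    | of j => exact h j i
    | inv_of j h => rw [map_inv]; exact h.inv_left
    | mul u v hu hv => rw [map_mul]; exact hu.mul_left hv
  induction v using FreeGroup.induction_on with
  | C1 => rw [map_one]; exact Commute.one_right _
  | of j => exact hgen u j
  | inv_of j h => rw [map_inv]; exact h.inv_right
  | mul u v hu hv => rw [map_mul]; exact hu.mul_right hv

/-- A finitely generated module over a finitely generated commutative ring of characteristic two is finite if its
quotients by `T ^ n - 1` are uniformly bounded, where `T` is a unit. -/
theorem Module.finite_of_index_le {R V : Type*} [CommRing R] [Algebra (ZMod 2) R] [Algebra.FiniteType (ZMod 2) R]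
    [AddCommGroup V] [Module R V] [Module.Finite R V] (T : Rˣ) (C : ℕ)
    (h : ∀ n, 0 < n → (LinearMap.lsmul R V (T ^ n - 1)).range.toAddSubgroup.index ≠ 0 ∧
      (LinearMap.lsmul R V (T ^ n - 1)).range.toAddSubgroup.index ≤ C) : Finite V ∧ Nat.card V ≤ C := by
  set I : ℕ → Submodule R V := fun n => (LinearMap.lsmul R V (T ^ n - 1)).range with hI
  have : IsNoetherianRing R := Algebra.FiniteType.isNoetherianRing (ZMod 2) R
  have hmono : ∀ n m, I (n * m) ≤ I n := by
    rintro n m _ ⟨v, rfl⟩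
    obtain ⟨s, hs⟩ : ((T : R) ^ n - 1) ∣ (T : R) ^ (n * m) - 1 := by rw [pow_mul]; exact sub_one_dvd_pow_sub_one _ _
    refine ⟨s • v, ?_⟩
    simp only [LinearMap.lsmul_apply, hs, mul_smul]
  have hbdd : BddAbove (Set.range fun n : ℕ => (I (n + 1)).toAddSubgroup.index) :=
    ⟨C, by rintro _ ⟨n, rfl⟩; exact (h _ n.succ_pos).2⟩
  obtain ⟨M, hM⟩ := Nat.sSup_mem (Set.range_nonempty _) hbdd
  have hstab : ∀ n, 0 < n → I ((M + 1) * n) = I (M + 1) := by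
    intro n hn
    obtain ⟨k, hk⟩ : ∃ k, (M + 1) * n = k + 1 := Nat.exists_eq_add_one_of_ne_zero (by positivity)
    have h1 := hmono (M + 1) n
    have h2 : (I ((M + 1) * n)).toAddSubgroup.index ≤ (I (M + 1)).toAddSubgroup.index := by
      rw [hk]; exact (le_csSup hbdd ⟨k, rfl⟩).trans_eq hM.symm
    have h3 := AddSubgroup.relIndex_mul_index (H := (I ((M + 1) * n)).toAddSubgroup)
      (K := (I (M + 1)).toAddSubgroup) h1
    have h4 := (h (M + 1) (by omega)).1
    have h5 := (h ((M + 1) * n) (by positivity)).1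
    have h6 : (I ((M + 1) * n)).toAddSubgroup.relIndex (I (M + 1)).toAddSubgroup = 1 := by
      have h7 : (I ((M + 1) * n)).toAddSubgroup.relIndex (I (M + 1)).toAddSubgroup ≠ 0 := fun h0 => by
        rw [h0, zero_mul] at h3; exact h5 h3.symm
      by_contra h8
      have h9 : 2 ≤ (I ((M + 1) * n)).toAddSubgroup.relIndex (I (M + 1)).toAddSubgroup := by omega
      nlinarith [Nat.pos_of_ne_zero h4]
    exact le_antisymm h1 (AddSubgroup.relIndex_eq_one.1 h6)
  have hbot : I (M + 1) = ⊥ := by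
    by_contra hne
    have : Nontrivial (I (M + 1)) := Submodule.nontrivial_iff_ne_bot.2 hne
    obtain ⟨W, hW, -⟩ := (eq_top_or_exists_le_coatom (⊥ : Submodule R (I (M + 1)))).resolve_left bot_ne_top
    have : IsSimpleModule R (I (M + 1) ⧸ W) := isSimpleModule_iff_isCoatom.2 hW
    obtain ⟨m, hm, ⟨e⟩⟩ := isSimpleModule_iff_quot_maximal.1 this
    let _ := Ideal.Quotient.field m
    have : Module.Finite (ZMod 2) (R ⧸ m) := finite_of_finite_type_of_isJacobsonRing (ZMod 2) (R ⧸ m)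
    have : Finite (R ⧸ m) := Module.finite_of_finite (ZMod 2)
    obtain ⟨n, hn, hTn⟩ := isOfFinOrder_iff_pow_eq_one.1 (isOfFinOrder_of_finite (Units.map (Ideal.Quotient.mk m : R →* R ⧸ m) T))
    have hTm : (T : R) ^ n - 1 ∈ m := by
      rw [← Ideal.Quotient.eq_zero_iff_mem, map_sub, map_pow, map_one, sub_eq_zero]
      exact congrArg Units.val hTn
    have hkill : ∀ w : I (M + 1), ((T : R) ^ n - 1) • w ∈ W := by
      intro w
      rw [← Submodule.Quotient.mk_eq_zero, Submodule.Quotient.mk_smul, ← e.map_eq_zero_iff, map_smul]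
      obtain ⟨r, hr⟩ := Ideal.Quotient.mk_surjective (e (Submodule.Quotient.mk w))
      rw [← hr]
      change Ideal.Quotient.mk m (((T : R) ^ n - 1) * r) = 0
      rw [Ideal.Quotient.eq_zero_iff_mem]
      exact m.mul_mem_right _ hTm
    refine hW.1 (eq_top_iff.2 fun w _ => ?_)
    have h2 : (2 : R) = 0 := by
      have := map_ofNat (algebraMap (ZMod 2) R) 2
      rw [← this, show (OfNat.ofNat 2 : ZMod 2) = 0 by decide, map_zero]
    have hw : (w : V) ∈ I ((M + 1) * (n * 2)) := (hstab (n * 2) (by omega)).symm ▸ w.2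
    obtain ⟨v, hv⟩ := hw
    obtain ⟨s, hs⟩ : ((T : R) ^ n - 1) ∣ (T : R) ^ ((M + 1) * n) - 1 := by
      rw [mul_comm, pow_mul]; exact sub_one_dvd_pow_sub_one _ _
    have hv' : (((T : R) ^ ((M + 1) * n) - 1) • v) ∈ I (M + 1) := hstab n hn ▸ ⟨v, rfl⟩
    have h3 : w = ((T : R) ^ n - 1) • (s • ⟨_, hv'⟩ : I (M + 1)) := by
      apply Subtype.ext
      rw [← hv]
      change ((T : R) ^ ((M + 1) * (n * 2)) - 1) • v = ((T : R) ^ n - 1) • s • ((T : R) ^ ((M + 1) * n) - 1) • v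
      rw [← mul_smul, ← mul_smul, ← hs, ← mul_assoc (M + 1), pow_mul]
      congr 1
      linear_combination ((T : R) ^ ((M + 1) * n) - 1) * h2
    rw [h3]
    exact hkill _
  have h0 := h (M + 1) (by omega)
  change (I (M + 1)).toAddSubgroup.index ≠ 0 ∧ (I (M + 1)).toAddSubgroup.index ≤ C at h0
  rw [hbot, Submodule.bot_toAddSubgroup, AddSubgroup.index_bot] at h0
  exact ⟨Nat.finite_of_card_ne_zero h0.1, h0.2⟩

/-- A vector space over the field with two elements which is finitely generated under an automorphism `T` is finite if
the coinvariants of the powers of `T` are uniformly bounded. -/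
theorem Module.End.finite_of_index_le {V : Type*} [AddCommGroup V] [Module (ZMod 2) V]
    (T : (Module.End (ZMod 2) V)ˣ) {S : Set V} (hS : S.Finite)
    (hspan : ∀ W : Submodule (ZMod 2) V, S ⊆ W → (∀ i : ℤ, ∀ w ∈ W, (T ^ i).val w ∈ W) → W = ⊤) (C : ℕ)
    (h : ∀ n : ℕ, 0 < n → Finite (V ⧸ (T.val ^ n - 1).range) → Nat.card (V ⧸ (T.val ^ n - 1).range) ≤ C) :
    Finite V ∧ Nat.card V ≤ C := by
  let R := MonoidAlgebra (ZMod 2) (Multiplicative ℤ)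
  let Φ : R →ₐ[ZMod 2] Module.End (ZMod 2) V :=
    MonoidAlgebra.lift _ _ _ ((Units.coeHom _).comp (zpowersHom _ T))
  let _ : Module R V := Module.compHom V Φ.toRingHom
  have hΦ : ∀ (r : R) (v : V), r • v = Φ r v := fun _ _ => rfl
  let X : Rˣ := (MonoidAlgebra.of (ZMod 2) (Multiplicative ℤ)).toHomUnits (ofAdd 1)
  have hX : Φ X = T := by
    change Φ (MonoidAlgebra.of _ _ _) = _
    rw [MonoidAlgebra.lift_of]
    simp
  have hXz : ∀ i : ℤ, Φ ((X ^ i : Rˣ) : R) = (T ^ i).val := fun i => by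
    have : Units.map (Φ : R →* Module.End (ZMod 2) V) X = T := Units.ext hX
    rw [← this]
    exact congrArg Units.val (map_zpow (Units.map (Φ : R →* Module.End (ZMod 2) V)) X i)
  have hscal : ∀ (c : ZMod 2) (v : V), c • v = algebraMap (ZMod 2) R c • v := fun c v => by
    rw [hΦ, AlgHom.commutes]; rfl
  have hfin : Module.Finite R V := by
    refine ⟨⟨hS.toFinset, ?_⟩⟩
    rw [hS.coe_toFinset, eq_top_iff]
    intro v _
    let W : Submodule (ZMod 2) V :=
      { (Submodule.span R S).toAddSubgroup with
        smul_mem' := fun c v hv => by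
          rw [hscal]; exact (Submodule.span R S).smul_mem _ hv }
    have hW : W = ⊤ := hspan W Submodule.subset_span fun i w hw => by
      rw [← hXz, ← hΦ]; exact (Submodule.span R S).smul_mem _ hw
    exact (hW ▸ Submodule.mem_top : v ∈ W)
  have hrange : ∀ n : ℕ, (LinearMap.lsmul R V ((X : R) ^ n - 1)).range.toAddSubgroup =
      (T.val ^ n - 1).range.toAddSubgroup := fun n => by
    have h1 : ∀ v, ((X : R) ^ n - 1) • v = (T.val ^ n - 1) v := fun v => by
      rw [hΦ, map_sub, map_pow, hX, map_one]
    ext v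
    exact ⟨fun ⟨w, hw⟩ => ⟨w, by rw [← hw, ← h1]; rfl⟩, fun ⟨w, hw⟩ => ⟨w, by rw [← hw, ← h1]; rfl⟩⟩
  have : Algebra.FiniteType (ZMod 2) R := MonoidAlgebra.finiteType_of_fg
  refine Module.finite_of_index_le X C fun n hn => ?_
  rw [hrange]
  have hq : Finite (V ⧸ (T.val ^ n - 1).range) := by
    set I := (T.val ^ n - 1).range
    let K : Subgroup (Module.End (ZMod 2) V)ˣ :=
      { carrier := {u | ∀ v, u.val v - v ∈ I}
        one_mem' := fun v => by simp
        mul_mem' := fun {u u'} hu hu' v => by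
          have := I.add_mem (hu (u'.val v)) (hu' v)
          rwa [sub_add_sub_cancel] at this
        inv_mem' := fun {u} hu v => by
          have := I.neg_mem (hu (u⁻¹.val v))
          rwa [← Module.End.mul_apply, Units.mul_inv, Module.End.one_apply, neg_sub] at this }
    have hTK : T ^ n ∈ K := fun v => ⟨v, by simp⟩
    have hW : Submodule.span (ZMod 2) {v | ∃ i : ℤ, ∃ s ∈ S, (T ^ i).val s = v} = ⊤ := by
      refine hspan _ (fun s hs => Submodule.subset_span ⟨0, s, hs, by simp⟩) fun i w hw => ?_
      induction hw using Submodule.span_induction with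
      | mem v hv =>
        obtain ⟨j, s, hs, rfl⟩ := hv
        exact Submodule.subset_span ⟨i + j, s, hs, by rw [zpow_add]; rfl⟩
      | zero => rw [map_zero]; exact Submodule.zero_mem _
      | add v w _ _ hv hw => rw [map_add]; exact Submodule.add_mem _ hv hw
      | smul c v _ hv => rw [map_smul]; exact Submodule.smul_mem _ c hv
    have hfq : Module.Finite (ZMod 2) (V ⧸ I) := by
      have hfs : (I.mkQ '' {v | ∃ i : ℤ, ∃ s ∈ S, (T ^ i).val s = v}).Finite := by
        refine ((Set.finite_Icc (0 : ℤ) n).image2 (fun i s => I.mkQ ((T ^ i).val s)) hS).subset ?_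
        rintro _ ⟨_, ⟨i, s, hs, rfl⟩, rfl⟩
        have hn0 : (0 : ℤ) < n := by exact_mod_cast hn
        refine ⟨i % n, ⟨Int.emod_nonneg i hn0.ne', (Int.emod_lt_of_pos i hn0).le⟩, s, hs, ?_⟩
        refine (Submodule.Quotient.eq I).2 ?_
        have h1 := I.neg_mem (K.zpow_mem hTK (i / n) ((T ^ (i % n)).val s))
        rwa [← Module.End.mul_apply, ← Units.val_mul, ← zpow_natCast, ← zpow_mul, ← zpow_add, neg_sub, add_comm,
          Int.emod_add_mul_ediv] at h1
      refine ⟨⟨hfs.toFinset, ?_⟩⟩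
      rw [hfs.coe_toFinset, Submodule.span_image, hW, Submodule.map_top, Submodule.range_mkQ]
    exact Module.finite_of_finite (ZMod 2)
  exact ⟨@Nat.card_pos _ _ hq |>.ne', h n hn hq⟩

namespace SisterGroup

open SemidirectProduct

/-- The degree of an element of a subgroup over the base circle. -/
abbrev degree (L : Subgroup SisterGroup) : L →* Multiplicative ℤ := rightHom.comp L.subtype

theorem mem_ker_degree {L : Subgroup SisterGroup} {x : L} : x ∈ (degree L).ker ↔ (x : SisterGroup) ∈ fibre := by
  rw [mem_fibre]; rfl

instance isFreeGroup_ker_degree (L : Subgroup SisterGroup) : IsFreeGroup (degree L).ker := by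
  let ι : (degree L).ker →* FreeGroupTwo := MonoidHom.mk' (fun x => (x : SisterGroup).left) fun x y => by
    have hx : ((x : L) : SisterGroup).right = 1 := x.2
    change ((x : SisterGroup) * (y : SisterGroup)).left = _
    rw [mul_left, hx, map_one]
    rfl
  have hι : Injective ι := fun x y h => Subtype.ext (Subtype.ext (SemidirectProduct.ext h
    ((show ((x : L) : SisterGroup).right = 1 from x.2).trans (show ((y : L) : SisterGroup).right = 1 from y.2).symm)))
  exact IsFreeGroup.ofMulEquiv (MonoidHom.ofInjective hι).symm

/-- Subgroups with two generic commutators which do not commute. -/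
def NonMetabelian (L : Subgroup SisterGroup) : Prop :=
  ∃ x₁ ∈ L, ∃ x₂ ∈ L, ∃ x₃ ∈ L, ∃ x₄ ∈ L, ⁅⁅x₁, x₂⁆, ⁅x₃, x₄⁆⁆ ≠ 1

variable {L : Subgroup SisterGroup}

theorem NonMetabelian.exists_not_commute (h : NonMetabelian L) : ∃ x y : (degree L).ker, ¬ Commute x y := by
  obtain ⟨x₁, h₁, x₂, h₂, x₃, h₃, x₄, h₄, hne⟩ := h
  have hk : ∀ x y : L, ⁅x, y⁆ ∈ (degree L).ker := fun x y => by
    rw [MonoidHom.mem_ker, map_commutatorElement, commutatorElement_eq_one_iff_mul_comm, mul_comm]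
  refine ⟨⟨_, hk ⟨x₁, h₁⟩ ⟨x₂, h₂⟩⟩, ⟨_, hk ⟨x₃, h₃⟩ ⟨x₄, h₄⟩⟩, fun hc => hne ?_⟩
  rw [commutatorElement_eq_one_iff_mul_comm]
  exact congrArg (fun z : (degree L).ker => ((z : L) : SisterGroup)) hc.eq

theorem NonMetabelian.nontrivial_generators (h : NonMetabelian L) : Nontrivial (IsFreeGroup.Generators (degree L).ker) := by
  obtain ⟨x, y, hxy⟩ := h.exists_not_commute
  by_contra hn
  rw [not_nontrivial_iff_subsingleton] at hn
  apply hxy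
  have := commute_map_freeGroup (IsFreeGroup.toFreeGroup (degree L).ker).symm.toMonoidHom
    (fun i j => Subsingleton.elim i j ▸ Commute.refl _) (IsFreeGroup.toFreeGroup _ x) (IsFreeGroup.toFreeGroup _ y)
  simpa [Commute, SemiconjBy] using this

/-- A non-metabelian subgroup whose finite quotients are quotients of the sister group is not contained in the fibre. -/
theorem NonMetabelian.exists_degree_ne_one (h : NonMetabelian L) (hdom : DominatesQuotients L) :
    ∃ x, degree L x ≠ 1 := by
  by_contra hne
  push Not at hne
  obtain ⟨x, y, hxy⟩ := h.nontrivial_generators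
  classical
  let A := Multiplicative (ZMod 2 × ZMod 2)
  let p : (degree L).ker →* A := IsFreeGroup.lift fun z => if z = x then ofAdd (1, 0) else
    if z = y then ofAdd (0, 1) else 1
  let q : L →* A := p.comp (MonoidHom.codRestrict (MonoidHom.id L) _ hne)
  have hq : Surjective q := by
    have hp : ∀ n : (degree L).ker, q n = p n := fun n => rfl
    have h1 : q (IsFreeGroup.of x : (degree L).ker) = ofAdd (1, 0) := by rw [hp, IsFreeGroup.lift_of]; simp
    have h2 : q (IsFreeGroup.of y : (degree L).ker) = ofAdd (0, 1) := by rw [hp, IsFreeGroup.lift_of]; simp [hxy.symm]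
    have h3 : ∀ z : A, z = 1 ∨ z = ofAdd (1, 0) ∨ z = ofAdd (0, 1) ∨
      z = ofAdd (1, 0) * ofAdd (0, 1) := by decide
    intro z
    rcases h3 z with rfl | rfl | rfl | rfl
    · exact ⟨1, map_one q⟩
    · exact ⟨_, h1⟩
    · exact ⟨_, h2⟩
    · exact ⟨(IsFreeGroup.of x : (degree L).ker) * (IsFreeGroup.of y : (degree L).ker), by rw [map_mul, h1, h2]⟩
  obtain ⟨f, hf⟩ := hdom A q hq
  have hA : ∀ z : A, z ^ 5 = z := by decide
  have hpow : ∀ z : A, ∃ n : ℤ, z = f t ^ n := by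
    intro z
    obtain ⟨u, rfl⟩ := hf z
    obtain ⟨v, hv, n, rfl⟩ := exists_mem_fibre_mul u
    exact ⟨n, by rw [map_mul, ← hA (f v), map_fibre_pow_five f hv, one_mul, map_zpow]⟩
  have hA2 : ∀ z : A, z ^ 2 = 1 := by decide
  have hcases : ∀ z : A, z = 1 ∨ z = f t := by
    intro z
    obtain ⟨n, rfl⟩ := hpow z
    rcases Int.even_or_odd' n with ⟨k, rfl | rfl⟩
    · left; rw [zpow_mul, zpow_ofNat, hA2, one_zpow]
    · right; rw [zpow_add, zpow_mul, zpow_ofNat, hA2, one_zpow, one_mul, zpow_one]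
  have h1 := (hcases (ofAdd (1, 0))).resolve_left (by decide)
  have h2 := (hcases (ofAdd (0, 1))).resolve_left (by decide)
  exact absurd (h1.trans h2.symm) (by decide)

end SisterGroup

theorem Module.End.pow_sub_one_mul {V : Type*} [AddCommGroup V] [Module (ZMod 2) V] {x y : Module.End (ZMod 2) V}
    (h : Commute x y) (n : ℕ) : (x ^ n - 1) * y = y * (x ^ n - 1) := by
  rw [sub_mul, mul_sub, (h.pow_left n).eq, one_mul, mul_one]

namespace SisterGroup

variable {L : Subgroup SisterGroup}

theorem NonMetabelian.card_generators (h : NonMetabelian L) (hfg : L.FG) (hdom : DominatesQuotients L) :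
    Nat.card (IsFreeGroup.Generators (degree L).ker) = 2 := by
  classical
  set X := IsFreeGroup.Generators (degree L).ker with hX
  have hnt : Nontrivial X := h.nontrivial_generators
  obtain ⟨τ, hgen⟩ := exists_generator (degree L)
  have hτ : degree L τ ≠ 1 := fun h1 => by
    obtain ⟨x, hx⟩ := h.exists_degree_ne_one hdom
    obtain ⟨i, hi⟩ := hgen x
    exact hx (by rw [hi, h1, one_zpow])
  let V := X →₀ ZMod 2
  let ab : (degree L).ker →* Multiplicative V := IsFreeGroup.lift fun x => ofAdd (Finsupp.single x 1)
  have hab : ∀ x : X, ab (IsFreeGroup.of x) = ofAdd (Finsupp.single x 1) := IsFreeGroup.lift_of _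
  have hsurj : ∀ v : V, ∃ n, (ab n).toAdd = v := by
    intro v
    induction v using Finsupp.induction_linear with
    | zero => exact ⟨1, by rw [map_one]; rfl⟩
    | add v w hv hw =>
      obtain ⟨n, rfl⟩ := hv
      obtain ⟨m, rfl⟩ := hw
      exact ⟨n * m, by rw [map_mul]; rfl⟩
    | single x c =>
      have hc : c = 0 ∨ c = 1 := by revert c; decide
      rcases hc with rfl | rfl
      · exact ⟨1, by rw [map_one, Finsupp.single_zero]; rfl⟩
      · exact ⟨IsFreeGroup.of x, by rw [hab]; rfl⟩
  let c₀ (g : L) : Module.End (ZMod 2) V :=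
    Finsupp.linearCombination (ZMod 2) fun x => (ab (MulAut.conjNormal g (IsFreeGroup.of x))).toAdd
  have hc₀ : ∀ g n, c₀ g (ab n).toAdd = (ab (MulAut.conjNormal g n)).toAdd := by
    intro g n
    have h1 : (AddMonoidHom.toMultiplicative (c₀ g).toAddMonoidHom).comp ab =
        ab.comp (MulAut.conjNormal g : MulAut (degree L).ker).toMonoidHom := by
      refine IsFreeGroup.ext_hom fun x => ?_
      change ofAdd (c₀ g (ab (IsFreeGroup.of x)).toAdd) = ab (MulAut.conjNormal g (IsFreeGroup.of x))
      rw [hab]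
      change ofAdd (Finsupp.linearCombination _ _ (Finsupp.single x 1)) = _
      rw [Finsupp.linearCombination_single, one_smul]
      rfl
    exact congrArg toAdd (DFunLike.congr_fun h1 n)
  let c : L →* Module.End (ZMod 2) V :=
    { toFun := c₀
      map_one' := LinearMap.ext fun v => by
        obtain ⟨n, rfl⟩ := hsurj v
        rw [hc₀, map_one]; rfl
      map_mul' := fun g g' => LinearMap.ext fun v => by
        obtain ⟨n, rfl⟩ := hsurj v
        rw [Module.End.mul_apply, hc₀, hc₀, hc₀, map_mul]; rfl }
  have hc : ∀ g n, c g (ab n).toAdd = (ab (MulAut.conjNormal g n)).toAdd := hc₀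
  let T : (Module.End (ZMod 2) V)ˣ := c.toHomUnits τ
  have hT : ∀ i : ℤ, (T ^ i).val = c (τ ^ i) := fun i => by
    rw [show T ^ i = c.toHomUnits (τ ^ i) from (map_zpow c.toHomUnits τ i).symm]; rfl
  choose ι hι using hgen
  have hιu : ∀ g i, degree L g = degree L τ ^ i → ι g = i := fun g i hi => by
    have h1 : ι g * (degree L τ).toAdd = i * (degree L τ).toAdd := congrArg toAdd ((hι g).symm.trans hi)
    exact mul_right_cancel₀ (fun h0 => hτ (Multiplicative.toAdd.injective h0)) h1
  let κ (g : L) : (degree L).ker := ⟨g * τ ^ (-ι g), mul_zpow_neg_mem_ker (hι g)⟩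
  have hκ : ∀ g, (κ g : L) * τ ^ ι g = g := fun g => by
    change g * τ ^ (-ι g) * τ ^ ι g = g
    rw [mul_assoc, ← zpow_add, neg_add_cancel, zpow_zero, mul_one]
  have hcker : ∀ n : (degree L).ker, c n = 1 := fun n => LinearMap.ext fun v => by
    obtain ⟨m, rfl⟩ := hsurj v
    have : MulAut.conjNormal (n : L) m = n * m * n⁻¹ := Subtype.ext (MulAut.conjNormal_apply _ _)
    rw [hc, this, map_mul ab, map_mul ab, map_inv, mul_right_comm, mul_inv_cancel, one_mul]; rfl
  have hcg : ∀ g, c g = c (τ ^ ι g) := fun g => by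
    conv_lhs => rw [← hκ g]
    rw [map_mul, hcker, one_mul]
  let β (g : L) : V := (ab (κ g)).toAdd
  have hβ : ∀ g g', β (g * g') = β g + c g (β g') := by
    intro g g'
    have h1 : ι (g * g') = ι g + ι g' := hιu _ _ (by rw [map_mul, hι g, hι g', ← zpow_add])
    have h2 : κ (g * g') = κ g * MulAut.conjNormal (τ ^ ι g) (κ g') := by
      apply Subtype.ext
      rw [Subgroup.coe_mul, MulAut.conjNormal_apply]
      change g * g' * τ ^ (-ι (g * g')) = g * τ ^ (-ι g) * (τ ^ ι g * (g' * τ ^ (-ι g')) * (τ ^ ι g)⁻¹)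
      rw [h1]
      group
    change (ab (κ (g * g'))).toAdd = _
    rw [h2, map_mul, hcg, hc]
    rfl
  have hβ1 : β 1 = 0 := by
    have := hβ 1 1
    rw [mul_one, map_one] at this
    exact left_eq_add.1 this
  have hβker : ∀ n : (degree L).ker, β n = (ab n).toAdd := by
    intro n
    have h1 : ι n = 0 := hιu _ _ (by rw [zpow_zero]; exact n.2)
    have h2 : κ n = n := Subtype.ext (by change (n : L) * τ ^ (-ι n) = n; rw [h1, neg_zero, zpow_zero, mul_one])
    change (ab (κ n)).toAdd = _
    rw [h2]
  obtain ⟨S, hS, hSfin⟩ := Group.fg_iff.1 ((Group.fg_iff_subgroup_fg L).2 hfg)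
  obtain ⟨hfin, hcard⟩ := Module.End.finite_of_index_le T (hSfin.image β) (fun W hSW hW => by
      let K : Subgroup L :=
        { carrier := {g | β g ∈ W}
          one_mem' := by change β 1 ∈ W; rw [hβ1]; exact W.zero_mem
          mul_mem' := fun {g g'} hg hg' => by
            change β (g * g') ∈ W
            rw [hβ, hcg, ← hT]
            exact W.add_mem hg (hW _ _ hg')
          inv_mem' := fun {g} hg => by
            change β g⁻¹ ∈ W
            have h1 := hβ g⁻¹ g
            rw [inv_mul_cancel, hβ1, hcg, ← hT, eq_comm, add_eq_zero_iff_eq_neg] at h1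
            rw [h1]
            exact W.neg_mem (hW _ _ hg) }
      have hK : K = ⊤ := top_unique (hS ▸ (Subgroup.closure_le K).2 fun s hs => hSW ⟨s, hs, rfl⟩)
      rw [eq_top_iff]
      intro v _
      obtain ⟨n, rfl⟩ := hsurj v
      rw [← hβker]
      exact (hK ▸ Subgroup.mem_top _ : (n : L) ∈ K)) 4 (fun n _ hfin => by
      set I := (T.val ^ n - 1).range
      let p : (degree L).ker →* Multiplicative (V ⧸ I) := (AddMonoidHom.toMultiplicative I.mkQ.toAddMonoidHom).comp ab
      have hp : ∀ n, p n = 1 ↔ (ab n).toAdd ∈ I := fun n => Submodule.Quotient.mk_eq_zero I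
      obtain ⟨φ, l, hφ, -⟩ := exists_hom_of_invariant hτ (fun x => ⟨ι x, hι x⟩) hdom p
        (fun y => by
          obtain ⟨v, rfl⟩ := Submodule.Quotient.mk_surjective I y
          obtain ⟨m, rfl⟩ := hsurj v
          exact ⟨m, rfl⟩)
        (fun g m hm => by
          rw [hp] at hm ⊢
          obtain ⟨v, hv⟩ := hm
          rw [← hc, ← hv]
          refine ⟨c g v, ?_⟩
          have hcomm : (T.val ^ n - 1) * c g = c g * (T.val ^ n - 1) := by
            have : Commute (T.val) (c g) := by
              rw [hcg, ← hT]
              exact congrArg Units.val ((Commute.refl T).zpow_right (ι g)).eq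
            exact Module.End.pow_sub_one_mul this n
          exact LinearMap.congr_fun hcomm v)
      exact card_le_four (A := Multiplicative (V ⧸ I)) (fun y => by
        obtain ⟨v, rfl⟩ := Submodule.Quotient.mk_surjective I y
        change ofAdd (2 • (Submodule.Quotient.mk v : V ⧸ I)) = 1
        rw [← Submodule.Quotient.mk_smul, show (2 : ℕ) • v = (2 : ZMod 2) • v from (Nat.cast_smul_eq_nsmul (ZMod 2) 2 v).symm,
          show (2 : ZMod 2) = 0 by decide, zero_smul]
        rfl) φ hφ)
  have hXfin : Finite X := Finite.of_injective (fun x : X => (Finsupp.single x 1 : V)) fun x y hxy =>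
    (Finsupp.single_left_inj one_ne_zero).1 hxy
  have := Fintype.ofFinite X
  rw [Nat.card_congr (Finsupp.equivFunOnFinite : V ≃ (X → ZMod 2)), Nat.card_fun, Nat.card_zmod] at hcard
  have h2 : 1 < Nat.card X := Finite.one_lt_card
  have h3 : Nat.card X ≤ 2 := by
    by_contra hlt
    have := Nat.pow_le_pow_right (n := 2) (by norm_num) (show 3 ≤ Nat.card X by omega)
    omega
  omega

theorem NonMetabelian.exists_mulEquiv (h : NonMetabelian L) (hfg : L.FG) (hdom : DominatesQuotients L) :
    Nonempty (FreeGroupTwo ≃* (degree L).ker) := by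
  have hc := h.card_generators hfg hdom
  have : Finite (IsFreeGroup.Generators (degree L).ker) := Nat.finite_of_card_ne_zero (by omega)
  exact ⟨(FreeGroup.freeGroupCongr ((Finite.equivFin _).trans (finCongr hc))).symm.trans
    (IsFreeGroup.toFreeGroup (degree L).ker).symm⟩

end SisterGroup

section CommutatorTrace

open FreeGroupTwo

theorem FreeGroupTwo.map_commutator {G : Type*} [Group G] (f : FreeGroupTwo →* G) (h : Commute (f gen₀) (f gen₁))
    (u v : FreeGroupTwo) : f ⁅u, v⁆ = 1 := by
  rw [map_commutatorElement, commutatorElement_eq_one_iff_mul_comm]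
  refine commute_map_freeGroup f (fun i j => ?_) u v
  fin_cases i <;> fin_cases j
  exacts [Commute.refl _, h, h.symm, Commute.refl _]

namespace Matrix.SpecialLinearGroup

variable {R : Type*} [CommRing R]

/-- The trace. -/
def tr (A : SL(2, R)) : R := (A : Mat₂ R).trace

theorem tr_eq (A : SL(2, R)) : A.tr = A 0 0 + A 1 1 := trace_fin_two _

theorem tr_mul_comm (A B : SL(2, R)) : (A * B).tr = (B * A).tr := Matrix.trace_mul_comm _ _

theorem tr_map {S : Type*} [CommRing S] (f : R →+* S) (A : SL(2, R)) : (SpecialLinearGroup.map f A).tr = f A.tr := by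
  rw [tr_eq, tr_eq, map_add]; rfl

theorem tr_conj (A B : SL(2, R)) : (B * A * B⁻¹).tr = A.tr := by rw [tr_mul_comm, inv_mul_cancel_left]

theorem det_eq (A : SL(2, R)) : A 0 0 * A 1 1 - A 0 1 * A 1 0 = 1 := by rw [← det_fin_two]; exact A.det_coe

theorem mul_apply_two (A B : SL(2, R)) (i j : Fin 2) : (A * B) i j = A i 0 * B 0 j + A i 1 * B 1 j := by
  rw [coe_mul, mul_apply, Fin.sum_univ_two]

theorem inv_apply_two (A : SL(2, R)) : A⁻¹ 0 0 = A 1 1 ∧ A⁻¹ 0 1 = -A 0 1 ∧ A⁻¹ 1 0 = -A 1 0 ∧ A⁻¹ 1 1 = A 0 0 := by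
  rw [SL2_inv_expl]; exact ⟨rfl, rfl, rfl, rfl⟩

theorem tr_mul_inv (A B : SL(2, R)) : (A * B⁻¹).tr = A.tr * B.tr - (A * B).tr := by
  obtain ⟨h1, h2, h3, h4⟩ := inv_apply_two B
  simp only [tr_eq, mul_apply_two, h1, h2, h3, h4]
  ring

/-- If the commutator of a pair of matrices has trace two, so does every commutator in the group they generate. -/
theorem tr_commutator_eq_two {ρ : FreeGroupTwo →* SL(2, R)} (h : (ρ 𝔠).tr = 2) (u v : FreeGroupTwo) :
    (ρ ⁅u, v⁆).tr = 2 := by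
  set A := (ρ gen₀ : Mat₂ R) with hA
  set B := (ρ gen₁ : Mat₂ R) with hB
  have dA := det_eq (ρ gen₀)
  have dB := det_eq (ρ gen₁)
  let l (Y : Mat₂ R) : R := (Y * (A * B - B * A)).trace
  have ladd : ∀ Y Z, l (Y + Z) = l Y + l Z := fun Y Z => by simp only [l, add_mul, Matrix.trace_add]
  have lsub : ∀ Y Z, l (Y - Z) = l Y - l Z := fun Y Z => by simp only [l, sub_mul, Matrix.trace_sub]
  have lsmul : ∀ (r : R) Y, l (r • Y) = r * l Y := fun r Y => by
    simp only [l, Matrix.smul_mul, trace_smul, smul_eq_mul]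
  have cay : ∀ X : SL(2, R), (X : Mat₂ R) * X = X.tr • (X : Mat₂ R) - 1 := by
    intro X
    have := det_eq X
    refine Matrix.ext fun i j => ?_
    fin_cases i <;> fin_cases j <;> simp [mul_apply, Fin.sum_univ_two, tr_eq] <;> first | linear_combination -this | ring
  have cinv : ∀ X : SL(2, R), ((X⁻¹ : SL(2, R)) : Mat₂ R) = X.tr • 1 - X := by
    intro X
    rw [SL2_inv_expl]
    refine Matrix.ext fun i j => ?_
    fin_cases i <;> fin_cases j <;> simp [tr_eq]
  have hBA : B * A = (ρ gen₁).tr • A + (ρ gen₀).tr • B + ((ρ (gen₀ * gen₁)).tr - (ρ gen₀).tr * (ρ gen₁).tr) • 1 - A * B := by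
    rw [map_mul]
    refine Matrix.ext fun i j => ?_
    fin_cases i <;> fin_cases j <;> simp [hA, hB, mul_apply, Fin.sum_univ_two, tr_eq] <;> ring
  have hAA := cay (ρ gen₀)
  have hBB := cay (ρ gen₁)
  have lAA : ∀ Y, l (Y * A * A) = (ρ gen₀).tr * l (Y * A) - l Y := fun Y => by
    rw [mul_assoc, hAA, mul_sub, Matrix.mul_smul, mul_one, lsub, lsmul]
  have lBB : ∀ Y, l (Y * B * B) = (ρ gen₁).tr * l (Y * B) - l Y := fun Y => by
    rw [mul_assoc, hBB, mul_sub, Matrix.mul_smul, mul_one, lsub, lsmul]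
  have lABB : ∀ Y, l (Y * A * B * B) = (ρ gen₁).tr * l (Y * A * B) - l (Y * A) := fun Y => lBB _
  have lAAB : ∀ Y, l (Y * A * A * B) = (ρ gen₀).tr * l (Y * A * B) - l (Y * B) := fun Y => by
    rw [mul_assoc Y A A, hAA, mul_sub, Matrix.mul_smul, mul_one, sub_mul, Matrix.smul_mul, lsub, lsmul]
  have lBA : ∀ Y, l (Y * B * A) = (ρ gen₁).tr * l (Y * A) + (ρ gen₀).tr * l (Y * B) +
      ((ρ (gen₀ * gen₁)).tr - (ρ gen₀).tr * (ρ gen₁).tr) * l Y - l (Y * A * B) := fun Y => by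
    rw [mul_assoc, hBA, mul_sub, mul_add, mul_add, Matrix.mul_smul, Matrix.mul_smul, Matrix.mul_smul, mul_one, lsub,
      ladd, ladd, lsmul, lsmul, lsmul, mul_assoc]
  have lBAB : ∀ Y, l (Y * B * A * B) = (ρ gen₁).tr * l (Y * A * B) + (ρ gen₀).tr * l (Y * B * B) +
      ((ρ (gen₀ * gen₁)).tr - (ρ gen₀).tr * (ρ gen₁).tr) * l (Y * B) - l (Y * A * B * B) := fun Y => by
    rw [mul_assoc Y B A, hBA, mul_sub, mul_add, mul_add, Matrix.mul_smul, Matrix.mul_smul, Matrix.mul_smul, mul_one,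
      sub_mul, add_mul, add_mul, Matrix.smul_mul, Matrix.smul_mul, Matrix.smul_mul, lsub, ladd, ladd, lsmul, lsmul, lsmul,
      mul_assoc Y A B]
  have key : ∀ w, l (ρ w) = 0 ∧ l (ρ w * A) = 0 ∧ l (ρ w * B) = 0 ∧ l (ρ w * A * B) = 0 := by
    let K (Y : Mat₂ R) : Prop := l Y = 0 ∧ l (Y * A) = 0 ∧ l (Y * B) = 0 ∧ l (Y * A * B) = 0
    have KA : ∀ Y, K Y → K (Y * A) := fun Y ⟨h1, h2, h3, h4⟩ =>
      ⟨h2, by rw [lAA, h1, h2]; ring, h4, by rw [lAAB, h3, h4]; ring⟩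
    have KB : ∀ Y, K Y → K (Y * B) := fun Y ⟨h1, h2, h3, h4⟩ =>
      ⟨h3, by rw [lBA, h1, h2, h3, h4]; ring, by rw [lBB, h1, h3]; ring, by
        rw [lBAB, lABB, lBB, h1, h2, h3, h4]; ring⟩
    have Klin : ∀ (r : R) Y Z, K Y → K Z → K (r • Y - Z) := by
      rintro r Y Z ⟨h1, h2, h3, h4⟩ ⟨k1, k2, k3, k4⟩
      refine ⟨?_, ?_, ?_, ?_⟩ <;> simp only [sub_mul, Matrix.smul_mul, lsub, lsmul, h1, h2, h3, h4, k1, k2, k3, k4] <;>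
        ring
    have Kinv : ∀ Y (X : SL(2, R)), K Y → K (Y * X) → K (Y * (X⁻¹ : SL(2, R))) := fun Y X h h' => by
      rw [cinv, mul_sub, Matrix.mul_smul, mul_one]; exact Klin _ _ _ h h'
    have Kw : ∀ w Y, K Y → K (Y * ρ w) := by
      intro w
      induction w using FreeGroup.induction_on with
      | C1 => intro Y h; rw [map_one, coe_one, mul_one]; exact h
      | of i => intro Y h; fin_cases i; exacts [KA Y h, KB Y h]
      | inv_of i h => intro Y hY; rw [map_inv]; exact Kinv _ _ hY (h Y hY)
      | mul u v hu hv => intro Y h; rw [map_mul, coe_mul, ← mul_assoc]; exact hv _ (hu _ h)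
    have K1 : K 1 := by
      have hc := h
      rw [commutatorElement_def, map_mul, map_mul, map_mul, map_inv, map_inv] at hc
      obtain ⟨a1, a2, a3, a4⟩ := inv_apply_two (ρ gen₀)
      obtain ⟨b1, b2, b3, b4⟩ := inv_apply_two (ρ gen₁)
      simp only [tr_eq, mul_apply_two, a1, a2, a3, a4, b1, b2, b3, b4] at hc
      refine ⟨by simp only [l, one_mul, Matrix.trace_sub, Matrix.trace_mul_comm B A, sub_self], ?_, ?_, ?_⟩ <;>
        rw [one_mul] <;>
        simp only [l, trace_fin_two, mul_apply, Matrix.sub_apply, Fin.sum_univ_two, hA, hB]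
      · ring
      · ring
      · linear_combination hc - 2 * ((ρ gen₁) 0 0 * (ρ gen₁) 1 1 - (ρ gen₁) 0 1 * (ρ gen₁) 1 0) * dA - 2 * dB
    intro w
    have := Kw w 1 K1
    rwa [one_mul] at this
  let M : Subgroup FreeGroupTwo :=
    { carrier := {w | ∀ g, (ρ (g * w)).tr = (ρ g).tr}
      one_mem' := fun g => by rw [mul_one]
      mul_mem' := fun {w w'} hw hw' g => by rw [← mul_assoc, hw', hw]
      inv_mem' := fun {w} hw g => by rw [← hw, inv_mul_cancel_right] }
  have hM : M.Normal := ⟨fun w hw g x => by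
    rw [← mul_assoc, ← mul_assoc, map_mul, tr_mul_comm, ← map_mul, ← mul_assoc, ← mul_assoc, hw, mul_assoc, map_mul,
      tr_mul_comm, ← map_mul, mul_inv_cancel_right]⟩
  have hcM : 𝔠 ∈ M := by
    intro g
    have h1 := (key (gen₀⁻¹ * gen₁⁻¹ * g)).1
    simp only [l, mul_sub, Matrix.trace_sub, sub_eq_zero] at h1
    have h2 : (ρ (gen₀⁻¹ * gen₁⁻¹ * g) * (ρ gen₀ * ρ gen₁)).tr = (ρ (gen₀⁻¹ * gen₁⁻¹ * g) * (ρ gen₁ * ρ gen₀)).tr := h1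
    simp only [← map_mul] at h2
    have h3 : ∀ x y : FreeGroupTwo, (ρ (x * y)).tr = (ρ (y * x)).tr := fun x y => by
      rw [map_mul, tr_mul_comm, map_mul]
    rw [commutatorElement_def, ← mul_assoc, h3, show gen₁⁻¹ * (g * (gen₀ * gen₁ * gen₀⁻¹)) =
      (gen₁⁻¹ * g * (gen₀ * gen₁)) * gen₀⁻¹ by group, h3, show gen₀⁻¹ * (gen₁⁻¹ * g * (gen₀ * gen₁)) =
      gen₀⁻¹ * gen₁⁻¹ * g * (gen₀ * gen₁) by group, h2, show gen₀⁻¹ * gen₁⁻¹ * g * (gen₁ * gen₀) =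
      (gen₀⁻¹ * gen₁⁻¹) * (g * (gen₁ * gen₀)) by group, h3]
    group
  have hM1 : ⁅u, v⁆ ∈ M := (eq_one_iff _).1 (map_commutator (mk' M) (by
    rw [← commutatorElement_eq_one_iff_commute, ← map_commutatorElement]
    exact (eq_one_iff _).2 hcM) u v)
  have h2 := hM1 1
  rw [one_mul, map_one] at h2
  rw [h2, tr_eq]
  simp [one_add_one_eq_two]

theorem dvd_tr_commutator_sub_two (ρ : FreeGroupTwo →* SL(2, R)) (u v : FreeGroupTwo) :
    (ρ 𝔠).tr - 2 ∣ (ρ ⁅u, v⁆).tr - 2 := by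
  let q := Ideal.Quotient.mk (Ideal.span {(ρ 𝔠).tr - 2})
  have hq : ∀ x, q (x - 2) = q x - 2 := fun x => by rw [map_sub, map_ofNat]
  have h := tr_commutator_eq_two (ρ := (map q).comp ρ)
    (by rw [MonoidHom.comp_apply, tr_map, ← sub_eq_zero, ← hq]
        exact Ideal.Quotient.eq_zero_iff_mem.2 (Ideal.mem_span_singleton_self _)) u v
  rw [MonoidHom.comp_apply, tr_map, ← sub_eq_zero, ← hq] at h
  exact Ideal.mem_span_singleton.1 (Ideal.Quotient.eq_zero_iff_mem.1 h)

theorem associated_tr_commutator_sub_two (ρ : FreeGroupTwo →* SL(2, R)) (α : MulAut FreeGroupTwo) :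
    ((ρ 𝔠).tr - 2) ∣ ((ρ (α 𝔠)).tr - 2) ∧ ((ρ (α 𝔠)).tr - 2) ∣ ((ρ 𝔠).tr - 2) := by
  constructor
  · rw [map_commutatorElement α]
    exact dvd_tr_commutator_sub_two ρ _ _
  · have := dvd_tr_commutator_sub_two (ρ.comp α.toMonoidHom) (α.symm gen₀) (α.symm gen₁)
    simpa [map_commutatorElement] using this

end Matrix.SpecialLinearGroup

namespace FreeGroupTwo

variable {R : Type*} [CommRing R]

/-- A one-parameter family of representations whose generators have equal traces. -/
def markovRep (T : R) : FreeGroupTwo →* SL(2, R) :=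
  FreeGroup.lift ![⟨!![1, -T; -T, 1 + T ^ 2], by rw [det_fin_two_of]; ring⟩,
    ⟨!![1, T; T, 1 + T ^ 2], by rw [det_fin_two_of]; ring⟩]

theorem markovRep_gen₀ (T : R) : (markovRep T gen₀ : Mat₂ R) = !![1, -T; -T, 1 + T ^ 2] := by simp [markovRep, gen₀]

theorem markovRep_gen₁ (T : R) : (markovRep T gen₁ : Mat₂ R) = !![1, T; T, 1 + T ^ 2] := by simp [markovRep, gen₁]

theorem map_markovRep {S : Type*} [CommRing S] (f : R →+* S) (T : R) (w : FreeGroupTwo) :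
    SpecialLinearGroup.map f (markovRep T w) = markovRep (f T) w := by
  rw [← MonoidHom.comp_apply]
  congr 1
  refine FreeGroup.ext_hom _ _ fun i => Subtype.ext ?_
  rw [MonoidHom.comp_apply, SpecialLinearGroup.map_apply_coe]
  fin_cases i
  · change _ = (markovRep (f T) gen₀ : Mat₂ S)
    rw [markovRep_gen₀]
    refine Eq.trans (congrArg _ (markovRep_gen₀ T)) (Matrix.ext fun i j => ?_)
    fin_cases i <;> fin_cases j <;> simp
  · change _ = (markovRep (f T) gen₁ : Mat₂ S)
    rw [markovRep_gen₁]
    refine Eq.trans (congrArg _ (markovRep_gen₁ T)) (Matrix.ext fun i j => ?_)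
    fin_cases i <;> fin_cases j <;> simp

theorem markovRep_omega (w : FreeGroupTwo) :
    markovRep (⟨0, 1⟩ : 𝓔) w = SisterGroup.holonomy (SemidirectProduct.inl w) := by
  rw [← MonoidHom.comp_apply]
  congr 1
  refine FreeGroup.ext_hom _ _ fun i => ?_
  rw [MonoidHom.comp_apply]
  fin_cases i
  · refine Eq.trans (Subtype.ext ?_) SisterGroup.holonomy_a.symm
    refine (markovRep_gen₀ _).trans ?_
    decide
  · refine Eq.trans (Subtype.ext ?_) SisterGroup.holonomy_b.symm
    refine (markovRep_gen₁ _).trans ?_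
    decide

theorem tr_markovRep_commutator (T : R) : (markovRep T 𝔠).tr - 2 = -4 * T ^ 6 := by
  obtain ⟨a1, a2, a3, a4⟩ := SpecialLinearGroup.inv_apply_two (markovRep T gen₀)
  obtain ⟨b1, b2, b3, b4⟩ := SpecialLinearGroup.inv_apply_two (markovRep T gen₁)
  rw [commutatorElement_def, map_mul, map_mul, map_mul, map_inv, map_inv]
  simp only [SpecialLinearGroup.tr_eq, SpecialLinearGroup.mul_apply_two, a1, a2, a3, a4, b1, b2, b3, b4,
    markovRep_gen₀, markovRep_gen₁]
  simp
  ring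

theorem tr_markovRep_mod_three (u v : FreeGroupTwo) : (markovRep (1 : ZMod 3) ⁅u, v⁆).tr ≠ 0 := by
  have h : ((mk' (Subgroup.center SL(2, ZMod 3))).comp (markovRep 1)) ⁅u, v⁆ = 1 := by
    refine map_commutator _ ?_ u v
    rw [← commutatorElement_eq_one_iff_commute, ← map_commutatorElement]
    refine (eq_one_iff _).2 ?_
    rw [map_commutatorElement, commutatorElement_def, Matrix.SpecialLinearGroup.mem_center_iff]
    refine ⟨-1, by decide, ?_⟩
    rw [SL2_inv_expl, SL2_inv_expl]
    simp only [markovRep_gen₀, markovRep_gen₁]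
    decide
  obtain ⟨r, hr, h⟩ := Matrix.SpecialLinearGroup.mem_center_iff.1 ((eq_one_iff _).1 h)
  rw [SpecialLinearGroup.tr, ← h]
  simp only [Matrix.scalar_apply, Matrix.trace_diagonal, Fin.sum_univ_two]
  clear h
  revert r
  decide

open Polynomial in
theorem tr_markovRep_eq_eval (T : R) (w : FreeGroupTwo) : (markovRep T w).tr =
    Polynomial.eval₂RingHom (Int.castRingHom R) T (markovRep (X : ℤ[X]) w).tr := by
  rw [← SpecialLinearGroup.tr_map, map_markovRep]
  simp

open Polynomial in
/-- The trace of the commutator of a basis does not depend on the basis. -/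
theorem tr_markovRep_map_commutator (T : R) (α : MulAut FreeGroupTwo) : (markovRep T (α 𝔠)).tr = 2 - 4 * T ^ 6 := by
  obtain ⟨h1, h2⟩ := SpecialLinearGroup.associated_tr_commutator_sub_two (markovRep (X : ℤ[X])) α
  rw [tr_markovRep_commutator] at h1 h2
  obtain ⟨⟨u, u', hu, hu'⟩, h⟩ := associated_of_dvd_dvd h1 h2
  obtain ⟨r, hr, rfl⟩ := Polynomial.isUnit_iff.1 (⟨⟨u, u', hu, hu'⟩, rfl⟩ : IsUnit u)
  simp only at h
  rcases Int.isUnit_iff.1 hr with rfl | rfl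
  · rw [tr_markovRep_eq_eval, ← sub_add_cancel (markovRep (X : ℤ[X]) _).tr 2, ← h]
    simp
    ring
  · exfalso
    have h3 := tr_markovRep_mod_three (α gen₀) (α gen₁)
    rw [← map_commutatorElement α, tr_markovRep_eq_eval, ← sub_add_cancel (markovRep (X : ℤ[X]) _).tr 2, ← h] at h3
    simp at h3
    revert h3
    decide

end FreeGroupTwo

end CommutatorTrace

section ParabolicElements

open FreeGroupTwo SemidirectProduct Matrix.SpecialLinearGroup

namespace SisterGroup

theorem inl_commutator : (inl 𝔠 : SisterGroup) = c := by rw [map_commutatorElement]; rfl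

theorem exists_eq_zpow_of_holonomy {w : FreeGroupTwo} (h : holonomy (inl w) 1 0 = 0) : ∃ i : ℤ, w = 𝔠 ^ i := by
  obtain ⟨i, j, hij⟩ := mem_peripheral.1 (mem_peripheral_of_holonomy h)
  have hj := congrArg rightHom hij
  rw [map_mul, map_zpow, map_zpow, ← inl_commutator, rightHom_inl, rightHom_inl, one_zpow, one_mul, t, rightHom_inr,
    ← ofAdd_zsmul, eq_comm, ofAdd_eq_one, smul_eq_mul, mul_one] at hj
  rw [hj, zpow_zero, mul_one, ← inl_commutator, ← map_zpow] at hij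
  exact ⟨i, inl_injective hij⟩

/-- The parabolic elements of the fibre are the conjugates of the powers of the boundary. -/
theorem exists_conj_zpow_of_tr {w : FreeGroupTwo} {s : 𝓔} (hs : s * s = 1) (h : (holonomy (inl w)).tr = 2 * s) :
    ∃ (f : FreeGroupTwo) (i : ℤ), w = f * 𝔠 ^ i * f⁻¹ := by
  obtain ⟨x, hx⟩ : ∃ x : SisterGroup, holonomy (x⁻¹ * (inl w * x)) 1 0 = 0 := by
    by_cases h0 : holonomy (inl w) 1 0 = 0
    · exact ⟨1, by simpa using h0⟩
    obtain ⟨x, hx⟩ := exists_holonomy_mul_eq (s - holonomy (inl w) 1 1) (holonomy (inl w) 1 0)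
    refine ⟨x, mul_left_cancel₀ h0 ?_⟩
    have hd := det_eq (holonomy (inl w))
    rw [tr_eq] at h
    rw [map_mul, map_inv, inv_mul_one_zero, map_mul, mul_apply_two, mul_apply_two]
    linear_combination (holonomy x 0 0 * holonomy (inl w) 1 0 + holonomy x 1 0 * (s - holonomy (inl w) 1 1) +
      (holonomy (inl w) 1 1 - holonomy (inl w) 0 0) * holonomy x 1 0) * hx +
      holonomy x 1 0 ^ 2 * (hd - hs - s * h)
  obtain ⟨f, n, rfl⟩ := exists_inl_mul_t_zpow x
  have hw : (inl f * t ^ n : SisterGroup)⁻¹ * (inl w * (inl f * t ^ n)) ∈ fibre := by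
    rw [← mul_assoc]
    exact (inferInstance : fibre.Normal).conj_mem' _ ⟨w, rfl⟩ _
  obtain ⟨v, hv⟩ := hw
  rw [← hv] at hx
  obtain ⟨i, rfl⟩ := exists_eq_zpow_of_holonomy hx
  suffices h : (inl w : SisterGroup) = inl (f * 𝔠 ^ i * f⁻¹) from ⟨f, i, inl_injective h⟩
  have hct := (commute_c_t.zpow_zpow i n).eq
  rw [map_mul, map_mul, map_inv]
  rw [map_zpow, inl_commutator] at hv ⊢
  have h1 : (inl w : SisterGroup) = inl f * (t ^ n * c ^ i) * (t ^ n)⁻¹ * (inl f)⁻¹ := by rw [hv]; group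
  rw [h1, ← hct]
  group

theorem eq_zpow_of_conj {p : FreeGroupTwo} {k m : ℤ} (hk : k ≠ 0) (h : p * 𝔠 ^ k = 𝔠 ^ m * p) : ∃ i : ℤ, p = 𝔠 ^ i := by
  refine exists_eq_zpow_of_holonomy (by_contra fun h0 => hk ?_)
  have h1 := congrArg (fun x => holonomy (inl x)) h
  simp only [map_mul, map_zpow, inl_commutator] at h1
  simp only [← map_zpow] at h1
  obtain ⟨s, hs, a1, a2, a3, a4⟩ := peripheral_apply k 0
  obtain ⟨s', -, b1, b2, b3, b4⟩ := peripheral_apply m 0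
  rw [zpow_zero, mul_one] at a1 a2 a3 a4 b1 b2 b3 b4
  have e0 := congrArg (fun X : SL(2, 𝓔) => X 1 0) h1
  have e1 := congrArg (fun X : SL(2, 𝓔) => X 1 1) h1
  simp only [mul_apply_two, a1, a2, a3, a4, b3, b4, mul_zero, zero_mul, zero_add, add_zero] at e0 e1
  have hss : s = s' := mul_left_cancel₀ h0 (e0.trans (mul_comm _ _))
  rw [← hss, mul_comm s (holonomy (inl p) 1 1), add_eq_right, mul_eq_zero, mul_eq_zero, or_iff_right h0, or_iff_right hs.ne_zero] at e1
  simpa using congrArg QuadraticAlgebra.im e1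

theorem commutator_ne_one : (𝔠 : FreeGroupTwo) ≠ 1 := fun h => by
  have := congrArg (fun x : FreeGroupTwo => holonomy (inl x) 0 1) h
  rw [inl_commutator, holonomy_c, map_one, map_one] at this
  revert this
  simp only [coe_neg, coe_one]
  decide

theorem commutator_zpow_injective {k l : ℤ} (h : (𝔠 : FreeGroupTwo) ^ k = 𝔠 ^ l) : k = l := by
  have : IsMulTorsionFree FreeGroupTwo := inferInstanceAs (IsMulTorsionFree (FreeGroup (Fin 2)))
  exact injective_zpow_iff_not_isOfFinOrder.2 (not_isOfFinOrder_of_isMulTorsionFree commutator_ne_one) h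

/-- An automorphism of the free group of rank two preserves the boundary up to conjugation and inversion. -/
theorem exists_map_commutator_eq (α : MulAut FreeGroupTwo) :
    ∃ (g : FreeGroupTwo) (k : ℤ), (k = 1 ∨ k = -1) ∧ α 𝔠 = g * 𝔠 ^ k * g⁻¹ := by
  have key : ∀ α : MulAut FreeGroupTwo, ∃ (g : FreeGroupTwo) (k : ℤ), α 𝔠 = g * 𝔠 ^ k * g⁻¹ :=
    fun α => exists_conj_zpow_of_tr (s := -1) (by ring) (by
      rw [← markovRep_omega, tr_markovRep_map_commutator]; decide)
  obtain ⟨g, k, hg⟩ := key α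
  obtain ⟨g', k', hg'⟩ := key α.symm
  have h1 := congrArg α hg'
  rw [MulEquiv.apply_symm_apply, map_mul, map_mul, map_inv, map_zpow, hg, conj_zpow, ← zpow_mul] at h1
  have h2 : (α g' * g) * 𝔠 ^ (k * k') = 𝔠 ^ (1 : ℤ) * (α g' * g) := by
    rw [zpow_one]
    conv_rhs => rw [h1]
    group
  have hk : k * k' ≠ 0 := fun h => by
    rw [h] at h1
    exact commutator_ne_one (by rw [h1]; group)
  obtain ⟨i, hi⟩ := eq_zpow_of_conj hk h2
  rw [hi, ← zpow_add, ← zpow_add] at h2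
  have h3 := commutator_zpow_injective h2
  exact ⟨g, k, Int.isUnit_iff.1 (IsUnit.of_mul_eq_one k' (by omega)), hg⟩

end SisterGroup

end ParabolicElements

section CommutingPairs

open FreeGroupTwo SemidirectProduct Matrix.SpecialLinearGroup

theorem EisensteinInt.finite_norm_le (K : ℝ) : {x : 𝓔 | ‖toComplex x‖ ≤ K}.Finite := by
  have key : ∀ x : 𝓔, ‖toComplex x‖ ≤ K → ∀ m : ℤ, 3 * m ^ 2 ≤ 4 * x.norm → m ∈ Set.Icc (-⌈2 * K⌉) ⌈2 * K⌉ := fun x hx m hm => by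
    have h1 : (x.norm : ℝ) ≤ K ^ 2 := by
      rw [← normSq_toComplex, Complex.normSq_eq_norm_sq]
      exact pow_le_pow_left₀ (_root_.norm_nonneg _) hx 2
    have h2 : 3 * (m : ℝ) ^ 2 ≤ 4 * x.norm := by exact_mod_cast hm
    have h3 : |(m : ℝ)| ≤ 2 * K := abs_le_of_sq_le_sq (by nlinarith [sq_nonneg (m : ℝ)]) (by linarith [_root_.norm_nonneg (toComplex x)])
    have h4 := Int.le_ceil (2 * K)
    rw [Set.mem_Icc, ← abs_le]
    exact_mod_cast h3.trans h4
  refine (((Set.finite_Icc (-⌈2 * K⌉) ⌈2 * K⌉).prod (Set.finite_Icc (-⌈2 * K⌉) ⌈2 * K⌉)).image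
    fun p => (⟨p.1, p.2⟩ : 𝓔)).subset fun x hx => ⟨(x.re, x.im), ⟨key x hx _ ?_, key x hx _ ?_⟩, rfl⟩ <;>
  rw [norm_apply]
  · nlinarith [sq_nonneg (x.re - 2 * x.im)]
  · nlinarith [sq_nonneg (2 * x.re - x.im)]

namespace Matrix.SpecialLinearGroup

theorem exists_common_eigenvector {A B : SL(2, ℂ)} (h : Commute A B) :
    ∃ v : Fin 2 → ℂ, v ≠ 0 ∧ ∃ a b : ℂˣ, (A : Mat₂ ℂ).mulVec v = a.1 • v ∧ (B : Mat₂ ℂ).mulVec v = b.1 • v := by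
  let f := Matrix.toLin' (A : Mat₂ ℂ)
  let g := Matrix.toLin' (B : Mat₂ ℂ)
  have hfg : Commute f g := by
    have : (A : Mat₂ ℂ) * B = B * A := congrArg Subtype.val h.eq
    rw [Commute, SemiconjBy, Module.End.mul_eq_comp, Module.End.mul_eq_comp, ← Matrix.toLin'_mul, this, Matrix.toLin'_mul]
  obtain ⟨a, ha⟩ := Module.End.exists_eigenvalue f
  have : Nontrivial (Module.End.eigenspace f a) := Submodule.nontrivial_iff_ne_bot.2 ha
  have hmaps : Set.MapsTo g (Module.End.eigenspace f a) (Module.End.eigenspace f a) :=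
    Module.End.mapsTo_genEigenspace_of_comm hfg a 1
  obtain ⟨b, hb⟩ := Module.End.exists_eigenvalue (g.restrict hmaps)
  obtain ⟨⟨v, hv⟩, hvb⟩ := hb.exists_hasEigenvector
  have hv0 : v ≠ 0 := fun h => hvb.2 (Subtype.ext h)
  have hA : (A : Mat₂ ℂ).mulVec v = a • v := Module.End.mem_eigenspace_iff.1 hv
  have hB : (B : Mat₂ ℂ).mulVec v = b • v := congrArg Subtype.val hvb.apply_eq_smul
  have hne : ∀ (X : SL(2, ℂ)) (x : ℂ), (X : Mat₂ ℂ).mulVec v = x • v → x ≠ 0 := fun X x hX h0 => by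
    rw [h0, zero_smul] at hX
    exact one_ne_zero (X.det_coe.symm.trans (Matrix.exists_mulVec_eq_zero_iff.1 ⟨v, hv0, hX⟩))
  exact ⟨v, hv0, Units.mk0 a (hne A a hA), Units.mk0 b (hne B b hB), hA, hB⟩

theorem tr_eq_of_mulVec {X : SL(2, ℂ)} {v : Fin 2 → ℂ} (hv : v ≠ 0) {x : ℂˣ}
    (h : (X : Mat₂ ℂ).mulVec v = x.1 • v) : X.tr = x.1 + x⁻¹.1 := by
  have h0 := congrFun h 0
  have h1 := congrFun h 1
  simp only [Matrix.mulVec, dotProduct, Fin.sum_univ_two, Pi.smul_apply, smul_eq_mul] at h0 h1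
  have hd := det_eq X
  suffices hs : ∀ i, (x.1 ^ 2 - X.tr * x.1 + 1) * v i = 0 by
    obtain ⟨i, hi⟩ := Function.ne_iff.1 hv
    have hp := (mul_eq_zero.1 (hs i)).resolve_right hi
    linear_combination -x⁻¹.1 * hp + (x.1 - X.tr) * x.inv_mul
  rw [Fin.forall_fin_two, tr_eq]
  exact ⟨by linear_combination (X 1 1 - x.1) * h0 - X 0 1 * h1 - v 0 * hd,
    by linear_combination (X 0 0 - x.1) * h1 - X 1 0 * h0 - v 1 * hd⟩

theorem eq_one_of_commute {R : Type*} [CommRing R] [IsDomain R] [CharZero R] {X C : SL(2, R)} (h : Commute X C)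
    (hX : X.tr = 2) (hC : C.tr * C.tr ≠ 4) : X = 1 := by
  have dX := det_eq X
  have dC := det_eq C
  have e : ∀ i j, (X * C) i j = (C * X) i j := fun i j => congrArg (fun Y : SL(2, R) => Y i j) h.eq
  have e00 := e 0 0
  have e01 := e 0 1
  have e10 := e 1 0
  simp only [mul_apply_two] at e00 e01 e10
  rw [tr_eq] at hX hC
  have hne : (C 0 0 + C 1 1) * (C 0 0 + C 1 1) - 4 ≠ 0 := sub_ne_zero.2 hC
  have h0 : (X 0 0 - X 1 1) ^ 2 + 4 * (X 0 1 * X 1 0) = 0 := by linear_combination (X 0 0 + X 1 1 + 2) * hX - 4 * dX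
  have hb : X 0 1 = 0 := by
    refine pow_eq_zero_iff two_ne_zero |>.1 ((mul_eq_zero.1 ?_).resolve_left hne)
    linear_combination C 0 1 ^ 2 * h0 + ((C 1 1 - C 0 0) * X 0 1 - C 0 1 * (X 0 0 - X 1 1)) * e01 + 4 * X 0 1 * C 0 1 * e00 +
      4 * X 0 1 ^ 2 * dC
  have hc : X 1 0 = 0 := by
    refine pow_eq_zero_iff two_ne_zero |>.1 ((mul_eq_zero.1 ?_).resolve_left hne)
    linear_combination C 1 0 ^ 2 * h0 + ((C 0 0 - C 1 1) * X 1 0 + C 1 0 * (X 0 0 - X 1 1)) * e10 - 4 * X 1 0 * C 1 0 * e00 +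
      4 * X 1 0 ^ 2 * dC
  have ha : X 0 0 - X 1 1 = 0 := pow_eq_zero_iff two_ne_zero |>.1 (by rw [hb, zero_mul, mul_zero, add_zero] at h0; exact h0)
  have h1 : X 0 0 = 1 := mul_left_cancel₀ (two_ne_zero : (2 : R) ≠ 0) (by linear_combination ha + hX)
  have h2 : X 1 1 = 1 := by linear_combination h1 - ha
  refine Subtype.ext (Matrix.ext fun i j => ?_)
  fin_cases i <;> fin_cases j <;> simp [h1, h2, hb, hc]

end Matrix.SpecialLinearGroup

namespace SisterGroup

/-- A pair of integer sequences along which a linear form stays bounded. -/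
theorem exists_bounded_pairs (x y : ℝ) : ∃ i j : ℕ → ℤ, (∃ K : ℝ, ∀ n, |i n * x + j n * y| ≤ K) ∧
    ∀ n m : ℕ, ((i n = i m ∧ j n = j m) ∨ (i n = -i m ∧ j n = -j m)) → n = m := by
  by_cases hx : x = 0
  · exact ⟨fun n => n, fun _ => 0, ⟨0, by simp [hx]⟩, fun n m h => by simp at h; omega⟩
  · refine ⟨fun n => -⌊n * y / x⌋, fun n => n, ⟨|x|, fun n => ?_⟩, fun n m h => by simp at h; omega⟩
    have : ((-⌊n * y / x⌋ : ℤ) : ℝ) * x + (n : ℤ) * y = Int.fract (n * y / x) * x := by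
      rw [← Int.self_sub_floor]; push_cast; field_simp; ring
    rw [this, abs_mul, abs_of_nonneg (Int.fract_nonneg _)]
    exact mul_le_of_le_one_left (abs_nonneg _) (Int.fract_lt_one _).le

/-- An element of a free abelian subgroup of rank two is parabolic. -/
theorem tr_mul_tr_of_commute {x y : SisterGroup} (hxy : Commute x y)
    (h : ∀ i j : ℤ, x ^ i * y ^ j = 1 → i = 0 ∧ j = 0) : (holonomy x).tr * (holonomy x).tr = 4 := by
  by_contra hC
  let f : SisterGroup →* SL(2, ℂ) := (SpecialLinearGroup.map toComplex).comp holonomy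
  obtain ⟨v, hv, a, b, ha, hb⟩ := exists_common_eigenvector (hxy.map f)
  let S : Subgroup (SL(2, ℂ) × ℂˣ) :=
    { carrier := {p | (p.1 : Mat₂ ℂ).mulVec v = p.2.1 • v}
      one_mem' := by
        change (1 : Mat₂ ℂ).mulVec v = (1 : ℂ) • v
        rw [Matrix.one_mulVec, one_smul]
      mul_mem' := fun {p q} hp hq => by
        change ((p.1 * q.1 : SL(2, ℂ)) : Mat₂ ℂ).mulVec v = (p.2 * q.2).1 • v
        rw [coe_mul, ← mulVec_mulVec, hq, Matrix.mulVec_smul, hp, smul_smul, mul_comm, Units.val_mul]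
      inv_mem' := fun {p} hp => by
        change ((p.1⁻¹ : SL(2, ℂ)) : Mat₂ ℂ).mulVec v = p.2⁻¹.1 • v
        have h1 := congrArg (fun w => p.2⁻¹.1 • ((p.1⁻¹ : SL(2, ℂ)) : Mat₂ ℂ).mulVec w) hp
        simp only [mulVec_mulVec, Matrix.mulVec_smul, ← coe_mul, inv_mul_cancel, coe_one, Matrix.one_mulVec,
          smul_smul, Units.inv_mul, one_smul] at h1
        exact h1.symm }
  have key : ∀ i j : ℤ, toComplex (holonomy (x ^ i * y ^ j)).tr = (a ^ i * b ^ j).1 + (a ^ i * b ^ j)⁻¹.1 :=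
    fun i j => by
      rw [← tr_map]
      refine tr_eq_of_mulVec (X := f (x ^ i * y ^ j)) hv ?_
      have := S.mul_mem (S.zpow_mem (x := (f x, a)) ha i) (S.zpow_mem (x := (f y, b)) hb j)
      rwa [map_mul, map_zpow, map_zpow]
  have hinj : Injective toComplex := (injective_iff_map_eq_zero _).2 fun z hz => by
    have h1 := EisensteinInt.normSq_toComplex z
    rw [hz, map_zero, eq_comm, Int.cast_eq_zero] at h1
    exact EisensteinInt.norm_eq_zero.1 h1
  have triv : ∀ i j : ℤ, a ^ i * b ^ j = 1 → i = 0 ∧ j = 0 := fun i j hij => h i j (by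
    have h1 := key i j
    rw [hij] at h1
    have h2 : holonomy (x ^ i * y ^ j) = 1 := eq_one_of_commute (C := holonomy x)
      ((((Commute.refl x).zpow_left i).mul_left (hxy.symm.zpow_left j)).map holonomy)
      (hinj (h1.trans (by rw [map_ofNat]; norm_num))) hC
    exact eq_one_of_holonomy (by rw [h2]; rfl) (by rw [h2]; rfl))
  obtain ⟨i, j, ⟨K, hK⟩, hij⟩ := exists_bounded_pairs (Real.log ‖a.1‖) (Real.log ‖b.1‖)
  have hu : ∀ n, ‖(a ^ i n * b ^ j n).1‖ = Real.exp (i n * Real.log ‖a.1‖ + j n * Real.log ‖b.1‖) := fun n => by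
    rw [Units.val_mul, norm_mul, Real.exp_add, Units.val_zpow_eq_zpow_val, Units.val_zpow_eq_zpow_val, norm_zpow, norm_zpow,
      mul_comm (i n : ℝ), mul_comm (j n : ℝ), Real.exp_mul, Real.exp_mul, Real.exp_log (norm_pos_iff.2 a.ne_zero),
      Real.exp_log (norm_pos_iff.2 b.ne_zero), Real.rpow_intCast, Real.rpow_intCast]
  have hbd : ∀ n, ‖toComplex (holonomy (x ^ i n * y ^ j n)).tr‖ ≤ Real.exp K + Real.exp K := fun n => by
    rw [key]
    refine (norm_add_le _ _).trans (add_le_add ?_ ?_)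
    · rw [hu]; exact Real.exp_le_exp.2 (abs_le.1 (hK n)).2
    · rw [Units.val_inv_eq_inv_val, norm_inv, hu, ← Real.exp_neg]
      exact Real.exp_le_exp.2 (by linarith [(abs_le.1 (hK n)).1])
  have := (EisensteinInt.finite_norm_le (Real.exp K + Real.exp K)).to_subtype
  obtain ⟨n, m, hnm, he⟩ := Finite.exists_ne_map_eq_of_infinite
    fun n => (⟨_, hbd n⟩ : {x : 𝓔 | ‖toComplex x‖ ≤ Real.exp K + Real.exp K})
  have he1 := congrArg (fun z => toComplex z.1) he
  simp only [key] at he1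
  refine hnm (hij n m ?_)
  set p := a ^ i n * b ^ j n with hp
  set q := a ^ i m * b ^ j m with hq
  have h1 : (p.1 - q.1) * (p.1 * q.1 - 1) = 0 := by
    linear_combination p.1 * q.1 * he1 - q.1 * p.mul_inv + p.1 * q.mul_inv
  rcases mul_eq_zero.1 h1 with h1 | h1
  · have h2 := triv (i n - i m) (j n - j m) (by
      rw [zpow_sub, zpow_sub, mul_mul_mul_comm, ← mul_inv, ← hp, ← hq, mul_inv_eq_one, Units.ext_iff]
      exact sub_eq_zero.1 h1)
    left; omega
  · have h2 := triv (i n + i m) (j n + j m) (by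
      rw [zpow_add, zpow_add, mul_mul_mul_comm, ← hp, ← hq, Units.ext_iff]
      exact sub_eq_zero.1 h1)
    right; omega

variable {L : Subgroup SisterGroup}

/-- The boundary of the fibre of `L` is parabolic. -/
theorem exists_commutator_eq_conj (e : FreeGroupTwo ≃* (degree L).ker) {τ : L} (hτ : degree L τ ≠ 1) :
    ∃ (f : FreeGroupTwo) (m : ℤ), m ≠ 0 ∧ ((e 𝔠 : L) : SisterGroup) = inl (f * 𝔠 ^ m * f⁻¹) := by
  obtain ⟨g, k, hk, hg⟩ := exists_map_commutator_eq ((e.trans (MulAut.conjNormal τ)).trans e.symm)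
  set x : SisterGroup := ((e 𝔠 : L) : SisterGroup) with hx
  set z : SisterGroup := ((e g)⁻¹ : (degree L).ker).1.1 * τ.1 with hz
  have hzx : z * x * z⁻¹ = x ^ k := by
    have h1 := congrArg (fun w => ((e w : L) : SisterGroup)) hg
    simp only [MulEquiv.trans_apply, MulEquiv.apply_symm_apply, MulAut.conjNormal_apply, map_mul, map_inv, map_zpow,
      Subgroup.coe_mul, Subgroup.coe_inv, Subgroup.coe_zpow] at h1
    rw [hz, hx, Subgroup.coe_inv, Subgroup.coe_inv, mul_inv_rev, inv_inv]
    calc _ = ((e g : L) : SisterGroup)⁻¹ * (τ * ((e 𝔠 : L) : SisterGroup) * (τ : SisterGroup)⁻¹) *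
          ((e g : L) : SisterGroup) := by group
      _ = _ := by rw [h1]; group
  have hx1 : x ≠ 1 := fun h => commutator_ne_one (e.injective (Subtype.ext (Subtype.ext (by rw [map_one]; exact h))))
  obtain ⟨w, hw⟩ : x ∈ fibre := mem_ker_degree.1 (e 𝔠).2
  have hcomm : Commute x (z ^ 2) := by
    have h2 : z ^ 2 * x * (z ^ 2)⁻¹ = (z * x * z⁻¹) ^ k := by rw [conj_zpow, ← hzx, pow_two]; group
    rw [hzx, ← zpow_mul, show k * k = 1 by rcases hk with rfl | rfl <;> rfl, zpow_one, mul_inv_eq_iff_eq_mul] at h2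
    exact h2.symm
  have hrz : rightHom z = degree L τ := by
    rw [hz, map_mul, show rightHom ((e g)⁻¹ : (degree L).ker).1.1 = 1 from (e g)⁻¹.2, one_mul]; rfl
  have : IsMulTorsionFree FreeGroupTwo := inferInstanceAs (IsMulTorsionFree (FreeGroup (Fin 2)))
  have htr := tr_mul_tr_of_commute hcomm fun i j hij => by
    have h1 := congrArg rightHom hij
    rw [map_mul, map_zpow, map_zpow, map_pow, ← hw, rightHom_inl, one_zpow, one_mul, hrz, map_one, ← zpow_natCast,
      ← zpow_mul, IsMulTorsionFree.zpow_eq_one_iff_right hτ] at h1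
    obtain rfl : j = 0 := by simpa using h1
    rw [zpow_zero, mul_one, ← hw, ← map_zpow, map_eq_one_iff _ inl_injective, IsMulTorsionFree.zpow_eq_one_iff_right] at hij
    · exact ⟨hij, rfl⟩
    · rintro rfl
      exact hx1 (hw.symm.trans (map_one _))
  obtain ⟨s, hs, h1⟩ : ∃ s : 𝓔, s * s = 1 ∧ (holonomy (inl w)).tr = 2 * s := by
    have h2 : ((holonomy x).tr - 2) * ((holonomy x).tr + 2) = 0 := by linear_combination htr
    rw [hw]
    rcases mul_eq_zero.1 h2 with h | h
    · exact ⟨1, by ring, by linear_combination h⟩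
    · exact ⟨-1, by ring, by linear_combination h⟩
  obtain ⟨f, m, rfl⟩ := exists_conj_zpow_of_tr hs h1
  refine ⟨f, m, fun hm => hx1 ?_, hw.symm⟩
  rw [← hw, hm, zpow_zero, mul_one, mul_inv_cancel, map_one]

end SisterGroup

end CommutingPairs

section MarkovDescent

open FreeGroupTwo Matrix.SpecialLinearGroup

theorem Matrix.SpecialLinearGroup.tr_commutator {R : Type*} [CommRing R] (U V : SL(2, R)) :
    ⁅U, V⁆.tr = U.tr ^ 2 + V.tr ^ 2 + (U * V).tr ^ 2 - U.tr * V.tr * (U * V).tr - 2 := by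
  have h1 := tr_mul_inv (U * V) (V⁻¹ * U)
  have h2 := tr_mul_inv U U
  have h3 := tr_mul_comm V⁻¹ U
  have h4 : (1 : SL(2, R)).tr = 2 := by rw [tr_eq]; simp [one_add_one_eq_two]
  rw [_root_.mul_inv_rev, inv_inv, show U * V * (V⁻¹ * U) = U * U by group] at h1
  rw [mul_inv_cancel, h4] at h2
  rw [tr_mul_inv] at h3
  rw [commutatorElement_def, tr_mul_inv, tr_conj, mul_assoc, h1, h3]
  linear_combination h2

theorem eq_three_of_markov {P Q R : ℤ} (hP : 3 ≤ P) (hQ : 3 ≤ Q) (hR : 3 ≤ R) (h : P ^ 2 + Q ^ 2 + R ^ 2 = P * Q * R)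
    (h1 : R ^ 2 ≤ P ^ 2 + Q ^ 2) (h2 : P ^ 2 ≤ Q ^ 2 + R ^ 2) (h3 : Q ^ 2 ≤ P ^ 2 + R ^ 2) : P = 3 ∧ Q = 3 ∧ R = 3 := by
  have key : ∀ P Q R : ℤ, 3 ≤ P → P ≤ Q → Q ≤ R → P ^ 2 + Q ^ 2 + R ^ 2 = P * Q * R → R ^ 2 ≤ P ^ 2 + Q ^ 2 →
      P = 3 ∧ Q = 3 ∧ R = 3 := by
    intro P Q R hP hQ hR h h1
    have h2 : R ≤ P * Q - R := le_of_mul_le_mul_left (by linear_combination h1 + h) (show 0 < R by omega)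
    have h3 : (R - Q) * (P * Q - R - Q) ≤ 0 := by nlinarith [mul_nonneg (sub_nonneg.2 hP) (sq_nonneg Q)]
    obtain rfl : Q = R := by
      by_contra hne
      have : 0 < (R - Q) * (P * Q - R - Q) := mul_pos (by omega) (by omega)
      omega
    obtain rfl : P = 3 := by
      by_contra hne
      nlinarith [mul_nonneg (show 0 ≤ P - 4 by omega) (sq_nonneg Q)]
    obtain rfl : Q = 3 := by nlinarith
    exact ⟨rfl, rfl, rfl⟩
  rcases le_total P Q with hPQ | hPQ <;> rcases le_total Q R with hQR | hQR <;> rcases le_total P R with hPR | hPR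
  · exact key P Q R hP hPQ hQR h h1
  · exact key P Q R hP hPQ hQR h h1
  · have := key P R Q hP hPR hQR (by linarith) h3; tauto
  · have := key R P Q hR hPR hPQ (by linarith) (by linarith); tauto
  · have := key Q P R hQ hPQ hPR (by linarith) (by linarith); tauto
  · have := key Q R P hQ hQR hPR (by linarith) h2; tauto
  · have := key R Q P hR hQR hPQ (by linarith) (by linarith); tauto
  · have := key R Q P hR hQR hPQ (by linarith) (by linarith); tauto

namespace FreeGroupTwo

/-- The Fuchsian representation of the once-punctured torus is faithful. -/
theorem markovRep_one_injective : Injective (markovRep (1 : ℤ)) := by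
  let V := {v : ℤ × ℤ // v ≠ 0}
  let _ : MulAction SL(2, ℤ) V :=
    { smul := fun g v => ⟨(g 0 0 * v.1.1 + g 0 1 * v.1.2, g 1 0 * v.1.1 + g 1 1 * v.1.2), fun h => v.2 (by
        have h0 := congrArg Prod.fst h
        have h1 := congrArg Prod.snd h
        have hd := det_eq g
        simp only [Prod.fst_zero, Prod.snd_zero] at h0 h1
        exact Prod.ext (by rw [Prod.fst_zero]; linear_combination g 1 1 * h0 - g 0 1 * h1 - v.1.1 * hd)
          (by rw [Prod.snd_zero]; linear_combination g 0 0 * h1 - g 1 0 * h0 - v.1.2 * hd))⟩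
      one_smul := fun v => Subtype.ext (Prod.ext
        (show (1 : SL(2, ℤ)) 0 0 * v.1.1 + (1 : SL(2, ℤ)) 0 1 * v.1.2 = _ by simp)
        (show (1 : SL(2, ℤ)) 1 0 * v.1.1 + (1 : SL(2, ℤ)) 1 1 * v.1.2 = _ by simp))
      mul_smul := fun g g' v => Subtype.ext (Prod.ext
        (show (g * g') 0 0 * v.1.1 + (g * g') 0 1 * v.1.2 = g 0 0 * (g' 0 0 * v.1.1 + g' 0 1 * v.1.2) +
          g 0 1 * (g' 1 0 * v.1.1 + g' 1 1 * v.1.2) by rw [mul_apply_two, mul_apply_two]; ring)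
        (show (g * g') 1 0 * v.1.1 + (g * g') 1 1 * v.1.2 = g 1 0 * (g' 0 0 * v.1.1 + g' 0 1 * v.1.2) +
          g 1 1 * (g' 1 0 * v.1.1 + g' 1 1 * v.1.2) by rw [mul_apply_two, mul_apply_two]; ring)) }
  have hsmul : ∀ (g : SL(2, ℤ)) (v : V), (g • v).1.1 = g 0 0 * v.1.1 + g 0 1 * v.1.2 ∧
      (g • v).1.2 = g 1 0 * v.1.1 + g 1 1 * v.1.2 := fun g v => ⟨rfl, rfl⟩
  have hne : ∀ v : V, v.1.2 = 0 → 0 < v.1.1 ^ 2 := fun v hv => by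
    have : v.1.1 ≠ 0 := fun h => v.2 (Prod.ext h hv)
    positivity
  let X : Fin 2 → Set V := ![{v | v.1.1 * v.1.2 < 0 ∧ 0 ≤ v.1.2 * (v.1.1 + v.1.2)},
    {v | 0 ≤ v.1.1 * v.1.2 ∧ 0 < v.1.2 * (v.1.2 - v.1.1)}]
  let Y : Fin 2 → Set V := ![{v | v.1.2 ≠ 0 ∧ 0 ≤ v.1.2 * (v.1.1 - v.1.2)},
    {v | v.1.2 = 0 ∨ v.1.2 * (v.1.1 + v.1.2) < 0}]
  have hsq : ∀ {y : ℤ}, y ≠ 0 → 0 < y ^ 2 := fun h => by positivity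
  let g := markovRep (1 : ℤ) gen₀
  let h := markovRep (1 : ℤ) gen₁
  have hg : ∀ v : V, (g • v).1.1 = v.1.1 - v.1.2 ∧ (g • v).1.2 = -v.1.1 + 2 * v.1.2 := fun v => by
    rw [(hsmul g v).1, (hsmul g v).2, markovRep_gen₀]
    constructor <;> simp; ring
  have hh : ∀ v : V, (h • v).1.1 = v.1.1 + v.1.2 ∧ (h • v).1.2 = v.1.1 + 2 * v.1.2 := fun v => by
    rw [(hsmul h v).1, (hsmul h v).2, markovRep_gen₁]
    constructor <;> simp
  have hg' : ∀ v : V, (g⁻¹ • v).1.1 = 2 * v.1.1 + v.1.2 ∧ (g⁻¹ • v).1.2 = v.1.1 + v.1.2 := fun v => by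
    obtain ⟨h1, h2, h3, h4⟩ := inv_apply_two g
    rw [(hsmul _ v).1, (hsmul _ v).2, h1, h2, h3, h4, markovRep_gen₀]
    constructor <;> simp
  have hh' : ∀ v : V, (h⁻¹ • v).1.1 = 2 * v.1.1 - v.1.2 ∧ (h⁻¹ • v).1.2 = v.1.2 - v.1.1 := fun v => by
    obtain ⟨h1, h2, h3, h4⟩ := inv_apply_two h
    rw [(hsmul _ v).1, (hsmul _ v).2, h1, h2, h3, h4, markovRep_gen₁]
    constructor <;> simp <;> ring
  have hlift : markovRep (1 : ℤ) = FreeGroup.lift ![g, h] := FreeGroup.ext_hom _ _ fun i => by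
    rw [FreeGroup.lift_apply_of]; fin_cases i <;> rfl
  rw [hlift]
  refine FreeGroup.injective_lift_of_ping_pong _ X Y ?_ ?_ ?_ ?_ ?_ ?_
  · rw [Fin.forall_fin_two]
    exact ⟨⟨⟨(-1, 1), by decide⟩, by decide, by decide⟩, ⟨⟨(0, 1), by decide⟩, by decide, by decide⟩⟩
  · have h : Disjoint (X 0) (X 1) := Set.disjoint_left.2 fun v h1 h2 => not_le.2 h1.1 h2.1
    intro i j hij
    fin_cases i <;> fin_cases j
    exacts [absurd rfl hij, h, h.symm, absurd rfl hij]
  · have h : Disjoint (Y 0) (Y 1) := Set.disjoint_left.2 fun v h1 h2 => by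
      have h3 := hsq h1.1
      have h4 := h1.2
      have h5 := h2.resolve_left h1.1
      nlinarith
    intro i j hij
    fin_cases i <;> fin_cases j
    exacts [absurd rfl hij, h, h.symm, absurd rfl hij]
  · rw [Fin.forall_fin_two, Fin.forall_fin_two, Fin.forall_fin_two]
    refine ⟨⟨Set.disjoint_left.2 fun v h1 h2 => ?_, Set.disjoint_left.2 fun v h1 h2 => ?_⟩,
      ⟨Set.disjoint_left.2 fun v h1 h2 => ?_, Set.disjoint_left.2 fun v h1 h2 => ?_⟩⟩ <;>
    have h3 := h1.1 <;> have h4 := h1.2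
    · have h5 := h2.2
      nlinarith [hsq h2.1]
    · rcases h2 with h | h
      · rw [h, mul_zero] at h3; exact lt_irrefl _ h3
      · exact not_lt.2 h4 h
    · have h5 := h2.2
      nlinarith [hsq h2.1]
    · rcases h2 with h | h
      · rw [h, zero_mul] at h4; exact lt_irrefl _ h4
      · nlinarith [sq_nonneg v.1.2]
  · rw [Fin.forall_fin_two]
    constructor <;> rintro _ ⟨v, hv, rfl⟩
    · change (g • v).1.1 * (g • v).1.2 < 0 ∧ 0 ≤ (g • v).1.2 * ((g • v).1.1 + (g • v).1.2)
      rw [(hg v).1, (hg v).2]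
      by_cases h0 : v.1.2 = 0
      · have := hne v h0
        rw [h0]
        constructor <;> nlinarith
      · have h1 : v.1.2 * (v.1.1 - v.1.2) < 0 := not_le.1 fun h => hv ⟨h0, h⟩
        constructor <;> nlinarith [sq_nonneg (v.1.1 - v.1.2), sq_nonneg v.1.2]
    · change 0 ≤ (h • v).1.1 * (h • v).1.2 ∧ 0 < (h • v).1.2 * ((h • v).1.2 - (h • v).1.1)
      rw [(hh v).1, (hh v).2]
      have h0 := hsq fun h => hv (Or.inl h)
      have h1 : 0 ≤ v.1.2 * (v.1.1 + v.1.2) := not_lt.1 fun h => hv (Or.inr h)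
      constructor <;> nlinarith [sq_nonneg (v.1.1 + v.1.2)]
  · rw [Fin.forall_fin_two]
    constructor <;> rintro _ ⟨v, hv, rfl⟩
    · change (g⁻¹ • v).1.2 ≠ 0 ∧ 0 ≤ (g⁻¹ • v).1.2 * ((g⁻¹ • v).1.1 - (g⁻¹ • v).1.2)
      rw [(hg' v).1, (hg' v).2]
      refine ⟨fun h0 => hv ⟨?_, by rw [h0, mul_zero]⟩, not_lt.1 fun h0 => hv ⟨?_, ?_⟩⟩
      · have h1 : v.1.2 = -v.1.1 := by linarith
        have h2 : v.1.1 ≠ 0 := fun h => v.2 (Prod.ext h (by rw [h1, h]; rfl))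
        rw [h1]
        nlinarith [hsq h2]
      · nlinarith [sq_nonneg v.1.1]
      · nlinarith [sq_nonneg (v.1.1 + v.1.2)]
    · change (h⁻¹ • v).1.2 = 0 ∨ (h⁻¹ • v).1.2 * ((h⁻¹ • v).1.1 + (h⁻¹ • v).1.2) < 0
      rw [(hh' v).1, (hh' v).2, or_iff_not_imp_left]
      refine fun h0 => not_le.1 fun h1 => hv ?_
      have := hsq h0
      constructor <;> nlinarith [sq_nonneg v.1.1]

local notation "ρ" => markovRep (1 : ℤ)

theorem markovRep_commutator_zpow (m : ℤ) : ∃ s : ℤ, (s = 1 ∨ s = -1) ∧ ρ (𝔠 ^ m) 0 0 = s ∧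
    ρ (𝔠 ^ m) 0 1 = 0 ∧ ρ (𝔠 ^ m) 1 0 = -6 * m * s ∧ ρ (𝔠 ^ m) 1 1 = s := by
  let M (m : ℤ) : SL(2, ℤ) := ⟨!![1, 0; -6 * m, 1], by rw [det_fin_two_of]; ring⟩
  let f : Multiplicative ℤ →* SL(2, ℤ) := MonoidHom.mk' (fun m => M m.toAdd) fun x y => by
    refine Subtype.ext (Matrix.ext fun i j => ?_)
    rw [mul_apply_two]
    fin_cases i <;> fin_cases j <;> simp [M]; ring
  have hM : ∀ m, M 1 ^ m = M m := fun m => by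
    rw [show M 1 = f (ofAdd 1) from rfl, ← map_zpow, ← ofAdd_zsmul, smul_eq_mul, mul_one]; rfl
  have hc : ρ 𝔠 = -1 * M 1 := by
    rw [map_commutatorElement, commutatorElement_def]
    refine Subtype.ext ?_
    rw [SL2_inv_expl, SL2_inv_expl]
    simp only [markovRep_gen₀, markovRep_gen₁, M]
    decide
  have h2 : Commute (-1 : SL(2, ℤ)) (M 1) := by rw [Commute, SemiconjBy]; simp
  rw [map_zpow, hc, h2.mul_zpow, hM]
  rcases Int.even_or_odd m with h | h
  · rw [h.neg_one_zpow, one_mul]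
    exact ⟨1, Or.inl rfl, by simp [M]⟩
  · rw [h.neg_one_zpow, neg_mul, one_mul]
    simp only [coe_neg, Matrix.neg_apply]
    exact ⟨-1, Or.inr rfl, by simp [M]⟩

theorem eq_zpow_of_markovRep {p : FreeGroupTwo} (h : ρ p 0 1 = 0) : ∃ i : ℤ, p = 𝔠 ^ i := by
  refine SisterGroup.eq_zpow_of_conj one_ne_zero (m := 1) (markovRep_one_injective ?_)
  obtain ⟨s, -, h1, h2, h3, h4⟩ := markovRep_commutator_zpow 1
  have hd := det_eq (ρ p)
  rw [h, zero_mul, sub_zero] at hd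
  have he : ρ p 0 0 = ρ p 1 1 := by rcases Int.mul_eq_one_iff_eq_one_or_neg_one.1 hd with h | h <;> rw [h.1, h.2]
  rw [map_mul, map_mul]
  generalize ρ (𝔠 ^ (1 : ℤ)) = C at *
  refine Subtype.ext (Matrix.ext fun i j => ?_)
  rw [mul_apply_two, mul_apply_two]
  fin_cases i <;> fin_cases j <;> simp [h, h1, h2, h3, h4, he] <;> ring

/-- Relation between the trace and the corner of the product of two elements whose commutator is peripheral. -/
theorem tr_of_commutator {u v : FreeGroupTwo} {m s : ℤ} (h : ⁅u, v⁆ = 𝔠 ^ m)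
    (hs : ρ (𝔠 ^ m) 0 0 = s) : (1 - s) * (ρ (u * v)).tr = -6 * m * ρ (u * v) 0 1 := by
  obtain ⟨s, -, h1, h2, h3, h4⟩ := markovRep_commutator_zpow m
  obtain rfl : s = _ := h1.symm.trans hs
  have e : ρ (u * v) = ρ (𝔠 ^ m) * ρ (v * u) := by rw [← map_mul, ← h, commutatorElement_def]; congr 1; group
  have ht : (ρ (u * v)).tr = (ρ (v * u)).tr := by rw [map_mul, tr_mul_comm, map_mul]
  have e00 := congrArg (fun X : SL(2, ℤ) => X 0 0) e
  have e01 := congrArg (fun X : SL(2, ℤ) => X 0 1) e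
  have e11 := congrArg (fun X : SL(2, ℤ) => X 1 1) e
  simp only [mul_apply_two, h1, h2, h3, h4] at e00 e01 e11
  rw [tr_eq, tr_eq] at ht
  rw [tr_eq]
  linear_combination e00 + e11 + 6 * m * e01 - s * ht

/-- Coset representatives for the matrices in the image of the Fuchsian representation with corner `±1`. -/
theorem exists_mem_of_markovRep {S : Subgroup FreeGroupTwo} {u : FreeGroupTwo} (hc : 𝔠 ∈ S) (hu : u ∈ S)
    (h : ρ u 0 1 * ρ u 0 1 = 1) {w : FreeGroupTwo} {k : ℤ} (hw : ρ w 0 1 * ρ w 0 1 = 1)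
    (hk : ρ u 0 0 * ρ u 0 1 = ρ w 0 0 * ρ w 0 1 + 6 * k) : w ∈ S := by
  obtain ⟨s, -, h1, h2, h3, h4⟩ := markovRep_commutator_zpow k
  obtain ⟨-, i2, -, i4⟩ := inv_apply_two (ρ w)
  obtain ⟨i, hi⟩ := eq_zpow_of_markovRep (p := u * 𝔠 ^ k * w⁻¹) (by
    rw [map_mul, map_mul, map_inv, mul_apply_two, mul_apply_two, mul_apply_two, h1, h2, h3, h4, i2, i4]
    linear_combination -s * ρ u 0 1 * ρ w 0 1 * hk + s * ρ u 0 0 * ρ w 0 1 * h - s * ρ u 0 1 * ρ w 0 0 * hw)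
  have hw' : w = (𝔠 ^ i)⁻¹ * (u * 𝔠 ^ k) := by rw [← hi]; group
  rw [hw']
  exact S.mul_mem (S.inv_mem (S.zpow_mem hc i)) (S.mul_mem hu (S.zpow_mem hc k))

theorem eq_top_of_markovRep {S : Subgroup FreeGroupTwo} {u v : FreeGroupTwo} (hc : 𝔠 ∈ S) (hu : u ∈ S)
    (hv : v ∈ S) (hu1 : ρ u 0 1 * ρ u 0 1 = 1) (hv1 : ρ v 0 1 * ρ v 0 1 = 1)
    (h : (ρ u 0 0 * ρ u 0 1 - ρ v 0 0 * ρ v 0 1) % 6 = 2 ∨ (ρ u 0 0 * ρ u 0 1 - ρ v 0 0 * ρ v 0 1) % 6 = 4) : S = ⊤ := by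
  obtain ⟨a1, a2, -, -⟩ := inv_apply_two (ρ gen₀)
  obtain ⟨b1, b2, b3, b4⟩ := inv_apply_two (ρ gen₁)
  simp only [markovRep_gen₀, ← map_inv] at a1 a2
  simp only [markovRep_gen₁, ← map_inv] at b1 b2 b3 b4
  let E : ℤ → FreeGroupTwo := fun r => if r = 0 then gen₀ * gen₁ else if r = 1 then gen₁ else if r = 2 then gen₀⁻¹ else
    if r = 3 then gen₀⁻¹ * gen₁⁻¹ else if r = 4 then gen₁⁻¹ else gen₀
  have key : ∀ w ∈ S, ρ w 0 1 * ρ w 0 1 = 1 → E (ρ w 0 0 * ρ w 0 1 % 6) ∈ S := by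
    intro w hw hw1
    have h6 := Int.emod_add_mul_ediv (ρ w 0 0 * ρ w 0 1) 6
    have h0 := Int.emod_nonneg (ρ w 0 0 * ρ w 0 1) (show (6 : ℤ) ≠ 0 by norm_num)
    have h5 := Int.emod_lt_of_pos (ρ w 0 0 * ρ w 0 1) (show (0 : ℤ) < 6 by norm_num)
    generalize ρ w 0 0 * ρ w 0 1 % 6 = r at *
    generalize ρ w 0 0 * ρ w 0 1 / 6 = k at *
    have : ρ (E r) 0 1 * ρ (E r) 0 1 = 1 ∧ (ρ (E r) 0 0 * ρ (E r) 0 1 = r ∨ ρ (E r) 0 0 * ρ (E r) 0 1 = r - 6) := by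
      clear h6
      simp only [E]
      interval_cases r <;> simp [-map_inv, map_mul, mul_apply_two, a1, a2, b1, b2, b3, b4, markovRep_gen₀, markovRep_gen₁]
    rcases this with ⟨h1, h2 | h2⟩
    · exact exists_mem_of_markovRep hc hw hw1 h1 (k := k) (by linarith)
    · exact exists_mem_of_markovRep hc hw hw1 h1 (k := k + 1) (by linarith)
  have fin : ∀ r r', E r ∈ S → E r' ∈ S → ((r = 0 ∧ r' = 2) ∨ (r = 0 ∧ r' = 4) ∨ (r = 2 ∧ r' = 4) ∨ (r = 1 ∧ r' = 3) ∨
      (r = 1 ∧ r' = 5) ∨ (r = 3 ∧ r' = 5)) → S = ⊤ := by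
    rintro r r' h h' (⟨rfl, rfl⟩ | ⟨rfl, rfl⟩ | ⟨rfl, rfl⟩ | ⟨rfl, rfl⟩ | ⟨rfl, rfl⟩ | ⟨rfl, rfl⟩) <;> simp [E] at h h'
    · exact eq_top_of_gen_mem h' ((S.mul_mem_cancel_left h').1 h)
    · exact eq_top_of_gen_mem ((S.mul_mem_cancel_right h').1 h) h'
    · exact eq_top_of_gen_mem h h'
    · exact eq_top_of_gen_mem (S.inv_mem_iff.1 ((S.mul_mem_cancel_right (S.inv_mem h)).1 h')) h
    · exact eq_top_of_gen_mem h' h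
    · exact eq_top_of_gen_mem h' (S.inv_mem_iff.1 ((S.mul_mem_cancel_left (S.inv_mem h')).1 h))
  have hu2 := key u hu hu1
  have hv2 := key v hv hv1
  generalize ρ u 0 0 * ρ u 0 1 = x at *
  generalize ρ v 0 0 * ρ v 0 1 = y at *
  clear key hu1 hv1 a1 a2 b1 b2 b3 b4
  by_cases hlt : x % 6 < y % 6
  · exact fin _ _ hu2 hv2 (by omega)
  · exact fin _ _ hv2 hu2 (by omega)

/-- A pair of elements whose commutator is a nontrivial power of the boundary generates the free group. -/
theorem eq_top_of_commutator {S : Subgroup FreeGroupTwo} {m : ℤ} (hm : m ≠ 0) {u v : FreeGroupTwo} (hu : u ∈ S)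
    (hv : v ∈ S) (h : ⁅u, v⁆ = 𝔠 ^ m) : S = ⊤ := by
  obtain ⟨s, hs, c1, c2, c3, c4⟩ := markovRep_commutator_zpow m
  have nielsen : ∀ u v : FreeGroupTwo, ⁅u * v⁻¹, v⁆ = ⁅u, v⁆ ∧ ⁅u * v, v⁆ = ⁅u, v⁆ ∧ ⁅u, v * u⁆ = ⁅u, v⁆ ∧
      ⁅u, v * u⁻¹⁆ = ⁅u, v⁆ := fun u v => by
    simp only [commutatorElement_def]
    refine ⟨?_, ?_, ?_, ?_⟩ <;> group
  have corner : ∀ u v : FreeGroupTwo, ⁅u, v⁆ = 𝔠 ^ m → (1 - s) * (ρ (u * v)).tr = -6 * m * ρ (u * v) 0 1 ∧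
      (1 - s) * (ρ u).tr = -6 * m * ρ u 0 1 ∧ (1 - s) * (ρ v).tr = -6 * m * (s * ρ v 0 1) := fun u v h => by
    refine ⟨tr_of_commutator h c1, ?_, ?_⟩
    · have := tr_of_commutator ((nielsen u v).1.trans h) c1
      rwa [inv_mul_cancel_right] at this
    · have := tr_of_commutator ((nielsen u v).2.2.2.trans h) c1
      rw [← mul_assoc, show u * v * u⁻¹ = ⁅u, v⁆ * v by rw [commutatorElement_def]; group] at this
      rw [show (ρ v).tr = (ρ (⁅u, v⁆ * v)).tr by
        rw [show ⁅u, v⁆ * v = u * v * u⁻¹ by rw [commutatorElement_def]; group, map_mul, map_mul, map_inv, tr_conj],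
        this, h, map_mul, mul_apply_two, c1, c2, zero_mul, add_zero]
  rcases hs with rfl | rfl
  · obtain ⟨-, h1, h2⟩ := corner u v h
    have hz : ∀ w, (1 - 1) * (ρ w).tr = -6 * m * ρ w 0 1 → ρ w 0 1 = 0 := fun w hw => by
      have h3 : m * ρ w 0 1 = 0 := by linarith
      exact (mul_eq_zero.1 h3).resolve_left hm
    obtain ⟨i, rfl⟩ := eq_zpow_of_markovRep (hz u h1)
    obtain ⟨j, rfl⟩ := eq_zpow_of_markovRep (hz v (by rw [h2, one_mul]))
    rw [commutatorElement_eq_one_iff_commute.2 ((Commute.refl _).zpow_zpow i j), ← zpow_zero 𝔠] at h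
    exact absurd (SisterGroup.commutator_zpow_injective h).symm hm
  have three : ∀ w, ∀ e : ℤ, (ρ w).tr = 3 * m * (e * ρ w 0 1) → e = 1 ∨ e = -1 →
      3 ≤ |(ρ w).tr| ∧ (|(ρ w).tr| = 3 → (m = 1 ∨ m = -1) ∧ ρ w 0 1 * ρ w 0 1 = 1) := fun w e he hee => by
    have h0 : ρ w 0 1 ≠ 0 := fun h0 => by
      have hd := det_eq (ρ w)
      rw [h0, mul_zero, mul_zero, tr_eq] at he
      rw [h0, zero_mul, sub_zero] at hd
      rcases Int.mul_eq_one_iff_eq_one_or_neg_one.1 hd with h | h <;> omega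
    have h1 : |(ρ w).tr| = 3 * (|m| * |ρ w 0 1|) := by
      rw [he, abs_mul, abs_mul, abs_mul, show |e| = 1 by rcases hee with rfl | rfl <;> rfl]; norm_num; ring
    have h2 := mul_pos (abs_pos.2 hm) (abs_pos.2 h0)
    refine ⟨by omega, fun h3 => ?_⟩
    obtain ⟨h4, h5⟩ : |m| = 1 ∧ |ρ w 0 1| = 1 := by
      rcases Int.mul_eq_one_iff_eq_one_or_neg_one.1 (show |m| * |ρ w 0 1| = 1 by omega) with h | h
      · exact h
      · exact absurd (abs_nonneg m) (by omega)
    exact ⟨eq_or_eq_neg_of_abs_eq h4, by rw [← abs_mul_abs_self, h5, one_mul]⟩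
  induction hn : ((ρ u).tr.natAbs + (ρ v).tr.natAbs + (ρ (u * v)).tr.natAbs) using Nat.strong_induction_on
    generalizing u v with
  | _ n ih =>
    obtain ⟨k3, k1, k2⟩ := corner u v h
    have e1 : (ρ u).tr = 3 * m * (-1 * ρ u 0 1) := by linarith
    have e2 : (ρ v).tr = 3 * m * (1 * ρ v 0 1) := by linarith
    have e3 : (ρ (u * v)).tr = 3 * m * (-1 * ρ (u * v) 0 1) := by linarith
    obtain ⟨p1, p2⟩ := three u _ e1 (by norm_num)
    obtain ⟨q1, q2⟩ := three v _ e2 (by norm_num)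
    obtain ⟨r1, r2⟩ := three (u * v) _ e3 (by norm_num)
    have hF := tr_commutator (ρ u) (ρ v)
    rw [← map_commutatorElement, h, tr_eq, c1, c4, ← map_mul] at hF
    have t1 : (ρ (u * v⁻¹)).tr = (ρ u).tr * (ρ v).tr - (ρ (u * v)).tr := by rw [map_mul, map_inv, tr_mul_inv, map_mul]
    have t2 : (ρ (u * v * v)).tr = (ρ (u * v)).tr * (ρ v).tr - (ρ u).tr := by
      have := tr_mul_inv (ρ (u * v)) (ρ v)
      rw [← map_inv, ← map_mul, mul_inv_cancel_right, ← map_mul] at this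
      linarith
    have t3 : (ρ (u * (v * u))).tr = (ρ (u * v)).tr * (ρ u).tr - (ρ v).tr := by
      have := tr_mul_inv (ρ (v * u)) (ρ u)
      rw [← map_inv, ← map_mul, mul_inv_cancel_right, map_mul ρ v, tr_mul_comm (ρ v), ← map_mul ρ u, tr_mul_comm _ (ρ u),
        ← map_mul, ← map_mul] at this
      linarith
    have t4 : (ρ (v * u)).tr = (ρ (u * v)).tr := by rw [map_mul, tr_mul_comm, map_mul]
    have d1 : ∀ x y z : ℤ, |x| ≤ |y| → x * y = z → 0 ≤ z → |x| ^ 2 ≤ z := fun x y z hxy h hz => by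
      rw [← abs_of_nonneg hz, ← h, abs_mul, pow_two]
      exact mul_le_mul_of_nonneg_left hxy (abs_nonneg _)
    obtain ⟨N, hN1, hN2, hN3⟩ := nielsen u v
    by_cases g1 : |(ρ (u * v)).tr| ≤ |(ρ (u * v⁻¹)).tr|; swap
    · rw [Int.abs_eq_natAbs, Int.abs_eq_natAbs] at g1
      exact ih _ (by rw [inv_mul_cancel_right]; omega) (S.mul_mem hu (S.inv_mem hv)) hv (N.trans h) rfl
    by_cases g2 : |(ρ u).tr| ≤ |(ρ (u * v * v)).tr|; swap
    · rw [Int.abs_eq_natAbs, Int.abs_eq_natAbs] at g2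
      exact ih _ (by omega) (S.mul_mem hu hv) hv (hN1.trans h) rfl
    by_cases g3 : |(ρ v).tr| ≤ |(ρ (u * (v * u))).tr|; swap
    · rw [Int.abs_eq_natAbs, Int.abs_eq_natAbs] at g3
      exact ih _ (by rw [t4]; omega) hu (S.mul_mem hv hu) (hN2.trans h) rfl
    rw [t1] at g1
    rw [t2] at g2
    rw [t3] at g3
    obtain ⟨hp, hq, hr⟩ := eq_three_of_markov p1 q1 r1
      (by rw [← abs_mul, ← abs_mul, sq_abs, sq_abs, sq_abs, abs_of_nonneg] <;> nlinarith)
      (d1 _ _ _ g1 (by rw [sq_abs, sq_abs]; linarith) (by positivity))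
      (d1 _ _ _ g2 (by rw [sq_abs, sq_abs]; linarith) (by positivity))
      (d1 _ _ _ g3 (by rw [sq_abs, sq_abs]; linarith) (by positivity))
    obtain ⟨hm1, hx⟩ := p2 hp
    have hy := (q2 hq).2
    have hz := (r2 hr).2
    have hc : 𝔠 ∈ S := by
      have h1 : ⁅u, v⁆ ∈ S := by
        rw [commutatorElement_def]
        exact S.mul_mem (S.mul_mem (S.mul_mem hu hv) (S.inv_mem hu)) (S.inv_mem hv)
      rw [h] at h1
      rcases hm1 with rfl | rfl
      · rwa [zpow_one] at h1
      · rwa [zpow_neg_one, S.inv_mem_iff] at h1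
    refine eq_top_of_markovRep hc hu hv hx hy ?_
    rw [map_mul, mul_apply_two] at hz
    rw [tr_eq] at e2
    have hw : (ρ u 0 0 * ρ u 0 1 - ρ v 0 0 * ρ v 0 1 + 3 * m) * (ρ u 0 0 * ρ u 0 1 - ρ v 0 0 * ρ v 0 1 + 3 * m) = 1 := by
      rw [show ρ u 0 0 * ρ u 0 1 - ρ v 0 0 * ρ v 0 1 + 3 * m =
          ρ u 0 1 * ρ v 0 1 * (ρ u 0 0 * ρ v 0 1 + ρ u 0 1 * ρ v 1 1) by
        linear_combination (-ρ u 0 0 * ρ u 0 1 - 3 * m) * hy - ρ v 0 1 * ρ v 1 1 * hx - ρ v 0 1 * e2]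
      linear_combination ρ u 0 1 * ρ u 0 1 * (ρ v 0 1 * ρ v 0 1) * hz + ρ u 0 1 * ρ u 0 1 * hy + hx
    generalize ρ u 0 0 * ρ u 0 1 - ρ v 0 0 * ρ v 0 1 = d at *
    rcases hm1 with rfl | rfl <;> rcases mul_self_eq_one_iff.1 hw with h | h
    exacts [Or.inr (by omega), Or.inl (by omega), Or.inr (by omega), Or.inl (by omega)]

end FreeGroupTwo

end MarkovDescent

section FullSubgroup

open FreeGroupTwo SemidirectProduct

namespace FreeGroupTwo

theorem map_monodromy_monodromy {A : Type*} [CommGroup A] (f : FreeGroupTwo →* A) (w : FreeGroupTwo) :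
    f (monodromy (monodromy w)) = f w ^ (-1 : ℤ) * f (monodromy w) ^ (-3 : ℤ) := by
  have h : (f.comp monodromy.toMonoidHom).comp monodromy.toMonoidHom =
      (zpowGroupHom (-1)).comp f * (zpowGroupHom (-3)).comp (f.comp monodromy.toMonoidHom) :=
    FreeGroup.ext_hom _ _ fun i => by
      have key : ∀ v : FreeGroupTwo, v = gen₀ ∨ v = gen₁ →
          f (monodromy (monodromy v)) = f v ^ (-1 : ℤ) * f (monodromy v) ^ (-3 : ℤ) := by
        rintro v (rfl | rfl) <;> simp only [monodromy_gen₀, monodromy_gen₁, map_mul, map_inv] <;>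
          refine Additive.ofMul.injective ?_ <;> simp only [ofMul_mul, ofMul_inv, ofMul_zpow] <;> abel
      fin_cases i
      exacts [key _ (Or.inl rfl), key _ (Or.inr rfl)]
  exact DFunLike.congr_fun h w

theorem exists_map_monodromy_pow (n : ℕ) : ∃ x y : ℤ, |x| ≤ |y| ∧ 2 ≤ |y| ∧ ∀ {A : Type} [CommGroup A]
    (f : FreeGroupTwo →* A) (w : FreeGroupTwo), f ((monodromy ^ (n + 2)) w) = f w ^ x * f (monodromy w) ^ y := by
  induction n with
  | zero => exact ⟨-1, -3, by decide, by decide, fun f w => map_monodromy_monodromy f w⟩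
  | succ n ih =>
    obtain ⟨x, y, h1, h2, h⟩ := ih
    refine ⟨-y, x - 3 * y, ?_, ?_, fun f w => ?_⟩
    · rw [abs_neg]; cases abs_cases x <;> cases abs_cases y <;> cases abs_cases (x - 3 * y) <;> omega
    · cases abs_cases x <;> cases abs_cases y <;> cases abs_cases (x - 3 * y) <;> omega
    · rw [show n + 1 + 2 = n + 2 + 1 by ring, pow_succ, MulAut.mul_apply, h, map_monodromy_monodromy, mul_zpow, ← zpow_mul,
        ← zpow_mul, mul_left_comm, ← zpow_add]
      congr 2 <;> ring

/-- The reduction of the abelianization. -/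
def homology (q : ℕ) : FreeGroupTwo →* Multiplicative (ZMod q × ZMod q) :=
  FreeGroup.lift ![ofAdd (1, 0), ofAdd (0, 1)]

theorem homology_surjective (q : ℕ) : Surjective (homology q) := fun v => by
  refine ⟨gen₀ ^ (v.toAdd.1.cast : ℤ) * gen₁ ^ (v.toAdd.2.cast : ℤ), ?_⟩
  rw [map_mul, map_zpow, map_zpow, homology, gen₀, gen₁, FreeGroup.lift_apply_of, FreeGroup.lift_apply_of]
  refine Multiplicative.toAdd.injective ?_
  simp

/-- Automorphisms acting on the reduced abelianization by a scalar. -/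
def scalarAut (q : ℕ) : Subgroup (MulAut FreeGroupTwo) where
  carrier := {α | ∃ r : ZMod q, ∀ w, (homology q (α w)).toAdd = r • (homology q w).toAdd}
  one_mem' := ⟨1, fun w => by rw [one_smul]; rfl⟩
  mul_mem' := fun {α β} ⟨r, hr⟩ ⟨s, hs⟩ => ⟨r * s, fun w => by rw [MulAut.mul_apply, hr, hs, smul_smul]⟩
  inv_mem' := fun {α} ⟨r, hr⟩ => by
    have h0 := hr (α⁻¹ gen₀)
    rw [MulAut.apply_inv_self] at h0
    have h1 : r * (homology q (α⁻¹ gen₀)).toAdd.1 = 1 := by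
      have := congrArg Prod.fst h0
      simpa [homology, gen₀] using this.symm
    refine ⟨(homology q (α⁻¹ gen₀)).toAdd.1, fun w => ?_⟩
    have h2 := hr (α⁻¹ w)
    rw [MulAut.apply_inv_self] at h2
    rw [h2, smul_smul, mul_comm, h1, one_smul]

theorem exists_monodromy_mem_scalarAut {n : ℕ} (hn : 2 ≤ n) : ∃ q : ℕ, 2 ≤ q ∧ monodromy ^ n ∈ scalarAut q := by
  obtain ⟨n, rfl⟩ := Nat.exists_eq_add_of_le' hn
  obtain ⟨x, y, -, hy, h⟩ := exists_map_monodromy_pow n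
  refine ⟨y.natAbs, by rw [Int.abs_eq_natAbs] at hy; exact_mod_cast hy, x, fun w => ?_⟩
  rw [h, toAdd_mul, toAdd_zpow, toAdd_zpow]
  have h0 : ((y : ℤ) : ZMod y.natAbs) = 0 := (ZMod.intCast_zmod_eq_zero_iff_dvd _ _).2 (Int.natAbs_dvd.2 dvd_rfl)
  rw [← Int.cast_smul_eq_zsmul (ZMod y.natAbs) y, h0, zero_smul, add_zero, Int.cast_smul_eq_zsmul]

end FreeGroupTwo

namespace SisterGroup

variable {L : Subgroup SisterGroup}

theorem NonMetabelian.fibre_le (h : NonMetabelian L) (hfg : L.FG) (hdom : DominatesQuotients L) : fibre ≤ L := by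
  obtain ⟨e⟩ := h.exists_mulEquiv hfg hdom
  obtain ⟨τ, hτ⟩ := h.exists_degree_ne_one hdom
  obtain ⟨f, m, hm, hc⟩ := exists_commutator_eq_conj e hτ
  obtain ⟨u, hu⟩ : ((e gen₀ : L) : SisterGroup) ∈ fibre := mem_ker_degree.1 (e gen₀).2
  obtain ⟨v, hv⟩ : ((e gen₁ : L) : SisterGroup) ∈ fibre := mem_ker_degree.1 (e gen₁).2
  have huv : ⁅u, v⁆ = f * 𝔠 ^ m * f⁻¹ := by
    have h1 : (inl ⁅u, v⁆ : SisterGroup) = inl (f * 𝔠 ^ m * f⁻¹) := by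
      rw [map_commutatorElement, hu, hv, ← hc, map_commutatorElement]; rfl
    exact inl_injective h1
  have hS := eq_top_of_commutator (S := (L.comap inl).comap (MulAut.conj f).toMonoidHom) hm
    (u := f⁻¹ * u * f) (v := f⁻¹ * v * f)
    (by
      rw [Subgroup.mem_comap, Subgroup.mem_comap]
      convert (e gen₀).1.2
      rw [← hu]
      congr 1
      simp [mul_assoc])
    (by
      rw [Subgroup.mem_comap, Subgroup.mem_comap]
      convert (e gen₁).1.2
      rw [← hv]
      congr 1
      simp [mul_assoc])
    (by
      have : ⁅f⁻¹ * u * f, f⁻¹ * v * f⁆ = f⁻¹ * ⁅u, v⁆ * f := by simp only [commutatorElement_def]; group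
      rw [this, huv]; group)
  rintro _ ⟨w, rfl⟩
  have h1 : f⁻¹ * w * f ∈ (L.comap inl).comap (MulAut.conj f).toMonoidHom := hS ▸ Subgroup.mem_top _
  rw [Subgroup.mem_comap, Subgroup.mem_comap] at h1
  simpa [mul_assoc] using h1

theorem NonMetabelian.eq_top (h : NonMetabelian L) (hfg : L.FG) (hdom : DominatesQuotients L) : L = ⊤ := by
  have hF := h.fibre_le hfg hdom
  obtain ⟨τ, hτ⟩ := exists_generator (degree L)
  have hτ1 : degree L τ ≠ 1 := fun h1 => by
    obtain ⟨x, hx⟩ := h.exists_degree_ne_one hdom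
    obtain ⟨i, hi⟩ := hτ x
    exact hx (by rw [hi, h1, one_zpow])
  obtain ⟨g, k, hg⟩ := exists_inl_mul_t_zpow τ
  have hdeg : ∀ (f : FreeGroupTwo) (n : ℤ), rightHom (inl f * t ^ n : SisterGroup) = ofAdd n := fun f n => by
    rw [map_mul, map_zpow, rightHom_inl, one_mul, t, rightHom_inr, ← ofAdd_zsmul, smul_eq_mul, mul_one]
  have hk : degree L τ = ofAdd k := by rw [← hdeg g k, ← hg]; rfl
  have hk0 : k ≠ 0 := by rintro rfl; exact hτ1 hk
  have htk : t ^ k ∈ L := by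
    have : t ^ k = (inl g)⁻¹ * τ.1 := by rw [hg]; group
    rw [this]
    exact L.mul_mem (L.inv_mem (hF ⟨g, rfl⟩)) τ.2
  rcases (show k.natAbs = 1 ∨ 2 ≤ k.natAbs by omega) with h1 | h1
  · refine eq_top_of_mem (hF ⟨_, rfl⟩) (hF ⟨_, rfl⟩) ?_
    rcases Int.natAbs_eq_iff.1 h1 with rfl | rfl
    · simpa using htk
    · simpa using htk
  exfalso
  obtain ⟨q, hq, hmem⟩ := exists_monodromy_mem_scalarAut h1
  have : NeZero q := ⟨by omega⟩
  have hzpow : monodromy ^ k ∈ scalarAut q := by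
    rcases Int.natAbs_eq k with h2 | h2 <;> rw [h2]
    · rwa [zpow_natCast]
    · rw [zpow_neg, zpow_natCast]; exact (scalarAut q).inv_mem hmem
  have hconj : ∀ (f w : FreeGroupTwo) (n : ℤ), (inl f * t ^ n * inl w * (inl f * t ^ n)⁻¹ : SisterGroup) =
      inl (f * (monodromy ^ n) w * f⁻¹) := fun f w n => by
    have h3 := SemidirectProduct.inl_aut (φ := zpowersHom (MulAut FreeGroupTwo) monodromy) (ofAdd n) w
    have h4 : (inr (ofAdd n) : SisterGroup) = t ^ n := by rw [t, ← map_zpow, ← ofAdd_zsmul, smul_eq_mul, mul_one]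
    have h5 : (zpowersHom (MulAut FreeGroupTwo) monodromy) (ofAdd n) = monodromy ^ n := by simp
    rw [h5, map_inv, h4] at h3
    rw [map_mul, map_mul, map_inv, h3]
    group
  let ι : FreeGroupTwo →* (degree L).ker :=
    (inl.codRestrict L fun w => hF ⟨w, rfl⟩).codRestrict _ fun w => mem_ker_degree.2 ⟨w, rfl⟩
  have hι : Bijective ι := ⟨fun x y hxy => inl_injective (congrArg (fun z : (degree L).ker => (z : SisterGroup)) hxy),
    fun x => by
      obtain ⟨w, hw⟩ := mem_ker_degree.1 x.2
      exact ⟨w, Subtype.ext (Subtype.ext hw)⟩⟩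
  let ε := MulEquiv.ofBijective ι hι
  have hscal : ∀ l : L, ∃ r : ZMod q, ∀ n, (homology q (ε.symm (MulAut.conjNormal l n))).toAdd =
      r • (homology q (ε.symm n)).toAdd := fun l => by
    obtain ⟨f, n, hl⟩ := exists_inl_mul_t_zpow l
    obtain ⟨j, hj⟩ := hτ l
    have hn : n = k * j := by
      have h3 : degree L l = ofAdd n := by rw [← hdeg f n, ← hl]; rfl
      rw [h3, hk, ← ofAdd_zsmul, smul_eq_mul, mul_comm] at hj
      exact Multiplicative.ofAdd.injective hj
    obtain ⟨r, hr⟩ := (scalarAut q).zpow_mem hzpow j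
    refine ⟨r, fun x => ?_⟩
    obtain ⟨w, rfl⟩ := ε.surjective x
    have h3 : MulAut.conjNormal l (ε w) = ε (f * ((monodromy ^ k) ^ j) w * f⁻¹) := by
      rw [← zpow_mul, ← hn]
      refine Subtype.ext (Subtype.ext ?_)
      rw [MulAut.conjNormal_apply]
      change l.1 * inl w * l.1⁻¹ = inl _
      rw [hl, hconj]
    rw [h3, MulEquiv.symm_apply_apply, MulEquiv.symm_apply_apply, ← hr, map_mul (homology q), map_mul (homology q),
      map_inv (homology q), mul_inv_cancel_comm]
  obtain ⟨φ, l, hφ, hmono⟩ := exists_hom_of_invariant hτ1 hτ hdom ((homology q).comp ε.symm.toMonoidHom)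
    ((homology_surjective q).comp ε.symm.surjective) fun l n hn => by
      obtain ⟨r, hr⟩ := hscal l
      refine Multiplicative.toAdd.injective ((hr n).trans ?_)
      rw [show homology q (ε.symm n) = 1 from hn, toAdd_one, smul_zero]
  obtain ⟨r, hr⟩ := hscal l
  have h2 : (φ gen₁).toAdd = r • (φ gen₀).toAdd := by
    obtain ⟨w, hw⟩ := homology_surjective q (φ gen₀)
    have h3 := hmono gen₀ (ε w) (hw.symm.trans (by simp))
    rw [monodromy_gen₀, map_mul, map_mul, map_inv, mul_inv_cancel_comm] at h3
    rw [h3, ← hw]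
    refine (hr _).trans ?_
    rw [MulEquiv.symm_apply_apply]
  have h3 : ∀ w, ∃ s : ZMod q, (φ w).toAdd = s • (φ gen₀).toAdd := fun w => by
    induction w using FreeGroup.induction_on with
    | C1 => exact ⟨0, by rw [map_one, zero_smul]; rfl⟩
    | of i => fin_cases i; exacts [⟨1, (one_smul _ _).symm⟩, ⟨r, h2⟩]
    | inv_of i h => obtain ⟨s, hs⟩ := h; exact ⟨-s, by rw [map_inv, toAdd_inv, hs, neg_smul]⟩
    | mul x y hx hy =>
      obtain ⟨s, hs⟩ := hx
      obtain ⟨s', hs'⟩ := hy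
      exact ⟨s + s', by rw [map_mul, toAdd_mul, hs, hs', add_smul]⟩
  obtain ⟨w, hw⟩ := hφ (ofAdd (1, 0))
  obtain ⟨w', hw'⟩ := hφ (ofAdd (0, 1))
  obtain ⟨s, hs⟩ := h3 w
  obtain ⟨s', hs'⟩ := h3 w'
  rw [hw] at hs
  rw [hw'] at hs'
  have a1 : 1 = s * (φ gen₀).toAdd.1 := congrArg Prod.fst hs
  have a2 : 0 = s * (φ gen₀).toAdd.2 := congrArg Prod.snd hs
  have a3 : 0 = s' * (φ gen₀).toAdd.1 := congrArg Prod.fst hs'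
  have a4 : 1 = s' * (φ gen₀).toAdd.2 := congrArg Prod.snd hs'
  have : Fact (1 < q) := ⟨hq⟩
  refine one_ne_zero (α := ZMod q) ?_
  linear_combination a1 + s * (φ gen₀).toAdd.1 * a4 - s * (φ gen₀).toAdd.2 * a3

end SisterGroup

end FullSubgroup

/-- `PGL(2, ℤ[ω])` is profinitely rigid in the absolute sense. -/
theorem pgl2_eisenstein_profinitely_rigid (Λ : Type) [Group Λ] [Group.FG Λ]
    (hrf : IsResiduallyFinite Λ)
    (hfq : SameFiniteQuotients Λ (PGL2 Eisenstein)) :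
    Nonempty (Λ ≃* PGL2 Eisenstein) := by
  obtain ⟨e⟩ := nonempty_eisenstein_ringEquiv
  have h : SameFiniteQuotients Λ (PGL2 EisensteinInt) := fun Q _ _ => (hfq Q).trans
    ⟨fun ⟨f, hf⟩ => ⟨f.comp (PGL2.mapEquiv e).toMonoidHom, hf.comp (PGL2.mapEquiv e).surjective⟩,
      fun ⟨f, hf⟩ => ⟨f.comp (PGL2.mapEquiv e).symm.toMonoidHom, hf.comp (PGL2.mapEquiv e).symm.surjective⟩⟩
  obtain ⟨c⟩ := exists_profiniteCorrespondence h
  obtain ⟨φ, hφ⟩ := c.exists_surjective fun L hfg hdom hL => SisterGroup.NonMetabelian.eq_top hL hfg hdom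
  exact ⟨(MulEquiv.ofBijective φ ⟨injective_of_sameFiniteQuotients hrf h φ hφ, hφ⟩).trans (PGL2.mapEquiv e)⟩
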